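/- Let φ be a continuous injective map on {z ∈ ℂ : |z| ≥ 1} that is holomorphic on {|z| > 1} with Laurent expansion φ(z) = z + φ₀ + ∑_{k≥1} φ_{-k} z^{-k} at infinity; assume θ ↦ φ(e^{iθ}) is five times continuously differentiable with α-Hölder continuous fifth derivative for some α ∈ (0,1) and nonvanishing derivative, that φ' extends continuously and without zeros to {|z| ≥ 1}, and that the Grunsky expansion of φ converges absolutely for |z|, |ζ| ≥ 1 (so the image curve γ = φ(𝕋) is a C^{5+α} Jordan curve of logarithmic capacity 1). Let G : ℝ → ℂ be a 2π-periodic integrable function with Fourier expansion G(θ) = a₀/2 + ∑_{k≥1} (a_k cos kθ + b_k sin kθ) (a_k, b_k ∈ ℂ) satisfying ∑_{k≥1} k(|a_k|² + |b_k|²) < ∞. Set b_{kℓ} = √(kℓ) a_{kℓ}, let K_m be the associated 2m×2m real symmetric block matrix, and let g_m ∈ ℂ^{2m} be the column vector with entries ((1/2)√k a_k)_{1≤k≤m} followed by ((1/2)√k b_k)_{1≤k≤m}. Define D_n = (1/n!) ∫_{[−π,π]^n} ∏_{1≤μ<ν≤n} |φ(e^{iθ_μ}) − φ(e^{iθ_ν})|²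 ∏_{μ=1}^n |φ'(e^{iθ_μ})| e^{G(θ_μ)} dθ. Then: each integral D_n converges absolutely; for every m the matrix I_{2m} + K_m is invertible with det(I_{2m} + K_m) > 0; the limit L = lim_{m→∞} det(I_{2m} + K_m)^{−1/2} exp( g_mᵗ (I_{2m} + K_m)^{−1} g_m ) exists in ℂ∖{0}; and lim_{n→∞} e^{−n a₀/2} (2π)^{−n} D_n = L. -/

import Mathlib

open MeasureTheory Filter Matrix

/-- The `2m × 2m` real symmetric block matrix `K_m = [[B⁽¹⁾, B⁽²⁾],[B⁽²⁾, −B⁽¹⁾]]`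
built from the truncated Grunsky matrix `B_m = (√(kℓ) a_{kℓ})_{1≤k,ℓ≤m}`
(with `B_m = B⁽¹⁾ + iB⁽²⁾`, `B⁽ʲ⁾` real). -/
noncomputable def grunskyK (a : ℕ → ℕ → ℂ) (m : ℕ) :
    Matrix (Fin m ⊕ Fin m) (Fin m ⊕ Fin m) ℝ :=
  Matrix.fromBlocks
    (Matrix.of fun k l : Fin m =>
      ((Real.sqrt ((((k : ℕ) + 1) * ((l : ℕ) + 1) : ℕ)) : ℂ)
        * a ((k : ℕ) + 1) ((l : ℕ) + 1)).re)
    (Matrix.of fun k l : Fin m =>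
      ((Real.sqrt ((((k : ℕ) + 1) * ((l : ℕ) + 1) : ℕ)) : ℂ)
        * a ((k : ℕ) + 1) ((l : ℕ) + 1)).im)
    (Matrix.of fun k l : Fin m =>
      ((Real.sqrt ((((k : ℕ) + 1) * ((l : ℕ) + 1) : ℕ)) : ℂ)
        * a ((k : ℕ) + 1) ((l : ℕ) + 1)).im)
    (-(Matrix.of fun k l : Fin m =>
      ((Real.sqrt ((((k : ℕ) + 1) * ((l : ℕ) + 1) : ℕ)) : ℂ)
        * a ((k : ℕ) + 1) ((l : ℕ) + 1)).re))

/-- point on the unit circle -/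
noncomputable def szp (θ : ℝ) : ℂ := Complex.exp (Complex.I * (θ : ℂ))

lemma szp_cont : Continuous szp := by unfold szp; fun_prop

lemma szp_norm (θ : ℝ) : ‖szp θ‖ = 1 := by
  unfold szp; rw [mul_comm]; exact Complex.norm_exp_ofReal_mul_I θ

lemma szp_ne (θ : ℝ) : szp θ ≠ 0 := Complex.exp_ne_zero _

lemma szp_neg (θ : ℝ) : szp (-θ) = (starRingEnd ℂ) (szp θ) := by
  unfold szp; rw [← Complex.exp_conj]; simp

lemma szp_inv (θ : ℝ) : (starRingEnd ℂ) (szp θ) = (szp θ)⁻¹ := by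
  rw [← szp_neg]; unfold szp; rw [← Complex.exp_neg]; simp

lemma szp_circleMap (θ : ℝ) : circleMap 0 1 θ = szp θ := by
  simp [circleMap, szp, mul_comm]

lemma szp_periodic : Function.Periodic szp (2 * Real.pi) := by
  intro θ
  have := periodic_circleMap 0 1 θ
  simpa [szp_circleMap] using this

/-- normalized arclength on `[-π, π]` -/
noncomputable def szν : Measure ℝ :=
  (ENNReal.ofReal (2 * Real.pi))⁻¹ • (volume.restrict (Set.Icc (-Real.pi) Real.pi))

instance szν_prob : IsProbabilityMeasure szν := by
  constructor
  have h : (0:ℝ) < 2 * Real.pi := by positivity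
  simp only [szν, Measure.smul_apply, Measure.restrict_apply_univ, Real.volume_Icc, smul_eq_mul]
  rw [show Real.pi - -Real.pi = 2 * Real.pi by ring]
  exact ENNReal.inv_mul_cancel (by simpa using h) ENNReal.ofReal_ne_top

lemma szν_integral {E : Type*} [NormedAddCommGroup E] [NormedSpace ℝ E] (f : ℝ → E) :
    ∫ θ, f θ ∂szν = (2 * Real.pi)⁻¹ • ∫ θ in (-Real.pi)..Real.pi, f θ := by
  have h : (0:ℝ) < 2 * Real.pi := by positivity
  rw [szν, integral_smul_measure, intervalIntegral.integral_of_le (by linarith [Real.pi_pos]),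
    integral_Icc_eq_integral_Ioc]
  congr 1
  rw [ENNReal.toReal_inv, ENNReal.toReal_ofReal h.le]

lemma szν_circle {E : Type*} [NormedAddCommGroup E] [NormedSpace ℝ E] (f : ℂ → E) :
    ∫ θ, f (szp θ) ∂szν = Real.circleAverage f 0 1 := by
  rw [szν_integral, Real.circleAverage_def]
  congr 1
  have hp : Function.Periodic (fun θ => f (szp θ)) (2 * Real.pi) := fun θ => by
    simp only [szp_periodic θ]
  have := hp.intervalIntegral_add_eq (-Real.pi) 0
  simp only [szp_circleMap]
  convert this using 2 <;> ring

lemma szν_neg {E : Type*} [NormedAddCommGroup E] [NormedSpace ℝ E] (f : ℝ → E) :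
    ∫ θ, f (-θ) ∂szν = ∫ θ, f θ ∂szν := by
  rw [szν_integral, szν_integral, intervalIntegral.integral_comp_neg]; simp

lemma szν_integrable_of_cont {E : Type*} [NormedAddCommGroup E] {f : ℝ → E}
    (hf : Continuous f) : Integrable f szν := by
  unfold szν
  refine Integrable.smul_measure ?_ (by simp [Real.pi_pos])
  exact hf.continuousOn.integrableOn_compact isCompact_Icc

/-- mean value property -/
lemma szν_mean {h : ℂ → ℂ} (hh : DiffContOnCl ℂ h (Metric.ball 0 1)) :
    ∫ θ, h (szp θ) ∂szν = h 0 := by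
  rw [szν_circle]
  exact DiffContOnCl.circleAverage (by simpa using hh)

/-- Cauchy formula -/
lemma szν_cauchy {h : ℂ → ℂ} (hh : DiffContOnCl ℂ h (Metric.ball 0 1)) {α : ℂ} (hα : ‖α‖ < 1) :
    ∫ θ, (1 - α * szp θ)⁻¹ * h ((starRingEnd ℂ) (szp θ)) ∂szν = h α := by
  rw [← szν_neg]
  have : ∀ θ, (1 - α * szp (-θ))⁻¹ * h ((starRingEnd ℂ) (szp (-θ))) =
      ((szp θ - 0) / (szp θ - α)) • h (szp θ) := by
    intro θ
    rw [szp_neg, Complex.conj_conj, szp_inv, smul_eq_mul]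
    congr 1
    have h1 : szp θ ≠ 0 := szp_ne θ
    have h2 : szp θ - α ≠ 0 := by
      intro h0
      have := szp_norm θ
      rw [sub_eq_zero.mp h0] at this
      linarith
    have h3 : 1 - α * (szp θ)⁻¹ = (szp θ - α) / szp θ := by field_simp
    rw [h3, inv_div, sub_zero]
  simp_rw [this]
  rw [szν_circle (fun z => ((z - 0) / (z - α)) • h z)]
  exact DiffContOnCl.circleAverage_smul_div (by simpa using hh) (by simpa using hα)

/-- Andreief identity -/
lemma sz_andreief {n : ℕ} (f g : Fin n → ℝ → ℂ)
    (hfg : ∀ i j, Integrable (fun θ => f i θ * g j θ) szν) :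
    ∫ θ : Fin n → ℝ, (Matrix.of fun i j => f i (θ j)).det * (Matrix.of fun i j => g i (θ j)).det
      ∂(Measure.pi fun _ => szν) =
    (n.factorial : ℂ) * (Matrix.of fun i j => ∫ θ, f i θ * g j θ ∂szν).det := by
  have h1 : ∀ θ : Fin n → ℝ,
      (Matrix.of fun i j => f i (θ j)).det * (Matrix.of fun i j => g i (θ j)).det =
      ∑ σ : Equiv.Perm (Fin n), ∑ τ : Equiv.Perm (Fin n),
        ((Equiv.Perm.sign σ : ℤ) : ℂ) * ((Equiv.Perm.sign τ : ℤ) : ℂ) *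
          ∏ j, (f (σ j) (θ j) * g (τ j) (θ j)) := by
    intro θ
    rw [Matrix.det_apply', Matrix.det_apply', Finset.sum_mul_sum]
    refine Finset.sum_congr rfl fun σ _ => Finset.sum_congr rfl fun τ _ => ?_
    rw [Finset.prod_mul_distrib]
    simp only [Matrix.of_apply]
    ring
  simp_rw [h1]
  have hintg : ∀ σ τ : Equiv.Perm (Fin n), Integrable (fun θ : Fin n → ℝ =>
      ((Equiv.Perm.sign σ : ℤ) : ℂ) * ((Equiv.Perm.sign τ : ℤ) : ℂ) *
          ∏ j, (f (σ j) (θ j) * g (τ j) (θ j))) (Measure.pi fun _ => szν) := by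
    intro σ τ
    refine Integrable.const_mul ?_ _
    exact Integrable.fintype_prod (f := fun j x => f (σ j) x * g (τ j) x) (fun j => hfg _ _)
  rw [integral_finsetSum _ (fun σ _ => integrable_finsetSum _ (fun τ _ => hintg σ τ))]
  simp_rw [integral_finsetSum _ (fun τ _ => hintg _ τ), integral_const_mul]
  have h2 : ∀ σ τ : Equiv.Perm (Fin n),
      ∫ θ : Fin n → ℝ, ∏ j, (f (σ j) (θ j) * g (τ j) (θ j)) ∂(Measure.pi fun _ => szν) =
      ∏ j, ∫ x, f (σ j) x * g (τ j) x ∂szν := fun σ τ =>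
    integral_fintype_prod_eq_prod (𝕜 := ℂ) (fun j x => f (σ j) x * g (τ j) x)
  simp_rw [h2]
  set M : Matrix (Fin n) (Fin n) ℂ := Matrix.of fun i j => ∫ θ, f i θ * g j θ ∂szν with hM
  have h3 : ∀ σ : Equiv.Perm (Fin n), ∑ τ : Equiv.Perm (Fin n),
      ((Equiv.Perm.sign σ : ℤ) : ℂ) * ((Equiv.Perm.sign τ : ℤ) : ℂ) *
        ∏ j, ∫ x, f (σ j) x * g (τ j) x ∂szν = M.det := by
    intro σ
    have : ((Equiv.Perm.sign σ : ℤ) : ℂ) * ((M.submatrix σ id)ᵀ).det = M.det := by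
      rw [Matrix.det_transpose, Matrix.det_permute, ← mul_assoc]
      have : ((Equiv.Perm.sign σ : ℤ) : ℂ) * ((Equiv.Perm.sign σ : ℤ) : ℂ) = 1 := by
        rcases Int.units_eq_one_or (Equiv.Perm.sign σ) with h | h <;> simp [h]
      rw [this, one_mul]
    rw [← this, Matrix.det_apply', Finset.mul_sum]
    refine Finset.sum_congr rfl fun τ _ => ?_
    rw [mul_assoc]
    rfl
  rw [Finset.sum_congr rfl (fun σ _ => h3 σ)]
  simp [Finset.card_univ, Fintype.card_perm]

/-- Vandermonde determinant on the circle -/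
noncomputable def szV {n : ℕ} (θ : Fin n → ℝ) : ℂ := (Matrix.vandermonde fun j => szp (θ j)).det

lemma szV_cont {n : ℕ} : Continuous (fun θ : Fin n → ℝ => szV θ) := by
  unfold szV
  simp only [Matrix.det_vandermonde]
  have := szp_cont
  fun_prop

/-- eigenvalue measure of `U(n)` -/
noncomputable def szE (n : ℕ) : Measure (Fin n → ℝ) :=
  (Measure.pi fun _ => szν).withDensity
    (fun θ => ((Real.toNNReal (‖szV θ‖ ^ 2 / n.factorial) : NNReal) : ENNReal))

lemma szE_meas (n : ℕ) :
    Measurable (fun θ : Fin n → ℝ => Real.toNNReal (‖szV θ‖ ^ 2 / n.factorial)) := by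
  have := szV_cont (n := n)
  have h : Continuous (fun θ : Fin n → ℝ => Real.toNNReal (‖szV θ‖ ^ 2 / n.factorial)) := by
    fun_prop
  exact h.measurable

lemma szE_integral {E : Type*} [NormedAddCommGroup E] [NormedSpace ℝ E] {n : ℕ}
    (f : (Fin n → ℝ) → E) :
    ∫ θ, f θ ∂(szE n) = ∫ θ, (‖szV θ‖ ^ 2 / n.factorial : ℝ) • f θ ∂(Measure.pi fun _ => szν) := by
  rw [szE, integral_withDensity_eq_integral_smul (szE_meas n)]
  refine integral_congr_ae (Eventually.of_forall fun θ => ?_)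
  simp only [NNReal.smul_def]
  rw [Real.coe_toNNReal _ (by positivity)]

lemma szV_sq {n : ℕ} (θ : Fin n → ℝ) : ((‖szV θ‖ ^ 2 : ℝ) : ℂ) =
    (Matrix.of fun i j : Fin n => szp (θ j) ^ (i : ℕ)).det *
    (Matrix.of fun i j : Fin n => ((starRingEnd ℂ) (szp (θ j))) ^ (i : ℕ)).det := by
  have h1 : (Matrix.of fun i j : Fin n => szp (θ j) ^ (i : ℕ)).det = szV θ := by
    rw [szV, ← Matrix.det_transpose]; rfl
  have h2 : (Matrix.of fun i j : Fin n => ((starRingEnd ℂ) (szp (θ j))) ^ (i : ℕ)).det =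
      (starRingEnd ℂ) (szV θ) := by
    rw [← h1, RingHom.map_det]
    congr 1
    ext i j
    simp
  rw [h1, h2, Complex.mul_conj, Complex.normSq_eq_norm_sq]

lemma sz_det_scale {n : ℕ} (A : Matrix (Fin n) (Fin n) ℂ) (u : Fin n → ℂ) :
    A.det * ∏ j, u j = (Matrix.of fun i j => u j * A i j).det := by
  rw [mul_comm]
  exact (Matrix.det_mul_row u A).symm

/-- Heine identity for product observables -/
lemma szE_prod {n : ℕ} (u v : ℝ → ℂ) (hu : Continuous u) (hv : Continuous v) :
    ∫ θ, ∏ j, (u (θ j) * v (θ j)) ∂(szE n) =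
    (Matrix.of fun i j : Fin n => ∫ θ, (u θ * szp θ ^ (i : ℕ)) *
      (v θ * ((starRingEnd ℂ) (szp θ)) ^ (j : ℕ)) ∂szν).det := by
  have hc := szp_cont
  rw [szE_integral]
  have hfac : (n.factorial : ℂ) ≠ 0 := by exact_mod_cast n.factorial_ne_zero
  have h := sz_andreief (n := n) (fun i θ => u θ * szp θ ^ (i : ℕ))
    (fun j θ => v θ * ((starRingEnd ℂ) (szp θ)) ^ (j : ℕ)) (fun i j => szν_integrable_of_cont (by
      have : Continuous (fun θ => (starRingEnd ℂ) (szp θ)) := Complex.continuous_conj.comp hc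
      fun_prop))
  rw [← mul_right_inj' hfac, ← h, ← integral_const_mul]
  refine integral_congr_ae (Eventually.of_forall fun θ => ?_)
  simp only []
  rw [Complex.real_smul]
  push_cast
  have := szV_sq θ
  push_cast at this
  have e1 : (Matrix.of fun i j : Fin n => u (θ j) * szp (θ j) ^ (i : ℕ)).det =
      (Matrix.of fun i j : Fin n => szp (θ j) ^ (i : ℕ)).det * ∏ j, u (θ j) :=
    (sz_det_scale _ (fun j => u (θ j))).symm
  have e2 : (Matrix.of fun i j : Fin n => v (θ j) * ((starRingEnd ℂ) (szp (θ j))) ^ (i : ℕ)).det =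
      (Matrix.of fun i j : Fin n => ((starRingEnd ℂ) (szp (θ j))) ^ (i : ℕ)).det *
        ∏ j, v (θ j) :=
    (sz_det_scale _ (fun j => v (θ j))).symm
  rw [this, Finset.prod_mul_distrib, e1, e2]
  field_simp

lemma szν_ae_mem : ∀ᵐ θ ∂szν, θ ∈ Set.Icc (-Real.pi) Real.pi := by
  unfold szν
  exact Measure.ae_smul_measure (ae_restrict_mem measurableSet_Icc) _

lemma szpi_ae_mem (n : ℕ) : ∀ᵐ θ ∂(Measure.pi fun _ : Fin n => szν),
    θ ∈ Set.pi Set.univ (fun _ : Fin n => Set.Icc (-Real.pi) Real.pi) := by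
  have : ∀ i : Fin n, ∀ᵐ θ ∂(Measure.pi fun _ : Fin n => szν),
      θ i ∈ Set.Icc (-Real.pi) Real.pi := fun i =>
    (Measure.tendsto_eval_ae_ae (μ := fun _ : Fin n => szν) (i := i)).eventually szν_ae_mem
  filter_upwards [eventually_all.2 this] with θ hθ i _ using hθ i

lemma szpi_integrable_of_cont {E : Type*} [NormedAddCommGroup E] [SecondCountableTopology E]
    {n : ℕ} {f : (Fin n → ℝ) → E} (hf : Continuous f) :
    Integrable f (Measure.pi fun _ : Fin n => szν) := by
  have hK : IsCompact (Set.pi Set.univ (fun _ : Fin n => Set.Icc (-Real.pi) Real.pi)) :=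
    isCompact_univ_pi fun _ => isCompact_Icc
  obtain ⟨C, hC⟩ := hK.exists_bound_of_continuousOn hf.continuousOn
  refine Integrable.of_bound hf.aestronglyMeasurable C ?_
  filter_upwards [szpi_ae_mem n] with θ hθ using hC θ hθ

lemma szE_integrable_of_cont {E : Type*} [NormedAddCommGroup E] [NormedSpace ℝ E]
    [SecondCountableTopology E]
    {n : ℕ} {f : (Fin n → ℝ) → E} (hf : Continuous f) : Integrable f (szE n) := by
  rw [szE, integrable_withDensity_iff_integrable_smul (szE_meas n)]
  refine szpi_integrable_of_cont ?_
  have := szV_cont (n := n)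
  have h : Continuous (fun θ : Fin n → ℝ => Real.toNNReal (‖szV θ‖ ^ 2 / n.factorial)) := by
    fun_prop
  exact h.smul hf

lemma sz_zpow (θ : ℝ) {i j : ℕ} (h : j ≤ i) :
    szp θ ^ i * ((starRingEnd ℂ) (szp θ)) ^ j = szp θ ^ (i - j) := by
  rw [szp_inv, inv_pow, pow_sub₀ _ (szp_ne θ) h]

lemma sz_dcl_cont {w : ℂ → ℂ} (hw : DiffContOnCl ℂ w (Metric.ball 0 1)) :
    Continuous (fun θ => w (szp θ)) := by
  have h := hw.continuousOn
  rw [closure_ball _ one_ne_zero] at h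
  exact h.comp_continuous szp_cont (fun θ => by simp [szp_norm])

lemma sz_dcl_cont' {w : ℂ → ℂ} (hw : DiffContOnCl ℂ w (Metric.ball 0 1)) :
    Continuous (fun θ => w ((starRingEnd ℂ) (szp θ))) := by
  simp_rw [← szp_neg]
  exact (sz_dcl_cont hw).comp continuous_neg

lemma szE_tri {n : ℕ} {w : ℂ → ℂ} (hw : DiffContOnCl ℂ w (Metric.ball 0 1)) (h0 : w 0 = 1) :
    ∫ θ, ∏ j, w (szp (θ j)) ∂(szE n) = 1 := by
  have h := szE_prod (n := n) (fun θ => w (szp θ)) (fun _ => 1) (sz_dcl_cont hw) continuous_const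
  simp only [mul_one, one_mul] at h
  rw [h]
  have key : ∀ i j : Fin n, j ≤ i → ∫ θ, w (szp θ) * szp θ ^ (i:ℕ) *
      ((starRingEnd ℂ) (szp θ)) ^ (j:ℕ) ∂szν = if i = j then 1 else 0 := by
    intro i j hij
    have h1 : ∀ θ, w (szp θ) * szp θ ^ (i:ℕ) * ((starRingEnd ℂ) (szp θ)) ^ (j:ℕ) =
        w (szp θ) * szp θ ^ ((i:ℕ) - j) := fun θ => by
      rw [mul_assoc, sz_zpow θ hij]
    simp_rw [h1]
    rw [szν_mean (h := fun z => w z * z ^ ((i:ℕ) - j))]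
    · split_ifs with hh
      · simp [hh, h0]
      · have : (i:ℕ) - j ≠ 0 := by
          have : (i:ℕ) ≠ j := fun h => hh (Fin.ext h)
          have : (j:ℕ) ≤ i := hij
          omega
        simp [this]
    · exact hw.smul (Differentiable.diffContOnCl (by fun_prop))
  rw [Matrix.det_of_isUpperTriangular]
  · refine Finset.prod_eq_one fun i _ => ?_
    rw [Matrix.of_apply, key i i le_rfl, if_pos rfl]
  · intro i j hij
    have hij' : j < i := hij
    rw [Matrix.of_apply, key i j hij'.le, if_neg hij'.ne']

instance szE_prob (n : ℕ) : IsProbabilityMeasure (szE n) := by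
  have h := szE_tri (n := n) (w := fun _ => 1) (Differentiable.diffContOnCl (by fun_prop)) rfl
  simp only [Finset.prod_const_one, integral_const] at h
  have h2 : (szE n).real Set.univ = 1 := by
    have : (((szE n).real Set.univ : ℝ) : ℂ) = 1 := by simpa using h
    exact_mod_cast this
  constructor
  rw [Measure.real] at h2
  rw [← ENNReal.toReal_eq_one_iff]; exact h2

lemma sz_one_sub_ne {α z : ℂ} (hα : ‖α‖ < 1) (hz : ‖z‖ ≤ 1) : 1 - α * z ≠ 0 := by
  intro h
  have h1 : α * z = 1 := (sub_eq_zero.mp h).symm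
  have h2 : ‖α * z‖ = 1 := by rw [h1]; simp
  rw [norm_mul] at h2
  nlinarith [norm_nonneg α, norm_nonneg z]

lemma sz_inv_dcl {n : ℕ} (α : Fin n → ℂ) (hα : ∀ i, ‖α i‖ < 1) :
    DiffContOnCl ℂ (fun z => ∏ i, (1 - α i * z)⁻¹) (Metric.ball 0 1) := by
  have h : DifferentiableOn ℂ (fun z => ∏ i, (1 - α i * z)⁻¹) (closure (Metric.ball 0 1)) := by
    refine DifferentiableOn.fun_finsetProd fun i _ => ?_
    refine DifferentiableOn.inv (by fun_prop) ?_
    intro z hz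
    rw [closure_ball _ one_ne_zero] at hz
    exact sz_one_sub_ne (hα i) (by simpa using hz)
  exact h.diffContOnCl

open Polynomial in
lemma sz_cauchy_factor {n : ℕ} (α : Fin n → ℂ) : ∃ C : Matrix (Fin n) (Fin n) ℂ,
    ∀ θ : Fin n → ℝ, (∀ i j, 1 - α i * szp (θ j) ≠ 0) →
      (Matrix.of fun i j => (1 - α i * szp (θ j))⁻¹).det =
      C.det * ((Matrix.of fun i j : Fin n => szp (θ j) ^ (i:ℕ)).det *
        ∏ j, ∏ i, (1 - α i * szp (θ j))⁻¹) := by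
  let P : Fin n → ℂ[X] := fun i => ∏ k ∈ Finset.univ.erase i, (1 - Polynomial.C (α k) * X)
  have hdeg : ∀ i, (P i).natDegree < n := by
    intro i
    have h1 : (P i).natDegree ≤ ∑ k ∈ Finset.univ.erase i, (1 - Polynomial.C (α k) * X).natDegree :=
      Polynomial.natDegree_prod_le _ _
    have h2 : ∑ k ∈ Finset.univ.erase i, (1 - Polynomial.C (α k) * X).natDegree ≤
        ∑ k ∈ Finset.univ.erase i, 1 := by
      refine Finset.sum_le_sum fun k _ => ?_
      compute_degree
    have h3 : (Finset.univ.erase i : Finset (Fin n)).card = n - 1 := by simp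
    have := i.2
    simp only [Finset.sum_const, smul_eq_mul, mul_one, h3] at h2
    omega
  refine ⟨Matrix.of fun i j => (P i).coeff j, fun θ hne => ?_⟩
  rw [← mul_assoc, ← Matrix.det_mul, sz_det_scale]
  congr 1
  ext i j
  simp only [Matrix.of_apply, Matrix.mul_apply]
  have h1 : ∑ k : Fin n, (P i).coeff k * szp (θ j) ^ (k:ℕ) = (P i).eval (szp (θ j)) := by
    rw [Polynomial.eval_eq_sum_range' (hdeg i), Finset.sum_range]
  rw [h1]
  simp only [P, Polynomial.eval_prod, Polynomial.eval_sub, Polynomial.eval_one,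
    Polynomial.eval_mul, Polynomial.eval_C, Polynomial.eval_X]
  rw [← Finset.mul_prod_erase Finset.univ (fun i => (1 - α i * szp (θ j))⁻¹) (Finset.mem_univ i),
    mul_assoc, ← Finset.prod_mul_distrib]
  rw [Finset.prod_eq_one, mul_one]
  intro k _
  exact inv_mul_cancel₀ (hne k j)

/-- exact formula, distinct nodes -/
lemma szE_exact_aux {n : ℕ} (α : Fin n → ℂ) (hα : ∀ i, ‖α i‖ < 1) (hd : Function.Injective α)
    {v : ℂ → ℂ} (hv : DiffContOnCl ℂ v (Metric.ball 0 1)) :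
    ∫ θ, ∏ j, ((∏ i, (1 - α i * szp (θ j))⁻¹) * v ((starRingEnd ℂ) (szp (θ j)))) ∂(szE n) =
      ∏ i, v (α i) := by
  obtain ⟨C, hC⟩ := sz_cauchy_factor α
  have hne : ∀ θ : Fin n → ℝ, ∀ i j, 1 - α i * szp (θ j) ≠ 0 := fun θ i j =>
    sz_one_sub_ne (hα i) (szp_norm _).le
  have hne1 : ∀ (i) (θ : ℝ), 1 - α i * szp θ ≠ 0 := fun i θ =>
    sz_one_sub_ne (hα i) (szp_norm _).le
  have hfac : (n.factorial : ℂ) ≠ 0 := by exact_mod_cast n.factorial_ne_zero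
  have hsz := szp_cont
  have key : ∀ {v : ℂ → ℂ}, DiffContOnCl ℂ v (Metric.ball 0 1) →
      C.det * ∫ θ, ∏ j, ((∏ i, (1 - α i * szp (θ j))⁻¹) * v ((starRingEnd ℂ) (szp (θ j)))) ∂(szE n)
      = (Matrix.vandermonde α).det * ∏ i, v (α i) := by
    intro v hv
    have hvc := sz_dcl_cont' hv
    have hcc : Continuous (fun θ => (starRingEnd ℂ) (szp θ)) := Complex.continuous_conj.comp hsz
    have h := sz_andreief (n := n) (fun i θ => (1 - α i * szp θ)⁻¹)
      (fun j θ => v ((starRingEnd ℂ) (szp θ)) * ((starRingEnd ℂ) (szp θ)) ^ (j:ℕ))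
      (fun i j => szν_integrable_of_cont (by
        have : Continuous (fun θ => (1 - α i * szp θ)⁻¹) :=
          Continuous.inv₀ (by fun_prop) (hne1 i)
        exact this.mul (hvc.mul (hcc.pow _))))
    have h2 : ∀ i j : Fin n, ∫ θ, (1 - α i * szp θ)⁻¹ *
        (v ((starRingEnd ℂ) (szp θ)) * ((starRingEnd ℂ) (szp θ)) ^ (j:ℕ)) ∂szν =
        v (α i) * α i ^ (j:ℕ) := fun i j => by
      refine szν_cauchy (h := fun z => v z * z ^ (j:ℕ)) ?_ (hα i)
      exact hv.smul (Differentiable.diffContOnCl (by fun_prop))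
    simp_rw [h2] at h
    have h3 : (Matrix.of fun i j : Fin n => v (α i) * α i ^ (j:ℕ)).det =
        (∏ i, v (α i)) * (Matrix.vandermonde α).det :=
      Matrix.det_mul_column (fun i => v (α i)) (Matrix.vandermonde α)
    rw [h3] at h
    rw [szE_integral, ← mul_right_inj' hfac, mul_comm (Matrix.vandermonde α).det, ← h,
      ← integral_const_mul, ← integral_const_mul]
    refine integral_congr_ae (Eventually.of_forall fun θ => ?_)
    simp only []
    rw [Complex.real_smul, hC θ (hne θ)]
    have e2 : (Matrix.of fun i j : Fin n => v ((starRingEnd ℂ) (szp (θ j))) *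
        ((starRingEnd ℂ) (szp (θ j))) ^ (i : ℕ)).det =
      (Matrix.of fun i j : Fin n => ((starRingEnd ℂ) (szp (θ j))) ^ (i : ℕ)).det *
        ∏ j, v ((starRingEnd ℂ) (szp (θ j))) :=
      (sz_det_scale _ (fun j => v ((starRingEnd ℂ) (szp (θ j))))).symm
    have := szV_sq θ
    push_cast at this ⊢
    rw [this, e2, Finset.prod_mul_distrib]
    field_simp
  have k1 := key (v := fun _ => 1) (Differentiable.diffContOnCl (by fun_prop))
  have t1 := szE_tri (n := n) (sz_inv_dcl α hα) (by simp)
  simp only [mul_one, Finset.prod_const_one] at k1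
  rw [t1, mul_one] at k1
  have hV : (Matrix.vandermonde α).det ≠ 0 := Matrix.det_vandermonde_ne_zero_iff.2 hd
  have k2 := key hv
  rw [k1] at k2
  exact mul_left_cancel₀ hV k2

/-- exact formula -/
lemma szE_exact {n : ℕ} (α : Fin n → ℂ) (hα : ∀ i, ‖α i‖ < 1)
    {v : ℂ → ℂ} (hv : DiffContOnCl ℂ v (Metric.ball 0 1)) :
    ∫ θ, ∏ j, ((∏ i, (1 - α i * szp (θ j))⁻¹) * v ((starRingEnd ℂ) (szp (θ j)))) ∂(szE n) =
      ∏ i, v (α i) := by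
  obtain ⟨r, hr1, hr⟩ : ∃ r : ℝ, r < 1 ∧ ∀ i, ‖α i‖ < r := by
    have : ∀ᶠ r in nhdsWithin (1:ℝ) (Set.Iio 1), ∀ i, ‖α i‖ < r :=
      eventually_all.2 fun i => (eventually_gt_nhds (hα i)).filter_mono nhdsWithin_le_nhds
    obtain ⟨r, h1, h2⟩ := (this.and self_mem_nhdsWithin).exists
    exact ⟨r, h2, h1⟩
  let αt : ℂ → Fin n → ℂ := fun t i => α i + t * ((i:ℕ):ℂ)
  have hαt : ∀ i, Continuous (fun t => αt t i) := fun i => by simp only [αt]; fun_prop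
  have hαt0 : ∀ i, αt 0 i = α i := fun i => by simp [αt]
  have hbd : ∀ᶠ t in nhdsWithin (0:ℂ) {0}ᶜ, ∀ i, ‖αt t i‖ < r := by
    refine eventually_all.2 fun i => Eventually.filter_mono nhdsWithin_le_nhds ?_
    have := (hαt i).norm.tendsto 0
    rw [hαt0] at this
    exact this.eventually (eventually_lt_nhds (hr i))
  have hinj : ∀ᶠ t in nhdsWithin (0:ℂ) {0}ᶜ, Function.Injective (αt t) := by
    have : ∀ᶠ t in nhdsWithin (0:ℂ) {0}ᶜ, ∀ i j, i ≠ j → αt t i ≠ αt t j := by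
      refine eventually_all.2 fun i => eventually_all.2 fun j => ?_
      by_cases h : α i = α j
      · filter_upwards [self_mem_nhdsWithin] with t ht hij he
        simp only [αt, h, add_right_inj] at he
        have := mul_left_cancel₀ ht he
        exact hij (Fin.ext (by exact_mod_cast this))
      · refine Eventually.filter_mono nhdsWithin_le_nhds ?_
        have h1 : ∀ᶠ t in nhds (0:ℂ), αt t i - αt t j ≠ 0 := by
          have : Tendsto (fun t => αt t i - αt t j) (nhds 0) (nhds (αt 0 i - αt 0 j)) :=
            ((hαt i).sub (hαt j)).tendsto 0
          rw [hαt0, hαt0] at this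
          exact this.eventually_ne (sub_ne_zero.2 h)
        filter_upwards [h1] with t ht _ using sub_ne_zero.1 ht
    filter_upwards [this] with t ht i j hij
    by_contra h
    exact ht i j h hij
  have hvc := sz_dcl_cont' hv
  have hnb : ∀ a : ℂ, ‖a‖ < r → ∀ θ, ‖(1 - a * szp θ)⁻¹‖ ≤ (1 - r)⁻¹ := by
    intro a ha θ
    rw [norm_inv]
    have h1 : 1 - r ≤ ‖1 - a * szp θ‖ := by
      have := norm_sub_norm_le (1:ℂ) (a * szp θ)
      rw [norm_mul, szp_norm, norm_one] at this
      linarith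
    exact inv_anti₀ (by linarith) h1
  have L1 : Tendsto (fun t => ∫ θ, ∏ j, ((∏ i, (1 - αt t i * szp (θ j))⁻¹) *
      v ((starRingEnd ℂ) (szp (θ j)))) ∂(szE n)) (nhdsWithin (0:ℂ) {0}ᶜ)
      (nhds (∫ θ, ∏ j, ((∏ i, (1 - α i * szp (θ j))⁻¹) *
        v ((starRingEnd ℂ) (szp (θ j)))) ∂(szE n))) := by
    refine tendsto_integral_filter_of_dominated_convergence
      (fun θ => ∏ j, ((∏ i : Fin n, (1 - r)⁻¹) * ‖v ((starRingEnd ℂ) (szp (θ j)))‖)) ?_ ?_ ?_ ?_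
    · filter_upwards [hbd] with t ht
      refine Continuous.aestronglyMeasurable ?_
      refine continuous_finsetProd _ fun j _ => ?_
      refine Continuous.mul (continuous_finsetProd _ fun i _ => ?_)
        (hvc.comp (continuous_apply j))
      refine Continuous.inv₀ ?_ fun θ => sz_one_sub_ne ((ht i).trans hr1) (szp_norm _).le
      have := szp_cont
      fun_prop
    · filter_upwards [hbd] with t ht
      refine Eventually.of_forall fun θ => ?_
      rw [norm_prod]
      refine Finset.prod_le_prod (fun _ _ => norm_nonneg _) fun j _ => ?_
      rw [norm_mul, norm_prod]
      refine mul_le_mul_of_nonneg_right ?_ (norm_nonneg _)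
      exact Finset.prod_le_prod (fun _ _ => norm_nonneg _) fun i _ => hnb _ (ht i) _
    · refine szE_integrable_of_cont ?_
      refine continuous_finsetProd _ fun j _ => ?_
      exact continuous_const.mul (hvc.comp (continuous_apply j)).norm
    · refine Eventually.of_forall fun θ => ?_
      refine Tendsto.mono_left ?_ nhdsWithin_le_nhds
      refine tendsto_finsetProd _ fun j _ => ?_
      refine Tendsto.mul_const _ (tendsto_finsetProd _ fun i _ => ?_)
      refine Tendsto.inv₀ ?_ (sz_one_sub_ne (hα i) (szp_norm _).le)
      have := (hαt i).tendsto 0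
      rw [hαt0] at this
      exact (this.mul_const _).const_sub _
  have L2 : Tendsto (fun t => ∏ i, v (αt t i)) (nhdsWithin (0:ℂ) {0}ᶜ) (nhds (∏ i, v (α i))) := by
    refine Tendsto.mono_left ?_ nhdsWithin_le_nhds
    refine tendsto_finsetProd _ fun i _ => ?_
    have h1 : ContinuousAt v (α i) := (hv.differentiableAt Metric.isOpen_ball
      (by simpa using hα i)).continuousAt
    have := (hαt i).tendsto 0
    rw [hαt0] at this
    exact Tendsto.comp h1 this
  refine tendsto_nhds_unique_of_eventuallyEq L1 L2 ?_
  filter_upwards [hbd, hinj] with t h1 h2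
  exact szE_exact_aux (αt t) (fun i => (h1 i).trans hr1) h2 hv

lemma szE_exactL {n : ℕ} (l : List ℂ) (hl : ∀ a ∈ l, ‖a‖ < 1) (hn : l.length ≤ n)
    {v : ℂ → ℂ} (hv : DiffContOnCl ℂ v (Metric.ball 0 1)) (hv0 : v 0 = 1) :
    ∫ θ, ∏ j, ((l.map fun a => (1 - a * szp (θ j))⁻¹).prod * v ((starRingEnd ℂ) (szp (θ j))))
      ∂(szE n) = (l.map v).prod := by
  obtain ⟨d, rfl⟩ := Nat.exists_eq_add_of_le hn
  obtain ⟨l', hl'⟩ : ∃ l', l' = l ++ List.replicate d 0 := ⟨_, rfl⟩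
  have hlen : l'.length = l.length + d := by simp [hl']
  rw [← hlen]
  have h := szE_exact (fun i : Fin l'.length => l'[i]) (fun i => by
    have : l'[i] ∈ l' := List.getElem_mem _
    have h2 : ∀ x ∈ l', x ∈ l ∨ x ∈ List.replicate d 0 := fun x hx => by
      rwa [hl', List.mem_append] at hx
    rcases h2 _ this with h | h
    · exact hl _ h
    · rw [List.eq_of_mem_replicate h]; simp) hv
  have e1 : ∀ f : ℂ → ℂ, f 0 = 1 → ∏ i : Fin l'.length, f l'[i] = (l.map f).prod := by
    intro f hf
    have := Fin.prod_univ_fun_getElem l' f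
    refine this.trans ?_
    rw [hl']
    simp [hf]
  rw [e1 v hv0] at h
  rw [← h]
  refine integral_congr_ae (Eventually.of_forall fun θ => ?_)
  refine Finset.prod_congr rfl fun j _ => ?_
  rw [e1 (fun a => (1 - a * szp (θ j))⁻¹) (by simp)]

open scoped ComplexOrder in
/-- monotonicity in `n` -/
lemma szE_mono (n : ℕ) {w : ℂ → ℂ} (hw : DiffContOnCl ℂ w (Metric.ball 0 1)) (h0 : w 0 = 1) :
    ∫ θ, ∏ j, ‖w (szp (θ j))‖ ^ 2 ∂(szE n) ≤ ∫ θ, ∏ j, ‖w (szp (θ j))‖ ^ 2 ∂(szE (n + 1)) := by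
  have hwc := sz_dcl_cont hw
  have hwc' : Continuous (fun θ => (starRingEnd ℂ) (w (szp θ))) :=
    Complex.continuous_conj.comp hwc
  let M : (n : ℕ) → Matrix (Fin n) (Fin n) ℂ := fun n => Matrix.of fun i j : Fin n =>
    ∫ θ, (w (szp θ) * szp θ ^ (i : ℕ)) *
      ((starRingEnd ℂ) (w (szp θ)) * ((starRingEnd ℂ) (szp θ)) ^ (j : ℕ)) ∂szν
  have hM : ∀ n, ((∫ θ, ∏ j, ‖w (szp (θ j))‖ ^ 2 ∂(szE n) : ℝ) : ℂ) = (M n).det := by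
    intro n
    rw [← szE_prod _ _ hwc hwc', ← integral_complex_ofReal]
    refine integral_congr_ae (Eventually.of_forall fun θ => ?_)
    simp only []
    push_cast
    refine Finset.prod_congr rfl fun j _ => ?_
    rw [Complex.mul_conj, Complex.normSq_eq_norm_sq]; push_cast; rfl
  set e : Fin (n+1) → ℂ := Pi.single 0 1 with he
  let A' : Matrix (Fin (n+1)) (Fin (n+1)) ℂ := M (n+1) - Matrix.vecMulVec e e
  have hdet : (M (n+1)).det = A'.det + (M n).det := by
    have h1 : M (n+1) = A'.updateRow 0 (A' 0 + e) := by
      ext i j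
      refine Fin.cases ?_ (fun i => ?_) i
      · simp [A', Matrix.vecMulVec_apply, he]
      · simp [A', Matrix.vecMulVec_apply, he]
    rw [h1, Matrix.det_updateRow_add, Matrix.updateRow_eq_self]
    congr 1
    rw [Matrix.det_succ_row_zero, Finset.sum_eq_single 0]
    · simp only [Fin.val_zero, pow_zero, one_mul, he, Matrix.updateRow_self, Pi.single_eq_same,
        mul_one]
      congr 1
      ext i j
      simp only [Matrix.submatrix_apply, Fin.succAbove_zero]
      rw [Matrix.updateRow_ne (Fin.succ_ne_zero i)]
      simp only [A', Matrix.sub_apply, Matrix.vecMulVec_apply, he, M, Matrix.of_apply]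
      simp only [Pi.single_eq_of_ne (Fin.succ_ne_zero _), zero_mul, sub_zero]
      refine integral_congr_ae (Eventually.of_forall fun θ => ?_)
      simp only [Fin.val_succ, pow_succ]
      have : szp θ * (starRingEnd ℂ) (szp θ) = 1 := by
        rw [szp_inv, mul_inv_cancel₀ (szp_ne θ)]
      linear_combination (w (szp θ) * szp θ ^ (i:ℕ) *
        (starRingEnd ℂ) (w (szp θ)) * (starRingEnd ℂ) (szp θ) ^ (j:ℕ)) * this
    · intro j _ hj
      simp [he, Pi.single_eq_of_ne hj]
    · simp
  have hpsd : A'.PosSemidef := by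
    have hintg : ∀ i j : ℕ, Integrable (fun θ => (w (szp θ) * szp θ ^ i) *
      ((starRingEnd ℂ) (w (szp θ)) * ((starRingEnd ℂ) (szp θ)) ^ j)) szν := fun i j => by
      refine szν_integrable_of_cont ?_
      have h1 := szp_cont
      have h2 : Continuous (fun θ => (starRingEnd ℂ) (szp θ)) := Complex.continuous_conj.comp h1
      exact (hwc.mul (h1.pow i)).mul (hwc'.mul (h2.pow j))
    refine Matrix.PosSemidef.of_dotProduct_mulVec_nonneg ?_ ?_
    · ext i j
      simp only [A', Matrix.conjTranspose_apply, Matrix.sub_apply, Matrix.vecMulVec_apply, M,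
        Matrix.of_apply, star_sub]
      congr 1
      · rw [Complex.star_def, ← integral_conj]
        refine integral_congr_ae (Eventually.of_forall fun θ => ?_)
        simp only [map_mul, map_pow, Complex.conj_conj]
        ring
      · simp only [he, Pi.single_apply]
        split_ifs <;> simp
    · intro x
      let P : ℂ → ℂ := fun z => w z * ∑ i : Fin (n+1), (starRingEnd ℂ) (x i) * z ^ (i:ℕ)
      have hP : DiffContOnCl ℂ P (Metric.ball 0 1) :=
        hw.smul (Differentiable.diffContOnCl (by fun_prop))
      have hP0 : P 0 = (starRingEnd ℂ) (x 0) := by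
        simp only [P, h0, one_mul]
        rw [Finset.sum_eq_single 0]
        · simp
        · intro i _ hi
          have : (i:ℕ) ≠ 0 := fun h => hi (Fin.ext h)
          simp [this]
        · simp
      have hPm := szν_mean hP
      rw [hP0] at hPm
      have hPc := sz_dcl_cont hP
      have hPc' : Continuous (fun θ => (starRingEnd ℂ) (P (szp θ))) :=
        Complex.continuous_conj.comp hPc
      have hPm' : ∫ θ, (starRingEnd ℂ) (P (szp θ)) ∂szν = x 0 := by
        rw [integral_conj, hPm, Complex.conj_conj]
      have e1 : star x ⬝ᵥ (M (n+1) *ᵥ x) =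
          ∫ θ, P (szp θ) * (starRingEnd ℂ) (P (szp θ)) ∂szν := by
        simp only [dotProduct, Matrix.mulVec, Finset.mul_sum, M, Matrix.of_apply]
        simp_rw [← integral_mul_const, ← integral_const_mul]
        have hI : ∀ i j : Fin (n+1), Integrable (fun θ => star x i * (w (szp θ) * szp θ ^ (i:ℕ) *
          ((starRingEnd ℂ) (w (szp θ)) * (starRingEnd ℂ) (szp θ) ^ (j:ℕ)) * x j)) szν :=
          fun i j => ((hintg i j).mul_const _).const_mul _
        simp_rw [← integral_finsetSum _ (fun j _ => hI _ j)]
        rw [← integral_finsetSum _ fun i _ => integrable_finsetSum _ fun j _ => hI i j]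
        refine integral_congr_ae (Eventually.of_forall fun θ => ?_)
        simp only [P, map_mul, map_sum, map_pow, Complex.conj_conj]
        rw [show ∀ a b c d : ℂ, (a * b) * (c * d) = (a * c) * (b * d) by intros; ring,
          Finset.sum_mul_sum, Finset.mul_sum]
        refine Finset.sum_congr rfl fun i _ => ?_
        rw [Finset.mul_sum]
        refine Finset.sum_congr rfl fun j _ => ?_
        simp only [Pi.star_apply, Complex.star_def]
        ring
      have e2 : star x ⬝ᵥ (Matrix.vecMulVec e e *ᵥ x) = (starRingEnd ℂ) (x 0) * x 0 := by
        simp [he, dotProduct, Matrix.mulVec, Matrix.vecMulVec_apply, Pi.single_apply]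
      have e3 : star x ⬝ᵥ (A' *ᵥ x) =
          ((∫ θ, ‖P (szp θ) - (starRingEnd ℂ) (x 0)‖ ^ 2 ∂szν : ℝ) : ℂ) := by
        rw [Matrix.sub_mulVec, dotProduct_sub, e1, e2, ← integral_complex_ofReal]
        have : ∀ θ, ((‖P (szp θ) - (starRingEnd ℂ) (x 0)‖ ^ 2 : ℝ) : ℂ) =
            P (szp θ) * (starRingEnd ℂ) (P (szp θ)) - P (szp θ) * x 0
              - (starRingEnd ℂ) (x 0) * (starRingEnd ℂ) (P (szp θ))
              + (starRingEnd ℂ) (x 0) * x 0 := fun θ => by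
          rw [← Complex.normSq_eq_norm_sq, ← Complex.mul_conj]
          simp only [map_sub, Complex.conj_conj]
          ring
        simp_rw [this]
        have i1 := szν_integrable_of_cont (hPc.mul hPc')
        have i2 := szν_integrable_of_cont (hPc.mul (continuous_const (y := x 0)))
        have i3 := szν_integrable_of_cont
          ((continuous_const (y := (starRingEnd ℂ) (x 0))).mul hPc')
        have s1 := integral_add ((i1.sub i2).sub i3) (integrable_const (μ := szν)
          ((starRingEnd ℂ) (x 0) * x 0))
        have s2 := integral_sub (i1.sub i2) i3
        have s3 := integral_sub i1 i2
        simp only [Pi.sub_apply, Pi.mul_apply] at s1 s2 s3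
        rw [s1, s2, s3, integral_mul_const, integral_const_mul, hPm, hPm']
        simp
      rw [e3]
      exact Complex.zero_le_real.2 (integral_nonneg fun θ => by positivity)
  have h2 := hpsd.det_nonneg
  have h3 : (0:ℂ) ≤ ((∫ θ, ∏ j, ‖w (szp (θ j))‖ ^ 2 ∂(szE (n + 1)) -
      ∫ θ, ∏ j, ‖w (szp (θ j))‖ ^ 2 ∂(szE n) : ℝ) : ℂ) := by
    push_cast
    rw [hM, hM, hdet]
    simpa using h2
  have h4 := Complex.zero_le_real.1 h3
  linarith

/-- the space of coefficient sequences -/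
abbrev szl : Type := lp (fun _ : ℕ => ℂ) 1

lemma szl_summable (x : szl) : Summable (fun r => ‖x r‖) := by
  have := (lp.memℓp x).summable (by simp)
  simpa using this

lemma szl_norm (x : szl) : ‖x‖ = ∑' r, ‖x r‖ := by
  have := lp.norm_eq_tsum_rpow (p := 1) (by simp) x
  simpa using this

lemma szl_sum_mul (x : szl) {c : ℕ → ℂ} {C : ℝ} (hc : ∀ r, ‖c r‖ ≤ C) :
    Summable (fun r => x r * c r) ∧ ‖∑' r, x r * c r‖ ≤ C * ‖x‖ := by
  have h1 : Summable (fun r => ‖x r‖ * C) := (szl_summable x).mul_right C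
  have h2 : ∀ r, ‖x r * c r‖ ≤ ‖x r‖ * C := fun r => by
    rw [norm_mul]; exact mul_le_mul_of_nonneg_left (hc r) (norm_nonneg _)
  refine ⟨Summable.of_norm_bounded h1 h2, ?_⟩
  refine (tsum_of_norm_bounded h1.hasSum h2).trans ?_
  rw [tsum_mul_right, ← szl_norm, mul_comm]

lemma sz_coef_bd (z : ℂ) (hz : ‖z‖ ≤ 1) (r : ℕ) : ‖z ^ (r+1) / ((r:ℂ)+1)‖ ≤ 1 := by
  rw [norm_div, norm_pow]
  have h1 : ‖((r:ℂ)+1)‖ = (r:ℝ)+1 := by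
    rw [show ((r:ℂ)+1) = (((r:ℝ)+1 : ℝ) : ℂ) by push_cast; rfl, Complex.norm_real]
    exact abs_of_nonneg (by positivity)
  rw [h1, div_le_one (by positivity)]
  have : ‖z‖ ^ (r+1) ≤ 1 := pow_le_one₀ (norm_nonneg _) hz
  have : (0:ℝ) ≤ r := by positivity
  linarith

/-- linear statistic at a single point -/
noncomputable def szF (θ : ℝ) : szl →L[ℂ] ℂ :=
  LinearMap.mkContinuous
    { toFun := fun x => ∑' r, x r * (szp θ ^ (r+1) / ((r:ℂ)+1))
      map_add' := fun x y => by
        rw [← ((szl_sum_mul x (sz_coef_bd _ (szp_norm θ).le)).1).tsum_add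
          ((szl_sum_mul y (sz_coef_bd _ (szp_norm θ).le)).1)]
        refine tsum_congr fun r => ?_
        simp [add_mul]
      map_smul' := fun c x => by
        simp only [RingHom.id_apply, smul_eq_mul]
        rw [← tsum_mul_left]
        refine tsum_congr fun r => ?_
        simp [mul_assoc] } 1
    (fun x => (szl_sum_mul x (sz_coef_bd _ (szp_norm θ).le)).2)

lemma szF_apply (θ : ℝ) (x : szl) : szF θ x = ∑' r, x r * (szp θ ^ (r+1) / ((r:ℂ)+1)) := rfl

lemma szF_norm (θ : ℝ) (x : szl) : ‖szF θ x‖ ≤ ‖x‖ := by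
  have := (szl_sum_mul x (sz_coef_bd _ (szp_norm θ).le)).2
  rw [one_mul] at this; exact this

lemma szF_cont (x : szl) : Continuous (fun θ => szF θ x) := by
  simp only [szF_apply]
  refine continuous_tsum (u := fun r => ‖x r‖) (fun r => ?_) (szl_summable x) (fun r θ => ?_)
  · have := szp_cont
    fun_prop
  · rw [norm_mul]
    exact mul_le_of_le_one_right (norm_nonneg _) (sz_coef_bd _ (szp_norm θ).le r)

/-- linear statistic -/
noncomputable def szX {n : ℕ} (θ : Fin n → ℝ) : szl →L[ℂ] ℂ := ∑ j, szF (θ j)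

lemma szX_apply {n : ℕ} (θ : Fin n → ℝ) (x : szl) : szX θ x = ∑ j, szF (θ j) x := by
  simp [szX]

lemma szX_cont {n : ℕ} (x : szl) : Continuous (fun θ : Fin n → ℝ => szX θ x) := by
  simp only [szX_apply]
  exact continuous_finsetSum _ fun j _ => (szF_cont x).comp (continuous_apply j)

lemma szX_norm {n : ℕ} (θ : Fin n → ℝ) (x : szl) : ‖szX θ x‖ ≤ n * ‖x‖ := by
  rw [szX_apply]
  refine (norm_sum_le _ _).trans ?_
  refine (Finset.sum_le_sum fun j _ => szF_norm (θ j) x).trans ?_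
  simp

lemma szB_bd (y : szl) (r : ℕ) : ‖(starRingEnd ℂ) (y r) / ((r:ℂ)+1)‖ ≤ ‖y‖ := by
  have h1 : ‖((r:ℂ)+1)‖ = (r:ℝ)+1 := by
    rw [show ((r:ℂ)+1) = (((r:ℝ)+1 : ℝ) : ℂ) by push_cast; rfl, Complex.norm_real]
    exact abs_of_nonneg (by positivity)
  rw [norm_div, h1, RCLike.norm_conj]
  have h2 : ‖y r‖ ≤ ‖y‖ := lp.norm_apply_le_norm (by simp) y r
  have : (0:ℝ) ≤ r := by positivity
  refine (div_le_self (norm_nonneg _) (by linarith)).trans h2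

/-- covariance form -/
noncomputable def szB : szl →L[ℂ] szl →L⋆[ℂ] ℂ :=
  LinearMap.mkContinuous₂ (LinearMap.mk₂'ₛₗ (RingHom.id ℂ) (starRingEnd ℂ)
    (fun x y : szl => ∑' r, x r * ((starRingEnd ℂ) (y r) / ((r:ℂ)+1)))
    (fun x x' y => by
      rw [← ((szl_sum_mul x (szB_bd y)).1).tsum_add ((szl_sum_mul x' (szB_bd y)).1)]
      refine tsum_congr fun r => ?_
      simp [add_mul])
    (fun c x y => by
      simp only [RingHom.id_apply, smul_eq_mul]
      rw [← tsum_mul_left]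
      refine tsum_congr fun r => ?_
      simp [mul_assoc])
    (fun x y y' => by
      rw [← ((szl_sum_mul x (szB_bd y)).1).tsum_add ((szl_sum_mul x (szB_bd y')).1)]
      refine tsum_congr fun r => ?_
      simp only [lp.coeFn_add, Pi.add_apply, map_add]
      ring)
    (fun c x y => by
      simp only [smul_eq_mul]
      rw [← tsum_mul_left]
      refine tsum_congr fun r => ?_
      simp only [lp.coeFn_smul, Pi.smul_apply, smul_eq_mul, map_mul]
      ring)) 1
    (fun x y => by
      have := (szl_sum_mul x (szB_bd y)).2
      simp only [LinearMap.mk₂'ₛₗ_apply]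
      linarith)

lemma szB_apply (x y : szl) :
    szB x y = ∑' r, x r * ((starRingEnd ℂ) (y r) / ((r:ℂ)+1)) := rfl

lemma szB_norm (x y : szl) : ‖szB x y‖ ≤ ‖x‖ * ‖y‖ := by
  have := (szl_sum_mul x (szB_bd y)).2
  rw [szB_apply]; linarith

lemma szB_self (x : szl) : szB x x = ((∑' r, ‖x r‖ ^ 2 / ((r:ℝ)+1) : ℝ) : ℂ) := by
  rw [szB_apply, Complex.ofReal_tsum]
  refine tsum_congr fun r => ?_
  rw [← mul_div_assoc, Complex.mul_conj, Complex.normSq_eq_norm_sq]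
  push_cast; rfl

/-- power sum sequence of one node -/
noncomputable def szP (a : ℂ) (ha : ‖a‖ < 1) : szl :=
  ⟨fun r => a ^ (r+1), by
    refine memℓp_gen ?_
    simp only [ENNReal.toReal_one, Real.rpow_one, norm_pow]
    exact (summable_nat_add_iff 1).2 (summable_geometric_of_lt_one (norm_nonneg _) ha)⟩

lemma szP_apply (a : ℂ) (ha : ‖a‖ < 1) (r : ℕ) : szP a ha r = a ^ (r+1) := rfl

lemma sz_log (w : ℂ) (hw : ‖w‖ < 1) :
    Complex.exp (∑' r : ℕ, w ^ (r+1) / ((r:ℂ)+1)) = (1 - w)⁻¹ := by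
  have h := Complex.hasSum_taylorSeries_neg_log hw
  have h2 := (hasSum_nat_add_iff' 1).2 h
  simp only [Finset.range_one, Finset.sum_singleton, pow_zero, Nat.cast_zero, div_zero,
    sub_zero, Nat.cast_add, Nat.cast_one] at h2
  rw [h2.tsum_eq, Complex.exp_neg, Complex.exp_log]
  intro h0
  rw [← sub_eq_zero.mp h0] at hw
  simp at hw

lemma szP_F (a : ℂ) (ha : ‖a‖ < 1) (θ : ℝ) :
    Complex.exp (szF θ (szP a ha)) = (1 - a * szp θ)⁻¹ := by
  rw [← sz_log (a * szp θ) (by rw [norm_mul, szp_norm, mul_one]; exact ha), szF_apply]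
  congr 1
  refine tsum_congr fun r => ?_
  rw [szP_apply, mul_pow]; ring

lemma szP_B (a b : ℂ) (ha : ‖a‖ < 1) (hb : ‖b‖ < 1) :
    Complex.exp (szB (szP a ha) (szP b hb)) = (1 - (starRingEnd ℂ) b * a)⁻¹ := by
  rw [← sz_log ((starRingEnd ℂ) b * a), szB_apply]
  · congr 1
    refine tsum_congr fun r => ?_
    rw [szP_apply, szP_apply, mul_pow, map_pow]; ring
  · rw [norm_mul, RCLike.norm_conj]
    nlinarith [norm_nonneg a, norm_nonneg b]

/-- nodes -/
abbrev szD : Type := {a : ℂ // ‖a‖ < 1}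

/-- power sums of a list of nodes -/
noncomputable def szPL (l : List szD) : szl := (l.map fun a => szP a.1 a.2).sum

lemma szPL_F (l : List szD) (θ : ℝ) :
    Complex.exp (szF θ (szPL l)) = ((l.map Subtype.val).map fun a => (1 - a * szp θ)⁻¹).prod := by
  induction l with
  | nil => simp [szPL]
  | cons a l ih =>
    have : szPL (a :: l) = szP a.1 a.2 + szPL l := by simp [szPL]
    rw [this, map_add, Complex.exp_add, ih, szP_F]
    simp

lemma szPL_B1 (l : List szD) (b : szl) (v : ℂ → ℂ)
    (hv : ∀ a : szD, Complex.exp (szB (szP a.1 a.2) b) = v a.1) :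
    Complex.exp (szB (szPL l) b) = ((l.map Subtype.val).map v).prod := by
  induction l with
  | nil => simp [szPL]
  | cons a l ih =>
    have : szPL (a :: l) = szP a.1 a.2 + szPL l := by simp [szPL]
    rw [this, map_add, _root_.add_apply, Complex.exp_add, ih, hv]
    simp

lemma szPL_B2 (l : List szD) (a : szD) :
    Complex.exp (szB (szP a.1 a.2) (szPL l)) =
      (l.map fun b => (1 - (starRingEnd ℂ) b.1 * a.1)⁻¹).prod := by
  induction l with
  | nil => simp [szPL]
  | cons b l ih =>
    have : szPL (b :: l) = szP b.1 b.2 + szPL l := by simp [szPL]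
    rw [this, map_add, Complex.exp_add, ih, szP_B]
    simp

lemma szX_exp {n : ℕ} (θ : Fin n → ℝ) (x : szl) :
    Complex.exp (szX θ x) = ∏ j, Complex.exp (szF (θ j) x) := by
  rw [szX_apply, Complex.exp_sum]

/-- exact two-list formula -/
lemma szE_exact2 {n : ℕ} (l l' : List szD) (hn : l.length ≤ n) :
    ∫ θ, Complex.exp (szX θ (szPL l)) * (starRingEnd ℂ) (Complex.exp (szX θ (szPL l'))) ∂(szE n)
      = Complex.exp (szB (szPL l) (szPL l')) := by
  let v : ℂ → ℂ := fun w => (l'.map fun b => (1 - (starRingEnd ℂ) b.1 * w)⁻¹).prod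
  have hv : DiffContOnCl ℂ v (Metric.ball 0 1) := by
    have h := sz_inv_dcl (fun i : Fin l'.length => (starRingEnd ℂ) l'[i].1)
      (fun i => by rw [RCLike.norm_conj]; exact l'[i].2)
    convert h using 2 with w
    exact (Fin.prod_univ_fun_getElem l' (fun b => (1 - (starRingEnd ℂ) b.1 * w)⁻¹)).symm
  have hv0 : v 0 = 1 := by simp [v]
  have h := szE_exactL (n := n) (l.map Subtype.val) (by
    intro a ha
    obtain ⟨b, _, rfl⟩ := List.mem_map.1 ha
    exact b.2) (by simpa using hn) hv hv0
  rw [szPL_B1 l (szPL l') v (fun a => szPL_B2 l' a), ← h]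
  refine integral_congr_ae (Eventually.of_forall fun θ => ?_)
  simp only []
  rw [szX_exp, szX_exp, map_prod, ← Finset.prod_mul_distrib]
  refine Finset.prod_congr rfl fun j _ => ?_
  rw [szPL_F, szPL_F]
  congr 1
  simp only [v, map_list_prod, List.map_map]
  congr 1
  refine List.map_congr_left fun b _ => ?_
  simp

lemma sz_exp_sq (z : ℂ) : Real.exp (2 * z.re) = ‖Complex.exp z‖ ^ 2 := by
  rw [Complex.norm_exp, ← Real.exp_nat_mul]; norm_num

lemma szE_F1_list (n : ℕ) (l : List szD) :
    ∫ θ, Real.exp (2 * (szX θ (szPL l)).re) ∂(szE n) ≤ Real.exp (szB (szPL l) (szPL l)).re := by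
  let w : ℂ → ℂ := fun z => (l.map fun b => (1 - b.1 * z)⁻¹).prod
  have hw : DiffContOnCl ℂ w (Metric.ball 0 1) := by
    have h := sz_inv_dcl (fun i : Fin l.length => l[i].1) (fun i => l[i].2)
    convert h using 2 with z
    exact (Fin.prod_univ_fun_getElem l (fun b => (1 - b.1 * z)⁻¹)).symm
  have hw0 : w 0 = 1 := by simp [w]
  have e : ∀ n, ∫ θ, Real.exp (2 * (szX θ (szPL l)).re) ∂(szE n) =
      ∫ θ, ∏ j, ‖w (szp (θ j))‖ ^ 2 ∂(szE n) := by
    intro n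
    refine integral_congr_ae (Eventually.of_forall fun θ => ?_)
    simp only []
    rw [sz_exp_sq, szX_exp, norm_prod, ← Finset.prod_pow]
    refine Finset.prod_congr rfl fun j _ => ?_
    rw [szPL_F, List.map_map]; rfl
  have hmono : Monotone (fun n => ∫ θ, Real.exp (2 * (szX θ (szPL l)).re) ∂(szE n)) :=
    monotone_nat_of_le_succ fun n => by
      rw [e, e]; exact szE_mono n hw hw0
  refine (hmono (le_max_left n l.length)).trans (le_of_eq ?_)
  have h := szE_exact2 (n := max n l.length) l l (le_max_right _ _)
  have h2 : ((∫ θ, Real.exp (2 * (szX θ (szPL l)).re) ∂(szE (max n l.length)) : ℝ) : ℂ) =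
      Complex.exp (szB (szPL l) (szPL l)) := by
    rw [← h, ← integral_complex_ofReal]
    refine integral_congr_ae (Eventually.of_forall fun θ => ?_)
    simp only []
    rw [sz_exp_sq, Complex.mul_conj, Complex.normSq_eq_norm_sq]
  have h3 : (szB (szPL l) (szPL l)).im = 0 := by rw [szB_self, Complex.ofReal_im]
  have h4 : szB (szPL l) (szPL l) = (((szB (szPL l) (szPL l)).re : ℝ) : ℂ) :=
    Complex.ext (by simp) (by simp [h3])
  rw [h4] at h2
  exact_mod_cast h2

lemma szB_cont2 : Continuous (fun p : szl × szl => szB p.1 p.2) := by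
  rw [continuous_iff_continuousAt]
  rintro ⟨x₀, y₀⟩
  rw [ContinuousAt, tendsto_iff_norm_sub_tendsto_zero]
  have hc : Continuous (fun p : szl × szl => ‖p.1 - x₀‖ * ‖p.2‖ + ‖x₀‖ * ‖p.2 - y₀‖) := by fun_prop
  have h0 := hc.tendsto (x₀, y₀)
  simp only [sub_self, norm_zero, zero_mul, mul_zero, add_zero] at h0
  refine squeeze_zero (fun _ => norm_nonneg _) (fun p => ?_) h0
  have e : szB p.1 p.2 - szB x₀ y₀ = szB (p.1 - x₀) p.2 + szB x₀ (p.2 - y₀) := by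
    rw [map_sub, map_sub, _root_.sub_apply]; ring
  rw [e]
  exact (norm_add_le _ _).trans (add_le_add (szB_norm _ _) (szB_norm _ _))

lemma szB_cont_self : Continuous (fun x : szl => (szB x x).re) := by
  refine Complex.continuous_re.comp ?_
  exact szB_cont2.comp (continuous_id.prodMk continuous_id)

lemma sz_single_approx (k : ℕ) (c : ℂ) (N : ℕ) :
    ∃ b : ℂ, b ^ (k+1) = c / ((N+1) * (k+1)) ∧
      (‖b‖ ≤ 1/2 → ∃ l : List szD, ‖szPL l - lp.single 1 k c‖ ≤
        2 * (N+1) * (k+1) * ‖b‖ ^ (2 * (k+1))) := by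
  obtain ⟨b, hb⟩ : ∃ b : ℂ, b ^ (k+1) = c / ((N+1) * (k+1)) :=
    IsAlgClosed.exists_pow_nat_eq _ (Nat.succ_pos k)
  refine ⟨b, hb, fun hb1 => ?_⟩
  have hω := Complex.isPrimitiveRoot_exp (k+1) (Nat.succ_ne_zero k)
  set ω := Complex.exp (2 * Real.pi * Complex.I / ((k+1 : ℕ):ℂ)) with hωdef
  have hωn : ‖ω‖ = 1 := hω.norm'_eq_one (Nat.succ_ne_zero k)
  have hlt : ∀ i : ℕ, ‖ω ^ i * b‖ < 1 := fun i => by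
    rw [norm_mul, norm_pow, hωn, one_pow, one_mul]; linarith
  let l1 : List szD := (List.range (k+1)).map fun i => ⟨ω ^ i * b, hlt i⟩
  let l : List szD := (List.replicate (N+1) l1).flatten
  have hl1 : ∀ r, (szPL l1 : szl) r = ∑ i ∈ Finset.range (k+1), (ω ^ i * b) ^ (r+1) := by
    intro r
    have : szPL l1 = ∑ i ∈ Finset.range (k+1), szP (ω ^ i * b) (hlt i) := by
      simp only [szPL, l1, List.map_map]
      rw [Finset.sum_eq_multiset_sum]
      rfl
    rw [this, lp.coeFn_sum, Finset.sum_apply]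
    rfl
  have hl : ∀ r, (szPL l : szl) r = (N+1) * ∑ i ∈ Finset.range (k+1), (ω ^ i * b) ^ (r+1) := by
    intro r
    have : szPL l = (N+1) • szPL l1 := by
      simp [szPL, l, List.map_flatten, List.sum_flatten]
    rw [this, ← hl1]
    simp
  refine ⟨l, ?_⟩
  have hco : ∀ r, ‖(szPL l - lp.single 1 k c : szl) r‖ ≤
      if r < 2 * k + 1 then 0 else (N+1) * (k+1) * ‖b‖ ^ (r+1) := by
    intro r
    rw [lp.coeFn_sub, Pi.sub_apply, hl]
    split_ifs with hr
    · by_cases hrk : r = k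
      · subst hrk
        rw [lp.single_apply_self]
        have : ∀ i ∈ Finset.range (r+1), (ω ^ i * b) ^ (r+1) = c / ((N+1) * (r+1)) := fun i _ => by
          rw [mul_pow, hb, ← pow_mul, mul_comm i, pow_mul, hω.pow_eq_one, one_pow, one_mul]
        rw [Finset.sum_congr rfl this]
        simp only [Finset.sum_const, Finset.card_range, nsmul_eq_mul]
        have h1 : ((N:ℂ)+1) ≠ 0 := by exact_mod_cast Nat.succ_ne_zero N
        have h2 : ((r:ℂ)+1) ≠ 0 := by exact_mod_cast Nat.succ_ne_zero r
        have : ((N:ℂ)+1) * (((r+1:ℕ):ℂ) * (c / ((N+1) * (r+1)))) - c = 0 := by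
          push_cast; field_simp; ring
        rw [this, norm_zero]
      · rw [lp.single_apply_ne _ _ _ hrk]
        have h1 : ω ^ (r+1) ≠ 1 := by
          rw [Ne, hω.pow_eq_one_iff_dvd]
          rintro ⟨q, hq⟩
          rcases q with _ | _ | q
          · omega
          · omega
          · nlinarith
        have : ∑ i ∈ Finset.range (k+1), (ω ^ i * b) ^ (r+1) =
            (∑ i ∈ Finset.range (k+1), (ω ^ (r+1)) ^ i) * b ^ (r+1) := by
          rw [Finset.sum_mul]
          refine Finset.sum_congr rfl fun i _ => ?_
          rw [mul_pow, ← pow_mul, ← pow_mul, mul_comm i]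
        rw [this, geom_sum_eq h1, ← pow_mul, mul_comm (r+1), pow_mul, hω.pow_eq_one]
        simp
    · have hk : r ≠ k := by omega
      rw [lp.single_apply_ne _ _ _ hk, sub_zero, norm_mul]
      have h1 : ‖((N:ℂ)+1)‖ = (N:ℝ)+1 := by
        rw [show ((N:ℂ)+1) = (((N:ℝ)+1 : ℝ) : ℂ) by push_cast; rfl, Complex.norm_real]
        exact abs_of_nonneg (by positivity)
      rw [h1, mul_assoc]
      refine mul_le_mul_of_nonneg_left ?_ (by positivity)
      refine (norm_sum_le _ _).trans ?_
      have : ∀ i ∈ Finset.range (k+1), ‖(ω ^ i * b) ^ (r+1)‖ ≤ ‖b‖ ^ (r+1) := fun i _ => by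
        rw [norm_pow, norm_mul, norm_pow, hωn, one_pow, one_mul]
      refine (Finset.sum_le_sum this).trans ?_
      simp
  have hgeo : HasSum (fun i : ℕ => ‖b‖ ^ i) (1 - ‖b‖)⁻¹ :=
    hasSum_geometric_of_lt_one (norm_nonneg _) (by linarith)
  have hs : HasSum (fun r => if r < 2 * k + 1 then 0 else ((N:ℝ)+1) * (k+1) * ‖b‖ ^ (r+1))
      (((N:ℝ)+1) * (k+1) * ‖b‖ ^ (2 * (k+1)) * (1 - ‖b‖)⁻¹) := by
    have h1 := hgeo.mul_left (((N:ℝ)+1) * (k+1) * ‖b‖ ^ (2 * (k+1)))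
    rw [← hasSum_nat_add_iff' (2*k+1)]
    rw [Finset.sum_eq_zero, sub_zero]
    · have e : ∀ i : ℕ, (if i + (2 * k + 1) < 2 * k + 1 then 0 else
          ((N:ℝ)+1) * (k+1) * ‖b‖ ^ (i + (2 * k + 1) + 1)) =
          ((N:ℝ)+1) * (k+1) * ‖b‖ ^ (2 * (k+1)) * ‖b‖ ^ i := fun i => by
        rw [if_neg (by omega), mul_assoc _ (‖b‖ ^ _), ← pow_add]
        congr 2
        omega
      simp_rw [e]
      exact h1
    · intro i hi
      rw [if_pos (Finset.mem_range.1 hi)]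
  rw [szl_norm]
  refine (Summable.tsum_le_tsum hco (szl_summable _) hs.summable).trans ?_
  rw [hs.tsum_eq]
  have h2 : (1 - ‖b‖)⁻¹ ≤ 2 := by
    rw [inv_le_comm₀ (by linarith) (by norm_num)]; linarith
  have h3 : 0 ≤ ((N:ℝ)+1) * (k+1) * ‖b‖ ^ (2 * (k+1)) := by positivity
  nlinarith

lemma szPL_append (l l' : List szD) : szPL (l ++ l') = szPL l + szPL l' := by
  simp [szPL]

/-- additive monoid of power sum sequences -/
noncomputable def szS : AddSubmonoid szl where
  carrier := Set.range szPL
  add_mem' := by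
    rintro _ _ ⟨l, rfl⟩ ⟨l', rfl⟩
    exact ⟨l ++ l', szPL_append l l'⟩
  zero_mem' := ⟨[], by simp [szPL]⟩

lemma szS_single (k : ℕ) (c : ℂ) : (lp.single 1 k c : szl) ∈ szS.topologicalClosure := by
  choose b hb hl using sz_single_approx k c
  have hbn : ∀ N : ℕ, ‖b N‖ ^ (k+1) = ‖c‖ / ((N+1) * (k+1)) := fun N => by
    rw [← norm_pow, hb, norm_div, norm_mul]
    congr 2
    · rw [show ((N:ℂ)+1) = (((N:ℝ)+1 : ℝ) : ℂ) by push_cast; rfl, Complex.norm_real]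
      exact abs_of_nonneg (by positivity)
    · rw [show ((k:ℂ)+1) = (((k:ℝ)+1 : ℝ) : ℂ) by push_cast; rfl, Complex.norm_real]
      exact abs_of_nonneg (by positivity)
  have t0 : Tendsto (fun N : ℕ => ((N:ℝ)+1)⁻¹) atTop (nhds 0) := by
    simpa using tendsto_one_div_add_atTop_nhds_zero_nat (𝕜 := ℝ)
  have t1 : Tendsto (fun N : ℕ => ‖c‖ / (((N:ℝ)+1) * (k+1))) atTop (nhds 0) := by
    have := t0.mul_const (‖c‖ / ((k:ℝ)+1))
    rw [zero_mul] at this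
    refine this.congr fun N => ?_
    field_simp
  have ev : ∀ᶠ N : ℕ in atTop, ‖b N‖ ≤ 1/2 := by
    have : (0:ℝ) < (1/2) ^ (k+1) := by positivity
    filter_upwards [t1.eventually (eventually_lt_nhds this)] with N hN
    rw [← hbn] at hN
    exact (lt_of_pow_lt_pow_left₀ _ (by norm_num) hN).le
  have t2 : Tendsto (fun N : ℕ => 2 * ((N:ℝ)+1) * (k+1) * ‖b N‖ ^ (2 * (k+1))) atTop (nhds 0) := by
    have := t1.const_mul (2 * ‖c‖)
    rw [mul_zero] at this
    refine this.congr fun N => ?_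
    rw [mul_comm 2 (k+1), pow_mul, hbn]
    field_simp
  change _ ∈ closure (szS : Set szl)
  rw [Metric.mem_closure_iff]
  intro ε hε
  obtain ⟨N, h1, h2⟩ := (ev.and (t2.eventually (eventually_lt_nhds hε))).exists
  obtain ⟨l, hl⟩ := hl N h1
  refine ⟨szPL l, ⟨l, rfl⟩, ?_⟩
  rw [dist_comm, dist_eq_norm]
  exact hl.trans_lt h2

lemma szS_dense (x : szl) : x ∈ closure (Set.range szPL) := by
  have h := lp.hasSum_single (p := 1) (by simp) x
  have hc : IsClosed (closure (Set.range szPL)) := isClosed_closure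
  refine hc.mem_of_tendsto h (Eventually.of_forall fun s => ?_)
  change _ ∈ szS.topologicalClosure
  exact sum_mem fun i _ => szS_single i _

lemma szX_ptw_cont {n : ℕ} (θ : Fin n → ℝ) : Continuous (fun x : szl => szX θ x) :=
  (szX θ).continuous

/-- F1 for all summable sequences -/
lemma szE_F1 (n : ℕ) (x : szl) :
    ∫ θ, Real.exp (2 * (szX θ x).re) ∂(szE n) ≤ Real.exp (szB x x).re := by
  have hclosed : IsClosed {x : szl | ∫ θ, Real.exp (2 * (szX θ x).re) ∂(szE n) ≤
      Real.exp (szB x x).re} := by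
    refine isClosed_le ?_ (Real.continuous_exp.comp szB_cont_self)
    rw [continuous_iff_continuousAt]
    intro x₀
    refine tendsto_integral_filter_of_dominated_convergence
      (fun _ => Real.exp (2 * (n * (‖x₀‖ + 1)))) ?_ ?_ (integrable_const _) ?_
    · refine Eventually.of_forall fun x => Continuous.aestronglyMeasurable ?_
      have := szX_cont (n := n) x
      fun_prop
    · have : ∀ᶠ x in nhds x₀, ‖x‖ < ‖x₀‖ + 1 :=
        continuous_norm.continuousAt.eventually (eventually_lt_nhds (by linarith))
      filter_upwards [this] with x hx
      refine Eventually.of_forall fun θ => ?_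
      rw [Real.norm_eq_abs, abs_of_pos (Real.exp_pos _), Real.exp_le_exp]
      have h1 := (Complex.re_le_norm _).trans (szX_norm θ x)
      have : (n:ℝ) * ‖x‖ ≤ n * (‖x₀‖ + 1) := by gcongr
      linarith
    · refine Eventually.of_forall fun θ => ?_
      have h : Continuous (fun x : szl => Real.exp (2 * (szX θ x).re)) := by
        have := szX_ptw_cont θ
        fun_prop
      exact h.tendsto x₀
  have hsub : closure (Set.range szPL) ⊆ {x : szl | ∫ θ, Real.exp (2 * (szX θ x).re) ∂(szE n) ≤
      Real.exp (szB x x).re} := by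
    refine hclosed.closure_subset_iff.2 ?_
    rintro _ ⟨l, rfl⟩
    exact szE_F1_list n l
  exact hsub (szS_dense x)

lemma szE_F1' (n : ℕ) (x : szl) :
    ∫ θ, Real.exp (szX θ x).re ∂(szE n) ≤ Real.exp (‖x‖ ^ 2) := by
  have h := szE_F1 n ((1/2 : ℂ) • x)
  have e : ∀ θ : Fin n → ℝ, 2 * (szX θ ((1/2 : ℂ) • x)).re = (szX θ x).re := fun θ => by
    rw [map_smul, smul_eq_mul, show (1/2:ℂ) = ((1/2:ℝ):ℂ) by push_cast; rfl, Complex.re_ofReal_mul]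
    ring
  simp_rw [e] at h
  refine h.trans (Real.exp_le_exp.2 ?_)
  refine (Complex.re_le_norm _).trans ((szB_norm _ _).trans ?_)
  rw [norm_smul]
  norm_num
  nlinarith [norm_nonneg x]

/-- elementary bound for differences of exponentials -/
lemma sz_exp_diff (A A' : ℂ) {ε : ℝ} (hε : 0 < ε) (hε1 : ε ≤ 1) :
    ‖Complex.exp A - Complex.exp A'‖ ≤ ε * Real.exp (2 / ε * ‖A - A'‖ + A'.re) := by
  have h1 : Complex.exp A - Complex.exp A' = Complex.exp A' * (Complex.exp (A - A') - 1) := by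
    rw [mul_sub, ← Complex.exp_add]; ring_nf
  rw [h1, norm_mul, Complex.norm_exp]
  set t := ‖A - A'‖ with ht
  have ht0 : 0 ≤ t := norm_nonneg _
  have h2 : ‖Complex.exp (A - A') - 1‖ ≤ t * Real.exp t := by
    have := Complex.norm_exp_sub_sum_le_norm_mul_exp (A - A') 1
    simpa using this
  have h3 : t ≤ ε * Real.exp (t / ε) := by
    have := Real.add_one_le_exp (t / ε)
    have h4 : t = ε * (t / ε) := by field_simp
    calc t = ε * (t / ε) := h4
      _ ≤ ε * Real.exp (t / ε) := by
        refine mul_le_mul_of_nonneg_left ?_ hε.le; linarith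
  have h5 : Real.exp t ≤ Real.exp (t / ε) := by
    rw [Real.exp_le_exp, le_div_iff₀ hε]; nlinarith
  calc Real.exp A'.re * ‖Complex.exp (A - A') - 1‖
      ≤ Real.exp A'.re * (ε * Real.exp (t / ε) * Real.exp (t / ε)) := by
        refine mul_le_mul_of_nonneg_left (h2.trans ?_) (Real.exp_pos _).le
        exact mul_le_mul h3 h5 (Real.exp_pos _).le (by positivity)
    _ = ε * Real.exp (2 / ε * t + A'.re) := by
        rw [show 2 / ε * t + A'.re = t / ε + t / ε + A'.re by ring, Real.exp_add, Real.exp_add]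
        ring

/-- the four diagonal directions -/
noncomputable def szζ (p : Bool × Bool) : ℂ := (if p.1 then 1 else -1) + (if p.2 then Complex.I else -Complex.I)

lemma szζ_norm (p : Bool × Bool) : ‖szζ p‖ ≤ 2 := by
  refine (norm_add_le _ _).trans ?_
  rcases p with ⟨_ | _, _ | _⟩ <;> norm_num

lemma sz_exp_norm_le (w : ℂ) : Real.exp ‖w‖ ≤ ∑ p : Bool × Bool, Real.exp (szζ p * w).re := by
  have h1 : ‖w‖ ≤ |w.re| + |w.im| := Complex.norm_le_abs_re_add_abs_im w
  obtain ⟨p, hp⟩ : ∃ p : Bool × Bool, (szζ p * w).re = |w.re| + |w.im| := by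
    rcases le_total 0 w.re with h | h <;> rcases le_total 0 w.im with h' | h'
    · exact ⟨(true, false), by simp [szζ, abs_of_nonneg h, abs_of_nonneg h']⟩
    · exact ⟨(true, true), by simp [szζ, abs_of_nonneg h, abs_of_nonpos h']; ring⟩
    · exact ⟨(false, false), by simp [szζ, abs_of_nonpos h, abs_of_nonneg h']⟩
    · exact ⟨(false, true), by simp [szζ, abs_of_nonpos h, abs_of_nonpos h']; ring⟩
  calc Real.exp ‖w‖ ≤ Real.exp (szζ p * w).re := by rw [hp]; exact Real.exp_le_exp.2 h1
    _ ≤ _ := Finset.single_le_sum (f := fun p => Real.exp (szζ p * w).re)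
      (fun _ _ => (Real.exp_pos _).le) (Finset.mem_univ p)

lemma sz_equi (n : ℕ) (x y x' y' : szl) {ε : ℝ} (hε : 0 < ε) (hε1 : ε ≤ 1)
    (hx : ‖x' - x‖ ≤ ε) (hy : ‖y' - y‖ ≤ ε) :
    ‖∫ θ, Complex.exp (szX θ x') * (starRingEnd ℂ) (Complex.exp (szX θ y')) ∂(szE n) -
      ∫ θ, Complex.exp (szX θ x) * (starRingEnd ℂ) (Complex.exp (szX θ y)) ∂(szE n)‖ ≤
      ε * (16 * Real.exp ((‖x‖ + ‖y‖ + 8) ^ 2)) := by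
  have hco : ∀ x y : szl, Continuous (fun θ : Fin n → ℝ => Complex.exp (szX θ x) *
      (starRingEnd ℂ) (Complex.exp (szX θ y))) := fun x y => by
    have h1 := szX_cont (n := n) x
    have h2 := szX_cont (n := n) y
    exact (Complex.continuous_exp.comp h1).mul
      (Complex.continuous_conj.comp (Complex.continuous_exp.comp h2))
  rw [← integral_sub (szE_integrable_of_cont (hco _ _)) (szE_integrable_of_cont (hco _ _))]
  let u : Bool × Bool → Bool × Bool → szl := fun p q =>
    x + y + (2 / ε : ℂ) • (szζ p • (x' - x) + szζ q • (y' - y))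
  have hu : ∀ p q, ‖u p q‖ ≤ ‖x‖ + ‖y‖ + 8 := by
    intro p q
    refine (norm_add_le _ _).trans (add_le_add (norm_add_le _ _) ?_)
    rw [norm_smul]
    have h1 : ‖(2 / ε : ℂ)‖ = 2 / ε := by
      rw [show (2/ε : ℂ) = ((2/ε : ℝ) : ℂ) by push_cast; rfl, Complex.norm_real]
      exact abs_of_pos (by positivity)
    rw [h1]
    have h2 : ‖szζ p • (x' - x) + szζ q • (y' - y)‖ ≤ 4 * ε := by
      refine (norm_add_le _ _).trans ?_
      rw [norm_smul, norm_smul]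
      have := mul_le_mul (szζ_norm p) hx (norm_nonneg _) (by norm_num)
      have := mul_le_mul (szζ_norm q) hy (norm_nonneg _) (by norm_num)
      linarith
    calc 2 / ε * ‖szζ p • (x' - x) + szζ q • (y' - y)‖ ≤ 2 / ε * (4 * ε) := by gcongr
      _ = 8 := by field_simp; norm_num
  have hpt : ∀ θ : Fin n → ℝ, ‖Complex.exp (szX θ x') * (starRingEnd ℂ) (Complex.exp (szX θ y')) -
      Complex.exp (szX θ x) * (starRingEnd ℂ) (Complex.exp (szX θ y))‖ ≤
      ε * ∑ p : Bool × Bool, ∑ q : Bool × Bool, Real.exp (szX θ (u p q)).re := by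
    intro θ
    rw [← Complex.exp_conj, ← Complex.exp_conj, ← Complex.exp_add, ← Complex.exp_add]
    refine (sz_exp_diff _ _ hε hε1).trans ?_
    refine mul_le_mul_of_nonneg_left ?_ hε.le
    set d := szX θ (x' - x) with hd
    set e := szX θ (y' - y) with he
    have h1 : ‖szX θ x' + (starRingEnd ℂ) (szX θ y') - (szX θ x + (starRingEnd ℂ) (szX θ y))‖ ≤
        ‖d‖ + ‖e‖ := by
      have : szX θ x' + (starRingEnd ℂ) (szX θ y') - (szX θ x + (starRingEnd ℂ) (szX θ y)) =
          d + (starRingEnd ℂ) e := by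
        simp only [hd, he, map_sub]; ring
      rw [this]
      refine (norm_add_le _ _).trans ?_
      rw [RCLike.norm_conj]
    have h2 : ∀ w : ℂ, 2 / ε * ‖w‖ = ‖(2 / ε : ℂ) * w‖ := fun w => by
      rw [norm_mul, show (2/ε : ℂ) = ((2/ε : ℝ) : ℂ) by push_cast; rfl, Complex.norm_real,
        Real.norm_eq_abs, abs_of_pos (by positivity)]
    calc Real.exp (2 / ε * ‖szX θ x' + (starRingEnd ℂ) (szX θ y') -
          (szX θ x + (starRingEnd ℂ) (szX θ y))‖ + (szX θ x + (starRingEnd ℂ) (szX θ y)).re)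
        ≤ Real.exp (2 / ε * ‖d‖ + 2 / ε * ‖e‖ + (szX θ x + (starRingEnd ℂ) (szX θ y)).re) := by
          rw [Real.exp_le_exp, ← mul_add]
          have := mul_le_mul_of_nonneg_left h1 (show 0 ≤ 2 / ε by positivity)
          linarith
      _ = Real.exp ‖(2 / ε : ℂ) * d‖ * Real.exp ‖(2 / ε : ℂ) * e‖ *
          Real.exp (szX θ x + (starRingEnd ℂ) (szX θ y)).re := by
          rw [Real.exp_add, Real.exp_add, h2, h2]
      _ ≤ (∑ p, Real.exp (szζ p * ((2 / ε : ℂ) * d)).re) *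
          (∑ q, Real.exp (szζ q * ((2 / ε : ℂ) * e)).re) *
          Real.exp (szX θ x + (starRingEnd ℂ) (szX θ y)).re := by
          gcongr
          · exact sz_exp_norm_le _
          · exact sz_exp_norm_le _
      _ = _ := by
          rw [Finset.sum_mul_sum, Finset.sum_mul]
          refine Finset.sum_congr rfl fun p _ => ?_
          rw [Finset.sum_mul]
          refine Finset.sum_congr rfl fun q _ => ?_
          rw [← Real.exp_add, ← Real.exp_add]
          congr 1
          have : szX θ (u p q) = szX θ x + szX θ y + (szζ p * ((2 / ε : ℂ) * d) +
              szζ q * ((2 / ε : ℂ) * e)) := by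
            simp only [u, map_add, map_smul, smul_eq_mul, hd, he]
            ring
          rw [this]
          simp only [Complex.add_re, Complex.conj_re]
          ring
  have hi : ∀ p q, Integrable (fun θ : Fin n → ℝ => Real.exp (szX θ (u p q)).re) (szE n) :=
    fun p q => szE_integrable_of_cont (by
      have := szX_cont (n := n) (u p q)
      fun_prop)
  refine (norm_integral_le_of_norm_le ((integrable_finsetSum _ fun p _ =>
    integrable_finsetSum _ fun q _ => hi p q).const_mul ε) (Eventually.of_forall hpt)).trans ?_
  rw [integral_const_mul]
  refine mul_le_mul_of_nonneg_left ?_ hε.le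
  rw [integral_finsetSum _ fun p _ => integrable_finsetSum _ fun q _ => hi p q]
  simp_rw [integral_finsetSum _ fun q _ => hi _ q]
  have hb : ∀ p q, ∫ θ, Real.exp (szX θ (u p q)).re ∂(szE n) ≤
      Real.exp ((‖x‖ + ‖y‖ + 8) ^ 2) := fun p q => by
    refine (szE_F1' n (u p q)).trans (Real.exp_le_exp.2 ?_)
    exact pow_le_pow_left₀ (norm_nonneg _) (hu p q) 2
  refine (Finset.sum_le_sum fun p _ => Finset.sum_le_sum fun q _ => hb p q).trans ?_
  simp only [Finset.sum_const, Finset.card_univ, Fintype.card_prod, Fintype.card_bool,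
    nsmul_eq_mul]
  norm_num
  linarith

/-- F2 for all summable sequences -/
lemma szE_F2 (x y : szl) :
    Tendsto (fun n => ∫ θ, Complex.exp (szX θ x) * (starRingEnd ℂ) (Complex.exp (szX θ y)) ∂(szE n))
      atTop (nhds (Complex.exp (szB x y))) := by
  rw [Metric.tendsto_atTop]
  intro δ hδ
  set Cst : ℝ := 16 * Real.exp ((‖x‖ + ‖y‖ + 8) ^ 2) with hC
  have hCpos : 0 < Cst := by positivity
  set ε : ℝ := min 1 (δ / (4 * Cst)) with hε
  have hε0 : 0 < ε := lt_min one_pos (by positivity)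
  have hε2 : ε * Cst ≤ δ / 4 := by
    calc ε * Cst ≤ δ / (4 * Cst) * Cst := by gcongr; exact min_le_right _ _
      _ = δ / 4 := by field_simp
  have hcont : Continuous (fun p : szl × szl => Complex.exp (szB p.1 p.2)) :=
    Complex.continuous_exp.comp szB_cont2
  obtain ⟨η, hη, hη2⟩ := Metric.continuous_iff.1 hcont (x, y) (δ / 2) (by positivity)
  obtain ⟨_, ⟨l, rfl⟩, hl⟩ := Metric.mem_closure_iff.1 (szS_dense x) (min ε η) (lt_min hε0 hη)
  obtain ⟨_, ⟨l', rfl⟩, hl'⟩ := Metric.mem_closure_iff.1 (szS_dense y) (min ε η) (lt_min hε0 hη)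
  refine ⟨l.length, fun n hn => ?_⟩
  have h1 := sz_equi n x y (szPL l) (szPL l') hε0 (min_le_left _ _)
    (by rw [← dist_eq_norm, dist_comm]; exact hl.le.trans (min_le_left _ _))
    (by rw [← dist_eq_norm, dist_comm]; exact hl'.le.trans (min_le_left _ _))
  rw [szE_exact2 l l' hn] at h1
  have h2 := hη2 (szPL l, szPL l') (by
    rw [Prod.dist_eq]
    refine max_lt ?_ ?_
    · rw [dist_comm]; exact hl.trans_le (min_le_right _ _)
    · rw [dist_comm]; exact hl'.trans_le (min_le_right _ _))
  simp only [] at h2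
  rw [← dist_eq_norm, dist_comm] at h1
  have h3 := dist_triangle (∫ θ, Complex.exp (szX θ x) * (starRingEnd ℂ) (Complex.exp (szX θ y))
    ∂(szE n)) (Complex.exp (szB (szPL l) (szPL l'))) (Complex.exp (szB x y))
  linarith

/-- power traces -/
noncomputable def szZ {n : ℕ} (θ : Fin n → ℝ) (k : ℕ) : ℂ := ∑ j, szp (θ j) ^ (k+1)

/-- normalized real traces -/
noncomputable def szW {n : ℕ} (θ : Fin n → ℝ) : ℕ ⊕ ℕ → ℝ :=
  Sum.elim (fun k => Real.sqrt (2 / ((k:ℝ)+1)) * (szZ θ k).re)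
    (fun k => Real.sqrt (2 / ((k:ℝ)+1)) * (szZ θ k).im)

/-- index embedding -/
def szi {m : ℕ} : Fin m ⊕ Fin m → ℕ ⊕ ℕ := Sum.map (fun k => (k:ℕ)) (fun k => (k:ℕ))

lemma szZ_cont {n : ℕ} (k : ℕ) : Continuous (fun θ : Fin n → ℝ => szZ θ k) := by
  unfold szZ
  have := szp_cont
  fun_prop

lemma szW_cont {n : ℕ} (i : ℕ ⊕ ℕ) : Continuous (fun θ : Fin n → ℝ => szW θ i) := by
  rcases i with k | k <;> simp only [szW, Sum.elim_inl, Sum.elim_inr] <;>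
  · have := szZ_cont (n := n) k
    fun_prop

/-- finitely supported sequence -/
noncomputable def szfs {m : ℕ} (c : Fin m → ℂ) : szl := ∑ k : Fin m, lp.single 1 (k:ℕ) (c k)

lemma szF_single (θ : ℝ) (k : ℕ) (c : ℂ) :
    szF θ (lp.single 1 k c) = c * (szp θ ^ (k+1) / ((k:ℂ)+1)) := by
  rw [szF_apply, tsum_eq_single k]
  · rw [lp.single_apply_self]
  · intro r hr
    rw [lp.single_apply_ne _ _ _ hr, zero_mul]

lemma szX_fs {n m : ℕ} (θ : Fin n → ℝ) (c : Fin m → ℂ) :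
    szX θ (szfs c) = ∑ k, c k / (((k:ℕ):ℂ)+1) * szZ θ k := by
  rw [szX_apply]
  simp only [szfs, map_sum, szF_single, szZ, Finset.mul_sum]
  rw [Finset.sum_comm]
  refine Finset.sum_congr rfl fun k _ => Finset.sum_congr rfl fun j _ => ?_
  ring

lemma szB_fs {m : ℕ} (c d : Fin m → ℂ) :
    szB (szfs c) (szfs d) = ∑ k, c k * (starRingEnd ℂ) (d k) / (((k:ℕ):ℂ)+1) := by
  have h1 : ∀ (k : Fin m) (e : ℂ) (y : szl), szB (lp.single 1 (k:ℕ) e) y =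
      e * ((starRingEnd ℂ) (y (k:ℕ)) / (((k:ℕ):ℂ)+1)) := fun k e y => by
    rw [szB_apply, tsum_eq_single (k:ℕ)]
    · rw [lp.single_apply_self]
    · intro r hr
      rw [lp.single_apply_ne _ _ _ hr, zero_mul]
  have h2 : ∀ k : Fin m, (szfs d : szl) (k:ℕ) = d k := fun k => by
    rw [szfs, lp.coeFn_sum, Finset.sum_apply, Finset.sum_eq_single k]
    · rw [lp.single_apply_self]
    · intro j _ hj
      rw [lp.single_apply_ne]
      exact fun h => hj (Fin.ext h.symm)
    · simp
  rw [szfs, map_sum, _root_.sum_apply]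
  refine Finset.sum_congr rfl fun k _ => ?_
  rw [h1, h2]; ring

lemma sz_sqrt_id (k : ℕ) : Real.sqrt (2 * ((k:ℝ)+1)) / ((k:ℝ)+1) = Real.sqrt (2 / ((k:ℝ)+1)) := by
  have hk : (0:ℝ) < (k:ℝ)+1 := by positivity
  rw [div_eq_iff hk.ne', ← Real.sqrt_sq hk.le, ← Real.sqrt_mul (by positivity), Real.sqrt_sq hk.le]
  congr 1
  field_simp

lemma sz_sqrt_idC (k : ℕ) :
    (Real.sqrt (2 * ((k:ℝ)+1)) : ℂ) / ((k:ℂ)+1) = (Real.sqrt (2 / ((k:ℝ)+1)) : ℂ) := by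
  rw [← sz_sqrt_id]; push_cast; rfl

lemma sz_sqrt_sq (k : ℕ) : (Real.sqrt (2 * ((k:ℝ)+1)) : ℂ) * (Real.sqrt (2 * ((k:ℝ)+1)) : ℂ) =
    2 * ((k:ℂ)+1) := by
  rw [← Complex.ofReal_mul, Real.mul_self_sqrt (by positivity)]; push_cast; rfl

/-- Gaussian domination -/
lemma szE_V1 (n : ℕ) {m : ℕ} (x : Fin m ⊕ Fin m → ℝ) :
    ∫ θ, Real.exp (∑ i, x i * szW θ (szi i)) ∂(szE n) ≤ Real.exp (1/2 * ∑ i, x i ^ 2) := by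
  let c : Fin m → ℂ := fun k => (1/2 : ℂ) * (Real.sqrt (2 * (((k:ℕ):ℝ)+1)) : ℂ) *
    ((x (Sum.inl k) : ℂ) - (x (Sum.inr k) : ℂ) * Complex.I)
  have h := szE_F1 n (szfs c)
  have e1 : ∀ θ : Fin n → ℝ, 2 * (szX θ (szfs c)).re = ∑ i, x i * szW θ (szi i) := by
    intro θ
    rw [szX_fs, Fintype.sum_sum_type, ← Finset.sum_add_distrib, Complex.re_sum, Finset.mul_sum]
    refine Finset.sum_congr rfl fun k _ => ?_
    have : c k / (((k:ℕ):ℂ)+1) * szZ θ k = ((1/2 : ℝ) : ℂ) * ((Real.sqrt (2 / (((k:ℕ):ℝ)+1)) : ℂ) *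
        (((x (Sum.inl k) : ℂ) - (x (Sum.inr k) : ℂ) * Complex.I) * szZ θ k)) := by
      rw [← sz_sqrt_idC]; simp only [c]; push_cast; ring
    rw [this, Complex.re_ofReal_mul, Complex.re_ofReal_mul]
    simp [szW, szi]
    ring
  have e2 : (szB (szfs c) (szfs c)).re = 1/2 * ∑ i, x i ^ 2 := by
    rw [szB_fs, Fintype.sum_sum_type, ← Finset.sum_add_distrib, Complex.re_sum, Finset.mul_sum]
    refine Finset.sum_congr rfl fun k _ => ?_
    have hk : (((k:ℕ):ℂ)+1) ≠ 0 := by exact_mod_cast Nat.succ_ne_zero (k:ℕ)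
    have : c k * (starRingEnd ℂ) (c k) / (((k:ℕ):ℂ)+1) =
        ((1/2 * (x (Sum.inl k) ^ 2 + x (Sum.inr k) ^ 2) : ℝ) : ℂ) := by
      simp only [c, map_mul, map_sub, Complex.conj_ofReal, Complex.conj_I, map_div₀, map_one,
        map_ofNat]
      rw [div_eq_iff hk]
      push_cast
      linear_combination (1/4 : ℂ) * ((x (Sum.inl k) : ℂ) ^ 2 + (x (Sum.inr k) : ℂ) ^ 2) *
        sz_sqrt_sq k - (1/4 : ℂ) * (Real.sqrt (2 * (((k:ℕ):ℝ)+1)) : ℂ) ^ 2 *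
          (x (Sum.inr k) : ℂ) ^ 2 * Complex.I_sq
    rw [this, Complex.ofReal_re]
  simp_rw [e1, e2] at h
  exact h

/-- Gaussian limit -/
lemma szE_V2 {m : ℕ} (z : Fin m ⊕ Fin m → ℂ) :
    Tendsto (fun n => ∫ θ, Complex.exp (∑ i, z i * (szW θ (szi i) : ℂ)) ∂(szE n)) atTop
      (nhds (Complex.exp (1/2 * ∑ i, z i ^ 2))) := by
  let c : Fin m → ℂ := fun k => (1/2 : ℂ) * (Real.sqrt (2 * (((k:ℕ):ℝ)+1)) : ℂ) *
    (z (Sum.inl k) - z (Sum.inr k) * Complex.I)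
  let d : Fin m → ℂ := fun k => (starRingEnd ℂ) ((1/2 : ℂ) * (Real.sqrt (2 * (((k:ℕ):ℝ)+1)) : ℂ) *
    (z (Sum.inl k) + z (Sum.inr k) * Complex.I))
  have h := szE_F2 (szfs c) (szfs d)
  have e2 : szB (szfs c) (szfs d) = 1/2 * ∑ i, z i ^ 2 := by
    rw [szB_fs, Fintype.sum_sum_type, ← Finset.sum_add_distrib, Finset.mul_sum]
    refine Finset.sum_congr rfl fun k _ => ?_
    have hk : (((k:ℕ):ℂ)+1) ≠ 0 := by exact_mod_cast Nat.succ_ne_zero (k:ℕ)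
    simp only [c, d, Complex.conj_conj]
    rw [div_eq_iff hk]
    linear_combination (1/4 : ℂ) * (z (Sum.inl k) ^ 2 + z (Sum.inr k) ^ 2) *
        sz_sqrt_sq k - (1/4 : ℂ) * (Real.sqrt (2 * (((k:ℕ):ℝ)+1)) : ℂ) ^ 2 *
          z (Sum.inr k) ^ 2 * Complex.I_sq
  rw [e2] at h
  refine h.congr fun n => ?_
  refine integral_congr_ae (Eventually.of_forall fun θ => ?_)
  simp only []
  rw [← Complex.exp_conj, ← Complex.exp_add]
  congr 1
  rw [szX_fs, szX_fs, Fintype.sum_sum_type, ← Finset.sum_add_distrib, map_sum,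
    ← Finset.sum_add_distrib]
  refine Finset.sum_congr rfl fun k _ => ?_
  have h1 : c k / (((k:ℕ):ℂ)+1) = 1/2 * (Real.sqrt (2 / (((k:ℕ):ℝ)+1)) : ℂ) *
      (z (Sum.inl k) - z (Sum.inr k) * Complex.I) := by
    rw [← sz_sqrt_idC]; simp only [c]; ring
  have h2 : (starRingEnd ℂ) (d k / (((k:ℕ):ℂ)+1)) = 1/2 * (Real.sqrt (2 / (((k:ℕ):ℝ)+1)) : ℂ) *
      (z (Sum.inl k) + z (Sum.inr k) * Complex.I) := by
    rw [← sz_sqrt_idC]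
    simp only [d, map_div₀, Complex.conj_conj, map_add, map_natCast, map_one]; ring
  rw [map_mul, h1, h2]
  simp only [szW, szi, Sum.map_inl, Sum.map_inr, Sum.elim_inl, Sum.elim_inr]
  push_cast
  have hre : szZ θ k = (szZ θ k).re + (szZ θ k).im * Complex.I := (Complex.re_add_im _).symm
  have him : (starRingEnd ℂ) (szZ θ k) = (szZ θ k).re - (szZ θ k).im * Complex.I := by
    conv_lhs => rw [hre]
    simp only [map_add, map_mul, Complex.conj_ofReal, Complex.conj_I]; ring
  rw [him]
  generalize (szZ θ k).re = r at *
  generalize (szZ θ k).im = s at *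
  rw [hre]
  linear_combination (-(Real.sqrt (2 / (((k:ℕ):ℝ)+1)) : ℂ) * z (Sum.inr k) * s) *
    Complex.I_sq

/-- standard Gaussian -/
noncomputable def szγ : Measure ℝ := ProbabilityTheory.gaussianReal 0 1

instance szγ_prob : IsProbabilityMeasure szγ := by unfold szγ; infer_instance

lemma szγ_mgf (c : ℂ) : ∫ ξ : ℝ, Complex.exp (c * ξ) ∂szγ = Complex.exp (1/2 * c ^ 2) := by
  have := ProbabilityTheory.complexMGF_id_gaussianReal (μ := 0) (v := 1) c
  rw [ProbabilityTheory.complexMGF] at this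
  simp only [id] at this
  rw [szγ, this]
  congr 1
  push_cast; ring

lemma szγ_integral {E : Type*} [NormedAddCommGroup E] [NormedSpace ℝ E] (f : ℝ → E) :
    ∫ ξ, f ξ ∂szγ = ∫ ξ : ℝ, ((Real.sqrt (2 * Real.pi))⁻¹ * Real.exp (-(1/2) * ξ ^ 2)) • f ξ := by
  rw [szγ, ProbabilityTheory.integral_gaussianReal_eq_integral_smul one_ne_zero]
  congr 1
  ext ξ
  simp only [ProbabilityTheory.gaussianPDFReal]
  congr 2
  · simp
  · congr 1; push_cast; ring

lemma szγ_integrable {E : Type*} [NormedAddCommGroup E] [NormedSpace ℝ E] {f : ℝ → E}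
    (h : Integrable (fun ξ : ℝ => Real.exp (-(1/2) * ξ ^ 2) • f ξ)) : Integrable f szγ := by
  rw [szγ, ProbabilityTheory.gaussianReal_of_var_ne_zero _ one_ne_zero]
  have e : ProbabilityTheory.gaussianPDF 0 1 = fun x =>
    ((Real.toNNReal (ProbabilityTheory.gaussianPDFReal 0 1 x) : NNReal) : ENNReal) := rfl
  rw [e, integrable_withDensity_iff_integrable_smul
    (ProbabilityTheory.measurable_gaussianPDFReal 0 1).real_toNNReal]
  have := h.smul ((Real.sqrt (2 * Real.pi))⁻¹)
  refine this.congr (Eventually.of_forall fun ξ => ?_)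
  simp only [Pi.smul_apply]
  rw [NNReal.smul_def, Real.coe_toNNReal _ (ProbabilityTheory.gaussianPDFReal_nonneg _ _ _), smul_smul]
  congr 1
  simp only [ProbabilityTheory.gaussianPDFReal]
  congr 2
  · simp
  · push_cast; ring

lemma szγ_quad_integrable {c h : ℂ} (hc : (c^2).re < 1) :
    Integrable (fun ξ : ℝ => Complex.exp (1/2 * (c * ξ + h) ^ 2)) szγ := by
  apply szγ_integrable
  have := integrable_cexp_quadratic (b := 1/2 * (1 - c^2)) (by
    have : (1/2 * (1 - c^2) : ℂ) = ((1/2 : ℝ) : ℂ) * (1 - c^2) := by push_cast; ring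
    rw [this, Complex.re_ofReal_mul, Complex.sub_re, Complex.one_re]; linarith) (c * h) (1/2 * h^2)
  refine this.congr (Eventually.of_forall fun ξ => ?_)
  simp only []
  rw [Complex.real_smul, Complex.ofReal_exp, ← Complex.exp_add]
  congr 1
  push_cast; ring

lemma szγ_quad {c h : ℂ} {s : ℝ} (hs : 0 < s) (hc : 1 - c^2 = (s:ℂ)) :
    ∫ ξ : ℝ, Complex.exp (1/2 * (c * ξ + h) ^ 2) ∂szγ =
      ((Real.sqrt s : ℝ) : ℂ)⁻¹ * Complex.exp (1/2 * (h^2 * (s:ℂ)⁻¹)) := by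
  have hs' : (s:ℂ) ≠ 0 := by exact_mod_cast hs.ne'
  rw [szγ_integral]
  have hb : ((-(1/2) * s : ℝ) : ℂ).re < 0 := by rw [Complex.ofReal_re]; nlinarith
  have e : ∀ ξ : ℝ, ((Real.sqrt (2 * Real.pi))⁻¹ * Real.exp (-(1/2) * ξ ^ 2)) •
      Complex.exp (1/2 * (c * ξ + h) ^ 2) = ((Real.sqrt (2 * Real.pi))⁻¹ : ℂ) *
      Complex.exp (((-(1/2) * s : ℝ) : ℂ) * ξ^2 + (c * h) * ξ + 1/2 * h^2) := by
    intro ξ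
    rw [Complex.real_smul, Complex.ofReal_mul, Complex.ofReal_exp, mul_assoc, ← Complex.exp_add,
      Complex.ofReal_inv]
    congr 2
    push_cast
    linear_combination (-(1/2) * (ξ:ℂ)^2) * hc
  simp_rw [e]
  rw [integral_const_mul, integral_cexp_quadratic hb]
  have e2 : ((Real.pi : ℂ) / -((-(1/2) * s : ℝ) : ℂ)) ^ (1/2 : ℂ) =
      (Real.sqrt (2 * Real.pi) : ℂ) * (Real.sqrt s : ℂ)⁻¹ := by
    rw [← Complex.ofReal_neg, ← Complex.ofReal_div]
    have : (1/2 : ℂ) = ((1/2 : ℝ) : ℂ) := by push_cast; ring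
    rw [this, ← Complex.ofReal_cpow (by apply div_nonneg Real.pi_pos.le; nlinarith),
      ← Real.sqrt_eq_rpow, ← Complex.ofReal_inv, ← Complex.ofReal_mul, ← Real.sqrt_inv,
      ← Real.sqrt_mul (by positivity)]
    congr 2
    field_simp
  rw [e2, ← mul_assoc, ← mul_assoc, inv_mul_cancel₀, one_mul]
  · congr 2
    have h2 : c^2 = 1 - s := by linear_combination -hc
    have hne : (4 * ((-(1/2) * s : ℝ) : ℂ)) ≠ 0 := by push_cast; simpa using hs'
    rw [mul_pow, h2, sub_eq_iff_eq_add, ← sub_eq_iff_eq_add', eq_div_iff hne]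
    push_cast
    field_simp
    ring
  · have : Real.sqrt (2 * Real.pi) ≠ 0 := by positivity
    exact_mod_cast this

lemma szγ_abs_integrable (M : ℝ) : Integrable (fun ξ : ℝ => Real.exp (M * |ξ|)) szγ := by
  have h1 := ProbabilityTheory.integrable_exp_mul_gaussianReal (μ := 0) (v := 1) M
  have h2 := ProbabilityTheory.integrable_exp_mul_gaussianReal (μ := 0) (v := 1) (-M)
  refine (h1.add h2).mono' (by fun_prop) (Eventually.of_forall fun ξ => ?_)
  simp only [Pi.add_apply]
  rw [Real.norm_eq_abs, abs_of_pos (Real.exp_pos _)]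
  rcases abs_cases ξ with ⟨h, _⟩ | ⟨h, _⟩ <;> rw [h]
  · linarith [Real.exp_pos (-M * ξ)]
  · rw [show M * -ξ = -M * ξ by ring]; linarith [Real.exp_pos (M * ξ)]

section diag
variable {ι : Type*} [Fintype ι]

lemma szγ_pi_prod (c : ι → ℂ) (y : ι → ℝ) (h : ι → ℂ) :
    ∫ ξ : ι → ℝ, Complex.exp (∑ i, (c i * ξ i + h i) * y i) ∂(Measure.pi fun _ => szγ) =
      Complex.exp (∑ i, (1/2 * (c i)^2 * (y i)^2 + h i * y i)) := by
  simp_rw [Complex.exp_sum]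
  rw [integral_fintype_prod_eq_prod (𝕜 := ℂ)
    (f := fun i (ξ : ℝ) => Complex.exp ((c i * ξ + h i) * y i))]
  refine Finset.prod_congr rfl fun i _ => ?_
  have : ∀ ξ : ℝ, Complex.exp ((c i * ξ + h i) * y i) =
      Complex.exp ((c i * y i) * ξ) * Complex.exp (h i * y i) := fun ξ => by
    rw [← Complex.exp_add]; congr 1; ring
  simp_rw [this]
  rw [integral_mul_const, szγ_mgf, ← Complex.exp_add]
  congr 1; ring

lemma szE_fubini {n : ℕ} (Y : (Fin n → ℝ) → ι → ℝ) (hY : ∀ i, Continuous fun θ => Y θ i)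
    (M : ℝ) (hM : ∀ θ i, |Y θ i| ≤ M) (c h : ι → ℂ) :
    ∫ θ, Complex.exp (∑ i, (1/2 * (c i)^2 * (Y θ i)^2 + h i * Y θ i)) ∂(szE n) =
      ∫ ξ : ι → ℝ, (∫ θ, Complex.exp (∑ i, (c i * ξ i + h i) * Y θ i) ∂(szE n))
        ∂(Measure.pi fun _ => szγ) := by
  simp_rw [← szγ_pi_prod]
  apply integral_integral_swap
  have hb : Integrable (fun p : (Fin n → ℝ) × (ι → ℝ) => (1:ℝ) *
      ∏ i, (Real.exp (‖c i‖ * M * |p.2 i|) * Real.exp (‖h i‖ * M)))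
      ((szE n).prod (Measure.pi fun _ => szγ)) := by
    refine Integrable.mul_prod (f := fun _ : Fin n → ℝ => (1:ℝ)) (g := fun ξ : ι → ℝ =>
      ∏ i, (Real.exp (‖c i‖ * M * |ξ i|) * Real.exp (‖h i‖ * M))) (integrable_const _) ?_
    exact Integrable.fintype_prod (f := fun i ξ => Real.exp (‖c i‖ * M * |ξ|) * Real.exp (‖h i‖ * M))
      fun i => (szγ_abs_integrable _).mul_const _
  refine hb.mono' ?_ (Eventually.of_forall fun p => ?_)
  · apply Continuous.aestronglyMeasurable
    have : ∀ i, Continuous fun p : (Fin n → ℝ) × (ι → ℝ) => Y p.1 i :=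
      fun i => (hY i).comp continuous_fst
    unfold Function.uncurry
    fun_prop
  · simp only [Function.uncurry]
    rw [Complex.norm_exp, one_mul, ← Finset.prod_congr rfl (fun i _ => Real.exp_add _ _),
      ← Real.exp_sum, Complex.re_sum]
    apply Real.exp_le_exp.2 (Finset.sum_le_sum fun i _ => ?_)
    refine (Complex.re_le_norm _).trans ?_
    rw [norm_mul]
    have h1 : ‖c i * (p.2 i : ℂ) + h i‖ ≤ ‖c i‖ * |p.2 i| + ‖h i‖ := by
      refine (norm_add_le _ _).trans ?_
      rw [norm_mul, Complex.norm_real, Real.norm_eq_abs]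
    have h2 : ‖(Y p.1 i : ℂ)‖ ≤ M := by
      rw [Complex.norm_real, Real.norm_eq_abs]; exact hM _ _
    calc _ ≤ (‖c i‖ * |p.2 i| + ‖h i‖) * M := by gcongr
      _ = _ := by ring

/-- the real form -/
lemma szE_diag_bound {n : ℕ} (Y : (Fin n → ℝ) → ι → ℝ) (hY : ∀ i, Continuous fun θ => Y θ i)
    (M : ℝ) (hM : ∀ θ i, |Y θ i| ≤ M)
    (hV : ∀ x : ι → ℝ, ∫ θ, Real.exp (∑ i, x i * Y θ i) ∂(szE n) ≤ Real.exp (1/2 * ∑ i, x i ^ 2))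
    (c h : ι → ℂ) (ξ : ι → ℝ) :
    ‖∫ θ, Complex.exp (∑ i, (c i * ξ i + h i) * Y θ i) ∂(szE n)‖ ≤
      ∏ i, Real.exp (1/2 * ((c i).re * ξ i + (h i).re)^2) := by
  refine (norm_integral_le_integral_norm _).trans ?_
  refine le_trans (le_of_eq ?_) ((hV fun i => (c i).re * ξ i + (h i).re).trans (le_of_eq ?_))
  · congr 1; ext θ
    rw [Complex.norm_exp, Complex.re_sum]
    congr 1
    refine Finset.sum_congr rfl fun i _ => ?_
    simp
  · rw [← Real.exp_sum, Finset.mul_sum]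

lemma szγ_quad_integrable_real {r s : ℝ} (hr : r^2 < 1) :
    Integrable (fun ξ : ℝ => Real.exp (1/2 * (r * ξ + s)^2)) szγ := by
  have := (szγ_quad_integrable (c := r) (h := s) (by norm_cast)).norm
  refine this.congr (Eventually.of_forall fun ξ => ?_)
  simp only []
  rw [Complex.norm_exp]
  congr 1
  have : (1/2 * ((r:ℂ) * ξ + s)^2 : ℂ) = ((1/2 * (r * ξ + s)^2 : ℝ) : ℂ) := by push_cast; ring
  rw [this, Complex.ofReal_re]

lemma szE_diag_limit (Y : ∀ n, (Fin n → ℝ) → ι → ℝ) (hY : ∀ n i, Continuous fun θ => Y n θ i)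
    (M : ℕ → ℝ) (hM : ∀ n θ i, |Y n θ i| ≤ M n)
    (hV : ∀ n, ∀ x : ι → ℝ, ∫ θ, Real.exp (∑ i, x i * Y n θ i) ∂(szE n) ≤
      Real.exp (1/2 * ∑ i, x i ^ 2))
    (hV2 : ∀ z : ι → ℂ, Tendsto (fun n => ∫ θ, Complex.exp (∑ i, z i * (Y n θ i : ℂ)) ∂(szE n)) atTop
      (nhds (Complex.exp (1/2 * ∑ i, z i ^ 2))))
    (c h : ι → ℂ) (hc : ∀ i, (c i).re ^2 < 1) :
    Tendsto (fun n => ∫ θ, Complex.exp (∑ i, (1/2 * (c i)^2 * (Y n θ i)^2 + h i * Y n θ i)) ∂(szE n))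
      atTop (nhds (∏ i, ∫ ξ : ℝ, Complex.exp (1/2 * (c i * ξ + h i) ^ 2) ∂szγ)) := by
  simp_rw [fun n => szE_fubini (Y n) (hY n) (M n) (hM n) c h]
  rw [← integral_fintype_prod_eq_prod (𝕜 := ℂ)
    (f := fun i (ξ : ℝ) => Complex.exp (1/2 * (c i * ξ + h i) ^ 2)) (μ := fun _ => szγ)]
  apply tendsto_integral_of_dominated_convergence
    (fun ξ : ι → ℝ => ∏ i, Real.exp (1/2 * ((c i).re * ξ i + (h i).re)^2))
  · intro n
    have : Continuous (fun p : (ι → ℝ) × (Fin n → ℝ) =>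
        Complex.exp (∑ i, (c i * p.1 i + h i) * Y n p.2 i)) := by
      have : ∀ i, Continuous fun p : (ι → ℝ) × (Fin n → ℝ) => Y n p.2 i :=
        fun i => (hY n i).comp continuous_snd
      fun_prop
    exact (this.stronglyMeasurable.integral_prod_right' (ν := szE n)).aestronglyMeasurable
  · exact Integrable.fintype_prod (f := fun i ξ => Real.exp (1/2 * ((c i).re * ξ + (h i).re)^2))
      fun i => szγ_quad_integrable_real (hc i)
  · intro n
    exact Eventually.of_forall fun ξ => szE_diag_bound (Y n) (hY n) (M n) (hM n) (hV n) c h ξ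
  · refine Eventually.of_forall fun ξ => ?_
    have := hV2 (fun i => c i * ξ i + h i)
    rwa [← Complex.exp_sum, ← Finset.mul_sum]

lemma szE_diag_upper {n : ℕ} (Y : (Fin n → ℝ) → ι → ℝ) (hY : ∀ i, Continuous fun θ => Y θ i)
    (M : ℝ) (hM : ∀ θ i, |Y θ i| ≤ M)
    (hV : ∀ x : ι → ℝ, ∫ θ, Real.exp (∑ i, x i * Y θ i) ∂(szE n) ≤ Real.exp (1/2 * ∑ i, x i ^ 2))
    (l : ι → ℝ) (κ : ℝ) (hκ : 0 < κ) (hl : ∀ i, κ ≤ 1 + l i) :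
    ∫ θ, Real.exp (-(1/2) * ∑ i, l i * (Y θ i)^2) ∂(szE n) ≤
      Real.exp ((2 * κ)⁻¹ * ∑ i, |l i|) := by
  let r : ι → ℝ := fun i => Real.sqrt (- l i)
  have hrl : ∀ i, - l i ≤ (r i)^2 := fun i => by
    rcases le_total 0 (- l i) with h | h
    · exact (Real.sq_sqrt h).ge
    · exact h.trans (sq_nonneg _)
  have hrl2 : ∀ i, (r i)^2 ≤ |l i| := fun i => by
    rcases le_total 0 (- l i) with h | h
    · rw [Real.sq_sqrt h]; exact neg_le_abs _
    · simp [r, Real.sqrt_eq_zero_of_nonpos h]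
  have hr1 : ∀ i, r i = 0 ∨ κ ≤ 1 - (r i)^2 := fun i => by
    rcases le_total 0 (- l i) with h | h
    · right; rw [Real.sq_sqrt h]; linarith [hl i]
    · left; exact Real.sqrt_eq_zero_of_nonpos h
  have hr2 : ∀ i, (r i)^2 < 1 := fun i => by
    rcases hr1 i with h | h
    · rw [h]; norm_num
    · linarith
  have step1 : ∫ θ, Real.exp (-(1/2) * ∑ i, l i * (Y θ i)^2) ∂(szE n) ≤
      ∫ θ, Real.exp (∑ i, 1/2 * (r i)^2 * (Y θ i)^2) ∂(szE n) := by
    apply integral_mono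
    · apply szE_integrable_of_cont; fun_prop
    · apply szE_integrable_of_cont; fun_prop
    · intro θ
      apply Real.exp_le_exp.2
      rw [Finset.mul_sum]
      refine Finset.sum_le_sum fun i _ => ?_
      nlinarith [hrl i, sq_nonneg (Y θ i)]
  have h1 := szE_fubini Y hY M hM (fun i => (r i : ℂ)) 0
  have e1 : ∀ θ, Complex.exp (∑ i, (1/2 * (r i : ℂ)^2 * (Y θ i : ℂ)^2 + (0 : ι → ℂ) i * Y θ i)) =
      ((Real.exp (∑ i, 1/2 * (r i)^2 * (Y θ i)^2) : ℝ) : ℂ) := fun θ => by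
    push_cast
    simp
  simp_rw [e1] at h1
  rw [integral_complex_ofReal] at h1
  have hpos : 0 ≤ ∫ θ, Real.exp (∑ i, 1/2 * (r i)^2 * (Y θ i)^2) ∂(szE n) :=
    integral_nonneg fun θ => (Real.exp_pos _).le
  have h2 := congrArg norm h1
  rw [Complex.norm_real, Real.norm_eq_abs, abs_of_nonneg hpos] at h2
  refine step1.trans (h2.le.trans ?_)
  refine (norm_integral_le_integral_norm _).trans ?_
  have hintg : Integrable (fun ξ : ι → ℝ => ∏ i, Real.exp (1/2 * (r i * ξ i + 0)^2))
    (Measure.pi fun _ => szγ) := Integrable.fintype_prod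
      (f := fun i ξ => Real.exp (1/2 * (r i * ξ + 0)^2)) fun i => szγ_quad_integrable_real (hr2 i)
  have step2 : ∫ ξ : ι → ℝ, ‖∫ θ, Complex.exp (∑ i, ((r i : ℂ) * ξ i + (0 : ι → ℂ) i) * Y θ i) ∂(szE n)‖
      ∂(Measure.pi fun _ => szγ) ≤ ∫ ξ : ι → ℝ, ∏ i, Real.exp (1/2 * (r i * ξ i + 0)^2)
      ∂(Measure.pi fun _ => szγ) := by
    apply integral_mono_of_nonneg (Eventually.of_forall fun _ => norm_nonneg _) hintg
    refine Eventually.of_forall fun ξ => ?_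
    exact szE_diag_bound Y hY M hM hV (fun i => (r i : ℂ)) 0 ξ
  refine step2.trans ?_
  rw [integral_fintype_prod_eq_prod (𝕜 := ℝ)
    (f := fun i (ξ : ℝ) => Real.exp (1/2 * (r i * ξ + 0) ^ 2)), Finset.mul_sum, Real.exp_sum]
  refine Finset.prod_le_prod (fun i _ => integral_nonneg fun _ => (Real.exp_pos _).le) fun i _ => ?_
  have hs : 0 < 1 - (r i)^2 := by linarith [hr2 i]
  have h3 := szγ_quad (c := (r i : ℂ)) (h := 0) hs (by push_cast; ring)
  have e3 : ∀ ξ : ℝ, Complex.exp (1/2 * ((r i : ℂ) * ξ + 0)^2) =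
      ((Real.exp (1/2 * (r i * ξ + 0)^2) : ℝ) : ℂ) := fun ξ => by push_cast; rfl
  simp_rw [e3] at h3
  rw [integral_complex_ofReal] at h3
  have h4 : ∫ ξ, Real.exp (1/2 * (r i * ξ + 0)^2) ∂szγ = (Real.sqrt (1 - (r i)^2))⁻¹ := by
    have : Complex.exp (1/2 * ((0:ℂ)^2 * ((1 - (r i)^2 : ℝ) : ℂ)⁻¹)) = 1 := by simp
    rw [this, mul_one, ← Complex.ofReal_inv] at h3
    exact_mod_cast h3
  rw [h4]
  rcases hr1 i with h | h
  · rw [h]; simp; positivity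
  · rw [← Real.sqrt_inv]
    apply Real.sqrt_le_iff.2 ⟨(Real.exp_pos _).le, ?_⟩
    rw [← Real.exp_nat_mul]
    calc (1 - (r i)^2)⁻¹ = (r i)^2 / (1 - (r i)^2) + 1 := by field_simp; ring
      _ ≤ Real.exp ((r i)^2 / (1 - (r i)^2)) := Real.add_one_le_exp _
      _ ≤ _ := by
        apply Real.exp_le_exp.2
        calc (r i)^2 / (1 - (r i)^2) ≤ |l i| / κ := by
              gcongr; exact hrl2 i
          _ = _ := by push_cast; field_simp

end diag

section spec
variable {ι : Type*} [Fintype ι] [DecidableEq ι]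

lemma sz_spec (K : Matrix ι ι ℝ) (hK : Kᵀ = K) : ∃ (U : Matrix ι ι ℝ) (l : ι → ℝ),
    Uᵀ * U = 1 ∧ U * Uᵀ = 1 ∧ K = U * diagonal l * Uᵀ := by
  have hH : K.IsHermitian := by
    rw [Matrix.IsHermitian, conjTranspose_eq_transpose_of_trivial, hK]
  refine ⟨hH.eigenvectorUnitary, hH.eigenvalues, ?_, ?_, ?_⟩
  · have := Unitary.coe_star_mul_self hH.eigenvectorUnitary
    rwa [star_eq_conjTranspose, conjTranspose_eq_transpose_of_trivial] at this
  · have := Unitary.coe_mul_star_self hH.eigenvectorUnitary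
    rwa [Unitary.coe_star, star_eq_conjTranspose, conjTranspose_eq_transpose_of_trivial] at this
  · have := hH.spectral_theorem
    rw [Unitary.conjStarAlgAut_apply, star_eq_conjTranspose,
      conjTranspose_eq_transpose_of_trivial] at this
    exact this

variable {K U : Matrix ι ι ℝ} {l : ι → ℝ}

lemma sz_gap_eig (h1 : Uᵀ * U = 1) (hK : K = U * diagonal l * Uᵀ) {κ : ℝ}
    (hgap : ∀ v : ι → ℝ, κ * (v ⬝ᵥ v) ≤ v ⬝ᵥ ((1 + K) *ᵥ v)) (i : ι) : κ ≤ 1 + l i := by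
  have h := hgap (U *ᵥ Pi.single i 1)
  have e1 : (U *ᵥ Pi.single i 1) ⬝ᵥ (U *ᵥ Pi.single i 1) = 1 := by
    rw [dotProduct_mulVec, vecMul_mulVec, ← dotProduct_mulVec, h1]
    simp
  have e2 : (U *ᵥ Pi.single i 1) ⬝ᵥ (K *ᵥ (U *ᵥ Pi.single i 1)) = l i := by
    rw [hK, mulVec_mulVec, Matrix.mul_assoc, h1, Matrix.mul_one, dotProduct_mulVec, vecMul_mulVec,
      ← Matrix.mul_assoc, ← dotProduct_mulVec, h1]
    simp
  rw [add_mulVec, one_mulVec, dotProduct_add, e1, e2] at h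
  linarith

lemma sz_sum_abs_eig (h2 : U * Uᵀ = 1) (h1 : Uᵀ * U = 1) (hK : K = U * diagonal l * Uᵀ) :
    ∑ i, |l i| ≤ ∑ i, ∑ j, |K i j| := by
  have hl : ∀ r, l r = ∑ i, ∑ j, U i r * K i j * U j r := by
    intro r
    have : diagonal l = Uᵀ * K * U := by
      rw [hK, Matrix.mul_assoc, Matrix.mul_assoc, h1, Matrix.mul_one, ← Matrix.mul_assoc, h1,
        Matrix.one_mul]
    have h := congrFun (congrFun this r) r
    rw [diagonal_apply_eq] at h
    rw [h, Matrix.mul_apply]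
    simp_rw [Matrix.mul_apply, Finset.sum_mul, transpose_apply]
    rw [Finset.sum_comm]
  have hrow : ∀ i, ∑ r, U i r ^ 2 = 1 := by
    intro i
    have h := congrFun (congrFun h2 i) i
    rw [Matrix.mul_apply, Matrix.one_apply_eq] at h
    rw [← h]
    exact Finset.sum_congr rfl fun r _ => by rw [transpose_apply, sq]
  calc ∑ r, |l r| ≤ ∑ r, ∑ i, ∑ j, |K i j| * (1/2 * (U i r ^ 2 + U j r ^ 2)) := by
        refine Finset.sum_le_sum fun r _ => ?_
        rw [hl r]
        refine (Finset.abs_sum_le_sum_abs _ _).trans (Finset.sum_le_sum fun i _ => ?_)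
        refine (Finset.abs_sum_le_sum_abs _ _).trans (Finset.sum_le_sum fun j _ => ?_)
        rw [abs_mul, abs_mul, mul_comm |U i r|, mul_assoc]
        refine mul_le_mul_of_nonneg_left ?_ (abs_nonneg _)
        nlinarith [sq_nonneg (|U i r| - |U j r|), sq_abs (U i r), sq_abs (U j r)]
    _ = ∑ i, ∑ j, |K i j| * (1/2 * (∑ r, U i r ^ 2 + ∑ r, U j r ^ 2)) := by
        rw [Finset.sum_comm]
        refine Finset.sum_congr rfl fun i _ => ?_
        rw [Finset.sum_comm]
        refine Finset.sum_congr rfl fun j _ => ?_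
        rw [← Finset.sum_add_distrib, Finset.mul_sum, Finset.mul_sum]
    _ = _ := by
        simp_rw [hrow]; norm_num

lemma sz_quad_diag (hK : K = U * diagonal l * Uᵀ) (w : ι → ℝ) :
    w ⬝ᵥ (K *ᵥ w) = ∑ i, l i * ((Uᵀ *ᵥ w) i)^2 := by
  rw [hK, ← mulVec_mulVec, ← mulVec_mulVec, dotProduct_mulVec, ← mulVec_transpose]
  simp only [dotProduct, mulVec_diagonal]
  exact Finset.sum_congr rfl fun i _ => by ring

lemma sz_det_diag (h2 : U * Uᵀ = 1) (hK : K = U * diagonal l * Uᵀ) :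
    (1 + K).det = ∏ i, (1 + l i) := by
  have : 1 + K = U * diagonal (fun i => 1 + l i) * Uᵀ := by
    have e : diagonal (fun i => 1 + l i) = 1 + diagonal l := by
      rw [← diagonal_one, diagonal_add]
    rw [e, Matrix.mul_add, Matrix.mul_one, Matrix.add_mul, h2, hK]
  rw [this, det_mul_right_comm, h2, Matrix.one_mul, det_diagonal]

lemma sz_inv_diag (h2 : U * Uᵀ = 1) (h1 : Uᵀ * U = 1) (hK : K = U * diagonal l * Uᵀ)
    (hl : ∀ i, 0 < 1 + l i) (h : ι → ℂ) :
    h ⬝ᵥ (((1 + K)⁻¹).map Complex.ofReal).mulVec h =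
      ∑ i, (((U.map Complex.ofReal)ᵀ *ᵥ h) i)^2 * (((1 + l i : ℝ)) : ℂ)⁻¹ := by
  have e : 1 + K = U * diagonal (fun i => 1 + l i) * Uᵀ := by
    have e : diagonal (fun i => 1 + l i) = 1 + diagonal l := by
      rw [← diagonal_one, diagonal_add]
    rw [e, Matrix.mul_add, Matrix.mul_one, Matrix.add_mul, h2, hK]
  have e2 : (1 + K)⁻¹ = U * diagonal (fun i => (1 + l i)⁻¹) * Uᵀ := by
    apply Matrix.inv_eq_right_inv
    rw [e]
    calc U * diagonal (fun i => 1 + l i) * Uᵀ * (U * diagonal (fun i => (1 + l i)⁻¹) * Uᵀ)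
        = U * (diagonal (fun i => 1 + l i) * ((Uᵀ * U) * diagonal (fun i => (1 + l i)⁻¹))) * Uᵀ := by
          simp only [Matrix.mul_assoc]
      _ = U * Uᵀ := by
          rw [h1, Matrix.one_mul, diagonal_mul_diagonal]
          have : (fun i => (1 + l i) * (1 + l i)⁻¹) = fun _ => 1 := by
            ext i; exact mul_inv_cancel₀ (hl i).ne'
          rw [this, diagonal_one, Matrix.mul_one]
      _ = 1 := h2
  have e3 : ((1 + K)⁻¹).map Complex.ofReal = U.map Complex.ofReal *
      diagonal (fun i => (((1 + l i : ℝ)) : ℂ)⁻¹) * (U.map Complex.ofReal)ᵀ := by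
    rw [e2]
    ext i j
    simp [Matrix.mul_apply, diagonal_apply]
  rw [e3, ← mulVec_mulVec, ← mulVec_mulVec, dotProduct_mulVec, ← mulVec_transpose]
  simp only [dotProduct, mulVec_diagonal]
  exact Finset.sum_congr rfl fun i _ => by ring

end spec

/-- truncated vector -/
noncomputable def szw (m : ℕ) {n : ℕ} (θ : Fin n → ℝ) : Fin m ⊕ Fin m → ℝ := fun i => szW θ (szi i)

lemma szw_cont (m : ℕ) {n : ℕ} (i) : Continuous fun θ : Fin n → ℝ => szw m θ i := szW_cont _

lemma szZ_norm {n : ℕ} (θ : Fin n → ℝ) (k : ℕ) : ‖szZ θ k‖ ≤ n := by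
  unfold szZ
  refine (norm_sum_le _ _).trans ?_
  simp [norm_pow, szp_norm]

lemma szW_abs {n : ℕ} (θ : Fin n → ℝ) (i : ℕ ⊕ ℕ) : |szW θ i| ≤ 2 * n := by
  have hs : ∀ k : ℕ, Real.sqrt (2 / ((k:ℝ)+1)) ≤ 2 := fun k => by
    rw [Real.sqrt_le_left (by norm_num), div_le_iff₀ (by positivity)]
    nlinarith [(Nat.cast_nonneg k : (0:ℝ) ≤ k)]
  rcases i with k | k <;> simp only [szW, Sum.elim_inl, Sum.elim_inr] <;>
    rw [abs_mul, abs_of_nonneg (Real.sqrt_nonneg _)]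
  · exact mul_le_mul (hs k) ((Complex.abs_re_le_norm _).trans (szZ_norm θ k)) (abs_nonneg _) (by norm_num)
  · exact mul_le_mul (hs k) ((Complex.abs_im_le_norm _).trans (szZ_norm θ k)) (abs_nonneg _) (by norm_num)

section fin
variable {m : ℕ} {U : Matrix (Fin m ⊕ Fin m) (Fin m ⊕ Fin m) ℝ}

lemma szY_V1 (h1 : Uᵀ * U = 1) (n : ℕ) (x : Fin m ⊕ Fin m → ℝ) :
    ∫ θ, Real.exp (∑ i, x i * (Uᵀ *ᵥ szw m θ) i) ∂(szE n) ≤ Real.exp (1/2 * ∑ i, x i ^ 2) := by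
  have h := szE_V1 n (U *ᵥ x)
  have e1 : ∀ θ : Fin n → ℝ, ∑ i, (U *ᵥ x) i * szW θ (szi i) = ∑ i, x i * (Uᵀ *ᵥ szw m θ) i := by
    intro θ
    change (U *ᵥ x) ⬝ᵥ szw m θ = x ⬝ᵥ (Uᵀ *ᵥ szw m θ)
    rw [dotProduct_mulVec, vecMul_transpose]
  have e2 : ∑ i, (U *ᵥ x) i ^ 2 = ∑ i, x i ^ 2 := by
    have : (U *ᵥ x) ⬝ᵥ (U *ᵥ x) = x ⬝ᵥ x := by
      rw [dotProduct_mulVec, vecMul_mulVec, ← dotProduct_mulVec, h1, one_mulVec]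
    simpa [dotProduct, ← sq] using this
  simp_rw [e1, e2] at h
  exact h

lemma szY_cont (n : ℕ) (i) : Continuous fun θ : Fin n → ℝ => (Uᵀ *ᵥ szw m θ) i := by
  have := fun i => szw_cont m (n := n) i
  simp only [mulVec, dotProduct]
  fun_prop

lemma szY_bdd (n : ℕ) : ∃ M : ℝ, ∀ (θ : Fin n → ℝ) i, |(Uᵀ *ᵥ szw m θ) i| ≤ M := by
  refine ⟨∑ i, ∑ j, |Uᵀ i j| * (2 * n), fun θ i => ?_⟩
  refine le_trans ?_ (Finset.single_le_sum (f := fun i => ∑ j, |Uᵀ i j| * (2 * (n:ℝ)))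
    (fun i _ => by positivity) (Finset.mem_univ i))
  simp only [mulVec, dotProduct]
  refine (Finset.abs_sum_le_sum_abs _ _).trans (Finset.sum_le_sum fun j _ => ?_)
  rw [abs_mul]
  exact mul_le_mul_of_nonneg_left (szW_abs _ _) (abs_nonneg _)

lemma szY_V2 (h1 : Uᵀ * U = 1) (z : Fin m ⊕ Fin m → ℂ) :
    Tendsto (fun n => ∫ θ, Complex.exp (∑ i, z i * ((Uᵀ *ᵥ szw m θ) i : ℂ)) ∂(szE n)) atTop
      (nhds (Complex.exp (1/2 * ∑ i, z i ^ 2))) := by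
  have h := szE_V2 ((U.map Complex.ofReal) *ᵥ z)
  have e0 : ∀ w : Fin m ⊕ Fin m → ℝ, (fun i => (((Uᵀ *ᵥ w) i : ℝ) : ℂ)) =
      (U.map Complex.ofReal)ᵀ *ᵥ (fun i => (w i : ℂ)) := fun w => by
    ext i; simp [mulVec, dotProduct]
  have h1' : (U.map Complex.ofReal)ᵀ * (U.map Complex.ofReal) = 1 := by
    have := congrArg (fun A => A.map Complex.ofReal) h1
    ext i j
    have := congrFun (congrFun this i) j
    simpa [Matrix.mul_apply, Matrix.one_apply, apply_ite] using this
  have e1 : ∀ n, ∀ θ : Fin n → ℝ, ∑ i, ((U.map Complex.ofReal) *ᵥ z) i * (szW θ (szi i) : ℂ) =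
      ∑ i, z i * ((Uᵀ *ᵥ szw m θ) i : ℂ) := by
    intro n θ
    change ((U.map Complex.ofReal) *ᵥ z) ⬝ᵥ (fun i => (szw m θ i : ℂ)) =
      z ⬝ᵥ (fun i => (((Uᵀ *ᵥ szw m θ) i : ℝ) : ℂ))
    rw [e0, dotProduct_mulVec, vecMul_transpose]
  have e2 : ∑ i, ((U.map Complex.ofReal) *ᵥ z) i ^ 2 = ∑ i, z i ^ 2 := by
    have : ((U.map Complex.ofReal) *ᵥ z) ⬝ᵥ ((U.map Complex.ofReal) *ᵥ z) = z ⬝ᵥ z := by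
      rw [dotProduct_mulVec, vecMul_mulVec, ← dotProduct_mulVec, h1', one_mulVec]
    simpa [dotProduct, ← sq] using this
  simp_rw [e1, e2] at h
  exact h

variable {K : Matrix (Fin m ⊕ Fin m) (Fin m ⊕ Fin m) ℝ}

/-- Gaussian limit of quadratic exponentials -/
lemma szE_G1 (hK : Kᵀ = K) {κ : ℝ} (hκ : 0 < κ)
    (hgap : ∀ v, κ * (v ⬝ᵥ v) ≤ v ⬝ᵥ ((1 + K) *ᵥ v)) (h : Fin m ⊕ Fin m → ℂ) :
    Tendsto (fun n => ∫ θ, Complex.exp (-(1/2) * ((szw m θ ⬝ᵥ (K *ᵥ szw m θ) : ℝ) : ℂ) +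
      ∑ i, h i * (szw m θ i : ℂ)) ∂(szE n)) atTop
      (nhds (((Real.sqrt ((1 + K).det) : ℂ))⁻¹ *
        Complex.exp (1/2 * (h ⬝ᵥ (((1 + K)⁻¹).map Complex.ofReal).mulVec h)))) := by
  obtain ⟨U, l, h1, h2, hKU⟩ := sz_spec K hK
  have hl : ∀ i, 0 < 1 + l i := fun i => hκ.trans_le (sz_gap_eig h1 hKU hgap i)
  choose M hM using fun n => szY_bdd (U := U) n
  have hc : ∀ r : ℝ, ∃ c : ℂ, c^2 = ((-r : ℝ) : ℂ) ∧ (0 < 1 + r → c.re^2 < 1) := by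
    intro r
    rcases le_total 0 (-r) with hr | hr
    · refine ⟨(Real.sqrt (-r) : ℂ), ?_, fun h => ?_⟩
      · rw [← Complex.ofReal_pow, Real.sq_sqrt hr]
      · rw [Complex.ofReal_re, Real.sq_sqrt hr]; linarith
    · refine ⟨(Real.sqrt r : ℂ) * Complex.I, ?_, fun h => ?_⟩
      · rw [mul_pow, Complex.I_sq, ← Complex.ofReal_pow, Real.sq_sqrt (by linarith)]; push_cast; ring
      · simp
  choose cf hcf hcf2 using hc
  let c : Fin m ⊕ Fin m → ℂ := fun i => cf (l i)
  let h' := (U.map Complex.ofReal)ᵀ *ᵥ h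
  have main := szE_diag_limit (fun n θ => Uᵀ *ᵥ szw m θ) (fun n i => szY_cont n i) M hM
    (fun n => szY_V1 h1 n) (fun z => szY_V2 h1 z) c h' (fun i => hcf2 _ (hl i))
  have e1 : (∏ i, ∫ ξ : ℝ, Complex.exp (1/2 * (c i * ξ + h' i) ^ 2) ∂szγ) =
      ((Real.sqrt ((1 + K).det) : ℂ))⁻¹ *
        Complex.exp (1/2 * (h ⬝ᵥ (((1 + K)⁻¹).map Complex.ofReal).mulVec h)) := by
    rw [sz_inv_diag h2 h1 hKU hl, sz_det_diag h2 hKU, Finset.mul_sum, Complex.exp_sum,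
      Real.sqrt_prod _ (fun i _ => (hl i).le), Complex.ofReal_prod, ← Finset.prod_inv_distrib,
      ← Finset.prod_mul_distrib]
    refine Finset.prod_congr rfl fun i _ => ?_
    rw [szγ_quad (hl i)]
    rw [hcf]; push_cast; ring
  rw [e1] at main
  refine main.congr fun n => ?_
  refine integral_congr_ae (Eventually.of_forall fun θ => ?_)
  simp only []
  congr 1
  rw [Finset.sum_add_distrib, sz_quad_diag hKU]
  congr 1
  · push_cast
    rw [Finset.mul_sum]
    refine Finset.sum_congr rfl fun i _ => ?_
    simp only [c]
    rw [hcf]; push_cast; ring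
  · have e0 : ∀ w : Fin m ⊕ Fin m → ℝ, (fun i => (((Uᵀ *ᵥ w) i : ℝ) : ℂ)) =
      (U.map Complex.ofReal)ᵀ *ᵥ (fun i => (w i : ℂ)) := fun w => by
      ext i; simp [mulVec, dotProduct]
    have h2' : (U.map Complex.ofReal) * (U.map Complex.ofReal)ᵀ = 1 := by
      have := congrArg (fun A => A.map Complex.ofReal) h2
      ext i j
      have := congrFun (congrFun this i) j
      simpa [Matrix.mul_apply, Matrix.one_apply, apply_ite] using this
    change h' ⬝ᵥ (fun i => (((Uᵀ *ᵥ szw m θ) i : ℝ) : ℂ)) = h ⬝ᵥ (fun i => (szw m θ i : ℂ))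
    rw [e0, dotProduct_mulVec, vecMul_transpose, mulVec_mulVec, h2', one_mulVec]

/-- uniform bound -/
lemma szE_G2 (hK : Kᵀ = K) {κ : ℝ} (hκ : 0 < κ)
    (hgap : ∀ v, κ * (v ⬝ᵥ v) ≤ v ⬝ᵥ ((1 + K) *ᵥ v)) (n : ℕ) :
    ∫ θ, Real.exp (-(1/2) * (szw m θ ⬝ᵥ (K *ᵥ szw m θ))) ∂(szE n) ≤
      Real.exp ((2 * κ)⁻¹ * ∑ i, ∑ j, |K i j|) := by
  obtain ⟨U, l, h1, h2, hKU⟩ := sz_spec K hK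
  obtain ⟨M, hM⟩ := szY_bdd (U := U) n
  have main := szE_diag_upper (fun θ => Uᵀ *ᵥ szw m θ) (fun i => szY_cont n i) M hM
    (szY_V1 h1 n) l κ hκ (sz_gap_eig h1 hKU hgap)
  simp_rw [← sz_quad_diag hKU] at main
  refine main.trans (Real.exp_le_exp.2 ?_)
  refine mul_le_mul_of_nonneg_left ?_ (by positivity)
  exact sz_sum_abs_eig h2 h1 hKU

end fin

/-- derivatives of the divided difference -/
noncomputable def szA (Φ : ℝ → ℂ) (j : ℕ) (η t : ℝ) : ℂ :=
  ∫ s in (0:ℝ)..1, (s:ℂ)^j * iteratedDeriv (j+1) Φ (η + s * t)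


lemma szA_P_cont {Φ : ℝ → ℂ} (hΦ : ContDiff ℝ 5 Φ) {j : ℕ} (hj : j ≤ 4) : Continuous (iteratedDeriv (j+1) Φ) :=
  hΦ.continuous_iteratedDeriv (j+1) (by exact_mod_cast (by omega : j + 1 ≤ 5))

lemma szA_P_deriv {Φ : ℝ → ℂ} (hΦ : ContDiff ℝ 5 Φ) {j : ℕ} (hj : j ≤ 3) (x : ℝ) :
    HasDerivAt (iteratedDeriv (j+1) Φ) (iteratedDeriv (j+2) Φ x) x := by
  have := (hΦ.differentiable_iteratedDeriv (j+1) (by exact_mod_cast (by omega : j + 1 < 5))) x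
  rw [iteratedDeriv_succ (n := j+1)]
  exact this.hasDerivAt

lemma szA_cont {Φ : ℝ → ℂ} (hΦ : ContDiff ℝ 5 Φ) {j : ℕ} (hj : j ≤ 4) : Continuous (fun p : ℝ × ℝ => szA Φ j p.1 p.2) := by
  apply intervalIntegral.continuous_parametric_intervalIntegral_of_continuous'
  have := szA_P_cont hΦ hj
  unfold Function.uncurry
  fun_prop

lemma szA_cont' {Φ : ℝ → ℂ} (hΦ : ContDiff ℝ 5 Φ) {j : ℕ} (hj : j ≤ 4) (η : ℝ) : Continuous (szA Φ j η) :=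
  (szA_cont hΦ hj).comp (f := fun t : ℝ => ((η, t) : ℝ × ℝ)) (Continuous.prodMk_right η)

lemma szA_zero {Φ : ℝ → ℂ} (hΦ : ContDiff ℝ 5 Φ) (η t : ℝ) : (t:ℂ) * szA Φ 0 η t = Φ (η + t) - Φ η := by
  have h : ∀ s : ℝ, HasDerivAt (fun s : ℝ => Φ (η + s * t)) ((t:ℂ) * iteratedDeriv 1 Φ (η + s * t)) s := by
    intro s
    have h1 : HasDerivAt Φ (iteratedDeriv 1 Φ (η + s*t)) (η + s * t) := by
      rw [iteratedDeriv_one]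
      exact ((hΦ.differentiable (by norm_num)) _).hasDerivAt
    have h2 : HasDerivAt (fun s : ℝ => η + s * t) t s := by
      simpa using ((hasDerivAt_id s).mul_const t).const_add η
    have := h1.scomp s h2
    refine this.congr_deriv ?_
    rw [Complex.real_smul]
  have hc := szA_P_cont hΦ (j := 0) (by norm_num)
  have := intervalIntegral.integral_eq_sub_of_hasDerivAt (a := 0) (b := 1) (fun s _ => h s)
    (Continuous.intervalIntegrable (by fun_prop) _ _)
  rw [intervalIntegral.integral_const_mul] at this
  simp only [szA, pow_zero, one_mul, zero_add]
  rw [this]; simp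

lemma szA_deriv {Φ : ℝ → ℂ} (hΦ : ContDiff ℝ 5 Φ) {j : ℕ} (hj : j ≤ 3) (η t : ℝ) :
    HasDerivAt (szA Φ j η) (szA Φ (j+1) η t) t := by
  have hc := szA_P_cont hΦ (j := j) (by omega)
  have hc' := szA_P_cont hΦ (j := j+1) (by omega)
  obtain ⟨C, hC⟩ := (isCompact_Icc (a := η - |t| - 1) (b := η + |t| + 1)).exists_bound_of_continuousOn
    hc'.continuousOn
  refine (intervalIntegral.hasDerivAt_integral_of_dominated_loc_of_deriv_le (μ := volume)
    (F := fun t s => (s:ℂ)^j * iteratedDeriv (j+1) Φ (η + s * t))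
    (F' := fun t s => (s:ℂ)^(j+1) * iteratedDeriv (j+1+1) Φ (η + s * t)) (bound := fun _ => C)
    (Metric.ball_mem_nhds t one_pos) ?_ ?_ ?_ ?_ ?_ ?_).2
  · exact Eventually.of_forall fun x => Continuous.aestronglyMeasurable (by fun_prop)
  · exact Continuous.intervalIntegrable (by fun_prop) _ _
  · exact Continuous.aestronglyMeasurable (by fun_prop)
  · refine Eventually.of_forall fun s hs x hx => ?_
    rw [Set.uIoc_of_le zero_le_one] at hs
    have hx' : |x| ≤ |t| + 1 := by
      have : |x - t| < 1 := by simpa [Real.dist_eq] using hx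
      have := abs_sub_abs_le_abs_sub x t
      linarith
    have hsx : |s * x| ≤ |t| + 1 := by
      rw [abs_mul, abs_of_pos hs.1]
      calc s * |x| ≤ 1 * |x| := by gcongr; exact hs.2
        _ ≤ _ := by linarith
    have h1 := hC (η + s * x) (by
      rw [abs_le] at hsx
      constructor <;> linarith)
    rw [norm_mul, norm_pow, Complex.norm_real, Real.norm_eq_abs, abs_of_pos hs.1]
    calc s^(j+1) * _ ≤ 1 * C := by
          apply mul_le_mul (pow_le_one₀ hs.1.le hs.2) h1 (norm_nonneg _) zero_le_one
      _ = C := one_mul _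
  · exact intervalIntegrable_const
  · refine Eventually.of_forall fun s hs x hx => ?_
    have h1 := szA_P_deriv hΦ hj (η + s * x)
    have h2 : HasDerivAt (fun x : ℝ => η + s * x) s x := by
      simpa using ((hasDerivAt_id x).const_mul s).const_add η
    have := (h1.scomp x h2).const_mul ((s:ℂ)^j)
    refine this.congr_deriv ?_
    rw [Complex.real_smul]; ring

lemma szA_bound {Φ : ℝ → ℂ} (hΦ : ContDiff ℝ 5 Φ) : ∃ M : ℝ, 0 < M ∧ ∀ j ≤ 4, ∀ η ∈ Set.Icc (-Real.pi) Real.pi,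
    ∀ t ∈ Set.Icc (-Real.pi) Real.pi, ‖szA Φ j η t‖ ≤ M := by
  have : ∀ j, ∃ M : ℝ, j ≤ 4 → ∀ p ∈ Set.Icc (-Real.pi) Real.pi ×ˢ Set.Icc (-Real.pi) Real.pi,
      ‖szA Φ j p.1 p.2‖ ≤ M := by
    intro j
    by_cases hj : j ≤ 4
    · obtain ⟨C, hC⟩ := (isCompact_Icc.prod isCompact_Icc).exists_bound_of_continuousOn
        (szA_cont hΦ hj).continuousOn (s := Set.Icc (-Real.pi) Real.pi ×ˢ Set.Icc (-Real.pi) Real.pi)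
      exact ⟨C, fun _ => hC⟩
    · exact ⟨0, fun h => absurd h hj⟩
  choose M hM using this
  refine ⟨1 + ∑ j ∈ Finset.range 5, |M j|, by positivity, fun j hj η hη t ht => ?_⟩
  have h1 := hM j hj (η, t) ⟨hη, ht⟩
  have h2 := Finset.single_le_sum (f := fun j => |M j|) (fun i _ => abs_nonneg _)
    (Finset.mem_range.2 (by omega : j < 5))
  simp only at h1 h2
  linarith [le_abs_self (M j)]



/-- log-derivative polynomials -/
noncomputable def szr (Φ : ℝ → ℂ) (η : ℝ) (j : ℕ) (t : ℝ) : ℂ := szA Φ j η t / szA Φ 0 η t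

/-- iterated logarithmic derivatives -/
noncomputable def szR (Φ : ℝ → ℂ) (η : ℝ) (j : ℕ) (t : ℝ) : ℂ :=
  match j with
  | 0 => 0
  | 1 => szr Φ η 1 t
  | 2 => szr Φ η 2 t - szr Φ η 1 t ^ 2
  | 3 => szr Φ η 3 t - 3 * szr Φ η 1 t * szr Φ η 2 t + 2 * szr Φ η 1 t ^ 3
  | _ => szr Φ η 4 t - 4 * szr Φ η 1 t * szr Φ η 3 t - 3 * szr Φ η 2 t ^ 2
      + 12 * szr Φ η 1 t ^ 2 * szr Φ η 2 t - 6 * szr Φ η 1 t ^ 4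

lemma szr_deriv {Φ : ℝ → ℂ} (hΦ : ContDiff ℝ 5 Φ) {j : ℕ} (hj : j ≤ 3) (η t : ℝ)
    (h0 : szA Φ 0 η t ≠ 0) :
    HasDerivAt (szr Φ η j) (szr Φ η (j+1) t - szr Φ η j t * szr Φ η 1 t) t := by
  have := (szA_deriv hΦ hj η t).div (szA_deriv hΦ (j := 0) (by norm_num) η t) h0
  refine this.congr_deriv ?_
  simp only [szr]
  field_simp

lemma szR_deriv {Φ : ℝ → ℂ} (hΦ : ContDiff ℝ 5 Φ) {j : ℕ} (hj1 : 1 ≤ j) (hj : j ≤ 3) (η t : ℝ)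
    (h0 : szA Φ 0 η t ≠ 0) : HasDerivAt (szR Φ η j) (szR Φ η (j+1) t) t := by
  have d1 := szr_deriv hΦ (j := 1) (by norm_num) η t h0
  have d2 := szr_deriv hΦ (j := 2) (by norm_num) η t h0
  have d3 := szr_deriv hΦ (j := 3) (by norm_num) η t h0
  interval_cases j
  · exact (d1.congr_deriv (by simp only [szR]; ring))
  · exact (d2.sub (d1.pow 2)).congr_deriv (by simp only [szR]; push_cast; ring)
  · exact ((d3.sub ((d1.const_mul 3).mul d2)).add ((d1.pow 3).const_mul 2)).congr_deriv
      (by simp only [szR]; push_cast; ring)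

lemma szR_bound {Φ : ℝ → ℂ} {η t M δ : ℝ} (hδ : 0 < δ) (hM : ∀ j ≤ 4, ‖szA Φ j η t‖ ≤ M)
    (h0 : δ ≤ ‖szA Φ 0 η t‖) : ‖szR Φ η 4 t‖ ≤ 26 * (1 + M/δ)^4 := by
  have hr : ∀ j ≤ 4, ‖szr Φ η j t‖ ≤ M / δ := fun j hj => by
    rw [szr, norm_div]
    have := hM j hj
    have h2 : 0 ≤ M := (norm_nonneg _).trans this
    gcongr
  have h1 := hr 1 (by norm_num)
  have h2 := hr 2 (by norm_num)
  have h3 := hr 3 (by norm_num)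
  have h4 := hr 4 (by norm_num)
  generalize M / δ = R at *
  have hR : 0 ≤ R := (norm_nonneg _).trans h1
  simp only [szR]
  generalize szr Φ η 1 t = r1 at *
  generalize szr Φ η 2 t = r2 at *
  generalize szr Φ η 3 t = r3 at *
  generalize szr Φ η 4 t = r4 at *
  have e : ‖r4 - 4 * r1 * r3 - 3 * r2 ^ 2 + 12 * r1 ^ 2 * r2 - 6 * r1 ^ 4‖ ≤
      ‖r4‖ + 4 * ‖r1‖ * ‖r3‖ + 3 * ‖r2‖^2 + 12 * ‖r1‖^2 * ‖r2‖ + 6 * ‖r1‖^4 := by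
    calc _ ≤ ‖r4‖ + ‖4 * r1 * r3‖ + ‖3 * r2 ^ 2‖ + ‖12 * r1 ^ 2 * r2‖ + ‖6 * r1 ^ 4‖ := by
          refine (norm_sub_le _ _).trans (add_le_add_left ?_ _)
          refine (norm_add_le _ _).trans (add_le_add_left ?_ _)
          refine (norm_sub_le _ _).trans (add_le_add_left ?_ _)
          exact norm_sub_le _ _
      _ = _ := by simp [norm_mul, norm_pow]
  refine e.trans ?_
  calc _ ≤ R + 4 * R * R + 3 * R^2 + 12 * R^2 * R + 6 * R^4 := by gcongr
    _ ≤ 26 * (1 + R)^4 := by nlinarith [pow_nonneg hR 2, pow_nonneg hR 3, pow_nonneg hR 4]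

lemma szR_cont {Φ : ℝ → ℂ} (hΦ : ContDiff ℝ 5 Φ) {s : Set ℝ} (η : ℝ) {j : ℕ} (hj : j ≤ 4)
    (h0 : ∀ t ∈ s, szA Φ 0 η t ≠ 0) : ContinuousOn (szR Φ η j) s := by
  have hr : ∀ i ≤ 4, ContinuousOn (szr Φ η i) s := fun i hi =>
    (szA_cont' hΦ hi η).continuousOn.div (szA_cont' hΦ (by norm_num) η).continuousOn h0
  have h1 := hr 1 (by norm_num)
  have h2 := hr 2 (by norm_num)
  have h3 := hr 3 (by norm_num)
  have h4 := hr 4 (by norm_num)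
  interval_cases j
  · exact continuousOn_const
  all_goals
    show ContinuousOn (fun t => szR Φ η _ t) s
    simp only [szR]
    fun_prop

/-- one integration by parts -/
lemma sz_ibp {p p' : ℝ → ℂ} (hper : ∀ t ∈ Set.Ioo (-(2*Real.pi)) 0, p (t + 2 * Real.pi) = p t)
    (hd : ∀ t ∈ Set.Ioo (-(2*Real.pi)) (2*Real.pi), HasDerivAt p (p' t) t)
    (hc : ContinuousOn p' (Set.Icc (-Real.pi) Real.pi)) (k : ℕ) :
    (∀ t ∈ Set.Ioo (-(2*Real.pi)) 0, p' (t + 2 * Real.pi) = p' t) ∧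
    ‖∫ t in -Real.pi..Real.pi, p t * szp t ^ (k+1)‖ =
      ((k:ℝ)+1)⁻¹ * ‖∫ t in -Real.pi..Real.pi, p' t * szp t ^ (k+1)‖ := by
  have hπ := Real.pi_pos
  constructor
  · intro t ht
    have h1 := hd (t + 2 * Real.pi) ⟨by linarith [ht.1], by linarith [ht.2]⟩
    have h2 := h1.comp_add_const t (2 * Real.pi)
    have h3 : HasDerivAt p (p' (t + 2 * Real.pi)) t := by
      refine h2.congr_of_eventuallyEq ?_
      filter_upwards [isOpen_Ioo.mem_nhds ht] with x hx
      exact (hper x hx).symm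
    exact h3.unique (hd t ⟨ht.1, by linarith [ht.2]⟩)
  · have hk : ((k:ℂ)+1) ≠ 0 := by exact_mod_cast Nat.succ_ne_zero k
    have hI : Complex.I * ((k:ℂ)+1) ≠ 0 := mul_ne_zero Complex.I_ne_zero hk
    have hv : ∀ t : ℝ, HasDerivAt (fun t : ℝ => szp t ^ (k+1) / (Complex.I * ((k:ℂ)+1)))
        (szp t ^ (k+1)) t := by
      intro t
      have h1 : HasDerivAt szp (szp t * Complex.I) t := by
        have : HasDerivAt (fun t : ℝ => Complex.I * (t:ℂ)) Complex.I t := by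
          simpa using (Complex.ofRealCLM.hasDerivAt (x := t)).const_mul Complex.I
        exact this.cexp
      have := (h1.pow (k+1)).div_const (Complex.I * ((k:ℂ)+1))
      refine this.congr_deriv ?_
      push_cast
      field_simp
      exact (pow_succ _ _).symm
    have hcz := szp_cont
    have := intervalIntegral.integral_mul_deriv_eq_deriv_mul (a := -Real.pi) (b := Real.pi)
      (u := p) (v := fun t : ℝ => szp t ^ (k+1) / (Complex.I * ((k:ℂ)+1))) (u' := p')
      (v' := fun t => szp t ^ (k+1))
      (fun x hx => by
        rw [Set.uIcc_of_le (by linarith)] at hx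
        exact hd x ⟨by linarith [hx.1], by linarith [hx.2]⟩)
      (fun x _ => hv x)
      (ContinuousOn.intervalIntegrable (by rwa [Set.uIcc_of_le (by linarith)]))
      (Continuous.intervalIntegrable (by fun_prop) _ _)
    rw [this]
    have e1 : p Real.pi = p (-Real.pi) := by
      have := hper (-Real.pi) ⟨by linarith, by linarith⟩
      rw [← this]; congr 1; ring
    have e2 : szp Real.pi = szp (-Real.pi) := by
      have := szp_periodic (-Real.pi)
      rw [← this]; congr 1; ring
    rw [e1, e2, sub_self, zero_sub, norm_neg]
    have e3 : ∀ t, p' t * (szp t ^ (k+1) / (Complex.I * ((k:ℂ)+1))) =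
        (Complex.I * ((k:ℂ)+1))⁻¹ * (p' t * szp t ^ (k+1)) := fun t => by
      field_simp
    simp_rw [e3]
    rw [intervalIntegral.integral_const_mul, norm_mul, norm_inv, norm_mul, Complex.norm_I, one_mul]
    congr 2
    have : ((k:ℂ)+1) = (((k:ℝ)+1 : ℝ) : ℂ) := by push_cast; rfl
    rw [this, Complex.norm_real, Real.norm_eq_abs, abs_of_pos (by positivity)]

/-- the Grunsky double series on the circle -/
noncomputable def szFF (b : ℕ → ℕ → ℂ) (θ η : ℝ) : ℂ :=
  ∑' p : ℕ × ℕ, b p.1 p.2 * szp (-θ) ^ (p.1+1) * szp (-η) ^ (p.2+1)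

lemma szFF_term_norm (b : ℕ → ℕ → ℂ) (θ η : ℝ) (p : ℕ × ℕ) :
    ‖b p.1 p.2 * szp (-θ) ^ (p.1+1) * szp (-η) ^ (p.2+1)‖ = ‖b p.1 p.2‖ := by
  simp [norm_mul, norm_pow, szp_norm]

lemma szFF_cont {b : ℕ → ℕ → ℂ} (hb : Summable fun p : ℕ × ℕ => ‖b p.1 p.2‖) :
    Continuous (fun q : ℝ × ℝ => szFF b q.1 q.2) := by
  refine continuous_tsum (fun p => ?_) hb fun p q => (szFF_term_norm b _ _ p).le
  have := szp_cont
  fun_prop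

lemma szFF_norm {b : ℕ → ℕ → ℂ} (hb : Summable fun p : ℕ × ℕ => ‖b p.1 p.2‖) (θ η : ℝ) :
    ‖szFF b θ η‖ ≤ ∑' p : ℕ × ℕ, ‖b p.1 p.2‖ := by
  refine (norm_tsum_le_tsum_norm ?_).trans (le_of_eq ?_)
  · simp_rw [szFF_term_norm]; exact hb
  · simp_rw [szFF_term_norm]

lemma szp_neg_periodic (θ : ℝ) : szp (-(θ + 2 * Real.pi)) = szp (-θ) := by
  rw [szp_neg, szp_neg, szp_periodic]

lemma szp_add (x y : ℝ) : szp (x + y) = szp x * szp y := by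
  simp only [szp]; rw [← Complex.exp_add]; congr 1; push_cast; ring

lemma szp_ne_one {t : ℝ} (h1 : -(2*Real.pi) < t) (h2 : t < 2 * Real.pi) (h0 : t ≠ 0) : szp t ≠ 1 := by
  intro h
  rw [szp, Complex.exp_eq_one_iff] at h
  obtain ⟨n, hn⟩ := h
  have hn' : (t:ℂ) = ((n * (2 * Real.pi) : ℝ) : ℂ) := by
    have := mul_left_cancel₀ Complex.I_ne_zero (a := Complex.I) (b := (t:ℂ)) (c := n * (2 * Real.pi))
      (by rw [hn]; ring)
    rw [this]; push_cast; ring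
  have hn2 : t = n * (2 * Real.pi) := by exact_mod_cast hn'
  have hπ := Real.pi_pos
  have a1 : (n:ℝ) < 1 := by
    by_contra hc; push Not at hc; nlinarith
  have a2 : (-1:ℝ) < n := by
    by_contra hc; push Not at hc; nlinarith
  have : n = 0 := by
    have : n < 1 := by exact_mod_cast a1
    have : -1 < n := by exact_mod_cast a2
    omega
  rw [this] at hn2; simp at hn2; exact h0 hn2

lemma szp_hasDeriv (t : ℝ) : HasDerivAt szp (szp t * Complex.I) t := by
  have : HasDerivAt (fun t : ℝ => Complex.I * (t:ℂ)) Complex.I t := by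
    simpa using (Complex.ofRealCLM.hasDerivAt (x := t)).const_mul Complex.I
  exact this.cexp

lemma szp_contDiff {n} : ContDiff ℝ n szp := by
  unfold szp
  exact Complex.contDiff_exp.comp (contDiff_const.mul Complex.ofRealCLM.contDiff)

lemma szA_szp_ne (η : ℝ) {t : ℝ} (h1 : -(2*Real.pi) < t) (h2 : t < 2 * Real.pi) :
    szA szp 0 η t ≠ 0 := by
  by_cases h0 : t = 0
  · subst h0
    simp only [szA, pow_zero, one_mul, zero_add, mul_zero, add_zero, iteratedDeriv_one]
    rw [(szp_hasDeriv η).deriv]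
    simp [szp_ne]
  · intro h
    have := szA_zero (szp_contDiff (n := 5)) η t
    rw [h, mul_zero, szp_add, eq_comm, sub_eq_zero] at this
    exact szp_ne_one h1 h2 h0 (mul_left_cancel₀ (szp_ne η) (by rw [this, mul_one]))

/-- derivative of a continuous logarithm -/
lemma sz_log_deriv {f u : ℝ → ℂ} {t : ℝ} {u' : ℂ} (hf : ContinuousAt f t)
    (hu : ∀ᶠ s in nhds t, u s = Complex.exp (- f s)) (hd : HasDerivAt u u' t) :
    HasDerivAt f (-(u' / u t)) t := by
  have hut : u t = Complex.exp (-f t) := hu.self_of_nhds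
  have e : Complex.exp (f t) * Complex.exp (-f t) = 1 := by rw [← Complex.exp_add]; simp
  have h1 : HasDerivAt (fun s => u s * Complex.exp (f t)) (u' * Complex.exp (f t)) t :=
    hd.mul_const _
  have h2 : HasDerivAt (fun s => f t - Complex.log (u s * Complex.exp (f t)))
      (-(u' / u t)) t := by
    have := (h1.clog_real (by
      rw [hut, mul_comm, e]; exact Complex.one_mem_slitPlane)).const_sub (f t)
    refine this.congr_deriv ?_
    rw [mul_div_mul_right _ _ (Complex.exp_ne_zero _)]
  refine h2.congr_of_eventuallyEq ?_
  have hnear : ∀ᶠ s in nhds t, ‖f s - f t‖ < 1 := by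
    have := Metric.continuousAt_iff'.1 hf 1 one_pos
    simpa [dist_eq_norm] using this
  filter_upwards [hu, hnear] with s hs hs2
  rw [hs, ← Complex.exp_add, Complex.log_exp]
  · ring
  · have := (Complex.abs_im_le_norm (-f s + f t)).trans_lt (by rw [neg_add_eq_sub, norm_sub_rev]; exact hs2)
    have := (abs_lt.1 this).1
    linarith [Real.pi_gt_three]
  · have := (Complex.abs_im_le_norm (-f s + f t)).trans_lt (by rw [neg_add_eq_sub, norm_sub_rev]; exact hs2)
    have := (abs_lt.1 this).2
    linarith [Real.pi_gt_three]

section decay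
variable {Φ : ℝ → ℂ} {b : ℕ → ℕ → ℂ}

lemma szA_ratio (hΦ : ContDiff ℝ 5 Φ) (hb : Summable fun p : ℕ × ℕ => ‖b p.1 p.2‖)
    (hF : ∀ θ η, szp θ ≠ szp η → Φ θ - Φ η = (szp θ - szp η) * Complex.exp (-szFF b θ η))
    (η : ℝ) {t : ℝ} (h1 : -(2*Real.pi) < t) (h2 : t < 2 * Real.pi) :
    szA Φ 0 η t = szA szp 0 η t * Complex.exp (-szFF b (η + t) η) := by
  have key : ∀ t, t ≠ 0 → -(2*Real.pi) < t → t < 2 * Real.pi →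
      szA Φ 0 η t = szA szp 0 η t * Complex.exp (-szFF b (η + t) η) := by
    intro t h0 h1 h2
    have ht : (t:ℂ) ≠ 0 := by exact_mod_cast h0
    apply mul_left_cancel₀ ht
    rw [← mul_assoc, szA_zero hΦ, szA_zero szp_contDiff, hF]
    rw [szp_add]
    intro h
    exact szp_ne_one h1 h2 h0 (mul_left_cancel₀ (szp_ne η) (by rw [h, mul_one]))
  by_cases h0 : t = 0
  · subst h0
    have c1 : Tendsto (szA Φ 0 η) (nhdsWithin 0 {0}ᶜ) (nhds (szA Φ 0 η 0)) :=
      ((szA_cont' hΦ (by norm_num) η).tendsto 0).mono_left nhdsWithin_le_nhds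
    have hc : Continuous (fun t : ℝ => szA szp 0 η t * Complex.exp (-szFF b (η + t) η)) := by
      have a1 := szA_cont' (szp_contDiff (n := 5)) (j := 0) (by norm_num) η
      have a2 : Continuous (fun t : ℝ => szFF b (η + t) η) :=
        (szFF_cont hb).comp (f := fun t : ℝ => ((η + t, η) : ℝ × ℝ)) (by fun_prop)
      fun_prop
    have c2 := (hc.tendsto 0).mono_left (nhdsWithin_le_nhds (s := {0}ᶜ))
    refine tendsto_nhds_unique c1 (c2.congr' ?_)
    have hπ := Real.pi_pos
    filter_upwards [self_mem_nhdsWithin, nhdsWithin_le_nhds (isOpen_Ioo.mem_nhds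
      (⟨by linarith, by linarith⟩ : (0:ℝ) ∈ Set.Ioo (-(2*Real.pi)) (2*Real.pi)))] with s hs hs2
    exact (key s hs hs2.1 hs2.2).symm
  · exact key t h0 h1 h2

lemma sz_decay_inner (hΦ : ContDiff ℝ 5 Φ) (hb : Summable fun p : ℕ × ℕ => ‖b p.1 p.2‖)
    (hF : ∀ θ η, szp θ ≠ szp η → Φ θ - Φ η = (szp θ - szp η) * Complex.exp (-szFF b θ η)) :
    ∃ C : ℝ, ∀ k : ℕ, ∀ η ∈ Set.Icc (-Real.pi) Real.pi,
      ‖∫ t in -Real.pi..Real.pi, szFF b (η + t) η * szp t ^ (k+1)‖ ≤ C / ((k:ℝ)+1)^4 := by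
  have hπ := Real.pi_pos
  have hs := szp_contDiff (n := 5)
  obtain ⟨M, hM0, hM⟩ := szA_bound hΦ
  obtain ⟨M', hM0', hM'⟩ := szA_bound hs
  -- lower bound
  obtain ⟨δ, hδ, hδ'⟩ : ∃ δ > 0, ∀ η ∈ Set.Icc (-Real.pi) Real.pi,
      ∀ t ∈ Set.Icc (-Real.pi) Real.pi, δ ≤ ‖szA szp 0 η t‖ := by
    have hcomp : IsCompact (Set.Icc (-Real.pi) Real.pi ×ˢ Set.Icc (-Real.pi) Real.pi) :=
      isCompact_Icc.prod isCompact_Icc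
    obtain ⟨p, hp, hmin⟩ := hcomp.exists_isMinOn ⟨(0,0), ⟨⟨by linarith, by linarith⟩, ⟨by linarith, by linarith⟩⟩⟩
      (szA_cont hs (j := 0) (by norm_num)).norm.continuousOn
    refine ⟨‖szA szp 0 p.1 p.2‖, norm_pos_iff.2 (szA_szp_ne _ (by linarith [hp.2.1]) (by linarith [hp.2.2])),
      fun η hη t ht => ?_⟩
    exact hmin (a := (η, t)) ⟨hη, ht⟩
  let S := ∑' p : ℕ × ℕ, ‖b p.1 p.2‖
  let δ2 := δ * Real.exp (-S)
  have hδ2 : 0 < δ2 := by positivity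
  have hlow : ∀ η ∈ Set.Icc (-Real.pi) Real.pi, ∀ t ∈ Set.Icc (-Real.pi) Real.pi,
      δ2 ≤ ‖szA Φ 0 η t‖ := by
    intro η hη t ht
    rw [szA_ratio hΦ hb hF η (by linarith [ht.1]) (by linarith [ht.2]), norm_mul, Complex.norm_exp]
    apply mul_le_mul (hδ' η hη t ht) _ (Real.exp_pos _).le (norm_nonneg _)
    apply Real.exp_le_exp.2
    rw [Complex.neg_re]
    have := (Complex.re_le_norm _).trans (szFF_norm hb (η + t) η)
    simp only [S]; linarith
  refine ⟨(26 * (1 + M'/δ)^4 + 26 * (1 + M/δ2)^4) * (2 * Real.pi), fun k η hη => ?_⟩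
  let p : ℕ → ℝ → ℂ := fun j t => szR szp η j t - szR Φ η j t
  let f : ℝ → ℂ := fun t => szFF b (η + t) η
  have hne : ∀ t ∈ Set.Ioo (-(2*Real.pi)) (2*Real.pi), szA Φ 0 η t ≠ 0 := fun t ht => by
    rw [szA_ratio hΦ hb hF η ht.1 ht.2]
    exact mul_ne_zero (szA_szp_ne η ht.1 ht.2) (Complex.exp_ne_zero _)
  have hIcc : ∀ t ∈ Set.Icc (-Real.pi) Real.pi, t ∈ Set.Ioo (-(2*Real.pi)) (2*Real.pi) :=
    fun t ht => ⟨by linarith [ht.1], by linarith [ht.2]⟩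
  have hpc : ∀ j ≤ 4, ContinuousOn (p j) (Set.Icc (-Real.pi) Real.pi) := fun j hj =>
    (szR_cont hs η hj fun t ht => szA_szp_ne η (hIcc t ht).1 (hIcc t ht).2).sub
      (szR_cont hΦ η hj fun t ht => hne t (hIcc t ht))
  have hpd : ∀ j, 1 ≤ j → j ≤ 3 → ∀ t ∈ Set.Ioo (-(2*Real.pi)) (2*Real.pi),
      HasDerivAt (p j) (p (j+1) t) t := fun j h1 h3 t ht =>
    (szR_deriv hs h1 h3 η t (szA_szp_ne η ht.1 ht.2)).sub (szR_deriv hΦ h1 h3 η t (hne t ht))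
  have hfc : Continuous f :=
    (szFF_cont hb).comp (f := fun t : ℝ => ((η + t, η) : ℝ × ℝ)) (by fun_prop)
  have hfd : ∀ t ∈ Set.Ioo (-(2*Real.pi)) (2*Real.pi), HasDerivAt f (p 1 t) t := by
    intro t ht
    have hu := (szA_deriv hΦ (j := 0) (by norm_num) η t).div
      (szA_deriv hs (j := 0) (by norm_num) η t) (szA_szp_ne η ht.1 ht.2)
    have := sz_log_deriv (f := f) hfc.continuousAt (by
      filter_upwards [isOpen_Ioo.mem_nhds ht] with s hs
      simp only [Pi.div_apply]
      rw [szA_ratio hΦ hb hF η hs.1 hs.2, mul_div_cancel_left₀ _ (szA_szp_ne η hs.1 hs.2)]) hu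
    refine this.congr_deriv ?_
    have n1 := hne t ht
    have n2 := szA_szp_ne η ht.1 ht.2
    simp only [p, szR, szr, Pi.div_apply, zero_add]
    field_simp
    ring
  have hper : ∀ t ∈ Set.Ioo (-(2*Real.pi)) 0, f (t + 2 * Real.pi) = f t := fun t _ => by
    simp only [f, szFF]
    rw [← add_assoc, szp_neg_periodic]
  obtain ⟨q1, i1⟩ := sz_ibp hper hfd (hpc 1 (by norm_num)) k
  obtain ⟨q2, i2⟩ := sz_ibp q1 (hpd 1 (by norm_num) (by norm_num)) (hpc 2 (by norm_num)) k
  obtain ⟨q3, i3⟩ := sz_ibp q2 (hpd 2 (by norm_num) (by norm_num)) (hpc 3 (by norm_num)) k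
  obtain ⟨q4, i4⟩ := sz_ibp q3 (hpd 3 (by norm_num) (by norm_num)) (hpc 4 (by norm_num)) k
  have hfin : ‖∫ t in -Real.pi..Real.pi, p 4 t * szp t ^ (k+1)‖ ≤
      (26 * (1 + M'/δ)^4 + 26 * (1 + M/δ2)^4) * (2 * Real.pi) := by
    have := intervalIntegral.norm_integral_le_of_norm_le_const (a := -Real.pi) (b := Real.pi)
      (f := fun t => p 4 t * szp t ^ (k+1)) (C := 26 * (1 + M'/δ)^4 + 26 * (1 + M/δ2)^4) (by
      intro t ht
      rw [Set.uIoc_of_le (by linarith)] at ht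
      have ht' : t ∈ Set.Icc (-Real.pi) Real.pi := ⟨ht.1.le, ht.2⟩
      rw [norm_mul, norm_pow, szp_norm, one_pow, mul_one]
      refine (norm_sub_le _ _).trans (add_le_add ?_ ?_)
      · exact szR_bound hδ (fun j hj => hM' j hj η hη t ht') (hδ' η hη t ht')
      · exact szR_bound hδ2 (fun j hj => hM j hj η hη t ht') (hlow η hη t ht'))
    rw [abs_of_pos (by linarith)] at this
    refine this.trans (le_of_eq ?_)
    ring
  change ‖∫ t in -Real.pi..Real.pi, f t * szp t ^ (k+1)‖ ≤ _
  rw [i1, i2, i3, i4, div_eq_inv_mul]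
  calc _ = (((k:ℝ)+1)^4)⁻¹ * ‖∫ t in -Real.pi..Real.pi, p 4 t * szp t ^ (k+1)‖ := by
        have : (k:ℝ) + 1 ≠ 0 := by positivity
        field_simp
    _ ≤ _ := by gcongr
end decay

lemma szν_pow {m : ℕ} (hm : m ≠ 0) : ∫ θ, szp θ ^ m ∂szν = 0 := by
  have := szν_mean (h := fun z => z^m) (by
    apply Differentiable.diffContOnCl; fun_prop)
  rw [this]; simp [hm]

lemma szp_neg_mul (θ : ℝ) : szp (-θ) * szp θ = 1 := by
  rw [← szp_add]; simp [szp]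

lemma szν_orth (i k : ℕ) : ∫ θ, szp (-θ) ^ (i+1) * szp θ ^ (k+1) ∂szν = if i = k then 1 else 0 := by
  rcases lt_trichotomy i k with h | h | h
  · have : ∀ θ, szp (-θ) ^ (i+1) * szp θ ^ (k+1) = szp θ ^ (k - i) := fun θ => by
      have : k + 1 = (i+1) + (k - i) := by omega
      rw [this, pow_add (szp θ) (i+1) (k-i), ← mul_assoc, ← mul_pow, szp_neg_mul, one_pow, one_mul]
    simp_rw [this]
    rw [szν_pow (by omega), if_neg (by omega)]
  · subst h
    have := szν_prob
    simp_rw [← mul_pow, szp_neg_mul]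
    simp
  · have : ∀ θ, szp (-θ) ^ (i+1) * szp θ ^ (k+1) = szp (-θ) ^ (i - k) := fun θ => by
      have : i + 1 = (i - k) + (k+1) := by omega
      rw [this, pow_add (szp (-θ)) (i-k) (k+1), mul_assoc, ← mul_pow, szp_neg_mul, one_pow, mul_one]
    simp_rw [this]
    rw [szν_neg (fun θ => szp θ ^ (i - k)), szν_pow (by omega), if_neg (by omega)]

lemma sz_coeff {b : ℕ → ℕ → ℂ} (hb : Summable fun p : ℕ × ℕ => ‖b p.1 p.2‖) (k l : ℕ) :
    ∫ η, (∫ θ, szFF b θ η * szp θ ^ (k+1) ∂szν) * szp η ^ (l+1) ∂szν = b k l := by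
  have hp := szν_prob
  have hcz := szp_cont
  have hF := szFF_cont hb
  let T : ℕ × ℕ → ℝ × ℝ → ℂ := fun p q => b p.1 p.2 *
    ((szp (-q.2) ^ (p.1+1) * szp q.2 ^ (k+1)) * (szp (-q.1) ^ (p.2+1) * szp q.1 ^ (l+1)))
  have hTn : ∀ p q, ‖T p q‖ = ‖b p.1 p.2‖ := fun p q => by
    simp [T, norm_mul, norm_pow, szp_norm]
  have hTc : ∀ p, Continuous (T p) := fun p => by simp only [T]; fun_prop
  have hTi : ∀ p, Integrable (T p) (szν.prod szν) := fun p =>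
    Integrable.of_bound (hTc p).aestronglyMeasurable _ (Eventually.of_forall fun q => (hTn p q).le)
  have h1 := hasSum_integral_of_summable_integral_norm hTi (by
    simp_rw [hTn]; simpa using hb)
  have e1 : ∀ p : ℕ × ℕ, ∫ q, T p q ∂(szν.prod szν) = if p = (k, l) then b k l else 0 := by
    intro p
    simp only [T]
    rw [integral_const_mul]
    have := integral_prod_mul (μ := szν) (ν := szν)
      (fun η => szp (-η) ^ (p.2+1) * szp η ^ (l+1)) (fun θ => szp (-θ) ^ (p.1+1) * szp θ ^ (k+1))
    rw [szν_orth, szν_orth] at this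
    have e : ∀ q : ℝ × ℝ, (szp (-q.2) ^ (p.1+1) * szp q.2 ^ (k+1)) * (szp (-q.1) ^ (p.2+1) * szp q.1 ^ (l+1))
      = (szp (-q.1) ^ (p.2+1) * szp q.1 ^ (l+1)) * (szp (-q.2) ^ (p.1+1) * szp q.2 ^ (k+1)) :=
      fun q => mul_comm _ _
    simp_rw [e]
    rw [this]
    rcases p with ⟨i, j⟩
    by_cases hi : i = k <;> by_cases hj : j = l <;> simp [hi, hj]
  simp_rw [e1] at h1
  have h2 := h1.unique (hasSum_ite_eq (k, l) (b k l))
  have e2 : ∀ q : ℝ × ℝ, ∑' p, T p q = szFF b q.2 q.1 * szp q.2 ^ (k+1) * szp q.1 ^ (l+1) := by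
    intro q
    rw [szFF, ← tsum_mul_right, ← tsum_mul_right]
    refine tsum_congr fun p => ?_
    simp only [T]; ring
  simp_rw [e2] at h2
  rw [integral_prod] at h2
  · simp only at h2
    simp_rw [integral_mul_const] at h2
    exact h2
  · have hc : Continuous fun q : ℝ × ℝ => szFF b q.2 q.1 * szp q.2 ^ (k+1) * szp q.1 ^ (l+1) := by
      have : Continuous fun q : ℝ × ℝ => szFF b q.2 q.1 :=
        hF.comp (f := fun q : ℝ × ℝ => ((q.2, q.1) : ℝ × ℝ)) (by fun_prop)
      fun_prop
    refine Integrable.of_bound hc.aestronglyMeasurable (∑' p : ℕ × ℕ, ‖b p.1 p.2‖)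
      (Eventually.of_forall fun q => ?_)
    rw [norm_mul, norm_mul, norm_pow, norm_pow, szp_norm, szp_norm, one_pow, one_pow, mul_one, mul_one]
    exact szFF_norm hb _ _

lemma sz_decay {Φ : ℝ → ℂ} {b : ℕ → ℕ → ℂ} (hΦ : ContDiff ℝ 5 Φ)
    (hb : Summable fun p : ℕ × ℕ => ‖b p.1 p.2‖)
    (hF : ∀ θ η, szp θ ≠ szp η → Φ θ - Φ η = (szp θ - szp η) * Complex.exp (-szFF b θ η)) :
    ∃ C : ℝ, ∀ k l : ℕ, ‖b k l‖ ≤ C / ((k:ℝ)+1)^4 := by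
  have hπ := Real.pi_pos
  have hp := szν_prob
  obtain ⟨C, hC⟩ := sz_decay_inner hΦ hb hF
  refine ⟨(2 * Real.pi)⁻¹ * C, fun k l => ?_⟩
  rw [← sz_coeff hb k l]
  have hin : ∀ η ∈ Set.Icc (-Real.pi) Real.pi,
      ‖∫ θ, szFF b θ η * szp θ ^ (k+1) ∂szν‖ ≤ (2 * Real.pi)⁻¹ * C / ((k:ℝ)+1)^4 := by
    intro η hη
    rw [szν_integral, norm_smul, Real.norm_eq_abs, abs_of_pos (by positivity), mul_div_assoc]
    refine mul_le_mul_of_nonneg_left ?_ (by positivity)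
    have hper : Function.Periodic (fun θ => szFF b θ η * szp θ ^ (k+1)) (2 * Real.pi) := by
      intro θ
      simp only [szFF]
      rw [szp_neg_periodic, szp_periodic]
    have e1 := hper.intervalIntegral_add_eq (-Real.pi) (η + -Real.pi)
    rw [show -Real.pi + 2 * Real.pi = Real.pi by ring,
      show η + -Real.pi + 2 * Real.pi = η + Real.pi by ring,
      ← intervalIntegral.integral_comp_add_left] at e1
    rw [e1]
    have e2 : ∀ t, szFF b (η + t) η * szp (η + t) ^ (k+1) =
        szp η ^ (k+1) * (szFF b (η + t) η * szp t ^ (k+1)) := fun t => by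
      rw [szp_add, mul_pow]; ring
    simp_rw [e2]
    rw [intervalIntegral.integral_const_mul, norm_mul, norm_pow, szp_norm, one_pow, one_mul]
    exact hC k η hη
  have := norm_integral_le_of_norm_le_const (μ := szν)
    (f := fun η => (∫ θ, szFF b θ η * szp θ ^ (k+1) ∂szν) * szp η ^ (l+1))
    (C := (2 * Real.pi)⁻¹ * C / ((k:ℝ)+1)^4) (by
      filter_upwards [szν_ae_mem] with η hη
      rw [norm_mul, norm_pow, szp_norm, one_pow, mul_one]
      exact hin η hη)
  simpa using this

/-- interpolated decay -/
lemma sz_interp {b : ℕ → ℕ → ℂ} (hsym : ∀ k l, b k l = b l k) {C : ℝ}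
    (hC : ∀ k l : ℕ, ‖b k l‖ ≤ C / ((k:ℝ)+1)^4) (k l : ℕ) :
    Real.sqrt (((k:ℝ)+1) * ((l:ℝ)+1)) * ‖b k l‖ ≤ C / (((k:ℝ)+1)^2 * ((l:ℝ)+1)) := by
  have hk : (0:ℝ) < (k:ℝ)+1 := by positivity
  have hl : (0:ℝ) < (l:ℝ)+1 := by positivity
  have h1 := hC k l
  have h2 := hC l k
  rw [hsym l k] at h2
  have hC0 : 0 ≤ C := by
    have := (norm_nonneg _).trans h1
    by_contra h
    push Not at h
    have := div_neg_of_neg_of_pos h (by positivity : 0 < ((k:ℝ)+1)^4)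
    linarith
  apply le_of_pow_le_pow_left₀ (n := 8) (by norm_num) (by positivity)
  rw [mul_pow, div_pow]
  have e1 : Real.sqrt (((k:ℝ)+1) * ((l:ℝ)+1)) ^ 8 = (((k:ℝ)+1) * ((l:ℝ)+1))^4 := by
    rw [show (8:ℕ) = 2 * 4 by norm_num, pow_mul, Real.sq_sqrt (by positivity)]
  have e2 : ‖b k l‖^8 ≤ (C / ((k:ℝ)+1)^4)^5 * (C / ((l:ℝ)+1)^4)^3 := by
    calc ‖b k l‖^8 = ‖b k l‖^5 * ‖b k l‖^3 := by ring
      _ ≤ _ := by gcongr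
  rw [e1]
  calc _ ≤ (((k:ℝ)+1) * ((l:ℝ)+1))^4 * ((C / ((k:ℝ)+1)^4)^5 * (C / ((l:ℝ)+1)^4)^3) := by gcongr
    _ = _ := by field_simp

/-- positivity of the Gaussian energy -/
lemma sz_J {w : ℝ → ℂ} {f : ℝ → ℝ} (hw : Continuous w) (hf : Continuous f) {R M : ℝ}
    (hR : ∀ θ, ‖w θ‖ ≤ R) (hM : ∀ θ, |f θ| ≤ M) {t : ℝ} (ht : 0 < t) :
    HasSum (fun q : ℕ × ℕ => t^q.1 / q.1.factorial * (t^q.2 / q.2.factorial) *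
      ‖∫ θ, (Real.exp (-(t * ‖w θ‖^2)) : ℂ) * w θ ^ q.1 * (starRingEnd ℂ) (w θ) ^ q.2 * (f θ : ℂ) ∂szν‖^2)
      (∫ p, Real.exp (-(t * ‖w p.1 - w p.2‖^2)) * (f p.1 * f p.2) ∂(szν.prod szν)) := by
  have hR0 : 0 ≤ R := (norm_nonneg _).trans (hR 0)
  have hM0 : 0 ≤ M := (abs_nonneg _).trans (hM 0)
  let g : ℕ × ℕ → ℝ → ℂ := fun q θ =>
    (Real.exp (-(t * ‖w θ‖^2)) : ℂ) * w θ ^ q.1 * (starRingEnd ℂ) (w θ) ^ q.2 * (f θ : ℂ)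
  let c : ℕ × ℕ → ℝ := fun q => t^q.1 / q.1.factorial * (t^q.2 / q.2.factorial)
  have hc0 : ∀ q, 0 ≤ c q := fun q => by simp only [c]; positivity
  have hgc : ∀ q, Continuous (g q) := fun q => by
    simp only [g]
    have : Continuous fun θ => (starRingEnd ℂ) (w θ) := Complex.continuous_conj.comp hw
    fun_prop
  have hgn : ∀ q θ, ‖g q θ‖ ≤ R^q.1 * R^q.2 * M := fun q θ => by
    simp only [g, norm_mul, norm_pow, RCLike.norm_conj, Complex.norm_real, Real.norm_eq_abs, Real.abs_exp]
    have h1 : Real.exp (-(t * ‖w θ‖^2)) ≤ 1 := Real.exp_le_one_iff.2 (by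
      have : 0 ≤ t * ‖w θ‖^2 := by positivity
      linarith)
    have := hR θ
    have := hM θ
    calc _ ≤ 1 * R^q.1 * R^q.2 * M := by gcongr
      _ = _ := by ring
  let T : ℕ × ℕ → ℝ × ℝ → ℂ := fun q p => (c q : ℂ) * (g q p.1 * (starRingEnd ℂ) (g q p.2))
  have hTc : ∀ q, Continuous (T q) := fun q => by
    simp only [T]
    have h1 := hgc q
    have : Continuous fun p : ℝ × ℝ => (starRingEnd ℂ) (g q p.2) :=
      Complex.continuous_conj.comp (h1.comp continuous_snd)
    fun_prop
  have hTn : ∀ q p, ‖T q p‖ ≤ ((t*R^2)^q.1/q.1.factorial) * ((t*R^2)^q.2/q.2.factorial) * M^2 := fun q p => by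
    simp only [T, norm_mul, RCLike.norm_conj, Complex.norm_real, Real.norm_eq_abs, abs_of_nonneg (hc0 q)]
    have h1 := hgn q p.1
    have h2 := hgn q p.2
    calc _ ≤ c q * ((R^q.1 * R^q.2 * M) * (R^q.1 * R^q.2 * M)) := by
          have := hc0 q
          gcongr
      _ = _ := by simp only [c, mul_pow]; ring
  have hsum : Summable fun q : ℕ × ℕ =>
      ((t*R^2)^q.1/q.1.factorial) * ((t*R^2)^q.2/q.2.factorial) * M^2 :=
    ((Real.summable_pow_div_factorial (t*R^2)).mul_of_nonneg (Real.summable_pow_div_factorial (t*R^2))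
      (fun _ => by positivity) (fun _ => by positivity)).mul_right _
  have hTi : ∀ q, Integrable (T q) (szν.prod szν) := fun q =>
    Integrable.of_bound (hTc q).aestronglyMeasurable _ (Eventually.of_forall (hTn q))
  have h1 := hasSum_integral_of_summable_integral_norm hTi (by
    refine Summable.of_nonneg_of_le (fun q => integral_nonneg fun p => norm_nonneg _) (fun q => ?_) hsum
    calc _ ≤ ∫ p, (((t*R^2)^q.1/q.1.factorial) * ((t*R^2)^q.2/q.2.factorial) * M^2) ∂(szν.prod szν) :=
          integral_mono (hTi q).norm (integrable_const _) (hTn q)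
      _ = _ := by simp)
  have e1 : ∀ q, ∫ p, T q p ∂(szν.prod szν) = ((c q * ‖∫ θ, g q θ ∂szν‖^2 : ℝ) : ℂ) := fun q => by
    simp only [T]
    rw [integral_const_mul, integral_prod_mul (g q) (fun θ => (starRingEnd ℂ) (g q θ)), integral_conj,
      Complex.mul_conj, Complex.normSq_eq_norm_sq]
    push_cast; ring
  have e2 : ∀ p : ℝ × ℝ, ∑' q, T q p =
      ((Real.exp (-(t * ‖w p.1 - w p.2‖^2)) * (f p.1 * f p.2) : ℝ) : ℂ) := fun p => by
    refine HasSum.tsum_eq ?_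
    have hx := NormedSpace.expSeries_div_hasSum_exp ((t:ℂ) * (w p.1 * (starRingEnd ℂ) (w p.2)))
    have hy := NormedSpace.expSeries_div_hasSum_exp ((t:ℂ) * ((starRingEnd ℂ) (w p.1) * w p.2))
    have hs := summable_mul_of_summable_norm hx.summable.norm hy.summable.norm
    have h3 := (hx.mul hy hs).mul_left ((Real.exp (-(t * ‖w p.1‖^2)) : ℂ) *
      (Real.exp (-(t * ‖w p.2‖^2)) : ℂ) * (f p.1 * f p.2))
    rw [← Complex.exp_eq_exp_ℂ] at h3
    have key : ∀ q : ℕ × ℕ, T q p = (Real.exp (-(t * ‖w p.1‖^2)) : ℂ) *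
        (Real.exp (-(t * ‖w p.2‖^2)) : ℂ) * (f p.1 * f p.2) *
        (((t:ℂ) * (w p.1 * (starRingEnd ℂ) (w p.2))) ^ q.1 / q.1.factorial *
        (((t:ℂ) * ((starRingEnd ℂ) (w p.1) * w p.2)) ^ q.2 / q.2.factorial)) := fun q => by
      simp only [T, c, g, map_mul, map_pow, Complex.conj_conj, Complex.conj_ofReal]
      push_cast
      ring
    have hval : ((Real.exp (-(t * ‖w p.1 - w p.2‖^2)) * (f p.1 * f p.2) : ℝ) : ℂ) =
        (Real.exp (-(t * ‖w p.1‖^2)) : ℂ) *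
        (Real.exp (-(t * ‖w p.2‖^2)) : ℂ) * (f p.1 * f p.2) *
        (Complex.exp ((t:ℂ) * (w p.1 * (starRingEnd ℂ) (w p.2))) *
         Complex.exp ((t:ℂ) * ((starRingEnd ℂ) (w p.1) * w p.2))) := by
      rw [Complex.ofReal_mul, Complex.ofReal_mul, Complex.ofReal_exp, Complex.ofReal_exp, Complex.ofReal_exp]
      rw [mul_right_comm, ← Complex.exp_add, ← Complex.exp_add, ← Complex.exp_add]
      congr 2
      rw [← Complex.normSq_eq_norm_sq, ← Complex.normSq_eq_norm_sq, ← Complex.normSq_eq_norm_sq]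
      push_cast
      rw [Complex.normSq_eq_conj_mul_self, Complex.normSq_eq_conj_mul_self, Complex.normSq_eq_conj_mul_self]
      rw [map_sub]
      ring
    rw [show (fun q => T q p) = _ from funext key, hval]
    exact h3
  simp_rw [e1, e2] at h1
  rw [integral_complex_ofReal] at h1
  exact Complex.hasSum_ofReal.1 h1

lemma sz_frullani {a : ℝ} (ha : 0 < a) :
    IntegrableOn (fun x : ℝ => x⁻¹ * (Real.exp (-(x * a)) - Real.exp (-x))) (Set.Ioi 0) ∧
    (∫ x in Set.Ioi 0, x⁻¹ * (Real.exp (-(x * a)) - Real.exp (-x))) = - Real.log a ∧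
    (∫ x in Set.Ioi 0, |x⁻¹ * (Real.exp (-(x * a)) - Real.exp (-x))|) = |Real.log a| := by
  have hm : 0 < min a 1 := lt_min ha one_pos
  have hcont : ContinuousOn (fun x : ℝ => x⁻¹ * (Real.exp (-(x * a)) - Real.exp (-x))) (Set.Ioi 0) := by
    apply ContinuousOn.mul
    · exact continuousOn_inv₀.mono fun x hx => ne_of_gt hx
    · fun_prop
  have hbd : ∀ x ∈ Set.Ioi (0:ℝ), |x⁻¹ * (Real.exp (-(x * a)) - Real.exp (-x))| ≤
      |a - 1| * Real.exp (-(min a 1) * x) := by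
    intro x hx
    have hx : 0 < x := hx
    have key : ∀ u v : ℝ, u ≤ v → Real.exp (-u) - Real.exp (-v) ≤ (v - u) * Real.exp (-u) := by
      intro u v huv
      have h1 := Real.add_one_le_exp (u - v)
      have h2 : Real.exp (-v) = Real.exp (-u) * Real.exp (u - v) := by rw [← Real.exp_add]; ring_nf
      rw [h2]
      nlinarith [Real.exp_pos (-u)]
    rw [abs_mul, abs_of_pos (inv_pos.2 hx), inv_mul_le_iff₀ hx]
    rcases le_total a 1 with h | h
    · rw [min_eq_left h]
      have h1 := key (x * a) x (by nlinarith)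
      have h2 : Real.exp (-x) ≤ Real.exp (-(x*a)) := Real.exp_le_exp.2 (by nlinarith)
      rw [abs_of_nonneg (by linarith), abs_of_nonpos (by linarith)]
      calc _ ≤ _ := h1
        _ = _ := by rw [show -(x*a) = -a*x by ring]; ring
    · rw [min_eq_right h]
      have h1 := key x (x * a) (by nlinarith)
      have h2 : Real.exp (-(x*a)) ≤ Real.exp (-x) := Real.exp_le_exp.2 (by nlinarith)
      rw [abs_of_nonpos (by linarith), abs_of_nonneg (by linarith)]
      calc _ ≤ _ := by linarith
        _ ≤ _ := h1
        _ = _ := by rw [show -1 * x = -x by ring]; ring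
  have hintg : IntegrableOn (fun x : ℝ => x⁻¹ * (Real.exp (-(x * a)) - Real.exp (-x))) (Set.Ioi 0) := by
    refine Integrable.mono' ((integrableOn_exp_mul_Ioi (a := -(min a 1)) (by linarith) 0).const_mul |a - 1|)
      (hcont.aestronglyMeasurable measurableSet_Ioi) ?_
    filter_upwards [ae_restrict_mem measurableSet_Ioi] with x hx
    exact hbd x hx
  have hval : (∫ x in Set.Ioi 0, x⁻¹ * (Real.exp (-(x * a)) - Real.exp (-x))) = - Real.log a := by
    have := Frullani.integral_Ioi_eq (f := fun x : ℝ => Real.exp (-x)) (a := a) (b := 1) (L := 1) (R := 0)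
      ((Continuous.locallyIntegrable (f := fun x : ℝ => Real.exp (-x)) (by fun_prop)).locallyIntegrableOn _) ha one_pos
      (by
        have : Tendsto (fun x : ℝ => Real.exp (-x)) (nhds 0) (nhds (Real.exp (-0))) :=
          Continuous.tendsto (by fun_prop) 0
        simp at this
        exact this.mono_left nhdsWithin_le_nhds)
      Real.tendsto_exp_neg_atTop_nhds_zero
      (by simpa [mul_comm] using hintg)
    simp only [smul_eq_mul, one_mul, one_div, sub_zero, mul_one, Real.log_inv] at this
    rw [← this]
    simp_rw [mul_comm _ a]
  refine ⟨hintg, hval, ?_⟩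
  rcases le_total a 1 with h | h
  · have : ∀ x ∈ Set.Ioi (0:ℝ), |x⁻¹ * (Real.exp (-(x * a)) - Real.exp (-x))| =
        x⁻¹ * (Real.exp (-(x * a)) - Real.exp (-x)) := fun x hx => by
      have hx : 0 < x := hx
      have h2 : Real.exp (-x) ≤ Real.exp (-(x*a)) := Real.exp_le_exp.2 (by nlinarith)
      exact abs_of_nonneg (mul_nonneg (by positivity) (by linarith))
    rw [setIntegral_congr_fun measurableSet_Ioi this, hval, abs_of_nonpos (Real.log_nonpos ha.le h)]
  · have : ∀ x ∈ Set.Ioi (0:ℝ), |x⁻¹ * (Real.exp (-(x * a)) - Real.exp (-x))| =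
        - (x⁻¹ * (Real.exp (-(x * a)) - Real.exp (-x))) := fun x hx => by
      have hx : 0 < x := hx
      have h2 : Real.exp (-(x*a)) ≤ Real.exp (-x) := Real.exp_le_exp.2 (by nlinarith)
      exact abs_of_nonpos (mul_nonpos_of_nonneg_of_nonpos (by positivity) (by linarith))
    rw [setIntegral_congr_fun measurableSet_Ioi this, integral_neg, hval, abs_of_nonneg (Real.log_nonneg h), neg_neg]

/-- positivity of the logarithmic energy -/
lemma sz_energy {w : ℝ → ℂ} {f : ℝ → ℝ} (hw : Continuous w) (hf : Continuous f) {R M : ℝ}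
    (hR : ∀ θ, ‖w θ‖ ≤ R) (hM : ∀ θ, |f θ| ≤ M) (hf0 : ∫ θ, f θ ∂szν = 0)
    (hne : ∀ᵐ p ∂(szν.prod szν), w p.1 ≠ w p.2)
    (hlog : Integrable (fun p : ℝ × ℝ => Real.log ‖w p.1 - w p.2‖) (szν.prod szν)) :
    0 ≤ -∫ p, Real.log ‖w p.1 - w p.2‖ * (f p.1 * f p.2) ∂(szν.prod szν) ∧
    ((∫ p, Real.log ‖w p.1 - w p.2‖ * (f p.1 * f p.2) ∂(szν.prod szν)) = 0 →
      ∃ t : ℝ, 0 < t ∧ ∀ a b : ℕ, ∫ θ, (Real.exp (-(t * ‖w θ‖^2)) : ℂ) * w θ ^ a *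
        (starRingEnd ℂ) (w θ) ^ b * (f θ : ℂ) ∂szν = 0) := by
  have hM0 : 0 ≤ M := (abs_nonneg _).trans (hM 0)
  let μ := szν.prod szν
  let J : ℝ → ℝ := fun t => ∫ p, Real.exp (-(t * ‖w p.1 - w p.2‖^2)) * (f p.1 * f p.2) ∂μ
  have hff : Continuous fun p : ℝ × ℝ => f p.1 * f p.2 := by fun_prop
  have hffM : ∀ p : ℝ × ℝ, |f p.1 * f p.2| ≤ M^2 := fun p => by
    rw [abs_mul, sq]; exact mul_le_mul (hM _) (hM _) (abs_nonneg _) hM0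
  have hffi : Integrable (fun p : ℝ × ℝ => f p.1 * f p.2) μ :=
    Integrable.of_bound hff.aestronglyMeasurable (M^2) (Eventually.of_forall hffM)
  have hff0 : ∫ p, f p.1 * f p.2 ∂μ = 0 := by
    rw [integral_prod_mul f f, hf0, zero_mul]
  let k : ℝ × ℝ → ℝ → ℝ := fun p t =>
    t⁻¹ * (Real.exp (-(t * ‖w p.1 - w p.2‖^2)) - Real.exp (-t)) * (f p.1 * f p.2)
  have hkm : Measurable (Function.uncurry k) := by
    have h1 : Measurable fun q : (ℝ × ℝ) × ℝ => (q.2)⁻¹ := measurable_snd.inv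
    have h2 : Continuous fun q : (ℝ × ℝ) × ℝ => (Real.exp (-(q.2 * ‖w q.1.1 - w q.1.2‖^2)) - Real.exp (-q.2)) := by
      fun_prop
    have h3 : Continuous fun q : (ℝ × ℝ) × ℝ => f q.1.1 * f q.1.2 := by fun_prop
    exact (h1.mul h2.measurable).mul h3.measurable
  have hfr : ∀ᵐ p ∂μ, IntegrableOn (k p) (Set.Ioi 0) ∧
      (∫ t in Set.Ioi 0, k p t) = -(2 * (Real.log ‖w p.1 - w p.2‖ * (f p.1 * f p.2))) ∧
      (∫ t in Set.Ioi 0, ‖k p t‖) = 2 * |Real.log ‖w p.1 - w p.2‖| * |f p.1 * f p.2| := by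
    filter_upwards [hne] with p hp
    have hd : 0 < ‖w p.1 - w p.2‖^2 := by
      have := norm_pos_iff.2 (sub_ne_zero.2 hp); positivity
    obtain ⟨h1, h2, h3⟩ := sz_frullani hd
    refine ⟨h1.mul_const _, ?_, ?_⟩
    · simp only [k]
      rw [integral_mul_const, h2, Real.log_pow]; push_cast; ring
    · simp only [k, norm_mul _ (f p.1 * f p.2), Real.norm_eq_abs]
      rw [integral_mul_const, h3, Real.log_pow, abs_mul]; norm_num
  have hintg : Integrable (Function.uncurry k) (μ.prod (volume.restrict (Set.Ioi 0))) := by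
    rw [integrable_prod_iff hkm.aestronglyMeasurable]
    refine ⟨?_, ?_⟩
    · filter_upwards [hfr] with p hp
      exact hp.1
    · have hi : Integrable (fun p : ℝ × ℝ => 2 * |Real.log ‖w p.1 - w p.2‖| * |f p.1 * f p.2|) μ := by
        refine Integrable.mul_bdd (c := M^2) (hlog.abs.const_mul 2) hff.abs.aestronglyMeasurable
          (Eventually.of_forall fun p => ?_)
        rw [Real.norm_eq_abs, abs_abs]; exact hffM p
      refine hi.congr ?_
      filter_upwards [hfr] with p hp
      exact hp.2.2.symm
  have hsw := integral_integral_swap hintg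
  have e1 : ∫ p, (∫ t in Set.Ioi 0, k p t) ∂μ =
      -(2 * ∫ p, Real.log ‖w p.1 - w p.2‖ * (f p.1 * f p.2) ∂μ) := by
    rw [← integral_const_mul, ← integral_neg]
    refine integral_congr_ae ?_
    filter_upwards [hfr] with p hp
    exact hp.2.1
  have e2 : ∀ t, 0 < t → ∫ p, k p t ∂μ = t⁻¹ * J t := fun t ht => by
    simp only [k, J]
    have : ∀ p : ℝ × ℝ, t⁻¹ * (Real.exp (-(t * ‖w p.1 - w p.2‖^2)) - Real.exp (-t)) * (f p.1 * f p.2)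
      = t⁻¹ * (Real.exp (-(t * ‖w p.1 - w p.2‖^2)) * (f p.1 * f p.2)) - t⁻¹ * Real.exp (-t) * (f p.1 * f p.2) :=
      fun p => by ring
    simp_rw [this]
    rw [integral_sub, integral_const_mul, integral_const_mul, hff0, mul_zero, sub_zero]
    · refine Integrable.const_mul ?_ _
      refine Integrable.bdd_mul (c := 1) hffi (Continuous.aestronglyMeasurable (by fun_prop))
        (Eventually.of_forall fun p => ?_)
      rw [Real.norm_eq_abs, Real.abs_exp, Real.exp_le_one_iff]
      have : 0 ≤ t * ‖w p.1 - w p.2‖^2 := by positivity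
      linarith
    · exact hffi.const_mul _
  have hJ : ∀ t, 0 < t → 0 ≤ J t := fun t ht =>
    (sz_J hw hf hR hM ht).nonneg fun q => by positivity
  have hae : ∀ᵐ t ∂(volume.restrict (Set.Ioi (0:ℝ))), 0 ≤ ∫ p, k p t ∂μ := by
    filter_upwards [ae_restrict_mem measurableSet_Ioi] with t ht
    have ht : 0 < t := ht
    rw [e2 t ht]
    exact mul_nonneg (by positivity) (hJ t ht)
  have hnn := integral_nonneg_of_ae hae
  rw [e1] at hsw
  refine ⟨?_, fun h0 => ?_⟩
  · change 0 ≤ -∫ p, Real.log ‖w p.1 - w p.2‖ * (f p.1 * f p.2) ∂μ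
    linarith
  · change (∫ p, Real.log ‖w p.1 - w p.2‖ * (f p.1 * f p.2) ∂μ) = 0 at h0
    rw [h0, mul_zero, neg_zero] at hsw
    have hz := (integral_eq_zero_iff_of_nonneg_ae hae hintg.integral_prod_right).1 hsw.symm
    have hne' : (volume.restrict (Set.Ioi (0:ℝ))) ≠ 0 := by
      intro h
      have := congrArg (fun m : Measure ℝ => m Set.univ) h
      simp at this
    have : (ae (volume.restrict (Set.Ioi (0:ℝ)))).NeBot := ae_neBot.2 hne'
    obtain ⟨t, ht1, ht2⟩ := (hz.and (ae_restrict_mem measurableSet_Ioi)).exists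
    have ht2 : 0 < t := ht2
    have hJ0 : J t = 0 := by
      have : ∫ p, k p t ∂μ = 0 := ht1
      rw [e2 t ht2] at this
      rcases mul_eq_zero.1 this with h | h
      · exact absurd h (by positivity)
      · exact h
    refine ⟨t, ht2, fun a b => ?_⟩
    have hs := sz_J hw hf hR hM ht2
    have hJ0' : (∫ p, Real.exp (-(t * ‖w p.1 - w p.2‖^2)) * (f p.1 * f p.2) ∂(szν.prod szν)) = 0 := hJ0
    rw [hJ0'] at hs
    have := (hasSum_zero_iff_of_nonneg (fun q => by positivity)).1 hs
    have := congrFun this (a, b)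
    simp only [Pi.zero_apply] at this
    rcases mul_eq_zero.1 this with h | h
    · exact absurd h (by positivity)
    · simpa using h

/-- power series on the circle -/
noncomputable def szU (u : ℕ → ℂ) (θ : ℝ) : ℂ := ∑' k, u k * szp θ ^ (k+1)

lemma szU_term (u : ℕ → ℂ) (θ : ℝ) (k : ℕ) : ‖u k * szp θ ^ (k+1)‖ = ‖u k‖ := by
  simp [szp_norm]

lemma szU_cont {u : ℕ → ℂ} (hu : Summable fun k => ‖u k‖) : Continuous (szU u) := by
  refine continuous_tsum (fun p => ?_) hu fun p q => (szU_term u q p).le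
  have := szp_cont
  fun_prop

lemma szU_norm {u : ℕ → ℂ} (hu : Summable fun k => ‖u k‖) (θ : ℝ) : ‖szU u θ‖ ≤ ∑' k, ‖u k‖ := by
  refine (norm_tsum_le_tsum_norm ?_).trans (le_of_eq ?_)
  · simp_rw [szU_term]; exact hu
  · simp_rw [szU_term]

lemma szU_integral {u : ℕ → ℂ} (hu : Summable fun k => ‖u k‖) {h : ℝ → ℂ} (hh : Integrable h szν) :
    HasSum (fun k => u k * ∫ θ, h θ * szp θ ^ (k+1) ∂szν) (∫ θ, h θ * szU u θ ∂szν) := by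
  have hcz := szp_cont
  have hi : ∀ k, Integrable (fun θ => h θ * (u k * szp θ ^ (k+1))) szν := fun k =>
    hh.mul_bdd (c := ‖u k‖) (Continuous.aestronglyMeasurable (by fun_prop))
      (Eventually.of_forall fun θ => (szU_term u θ k).le)
  have h1 := hasSum_integral_of_summable_integral_norm hi (by
    simp_rw [norm_mul (h _), szU_term]
    simp_rw [integral_mul_const]
    exact hu.mul_left _)
  have e1 : ∀ k, ∫ θ, h θ * (u k * szp θ ^ (k+1)) ∂szν = u k * ∫ θ, h θ * szp θ ^ (k+1) ∂szν := fun k => by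
    rw [← integral_const_mul]; congr 1; funext θ; ring
  simp_rw [e1, tsum_mul_left] at h1
  exact h1

lemma szU_neg {u : ℕ → ℂ} (hu : Summable fun k => ‖u k‖) (k : ℕ) :
    ∫ θ, szp (-θ) ^ (k+1) * szU u θ ∂szν = u k := by
  have hcz := szp_cont
  have h := szU_integral hu (h := fun θ => szp (-θ) ^ (k+1)) (szν_integrable_of_cont (by fun_prop))
  simp_rw [szν_orth] at h
  refine h.unique ?_
  convert hasSum_ite_eq k (u k) using 2 with j
  by_cases hj : j = k
  · simp [hj]
  · simp [hj, Ne.symm hj]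

lemma szU_pos {u : ℕ → ℂ} (hu : Summable fun k => ‖u k‖) (k : ℕ) :
    ∫ θ, szp θ ^ k * szU u θ ∂szν = 0 := by
  have hcz := szp_cont
  have h := szU_integral hu (h := fun θ => szp θ ^ k) (szν_integrable_of_cont (by fun_prop))
  simp_rw [← pow_add, szν_pow (show k + (_ + 1) ≠ 0 by omega)] at h
  refine h.unique ?_
  simp only [mul_zero]
  exact hasSum_zero

lemma szU_re_pos {u : ℕ → ℂ} (hu : Summable fun k => ‖u k‖) (k : ℕ) :
    ∫ θ, szp θ ^ (k+1) * ((szU u θ).re : ℂ) ∂szν = (starRingEnd ℂ) (u k) / 2 := by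
  have hcz := szp_cont
  have hcU := szU_cont hu
  have hcU' : Continuous fun θ => (starRingEnd ℂ) (szU u θ) := Complex.continuous_conj.comp hcU
  have e : ∀ θ, szp θ ^ (k+1) * ((szU u θ).re : ℂ) =
      (1/2) * (szp θ ^ (k+1) * szU u θ) + (1/2) * (starRingEnd ℂ) (szp (-θ) ^ (k+1) * szU u θ) := fun θ => by
    rw [Complex.re_eq_add_conj, map_mul, map_pow, szp_neg, Complex.conj_conj]; ring
  simp_rw [e]
  rw [integral_add, integral_const_mul, integral_const_mul, szU_pos hu, integral_conj, szU_neg hu]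
  · ring
  · exact szν_integrable_of_cont (by fun_prop)
  · exact szν_integrable_of_cont (by
      refine continuous_const.mul (Complex.continuous_conj.comp ?_)
      fun_prop)

lemma szU_re_neg {u : ℕ → ℂ} (hu : Summable fun k => ‖u k‖) (k : ℕ) :
    ∫ θ, szp (-θ) ^ (k+1) * ((szU u θ).re : ℂ) ∂szν = u k / 2 := by
  have := congrArg (starRingEnd ℂ) (szU_re_pos hu k)
  rw [← integral_conj] at this
  simp only [map_mul, map_pow, Complex.conj_ofReal, map_div₀, Complex.conj_conj, ← szp_neg, Complex.conj_ofNat] at this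
  exact this

lemma szU_re_mean {u : ℕ → ℂ} (hu : Summable fun k => ‖u k‖) :
    ∫ θ, (szU u θ).re ∂szν = 0 := by
  have h := szU_pos hu 0
  simp only [pow_zero, one_mul] at h
  have := congrArg Complex.re h
  rw [← RCLike.re_eq_complex_re, ← integral_re (szν_integrable_of_cont (szU_cont hu))] at this
  simpa using this

lemma sz_log_int : Integrable (fun t => Real.log ‖1 - szp t‖) szν := by
  have h := circleIntegrable_log_norm_sub_const (a := 1) (c := 0) 1
  unfold CircleIntegrable at h
  simp_rw [szp_circleMap] at h
  have hp : Function.Periodic (fun t => Real.log ‖szp t - 1‖) (2 * Real.pi) := fun t => by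
    simp only [szp_periodic t]
  have h2 := hp.intervalIntegrable₀ (by positivity) h (-Real.pi) Real.pi
  rw [intervalIntegrable_iff_integrableOn_Icc_of_le (by linarith [Real.pi_pos])] at h2
  unfold szν
  refine Integrable.smul_measure ?_ (by simp [Real.pi_pos])
  simp_rw [norm_sub_rev (1:ℂ)]
  exact h2

lemma sz_ae_ne : ∀ᵐ t ∂szν, szp t ≠ 1 := by
  unfold szν
  apply Measure.ae_smul_measure
  have h0 : ∀ᵐ t ∂(volume.restrict (Set.Icc (-Real.pi) Real.pi)), t ≠ 0 :=
    ae_restrict_of_ae (by simp [ae_iff])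
  filter_upwards [h0, ae_restrict_mem measurableSet_Icc] with t h1 h2
  exact szp_ne_one (by linarith [h2.1, Real.pi_pos]) (by linarith [h2.2, Real.pi_pos]) h1

lemma sz_log_coeff (k : ℕ) :
    ∫ t, (Real.log ‖1 - szp t‖ : ℂ) * szp t ^ (k+1) ∂szν = -(1 / (2 * ((k:ℂ)+1))) := by
  have hcz := szp_cont
  let r : ℕ → ℝ := fun n => 1 - 1/((n:ℝ)+2)
  have hr0 : ∀ n, 1/2 ≤ r n := fun n => by
    simp only [r]
    have : 1/((n:ℝ)+2) ≤ 1/2 := by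
      apply one_div_le_one_div_of_le <;> linarith [(Nat.cast_nonneg n : (0:ℝ) ≤ n)]
    linarith
  have hr1 : ∀ n, r n < 1 := fun n => by
    simp only [r]
    have : 0 < 1/((n:ℝ)+2) := by positivity
    linarith
  have hrt : Tendsto r atTop (nhds 1) := by
    have : Tendsto (fun n : ℕ => 1/((n:ℝ)+2)) atTop (nhds 0) := by
      have h := (tendsto_one_div_add_atTop_nhds_zero_nat (𝕜 := ℝ)).comp (tendsto_add_atTop_nat 1)
      refine h.congr fun n => ?_
      simp only [Function.comp]; push_cast; ring
    simpa [r] using this.const_sub 1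
  have hlow : ∀ n t, ‖1 - szp t‖ / 2 ≤ ‖1 - (r n : ℂ) * szp t‖ := fun n t => by
    have h1 : ‖1 - szp t‖ ≤ ‖1 - (r n:ℂ) * szp t‖ + (1 - r n) := by
      have : 1 - szp t = (1 - (r n:ℂ) * szp t) + ((r n - 1 : ℝ) : ℂ) * szp t := by push_cast; ring
      rw [this]
      refine (norm_add_le _ _).trans ?_
      rw [norm_mul, szp_norm, mul_one, Complex.norm_real, Real.norm_eq_abs, abs_of_nonpos (by linarith [hr1 n])]
      linarith
    have h2 : 1 - r n ≤ ‖1 - (r n:ℂ) * szp t‖ := by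
      have := norm_sub_norm_le (1:ℂ) ((r n:ℂ) * szp t)
      rw [norm_one, norm_mul, szp_norm, mul_one, Complex.norm_real, Real.norm_eq_abs,
        abs_of_nonneg (by linarith [hr0 n])] at this
      exact this
    linarith
  have hup : ∀ n t, ‖1 - (r n : ℂ) * szp t‖ ≤ 2 := fun n t => by
    refine (norm_sub_le _ _).trans ?_
    rw [norm_one, norm_mul, szp_norm, mul_one, Complex.norm_real, Real.norm_eq_abs,
        abs_of_nonneg (by linarith [hr0 n])]
    linarith [hr1 n]
  have hpos : ∀ n t, 0 < ‖1 - (r n : ℂ) * szp t‖ := fun n t => by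
    have := norm_sub_norm_le (1:ℂ) ((r n:ℂ) * szp t)
    rw [norm_one, norm_mul, szp_norm, mul_one, Complex.norm_real, Real.norm_eq_abs,
        abs_of_nonneg (by linarith [hr0 n])] at this
    linarith [hr1 n]
  have hlim : Tendsto (fun n => ∫ t, (Real.log ‖1 - (r n : ℂ) * szp t‖ : ℂ) * szp t ^ (k+1) ∂szν) atTop
      (nhds (∫ t, (Real.log ‖1 - szp t‖ : ℂ) * szp t ^ (k+1) ∂szν)) := by
    refine tendsto_integral_of_dominated_convergence
      (fun t => 2 * Real.log 2 + |Real.log ‖1 - szp t‖|) ?_ ?_ ?_ ?_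
    · intro n
      refine Continuous.aestronglyMeasurable (Continuous.mul ?_ (by fun_prop))
      refine Complex.continuous_ofReal.comp (Continuous.log (by fun_prop) fun t => (hpos n t).ne')
    · exact (integrable_const _).add sz_log_int.abs
    · intro n
      filter_upwards [sz_ae_ne] with t ht
      have hn0 : 0 < ‖1 - szp t‖ := norm_pos_iff.2 (sub_ne_zero.2 ht.symm)
      rw [norm_mul, norm_pow, szp_norm, one_pow, mul_one, Complex.norm_real, Real.norm_eq_abs]
      have h1 := Real.log_le_log (by positivity) (hlow n t)
      have h2 := Real.log_le_log (hpos n t) (hup n t)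
      rw [Real.log_div hn0.ne' (by norm_num)] at h1
      have hl2 : 0 < Real.log 2 := Real.log_pos (by norm_num)
      rw [abs_le]
      constructor
      · linarith [neg_abs_le (Real.log ‖1 - szp t‖)]
      · linarith [abs_nonneg (Real.log ‖1 - szp t‖)]
    · filter_upwards [sz_ae_ne] with t ht
      have hn0 : 0 < ‖1 - szp t‖ := norm_pos_iff.2 (sub_ne_zero.2 ht.symm)
      refine Tendsto.mul_const _ ?_
      refine (Complex.continuous_ofReal.tendsto _).comp ?_
      refine Tendsto.log ?_ hn0.ne'
      have h1 : Tendsto (fun n => (r n : ℂ)) atTop (nhds 1) := by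
        have := (Complex.continuous_ofReal.tendsto _).comp hrt
        rw [Complex.ofReal_one] at this
        exact this
      have h2 := ((h1.mul_const (szp t)).const_sub 1).norm
      simpa using h2
  have hval : ∀ n, ∫ t, (Real.log ‖1 - (r n : ℂ) * szp t‖ : ℂ) * szp t ^ (k+1) ∂szν =
      -((r n : ℂ)^(k+1) / (2 * ((k:ℂ)+1))) := fun n => by
    let u : ℕ → ℂ := fun j => -((r n : ℂ)^(j+1) / ((j:ℂ)+1))
    have hrn : ‖(r n:ℂ)‖ < 1 := by
      rw [Complex.norm_real, Real.norm_eq_abs, abs_of_nonneg (by linarith [hr0 n])]; exact hr1 n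
    have hu : Summable fun j => ‖u j‖ := (Complex.hasSum_taylorSeries_neg_log' hrn).neg.summable.norm
    have e : ∀ t, (Real.log ‖1 - (r n : ℂ) * szp t‖ : ℂ) * szp t ^ (k+1) =
        szp t ^ (k+1) * ((szU u t).re : ℂ) := fun t => by
      have hz : ‖(r n:ℂ) * szp t‖ < 1 := by rw [norm_mul, szp_norm, mul_one]; exact hrn
      have h1 := (Complex.hasSum_taylorSeries_neg_log' hz).neg
      rw [neg_neg] at h1
      have h2 : szU u t = Complex.log (1 - (r n:ℂ) * szp t) := by
        rw [← h1.tsum_eq, szU]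
        refine tsum_congr fun j => ?_
        simp only [u]; rw [mul_pow]; ring
      rw [h2, Complex.log_re, mul_comm]
    simp_rw [e]
    rw [szU_re_pos hu]
    simp only [u, map_neg, map_div₀, map_pow, Complex.conj_ofReal, map_add, map_natCast, map_one]
    field_simp
  simp_rw [hval] at hlim
  refine tendsto_nhds_unique hlim ?_
  have h1 : Tendsto (fun n => (r n : ℂ)) atTop (nhds 1) := by
    have := (Complex.continuous_ofReal.tendsto _).comp hrt
    rw [Complex.ofReal_one] at this
    exact this
  have := ((h1.pow (k+1)).div_const (2 * ((k:ℂ)+1))).neg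
  simpa using this

lemma szν_integrable_iff {f : ℝ → ℝ} :
    Integrable f szν ↔ IntervalIntegrable f volume (-Real.pi) Real.pi := by
  rw [intervalIntegrable_iff_integrableOn_Icc_of_le (by linarith [Real.pi_pos])]
  unfold szν
  rw [integrable_smul_measure (by simp [ENNReal.mul_eq_top]) (by simp [Real.pi_pos])]
  rfl

lemma szν_shift {E : Type*} [NormedAddCommGroup E] [NormedSpace ℝ E] {h : ℝ → E}
    (hp : Function.Periodic h (2 * Real.pi)) (s : ℝ) : ∫ t, h (t + s) ∂szν = ∫ t, h t ∂szν := by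
  rw [szν_integral, szν_integral, intervalIntegral.integral_comp_add_right]
  have := hp.intervalIntegral_add_eq (-Real.pi + s) (-Real.pi)
  rw [show -Real.pi + s + 2 * Real.pi = Real.pi + s by ring, show -Real.pi + 2 * Real.pi = Real.pi by ring] at this
  rw [this]

lemma szν_shift_integrable {h : ℝ → ℝ}
    (hp : Function.Periodic h (2 * Real.pi)) (s : ℝ) (hi : Integrable h szν) :
    Integrable (fun t => h (t + s)) szν := by
  rw [szν_integrable_iff] at hi ⊢
  have h1 := hp.intervalIntegrable (t := -Real.pi) (by positivity)
    (by rwa [show -Real.pi + 2 * Real.pi = Real.pi by ring]) (-Real.pi + s) (Real.pi + s)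
  have := h1.comp_add_right s
  simpa using this

lemma sz_ae_ne' : ∀ᵐ p ∂(szν.prod szν), szp p.1 ≠ szp p.2 := by
  have hcz := szp_cont
  rw [Measure.ae_prod_iff_ae_ae]
  · refine Eventually.of_forall fun θ => ?_
    simp only
    unfold szν
    apply Measure.ae_smul_measure
    apply ae_restrict_of_ae
    rw [ae_iff]
    refine Set.Countable.measure_zero ?_ _
    refine (Set.countable_range (fun n : ℤ => θ + n * (2 * Real.pi))).mono ?_
    intro η hη
    simp only [ne_eq, not_not, Set.mem_ofPred_eq] at hη
    rw [szp, szp, Complex.exp_eq_exp_iff_exists_int] at hη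
    obtain ⟨n, hn⟩ := hη
    refine ⟨-n, ?_⟩
    have : (η : ℂ) = ((θ + ((-n : ℤ) : ℝ) * (2 * Real.pi) : ℝ) : ℂ) := by
      apply mul_left_cancel₀ Complex.I_ne_zero
      push_cast
      linear_combination -hn
    exact (Complex.ofReal_inj.1 this).symm
  · exact (isOpen_ne_fun (by fun_prop) (by fun_prop)).measurableSet

lemma sz_log_sub (θ η : ℝ) : Real.log ‖szp θ - szp η‖ = Real.log ‖1 - szp (η + -θ)‖ := by
  congr 1
  have : szp θ - szp η = szp θ * (1 - szp (η + -θ)) := by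
    rw [mul_sub, ← szp_add, mul_one]; congr 2; ring
  rw [this, norm_mul, szp_norm, one_mul]

lemma sz_log_per : Function.Periodic (fun t => Real.log ‖1 - szp t‖) (2 * Real.pi) := fun t => by
  simp only [szp_periodic t]

lemma sz_log_int2 (θ : ℝ) : Integrable (fun η => Real.log ‖szp θ - szp η‖) szν := by
  simp_rw [sz_log_sub]
  exact szν_shift_integrable sz_log_per (-θ) sz_log_int

lemma sz_log_prod : Integrable (fun p : ℝ × ℝ => Real.log ‖szp p.1 - szp p.2‖) (szν.prod szν) := by
  have hcz := szp_cont
  have hm : Measurable (fun p : ℝ × ℝ => Real.log ‖szp p.1 - szp p.2‖) := by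
    refine Real.measurable_log.comp (Continuous.measurable ?_)
    fun_prop
  rw [integrable_prod_iff hm.aestronglyMeasurable]
  refine ⟨Eventually.of_forall sz_log_int2, ?_⟩
  have : ∀ θ, ∫ η, ‖Real.log ‖szp θ - szp η‖‖ ∂szν = ∫ η, ‖Real.log ‖1 - szp η‖‖ ∂szν := fun θ => by
    simp_rw [sz_log_sub]
    exact szν_shift (h := fun t => ‖Real.log ‖1 - szp t‖‖)
      (fun t => by simp only [szp_periodic t]) (-θ)
  simp only [this]
  exact integrable_const _

lemma sz_log_coeff2 (θ : ℝ) (k : ℕ) :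
    ∫ η, (Real.log ‖szp θ - szp η‖ : ℂ) * szp η ^ (k+1) ∂szν =
      -(1 / (2 * ((k:ℂ)+1))) * szp θ ^ (k+1) := by
  have e : ∀ η, (Real.log ‖szp θ - szp η‖ : ℂ) * szp η ^ (k+1) =
      szp θ ^ (k+1) * ((Real.log ‖1 - szp (η + -θ)‖ : ℂ) * szp (η + -θ) ^ (k+1)) := fun η => by
    rw [sz_log_sub, show szp η = szp θ * szp (η + -θ) by rw [← szp_add]; congr 1; ring, mul_pow]
    have : η + -θ + 0 = η + -θ := by ring
    ring
  simp_rw [e]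
  rw [integral_const_mul, szν_shift (h := fun t => (Real.log ‖1 - szp t‖ : ℂ) * szp t ^ (k+1))
    (fun t => by simp only [szp_periodic t]), sz_log_coeff]
  ring

/-- logarithmic energy on the circle -/
lemma sz_circle_energy {u : ℕ → ℂ} (hu : Summable fun k => ‖u k‖) :
    HasSum (fun k : ℕ => ‖u k‖^2 / (4 * ((k:ℝ)+1)))
      (-∫ p, Real.log ‖szp p.1 - szp p.2‖ * ((szU u p.1).re * (szU u p.2).re) ∂(szν.prod szν)) := by
  have hcz := szp_cont
  have hcU := szU_cont hu
  let f : ℝ → ℝ := fun θ => (szU u θ).re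
  have hfc : Continuous f := Complex.continuous_re.comp hcU
  have hfb : ∀ θ, |f θ| ≤ ∑' k, ‖u k‖ := fun θ => (Complex.abs_re_le_norm _).trans (szU_norm hu θ)
  let v : ℕ → ℂ := fun k => -(1 / (2 * ((k:ℂ)+1))) * u k
  have hck : ∀ k : ℕ, ‖-(1 / (2 * ((k:ℂ)+1)))‖ = 1/(2*((k:ℝ)+1)) := fun k => by
    have : -(1 / (2 * ((k:ℂ)+1))) = ((-(1/(2*((k:ℝ)+1))) : ℝ) : ℂ) := by push_cast; ring
    rw [this, Complex.norm_real, Real.norm_eq_abs, abs_neg, abs_of_nonneg (by positivity)]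
  have hv : Summable fun k => ‖v k‖ := by
    refine Summable.of_nonneg_of_le (fun k => norm_nonneg _) (fun k => ?_) hu
    simp only [v]
    rw [norm_mul, hck]
    refine mul_le_of_le_one_left (norm_nonneg _) ?_
    rw [div_le_one (by positivity)]
    linarith [(Nat.cast_nonneg k : (0:ℝ) ≤ k)]
  have inner : ∀ θ, ∫ η, Real.log ‖szp θ - szp η‖ * f η ∂szν = (szU v θ).re := fun θ => by
    have hi := (sz_log_int2 θ).ofReal (𝕜 := ℂ)
    have h1 := szU_integral hu hi
    have h2 : HasSum (fun k => u k * ∫ η, (Real.log ‖szp θ - szp η‖ : ℂ) * szp η ^ (k+1) ∂szν) (szU v θ) := by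
      simp_rw [sz_log_coeff2]
      have : Summable fun k => v k * szp θ ^ (k+1) := by
        refine Summable.of_norm ?_
        simp_rw [szU_term]; exact hv
      refine this.hasSum.congr_fun ?_
      intro k; simp only [v]; ring
    have h3 := h1.unique h2
    rw [← h3]
    have h4 : Integrable (fun η => (Real.log ‖szp θ - szp η‖ : ℂ) * szU u η) szν :=
      Integrable.mul_bdd (c := ∑' k, ‖u k‖) hi hcU.aestronglyMeasurable
        (Eventually.of_forall fun η => szU_norm hu η)
    have h5 := integral_re (𝕜 := ℂ) h4
    simp only [RCLike.re_eq_complex_re, Complex.re_ofReal_mul] at h5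
    exact h5
  have hI : Integrable (fun p : ℝ × ℝ => Real.log ‖szp p.1 - szp p.2‖ * (f p.1 * f p.2)) (szν.prod szν) := by
    refine Integrable.mul_bdd (c := (∑' k, ‖u k‖)^2) sz_log_prod
      (Continuous.aestronglyMeasurable (by fun_prop)) (Eventually.of_forall fun p => ?_)
    rw [norm_mul, sq]
    exact mul_le_mul (hfb _) (hfb _) (norm_nonneg _) ((abs_nonneg _).trans (hfb 0))
  have e1 : ∫ p, Real.log ‖szp p.1 - szp p.2‖ * (f p.1 * f p.2) ∂(szν.prod szν) =
      ∫ θ, f θ * (szU v θ).re ∂szν := by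
    rw [integral_prod _ hI]
    congr 1; funext θ
    rw [← inner θ, ← integral_const_mul]
    congr 1; funext η; ring
  change HasSum _ (-∫ p, Real.log ‖szp p.1 - szp p.2‖ * (f p.1 * f p.2) ∂(szν.prod szν))
  rw [e1]
  have hcv := szU_cont hv
  have hfi : Integrable (fun θ => (f θ : ℂ)) szν := szν_integrable_of_cont (by fun_prop)
  have h1 := szU_integral hv hfi
  have e2 : ∀ k, v k * ∫ θ, (f θ : ℂ) * szp θ ^ (k+1) ∂szν = ((-(‖u k‖^2 / (4 * ((k:ℝ)+1))) : ℝ) : ℂ) := fun k => by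
    have := szU_re_pos hu k
    simp_rw [mul_comm (szp _ ^ (k+1))] at this
    rw [show (∫ θ, (f θ : ℂ) * szp θ ^ (k+1) ∂szν) = _ from this]
    simp only [v]
    have h3 : u k * (starRingEnd ℂ) (u k) = ((‖u k‖^2 : ℝ) : ℂ) := by
      rw [Complex.mul_conj, Complex.normSq_eq_norm_sq]
    have h4 : -(1 / (2 * ((k:ℂ)+1))) * u k * ((starRingEnd ℂ) (u k) / 2) =
      -(1 / (2 * ((k:ℂ)+1))) * (u k * (starRingEnd ℂ) (u k)) / 2 := by ring
    rw [h4, h3]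
    have : (k:ℂ)+1 ≠ 0 := by exact_mod_cast Nat.succ_ne_zero k
    push_cast
    field_simp
    ring
  simp_rw [e2] at h1
  have h4 : Integrable (fun θ => (f θ : ℂ) * szU v θ) szν := szν_integrable_of_cont (by fun_prop)
  have h5 := integral_re (𝕜 := ℂ) h4
  simp only [RCLike.re_eq_complex_re, Complex.re_ofReal_mul] at h5
  rw [h5]
  have h6 := (Complex.hasSum_re h1).neg
  simp only [Complex.ofReal_re, neg_neg] at h6
  exact h6

lemma szFF_energy {b : ℕ → ℕ → ℂ} (hb : Summable fun p : ℕ × ℕ => ‖b p.1 p.2‖)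
    {u : ℕ → ℂ} (hu : Summable fun k => ‖u k‖) :
    HasSum (fun q : ℕ × ℕ => b q.1 q.2 * (u q.1 * u q.2) / 4)
      (∫ p, szFF b p.1 p.2 * (((szU u p.1).re * (szU u p.2).re : ℝ) : ℂ) ∂(szν.prod szν)) := by
  have hcz := szp_cont
  have hcU := szU_cont hu
  let f : ℝ → ℝ := fun θ => (szU u θ).re
  have hfc : Continuous f := Complex.continuous_re.comp hcU
  set M := ∑' k, ‖u k‖
  have hfb : ∀ θ, |f θ| ≤ M := fun θ => (Complex.abs_re_le_norm _).trans (szU_norm hu θ)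
  have hM0 : 0 ≤ M := (abs_nonneg _).trans (hfb 0)
  let T : ℕ × ℕ → ℝ × ℝ → ℂ := fun q p => b q.1 q.2 *
    ((szp (-p.1) ^ (q.1+1) * (f p.1 : ℂ)) * (szp (-p.2) ^ (q.2+1) * (f p.2 : ℂ)))
  have hTc : ∀ q, Continuous (T q) := fun q => by simp only [T]; fun_prop
  have hTn : ∀ q p, ‖T q p‖ ≤ ‖b q.1 q.2‖ * M^2 := fun q p => by
    simp only [T, norm_mul, norm_pow, szp_norm, one_pow, one_mul, Complex.norm_real, Real.norm_eq_abs, sq]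
    exact mul_le_mul_of_nonneg_left (mul_le_mul (hfb _) (hfb _) (abs_nonneg _) hM0) (norm_nonneg _)
  have hTi : ∀ q, Integrable (T q) (szν.prod szν) := fun q =>
    Integrable.of_bound (hTc q).aestronglyMeasurable _ (Eventually.of_forall (hTn q))
  have h1 := hasSum_integral_of_summable_integral_norm hTi (by
    refine Summable.of_nonneg_of_le (fun q => integral_nonneg fun p => norm_nonneg _) (fun q => ?_)
      (hb.mul_right (M^2))
    calc _ ≤ ∫ p, (‖b q.1 q.2‖ * M^2) ∂(szν.prod szν) :=
          integral_mono (hTi q).norm (integrable_const _) (hTn q)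
      _ = _ := by simp)
  have e1 : ∀ q : ℕ × ℕ, ∫ p, T q p ∂(szν.prod szν) = b q.1 q.2 * (u q.1 * u q.2) / 4 := fun q => by
    simp only [T]
    rw [integral_const_mul, integral_prod_mul (fun θ => szp (-θ) ^ (q.1+1) * (f θ : ℂ))
      (fun θ => szp (-θ) ^ (q.2+1) * (f θ : ℂ)), szU_re_neg hu, szU_re_neg hu]
    ring
  simp_rw [e1] at h1
  rw [integral_congr_ae (g := fun p => ∑' q, T q p)]
  · exact h1
  refine Eventually.of_forall fun p => ?_
  simp only
  rw [szFF, ← tsum_mul_right]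
  refine tsum_congr fun q => ?_
  simp only [T, f]; push_cast; ring

/-- Stone–Weierstrass on the curve -/
lemma sz_SW {φ : ℂ → ℂ} (hcont : ContinuousOn φ {z : ℂ | 1 ≤ ‖z‖})
    (hinj : Set.InjOn φ {z : ℂ | 1 ≤ ‖z‖}) {m : ℝ → ℂ} (hm : Integrable m szν)
    (h0 : ∀ a b : ℕ, ∫ θ, φ (szp θ) ^ a * (starRingEnd ℂ) (φ (szp θ)) ^ b * m θ ∂szν = 0)
    {h : ℂ → ℂ} (hh : ContinuousOn h (Metric.sphere 0 1)) :
    ∫ θ, h (szp θ) * m θ ∂szν = 0 := by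
  let X := Metric.sphere (0:ℂ) 1
  let s : ℝ → X := fun θ => ⟨szp θ, mem_sphere_zero_iff_norm.2 (szp_norm θ)⟩
  have hs : Continuous s := szp_cont.subtype_mk _
  have hsub : Metric.sphere (0:ℂ) 1 ⊆ {z : ℂ | 1 ≤ ‖z‖} := fun z hz => by
    simp at hz; simp [hz]
  let Φ : C(X, ℂ) := ⟨fun x => φ x, continuousOn_iff_continuous_domRestrict.1 (hcont.mono hsub)⟩
  let H : C(X, ℂ) := ⟨fun x => h x, continuousOn_iff_continuous_domRestrict.1 hh⟩
  have hintg : ∀ g : C(X, ℂ), Integrable (fun θ => g (s θ) * m θ) szν := fun g =>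
    Integrable.bdd_mul (c := ‖g‖) hm (g.continuous.comp hs).aestronglyMeasurable
      (Eventually.of_forall fun θ => g.norm_coe_le_norm _)
  let Λ₀ : C(X, ℂ) →ₗ[ℂ] ℂ :=
    { toFun := fun g => ∫ θ, g (s θ) * m θ ∂szν
      map_add' := fun g1 g2 => by
        rw [← integral_add (hintg g1) (hintg g2)]
        congr 1; funext θ; simp [add_mul]
      map_smul' := fun c g => by
        simp only [RingHom.id_apply, smul_eq_mul]
        rw [← integral_const_mul]
        congr 1; funext θ; simp [mul_assoc] }
  let Λ : C(X, ℂ) →L[ℂ] ℂ := Λ₀.mkContinuous (∫ θ, ‖m θ‖ ∂szν) (fun g => by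
    change ‖∫ θ, g (s θ) * m θ ∂szν‖ ≤ _
    refine (norm_integral_le_integral_norm _).trans ?_
    rw [mul_comm, ← integral_const_mul]
    refine integral_mono (hintg g).norm (hm.norm.const_mul _) fun θ => ?_
    simp only [norm_mul]
    exact mul_le_mul_of_nonneg_right (g.norm_coe_le_norm _) (norm_nonneg _))
  have hΛ : ∀ g, Λ g = ∫ θ, g (s θ) * m θ ∂szν := fun g => rfl
  let A : StarSubalgebra ℂ C(X, ℂ) := StarAlgebra.adjoin ℂ {Φ}
  have hsep : A.SeparatesPoints := by
    intro x y hxy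
    refine ⟨Φ, ⟨Φ, StarAlgebra.subset_adjoin ℂ {Φ} rfl, rfl⟩, ?_⟩
    intro he
    exact hxy (Subtype.ext (hinj (hsub x.2) (hsub y.2) he))
  have htop := ContinuousMap.starSubalgebra_topologicalClosure_eq_top_of_separatesPoints A hsep
  have hAz : ∀ g ∈ A, Λ g = 0 := by
    intro g hg
    have h1 : g ∈ Subalgebra.toSubmodule A.toSubalgebra := hg
    rw [StarAlgebra.adjoin_toSubalgebra, Algebra.adjoin_eq_span] at h1
    have h2 : Submodule.span ℂ (Submonoid.closure (({Φ} : Set C(X, ℂ)) ∪ star {Φ}) : Set C(X, ℂ)) ≤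
        LinearMap.ker (Λ : C(X, ℂ) →ₗ[ℂ] ℂ) := by
      rw [Submodule.span_le]
      intro x hx
      rw [Set.star_singleton, Set.singleton_union] at hx
      obtain ⟨i, j, rfl⟩ := (Submonoid.mem_closure_pair _ _ _).1 hx
      change Λ (Φ ^ i * star Φ ^ j) = 0
      rw [hΛ]
      have := h0 i j
      rw [← this]
      rfl
    exact h2 h1
  have hH : H ∈ A.topologicalClosure := by rw [htop]; trivial
  have h3 : (A.topologicalClosure : Set C(X, ℂ)) ⊆ {g | Λ g = 0} := by
    rw [StarSubalgebra.topologicalClosure_coe]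
    exact closure_minimal (fun g hg => hAz g hg) (isClosed_eq Λ.continuous continuous_const)
  have h4 : Λ H = 0 := h3 hH
  rw [hΛ] at h4
  exact h4

/-- positivity of the Grunsky form -/
lemma sz_form_pos {φ : ℂ → ℂ} (hcont : ContinuousOn φ {z : ℂ | 1 ≤ ‖z‖})
    (hinj : Set.InjOn φ {z : ℂ | 1 ≤ ‖z‖}) {b : ℕ → ℕ → ℂ}
    (hb : Summable fun p : ℕ × ℕ => ‖b p.1 p.2‖)
    (hF : ∀ θ η, szp θ ≠ szp η → φ (szp θ) - φ (szp η) = (szp θ - szp η) * Complex.exp (-szFF b θ η))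
    {u : ℕ → ℂ} (hu : Summable fun k => ‖u k‖) :
    0 ≤ ∑' k : ℕ, ‖u k‖^2 / ((k:ℝ)+1) + (∑' q : ℕ × ℕ, b q.1 q.2 * (u q.1 * u q.2)).re ∧
    ((∑' k : ℕ, ‖u k‖^2 / ((k:ℝ)+1) + (∑' q : ℕ × ℕ, b q.1 q.2 * (u q.1 * u q.2)).re) = 0 →
      ∀ k, u k = 0) := by
  have hcz := szp_cont
  have hcU := szU_cont hu
  have hcF := szFF_cont hb
  let w : ℝ → ℂ := fun θ => φ (szp θ)
  have hsub : Metric.sphere (0:ℂ) 1 ⊆ {z : ℂ | 1 ≤ ‖z‖} := fun z hz => by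
    simp at hz; simp [hz]
  have hws : ∀ θ, szp θ ∈ {z : ℂ | 1 ≤ ‖z‖} := fun θ => by simp [szp_norm]
  have hw : Continuous w := hcont.comp_continuous hcz hws
  obtain ⟨R, hR⟩ : ∃ R, ∀ θ, ‖w θ‖ ≤ R := by
    obtain ⟨R, hR⟩ := (isCompact_sphere (0:ℂ) 1).exists_bound_of_continuousOn (hcont.mono hsub)
    exact ⟨R, fun θ => hR _ (by simp [szp_norm])⟩
  let f : ℝ → ℝ := fun θ => (szU u θ).re
  have hfc : Continuous f := Complex.continuous_re.comp hcU
  have hfb : ∀ θ, |f θ| ≤ ∑' k, ‖u k‖ := fun θ => (Complex.abs_re_le_norm _).trans (szU_norm hu θ)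
  have hne : ∀ᵐ p ∂(szν.prod szν), w p.1 ≠ w p.2 := by
    filter_upwards [sz_ae_ne'] with p hp h
    exact hp (hinj (hws _) (hws _) h)
  have hlog_eq : ∀ᵐ p ∂(szν.prod szν), Real.log ‖w p.1 - w p.2‖ =
      Real.log ‖szp p.1 - szp p.2‖ - (szFF b p.1 p.2).re := by
    filter_upwards [sz_ae_ne'] with p hp
    have : w p.1 - w p.2 = _ := hF _ _ hp
    rw [this, norm_mul, Real.log_mul (norm_ne_zero_iff.2 (sub_ne_zero.2 hp))
      (norm_ne_zero_iff.2 (Complex.exp_ne_zero _)), Complex.norm_exp, Real.log_exp, Complex.neg_re]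
    ring
  have hFi : Integrable (fun p : ℝ × ℝ => szFF b p.1 p.2) (szν.prod szν) :=
    Integrable.of_bound hcF.aestronglyMeasurable _ (Eventually.of_forall fun p => szFF_norm hb _ _)
  have hFr : Integrable (fun p : ℝ × ℝ => (szFF b p.1 p.2).re) (szν.prod szν) := hFi.re
  have hlog : Integrable (fun p : ℝ × ℝ => Real.log ‖w p.1 - w p.2‖) (szν.prod szν) := by
    refine (sz_log_prod.sub hFr).congr ?_
    filter_upwards [hlog_eq] with p hp
    rw [hp]; rfl
  obtain ⟨E1, E2⟩ := sz_energy hw hfc hR hfb (szU_re_mean hu) hne hlog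
  have hffc : Continuous fun p : ℝ × ℝ => f p.1 * f p.2 := by fun_prop
  have hffb : ∀ p : ℝ × ℝ, ‖f p.1 * f p.2‖ ≤ (∑' k, ‖u k‖)^2 := fun p => by
    rw [norm_mul, sq]
    exact mul_le_mul (hfb _) (hfb _) (norm_nonneg _) ((abs_nonneg _).trans (hfb 0))
  have key : 4 * (-∫ p, Real.log ‖w p.1 - w p.2‖ * (f p.1 * f p.2) ∂(szν.prod szν)) =
      ∑' k : ℕ, ‖u k‖^2 / ((k:ℝ)+1) + (∑' q : ℕ × ℕ, b q.1 q.2 * (u q.1 * u q.2)).re := by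
    have e1 : ∫ p, Real.log ‖w p.1 - w p.2‖ * (f p.1 * f p.2) ∂(szν.prod szν) =
        ∫ p, (Real.log ‖szp p.1 - szp p.2‖ * (f p.1 * f p.2) -
          (szFF b p.1 p.2).re * (f p.1 * f p.2)) ∂(szν.prod szν) := by
      refine integral_congr_ae ?_
      filter_upwards [hlog_eq] with p hp
      rw [hp]; ring
    rw [e1, integral_sub (sz_log_prod.mul_bdd hffc.aestronglyMeasurable (Eventually.of_forall hffb))
      (hFr.mul_bdd hffc.aestronglyMeasurable (Eventually.of_forall hffb))]
    have h1 := (sz_circle_energy hu).mul_left 4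
    have h2 := (szFF_energy hb hu).mul_left 4
    have h2' : HasSum (fun q : ℕ × ℕ => b q.1 q.2 * (u q.1 * u q.2))
        (4 * ∫ p, szFF b p.1 p.2 * ((f p.1 * f p.2 : ℝ) : ℂ) ∂(szν.prod szν)) := by
      refine h2.congr_fun ?_
      intro q; ring
    have h1' : HasSum (fun k : ℕ => ‖u k‖^2 / ((k:ℝ)+1))
        (4 * -∫ p, Real.log ‖szp p.1 - szp p.2‖ * (f p.1 * f p.2) ∂(szν.prod szν)) := by
      refine h1.congr_fun ?_
      intro k
      field_simp
    rw [h1'.tsum_eq, h2'.tsum_eq]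
    have h3 : Integrable (fun p : ℝ × ℝ => szFF b p.1 p.2 * ((f p.1 * f p.2 : ℝ) : ℂ)) (szν.prod szν) := by
      refine hFi.mul_bdd (c := (∑' k, ‖u k‖)^2) (Continuous.aestronglyMeasurable (by fun_prop))
        (Eventually.of_forall fun p => ?_)
      rw [Complex.norm_real]; exact hffb p
    have h5 := integral_re (𝕜 := ℂ) h3
    simp only [RCLike.re_eq_complex_re, Complex.re_mul_ofReal] at h5
    rw [h5]
    have : (4 * ∫ p, szFF b p.1 p.2 * ((f p.1 * f p.2 : ℝ) : ℂ) ∂(szν.prod szν)).re =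
        4 * (∫ p, szFF b p.1 p.2 * ((f p.1 * f p.2 : ℝ) : ℂ) ∂(szν.prod szν)).re := by
      simp [Complex.mul_re]
    rw [this]
    ring
  rw [← key]
  refine ⟨by
    change 0 ≤ -∫ p, Real.log ‖w p.1 - w p.2‖ * (f p.1 * f p.2) ∂(szν.prod szν) at E1
    linarith, fun h0 k => ?_⟩
  obtain ⟨t, ht, hmom⟩ := E2 (by
    change (∫ p, Real.log ‖w p.1 - w p.2‖ * (f p.1 * f p.2) ∂(szν.prod szν)) = 0
    linarith)
  have hcm : Continuous fun θ => (Real.exp (-(t * ‖w θ‖^2)) : ℂ) * (f θ : ℂ) := by fun_prop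
  have hsw := sz_SW hcont hinj (m := fun θ => (Real.exp (-(t * ‖w θ‖^2)) : ℂ) * (f θ : ℂ))
    (szν_integrable_of_cont hcm) (fun i j => by
      rw [← hmom i j]
      congr 1; funext θ
      simp only [w, f]; ring)
    (h := fun z => (Real.exp (t * ‖φ z‖^2) : ℂ) * (starRingEnd ℂ z) ^ (k+1)) (by
      have h1 := hcont.mono hsub
      refine ContinuousOn.mul ?_ ((Complex.continuous_conj.pow _).continuousOn)
      refine Complex.continuous_ofReal.comp_continuousOn ?_
      exact Real.continuous_exp.comp_continuousOn (continuousOn_const.mul (h1.norm.pow 2)))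
  have hk := szU_re_neg hu k
  have : ∫ θ, szp (-θ) ^ (k+1) * ((szU u θ).re : ℂ) ∂szν = 0 := by
    rw [← hsw]
    congr 1; funext θ
    have hx : (Real.exp (t * ‖φ (szp θ)‖^2) : ℂ) * (Real.exp (-(t * ‖φ (szp θ)‖^2)) : ℂ) = 1 := by
      rw [← Complex.ofReal_mul, ← Real.exp_add]; simp
    simp only [w, f]
    rw [szp_neg]
    linear_combination -((starRingEnd ℂ) (szp θ) ^ (k+1) * ((szU u θ).re : ℂ)) * hx
  rw [this] at hk
  have : u k / 2 = 0 := hk.symm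
  simpa using this

/-- infinite quadratic form -/
noncomputable def szEn (K : ℕ ⊕ ℕ → ℕ ⊕ ℕ → ℝ) (V : ℕ ⊕ ℕ → ℝ) : ℝ :=
  ∑' i, V i ^ 2 + ∑' p : (ℕ ⊕ ℕ) × (ℕ ⊕ ℕ), K p.1 p.2 * (V p.1 * V p.2)

section
variable {K : ℕ ⊕ ℕ → ℕ ⊕ ℕ → ℝ}

lemma szQ_summable (hKs : Summable fun p : (ℕ ⊕ ℕ) × (ℕ ⊕ ℕ) => |K p.1 p.2|) {V : ℕ ⊕ ℕ → ℝ} {M : ℝ}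
    (hV : ∀ i, |V i| ≤ M) : Summable fun p : (ℕ ⊕ ℕ) × (ℕ ⊕ ℕ) => K p.1 p.2 * (V p.1 * V p.2) := by
  have hM : 0 ≤ M := (abs_nonneg _).trans (hV (Sum.inl 0))
  refine Summable.of_norm_bounded (hKs.mul_right (M*M)) fun p => ?_
  rw [norm_mul, norm_mul, Real.norm_eq_abs]
  exact mul_le_mul_of_nonneg_left (mul_le_mul (hV _) (hV _) (norm_nonneg _) hM) (abs_nonneg _)

lemma sz_l2_bdd {V : ℕ ⊕ ℕ → ℝ} (hV : Summable fun i => V i ^ 2) (i : ℕ ⊕ ℕ) :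
    |V i| ≤ Real.sqrt (∑' i, V i ^ 2) := by
  apply Real.abs_le_sqrt
  exact hV.le_tsum i fun j _ => sq_nonneg _

lemma szEn_nonneg (hKs : Summable fun p : (ℕ ⊕ ℕ) × (ℕ ⊕ ℕ) => |K p.1 p.2|)
    (hpos : ∀ V : ℕ ⊕ ℕ → ℝ, V.support.Finite → 0 ≤ szEn K V) {V : ℕ ⊕ ℕ → ℝ}
    (hV : Summable fun i => V i ^ 2) : 0 ≤ szEn K V := by
  classical
  set M := Real.sqrt (∑' i, V i ^ 2)
  have hM := sz_l2_bdd hV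
  have hM0 : 0 ≤ M := Real.sqrt_nonneg _
  let W : Finset (ℕ ⊕ ℕ) → ℕ ⊕ ℕ → ℝ := fun s i => if i ∈ s then V i else 0
  have hW : ∀ i, Tendsto (fun s => W s i) atTop (nhds (V i)) := fun i => by
    refine tendsto_const_nhds.congr' ?_
    filter_upwards [eventually_ge_atTop {i}] with s hs
    simp only [W]
    rw [if_pos (hs (Finset.mem_singleton_self i))]
  have hWV : ∀ s i, |W s i| ≤ |V i| := fun s i => by
    simp only [W]; split_ifs
    · exact le_rfl
    · simp
  have hlim : Tendsto (fun s => szEn K (W s)) atTop (nhds (szEn K V)) := by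
    unfold szEn
    refine Tendsto.add ?_ ?_
    · refine tendsto_tsum_of_dominated_convergence hV (fun i => (hW i).pow 2) (Eventually.of_forall fun s i => ?_)
      rw [Real.norm_eq_abs, abs_of_nonneg (sq_nonneg _)]
      exact sq_le_sq.2 (hWV s i)
    · refine tendsto_tsum_of_dominated_convergence (hKs.mul_right (M*M))
        (fun p => ((hW p.1).mul (hW p.2)).const_mul _) (Eventually.of_forall fun s p => ?_)
      rw [norm_mul, norm_mul, Real.norm_eq_abs]
      exact mul_le_mul_of_nonneg_left (mul_le_mul ((hWV _ _).trans (hM _)) ((hWV _ _).trans (hM _))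
        (norm_nonneg _) hM0) (abs_nonneg _)
  refine ge_of_tendsto' hlim fun s => hpos _ ?_
  refine s.finite_toSet.subset fun i hi => ?_
  by_contra h
  exact hi (if_neg h)

lemma szEn_perturb (hKsym : ∀ i j, K i j = K j i)
    (hKs : Summable fun p : (ℕ ⊕ ℕ) × (ℕ ⊕ ℕ) => |K p.1 p.2|) {V : ℕ ⊕ ℕ → ℝ}
    (hV : Summable fun i => V i ^ 2) (i : ℕ ⊕ ℕ) (s : ℝ) :
    (Summable fun j => (V j + s * (Pi.single i (1:ℝ) : ℕ ⊕ ℕ → ℝ) j) ^ 2) ∧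
    szEn K (fun j => V j + s * (Pi.single i (1:ℝ) : ℕ ⊕ ℕ → ℝ) j) =
      szEn K V + 2 * s * (V i + ∑' j, K i j * V j) + s^2 * (1 + K i i) := by
  classical
  have hM := sz_l2_bdd hV
  set M := Real.sqrt (∑' i, V i ^ 2)
  let e : ℕ ⊕ ℕ → ℝ := Pi.single i (1:ℝ)
  have he1 : e i = 1 := by simp [e]
  have he0 : ∀ j, j ≠ i → e j = 0 := fun j hj => by simp [e, hj]
  have h1 : HasSum (fun j => (V j + s * e j)^2) (∑' j, V j ^ 2 + (2 * s * V i + s^2)) := by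
    have := hV.hasSum.add (hasSum_ite_eq i (2 * s * V i + s^2))
    refine this.congr_fun fun j => ?_
    by_cases hj : j = i
    · subst hj; rw [if_pos rfl, he1]; ring
    · rw [if_neg hj, he0 j hj]; ring
  have hKi : Summable fun j => K i j * V j := by
    have := hKs.comp_injective (i := fun j => (i, j)) (fun a b h => (Prod.ext_iff.1 h).2)
    refine Summable.of_norm_bounded (this.mul_right M) fun j => ?_
    rw [norm_mul]
    exact mul_le_mul_of_nonneg_left (hM j) (abs_nonneg _)
  have h2 : HasSum (fun p : (ℕ ⊕ ℕ) × (ℕ ⊕ ℕ) => K p.1 p.2 * (e p.1 * V p.2)) (∑' j, K i j * V j) := by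
    have hinj : Function.Injective (fun j : ℕ ⊕ ℕ => (i, j)) := fun a b h => (Prod.ext_iff.1 h).2
    rw [← hinj.hasSum_iff]
    · refine hKi.hasSum.congr_fun fun j => ?_
      simp [he1]
    · intro p hp
      have : p.1 ≠ i := fun h => hp ⟨p.2, by ext <;> simp [h]⟩
      rw [he0 _ this]; ring
  have h3 : HasSum (fun p : (ℕ ⊕ ℕ) × (ℕ ⊕ ℕ) => K p.1 p.2 * (V p.1 * e p.2)) (∑' j, K i j * V j) := by
    have hinj : Function.Injective (fun j : ℕ ⊕ ℕ => (j, i)) := fun a b h => (Prod.ext_iff.1 h).1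
    rw [← hinj.hasSum_iff]
    · refine hKi.hasSum.congr_fun fun j => ?_
      simp [he1, hKsym j i]
    · intro p hp
      have : p.2 ≠ i := fun h => hp ⟨p.1, by ext <;> simp [h]⟩
      rw [he0 _ this]; ring
  have h4 : HasSum (fun p : (ℕ ⊕ ℕ) × (ℕ ⊕ ℕ) => K p.1 p.2 * (e p.1 * e p.2)) (K i i) := by
    refine (hasSum_ite_eq (i, i) (K i i)).congr_fun fun p => ?_
    by_cases hp : p = (i, i)
    · rw [if_pos hp, hp]; simp [he1]
    · rw [if_neg hp]
      by_cases h5 : p.1 = i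
      · have : p.2 ≠ i := fun h => hp (Prod.ext h5 h)
        rw [he0 _ this]; ring
      · rw [he0 _ h5]; ring
  have h5 := (szQ_summable hKs hM).hasSum
  have h6 := ((h5.add (h2.mul_left s)).add (h3.mul_left s)).add (h4.mul_left (s^2))
  refine ⟨h1.summable, ?_⟩
  have h7 : HasSum (fun p : (ℕ ⊕ ℕ) × (ℕ ⊕ ℕ) => K p.1 p.2 * ((V p.1 + s * e p.1) * (V p.2 + s * e p.2)))
    (∑' p : (ℕ ⊕ ℕ) × (ℕ ⊕ ℕ), K p.1 p.2 * (V p.1 * V p.2) + s * (∑' j, K i j * V j) + s * (∑' j, K i j * V j)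
      + s^2 * K i i) := h6.congr_fun fun p => by ring
  have e1 : szEn K (fun j => V j + s * e j) = _ := congrArg₂ (· + ·) h1.tsum_eq h7.tsum_eq
  change szEn K (fun j => V j + s * e j) = _
  rw [e1, szEn]
  ring

lemma szEn_zero (hKsym : ∀ i j, K i j = K j i)
    (hKs : Summable fun p : (ℕ ⊕ ℕ) × (ℕ ⊕ ℕ) => |K p.1 p.2|)
    (hpos : ∀ V : ℕ ⊕ ℕ → ℝ, V.support.Finite → 0 ≤ szEn K V) {V : ℕ ⊕ ℕ → ℝ}
    (hV : Summable fun i => V i ^ 2) (h0 : szEn K V = 0) (i : ℕ ⊕ ℕ) :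
    V i = -∑' j, K i j * V j := by
  have key : ∀ s : ℝ, 0 ≤ 2 * s * (V i + ∑' j, K i j * V j) + s^2 * (1 + K i i) := fun s => by
    obtain ⟨h1, h2⟩ := szEn_perturb hKsym hKs hV i s
    have := szEn_nonneg hKs hpos h1
    rw [h2, h0] at this
    linarith
  set x := V i + ∑' j, K i j * V j with hx
  set d := 1 + K i i
  have hx0 : x = 0 := by
    by_contra hne
    have h1 := key (-(x / (|d| + 1)))
    have hd : 0 < |d| + 1 := by positivity
    have h2 : 0 < x^2 := by positivity
    have e1 : 2 * (-(x / (|d| + 1))) * x + (-(x / (|d| + 1)))^2 * d =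
        x^2 * (d - 2 * (|d|+1)) / (|d| + 1)^2 := by field_simp; ring
    rw [e1] at h1
    have h3 : x^2 * (d - 2 * (|d|+1)) < 0 := by nlinarith [le_abs_self d, abs_nonneg d]
    have := div_neg_of_neg_of_pos h3 (by positivity : 0 < (|d|+1)^2)
    linarith
  linarith

/-- uniform gap -/
lemma sz_gap (hKsym : ∀ i j, K i j = K j i)
    (hKs : Summable fun p : (ℕ ⊕ ℕ) × (ℕ ⊕ ℕ) => |K p.1 p.2|)
    (hpos : ∀ V : ℕ ⊕ ℕ → ℝ, V.support.Finite → 0 ≤ szEn K V)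
    (hdef : ∀ V : ℕ ⊕ ℕ → ℝ, (Summable fun i => V i ^ 2) → (∀ i, V i = -∑' j, K i j * V j) →
      szEn K V = 0 → V = 0) :
    ∃ κ : ℝ, 0 < κ ∧ ∀ V : ℕ ⊕ ℕ → ℝ, V.support.Finite → κ * ∑' i, V i ^ 2 ≤ szEn K V := by
  by_contra hcon
  push Not at hcon
  have h1 : ∀ n : ℕ, ∃ V : ℕ ⊕ ℕ → ℝ, V.support.Finite ∧ ∑' i, V i ^ 2 = 1 ∧ szEn K V < 1 / ((n:ℝ)+1) := by
    intro n
    obtain ⟨V, hVf, hV⟩ := hcon (1 / ((n:ℝ)+1)) (by positivity)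
    have hV2 : ∀ i, i ∉ hVf.toFinset → V i ^ 2 = 0 := fun i hi => by
      simp at hi; simp [hi]
    set S := ∑' i, V i ^ 2 with hS
    have hS0 : 0 ≤ S := tsum_nonneg fun i => sq_nonneg _
    have hSpos : 0 < S := by
      rcases hS0.eq_or_lt with h | h
      · rw [← h] at hV
        have := hpos V hVf
        linarith
      · exact h
    set c := (Real.sqrt S)⁻¹
    have hc2 : c^2 = S⁻¹ := by simp only [c]; rw [inv_pow, Real.sq_sqrt hS0]
    refine ⟨fun i => c * V i, hVf.subset fun i hi => ?_, ?_, ?_⟩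
    · intro h; exact hi (by simp [h])
    · simp_rw [mul_pow]
      rw [tsum_mul_left, hc2, ← hS]; field_simp
    · have : szEn K (fun i => c * V i) = c^2 * szEn K V := by
        unfold szEn
        rw [mul_add, ← tsum_mul_left, ← tsum_mul_left]
        congr 1
        · exact tsum_congr fun i => by ring
        · exact tsum_congr fun p => by ring
      rw [this, hc2, inv_mul_lt_iff₀ hSpos, mul_comm S]
      exact hV
  choose V hVf hV1 hVE using h1
  have hVs : ∀ n, Summable fun i => V n i ^ 2 := fun n => by
    by_contra h
    have := hV1 n
    rw [tsum_eq_zero_of_not_summable h] at this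
    norm_num at this
  have hVb : ∀ n i, |V n i| ≤ 1 := fun n i => by
    have := sz_l2_bdd (hVs n) i
    rwa [hV1 n, Real.sqrt_one] at this
  have hcomp : IsCompact (Set.pi Set.univ (fun _ : ℕ ⊕ ℕ => Set.Icc (-1:ℝ) 1)) :=
    isCompact_univ_pi fun _ => isCompact_Icc
  obtain ⟨W, hW, σ, hσ, hlim⟩ := hcomp.tendsto_subseq (x := V) fun n i _ => abs_le.1 (hVb n i)
  have hlimi : ∀ i, Tendsto (fun n => V (σ n) i) atTop (nhds (W i)) := fun i =>
    (tendsto_pi_nhds.1 hlim) i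
  have hWb : ∀ i, |W i| ≤ 1 := fun i => abs_le.2 (hW i trivial)
  have hQ : Tendsto (fun n => ∑' p : (ℕ ⊕ ℕ) × (ℕ ⊕ ℕ), K p.1 p.2 * (V (σ n) p.1 * V (σ n) p.2)) atTop
      (nhds (∑' p : (ℕ ⊕ ℕ) × (ℕ ⊕ ℕ), K p.1 p.2 * (W p.1 * W p.2))) := by
    refine tendsto_tsum_of_dominated_convergence hKs
        (fun p => ((hlimi p.1).mul (hlimi p.2)).const_mul _) (Eventually.of_forall fun n p => ?_)
    rw [norm_mul, norm_mul, Real.norm_eq_abs]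
    refine mul_le_of_le_one_right (abs_nonneg _) ?_
    exact mul_le_one₀ (hVb _ _) (norm_nonneg _) (hVb _ _)
  have hE : Tendsto (fun n => szEn K (V (σ n))) atTop (nhds 0) := by
    refine squeeze_zero (fun n => hpos _ (hVf _)) (fun n => (hVE (σ n)).le) ?_
    exact (tendsto_one_div_add_atTop_nhds_zero_nat (𝕜 := ℝ)).comp hσ.tendsto_atTop
  have hQ1 : ∑' p : (ℕ ⊕ ℕ) × (ℕ ⊕ ℕ), K p.1 p.2 * (W p.1 * W p.2) = -1 := by
    have h2 := hE.sub_const 1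
    have h3 : ∀ n, szEn K (V (σ n)) - 1 =
        ∑' p : (ℕ ⊕ ℕ) × (ℕ ⊕ ℕ), K p.1 p.2 * (V (σ n) p.1 * V (σ n) p.2) := fun n => by
      unfold szEn; rw [hV1]; ring
    simp_rw [h3] at h2
    have := tendsto_nhds_unique hQ h2
    rw [this]; norm_num
  have hWfin : ∀ s : Finset (ℕ ⊕ ℕ), ∑ i ∈ s, W i ^ 2 ≤ 1 := fun s => by
    have : Tendsto (fun n => ∑ i ∈ s, V (σ n) i ^ 2) atTop (nhds (∑ i ∈ s, W i ^ 2)) :=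
      tendsto_finsetSum _ fun i _ => (hlimi i).pow 2
    refine le_of_tendsto' this fun n => ?_
    rw [← hV1 (σ n)]
    exact (hVs (σ n)).sum_le_tsum s fun i _ => sq_nonneg _
  have hWs : Summable fun i => W i ^ 2 := summable_of_sum_le (fun i => sq_nonneg _) hWfin
  have hW1 : ∑' i, W i ^ 2 ≤ 1 := hWs.tsum_le_of_sum_le hWfin
  have hEW : szEn K W = 0 := by
    have h2 := szEn_nonneg hKs hpos hWs
    have h3 : szEn K W ≤ 0 := by unfold szEn; rw [hQ1]; linarith
    linarith
  have := hdef W hWs (szEn_zero hKsym hKs hpos hWs hEW) hEW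
  rw [this] at hQ1
  simp at hQ1

end

/-- weight of an index -/
noncomputable def szwt : ℕ ⊕ ℕ → ℝ := Sum.elim (fun k => (k:ℝ)+1) (fun k => (k:ℝ)+1)

/-- scaled Grunsky coefficients -/
noncomputable def szβ (b : ℕ → ℕ → ℂ) (k l : ℕ) : ℂ := (Real.sqrt (((k:ℝ)+1) * ((l:ℝ)+1)) : ℂ) * b k l

/-- infinite real Grunsky block matrix -/
noncomputable def szK (b : ℕ → ℕ → ℂ) : ℕ ⊕ ℕ → ℕ ⊕ ℕ → ℝ
  | Sum.inl k, Sum.inl l => (szβ b k l).re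
  | Sum.inl k, Sum.inr l => (szβ b k l).im
  | Sum.inr k, Sum.inl l => (szβ b k l).im
  | Sum.inr k, Sum.inr l => -(szβ b k l).re

lemma szwt_pos (i) : 0 < szwt i := by
  rcases i with k | k <;> simp only [szwt, Sum.elim_inl, Sum.elim_inr] <;> positivity

lemma szβ_symm {b : ℕ → ℕ → ℂ} (hsym : ∀ k l, b k l = b l k) (k l) : szβ b k l = szβ b l k := by
  rw [szβ, szβ, hsym k l, mul_comm ((k:ℝ)+1)]

lemma szK_symm {b : ℕ → ℕ → ℂ} (hsym : ∀ k l, b k l = b l k) (i j) : szK b i j = szK b j i := by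
  rcases i with k | k <;> rcases j with l | l <;> simp only [szK, szβ_symm hsym k l]

lemma szK_bound {b : ℕ → ℕ → ℂ} (hsym : ∀ k l, b k l = b l k) {C : ℝ}
    (hC : ∀ k l : ℕ, ‖b k l‖ ≤ C / ((k:ℝ)+1)^4) (i j) :
    |szK b i j| ≤ C / (szwt i ^ 2 * szwt j) := by
  have key : ∀ k l, ‖szβ b k l‖ ≤ C / (((k:ℝ)+1)^2 * ((l:ℝ)+1)) := fun k l => by
    rw [szβ, norm_mul, Complex.norm_real, Real.norm_of_nonneg (Real.sqrt_nonneg _)]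
    exact sz_interp hsym hC k l
  rcases i with k | k <;> rcases j with l | l <;>
    simp only [szK, szwt, Sum.elim_inl, Sum.elim_inr, abs_neg]
  · exact (Complex.abs_re_le_norm _).trans (key k l)
  · exact (Complex.abs_im_le_norm _).trans (key k l)
  · exact (Complex.abs_im_le_norm _).trans (key k l)
  · exact (Complex.abs_re_le_norm _).trans (key k l)

/-- the summable weight -/
noncomputable def szρ (i : ℕ ⊕ ℕ) : ℝ := (szwt i * Real.sqrt (szwt i))⁻¹

lemma szρ_summable_nat : Summable fun k : ℕ => (((k:ℝ)+1) * Real.sqrt ((k:ℝ)+1))⁻¹ := by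
  have h := (summable_nat_add_iff 1).mpr (Real.summable_one_div_nat_rpow.mpr (by norm_num : (1:ℝ) < 3/2))
  refine h.congr fun k => ?_
  have hk : (0:ℝ) < (k:ℝ)+1 := by positivity
  push_cast
  rw [one_div, show (3/2:ℝ) = 1 + 1/2 by norm_num, Real.rpow_add hk, Real.rpow_one, Real.sqrt_eq_rpow]

lemma szρ_summable : Summable szρ := by
  refine Summable.sum _ ?_ ?_ <;>
  · exact szρ_summable_nat

lemma szρ_pos (i) : 0 < szρ i := by
  have := szwt_pos i
  unfold szρ; positivity

lemma szK_summable {b : ℕ → ℕ → ℂ} (hsym : ∀ k l, b k l = b l k) {C : ℝ}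
    (hC : ∀ k l : ℕ, ‖b k l‖ ≤ C / ((k:ℝ)+1)^4) :
    Summable fun p : (ℕ ⊕ ℕ) × (ℕ ⊕ ℕ) => |szK b p.1 p.2| := by
  have hC0 : 0 ≤ C := by
    have := (norm_nonneg _).trans (hC 0 0); simpa using this
  have h1 : Summable fun p : (ℕ ⊕ ℕ) × (ℕ ⊕ ℕ) => C * (szρ p.1 * szρ p.2) :=
    (szρ_summable.mul_of_nonneg szρ_summable (fun i => (szρ_pos i).le) (fun i => (szρ_pos i).le)).mul_left C
  refine Summable.of_nonneg_of_le (fun p => abs_nonneg _) (fun p => ?_) h1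
  obtain ⟨i, j⟩ := p
  have hi := szwt_pos i
  have hj := szwt_pos j
  have h2 := szK_bound hsym hC i j
  have h3 := szK_bound hsym hC j i
  rw [szK_symm hsym j i] at h3
  have hpi := szρ_pos i
  have hpj := szρ_pos j
  apply abs_le_of_sq_le_sq _ (by positivity)
  rw [← sq_abs]
  calc |szK b i j| ^ 2 = |szK b i j| * |szK b i j| := sq _
    _ ≤ C / (szwt i ^ 2 * szwt j) * (C / (szwt j ^ 2 * szwt i)) :=
        mul_le_mul h2 h3 (abs_nonneg _) (by positivity)
    _ = (C * (szρ i * szρ j)) ^ 2 := by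
        simp only [szρ, mul_pow, inv_pow, Real.sq_sqrt hi.le, Real.sq_sqrt hj.le]
        field_simp

/-- reindexing -/
def sze : (ℕ × ℕ) × (Bool × Bool) ≃ (ℕ ⊕ ℕ) × (ℕ ⊕ ℕ) :=
  (show (ℕ × ℕ) × (Bool × Bool) ≃ (Bool × ℕ) × (Bool × ℕ) from
    ⟨fun x => ((x.2.1, x.1.1), (x.2.2, x.1.2)), fun x => ((x.1.2, x.2.2), (x.1.1, x.2.1)),
      fun _ => rfl, fun _ => rfl⟩).trans
    ((Equiv.boolProdEquivSum ℕ).prodCongr (Equiv.boolProdEquivSum ℕ))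

lemma sz_tsum4 {f : (ℕ ⊕ ℕ) × (ℕ ⊕ ℕ) → ℝ} (hf : Summable f) :
    HasSum (fun q : ℕ × ℕ => f (Sum.inl q.1, Sum.inl q.2) + f (Sum.inl q.1, Sum.inr q.2)
      + f (Sum.inr q.1, Sum.inl q.2) + f (Sum.inr q.1, Sum.inr q.2)) (∑' p, f p) := by
  have h1 : HasSum (f ∘ sze) (∑' p, f p) := (Equiv.hasSum_iff sze).mpr hf.hasSum
  have h2 := h1.prod_fiberwise (g := fun q : ℕ × ℕ => f (Sum.inl q.1, Sum.inl q.2) + f (Sum.inl q.1, Sum.inr q.2)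
      + f (Sum.inr q.1, Sum.inl q.2) + f (Sum.inr q.1, Sum.inr q.2)) (fun q => by
    have := hasSum_fintype (fun c : Bool × Bool => (f ∘ sze) (q, c))
    have e : ∑ c : Bool × Bool, (f ∘ sze) (q, c) = f (Sum.inl q.1, Sum.inl q.2) + f (Sum.inl q.1, Sum.inr q.2)
      + f (Sum.inr q.1, Sum.inl q.2) + f (Sum.inr q.1, Sum.inr q.2) := by
      rw [Fintype.sum_prod_type]
      simp [sze, Equiv.boolProdEquivSum]
      ring
    rw [e] at this
    exact this)
  exact h2

lemma sz_tsum2 {f : ℕ ⊕ ℕ → ℝ} (hf : Summable f) :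
    HasSum (fun k : ℕ => f (Sum.inl k) + f (Sum.inr k)) (∑' i, f i) := by
  have h1 : Summable (fun k : ℕ => f (Sum.inl k)) := hf.comp_injective Sum.inl_injective
  have h2 : Summable (fun k : ℕ => f (Sum.inr k)) := hf.comp_injective Sum.inr_injective
  have h3 : HasSum f (∑' k, f (Sum.inl k) + ∑' k, f (Sum.inr k)) := HasSum.sum h1.hasSum h2.hasSum
  rw [h3.tsum_eq]
  exact h1.hasSum.add h2.hasSum

/-- complex vector -/
noncomputable def szu (V : ℕ ⊕ ℕ → ℝ) (k : ℕ) : ℂ :=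
  (Real.sqrt ((k:ℝ)+1) : ℂ) * ((V (Sum.inl k) : ℂ) - Complex.I * (V (Sum.inr k) : ℂ))

lemma szu_form (b : ℕ → ℕ → ℂ) (V : ℕ ⊕ ℕ → ℝ) (k l : ℕ) :
    (b k l * (szu V k * szu V l)).re = szK b (Sum.inl k) (Sum.inl l) * (V (Sum.inl k) * V (Sum.inl l))
      + szK b (Sum.inl k) (Sum.inr l) * (V (Sum.inl k) * V (Sum.inr l))
      + szK b (Sum.inr k) (Sum.inl l) * (V (Sum.inr k) * V (Sum.inl l))
      + szK b (Sum.inr k) (Sum.inr l) * (V (Sum.inr k) * V (Sum.inr l)) := by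
  simp only [szK, szβ, szu]
  rw [Real.sqrt_mul (by positivity)]
  simp
  ring

lemma szu_normsq (V : ℕ ⊕ ℕ → ℝ) (k : ℕ) :
    ‖szu V k‖^2 / ((k:ℝ)+1) = V (Sum.inl k) ^ 2 + V (Sum.inr k) ^ 2 := by
  have hk : (0:ℝ) < (k:ℝ)+1 := by positivity
  rw [szu, norm_mul, mul_pow, Complex.norm_real, Real.norm_of_nonneg (Real.sqrt_nonneg _), Real.sq_sqrt hk.le,
    ← Complex.normSq_eq_norm_sq, Complex.normSq_apply]
  simp
  field_simp

lemma szu_norm_le (V : ℕ ⊕ ℕ → ℝ) (k : ℕ) :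
    ‖szu V k‖ ≤ Real.sqrt ((k:ℝ)+1) * (|V (Sum.inl k)| + |V (Sum.inr k)|) := by
  rw [szu, norm_mul, Complex.norm_real, Real.norm_of_nonneg (Real.sqrt_nonneg _)]
  refine mul_le_mul_of_nonneg_left ((norm_sub_le _ _).trans ?_) (Real.sqrt_nonneg _)
  simp

lemma szEn_eq {b : ℕ → ℕ → ℂ} (hb : Summable fun p : ℕ × ℕ => ‖b p.1 p.2‖)
    (hKs : Summable fun p : (ℕ ⊕ ℕ) × (ℕ ⊕ ℕ) => |szK b p.1 p.2|)
    {V : ℕ ⊕ ℕ → ℝ} (hV : Summable fun i => V i ^ 2) (hu : Summable fun k => ‖szu V k‖) :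
    szEn (szK b) V = ∑' k : ℕ, ‖szu V k‖^2 / ((k:ℝ)+1) +
      (∑' q : ℕ × ℕ, b q.1 q.2 * (szu V q.1 * szu V q.2)).re := by
  rw [szEn, ← (sz_tsum2 hV).tsum_eq]
  simp only [szu_normsq]
  congr 1
  have h1 := sz_tsum4 (szQ_summable hKs (sz_l2_bdd hV))
  rw [← h1.tsum_eq]
  have hM : ∀ k, ‖szu V k‖ ≤ ∑' k, ‖szu V k‖ := fun k => hu.le_tsum k fun _ _ => norm_nonneg _
  have hs : Summable fun q : ℕ × ℕ => b q.1 q.2 * (szu V q.1 * szu V q.2) := by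
    refine Summable.of_norm_bounded (hb.mul_right ((∑' k, ‖szu V k‖) * (∑' k, ‖szu V k‖))) fun q => ?_
    rw [norm_mul, norm_mul]
    exact mul_le_mul_of_nonneg_left (mul_le_mul (hM _) (hM _) (norm_nonneg _)
      (tsum_nonneg fun _ => norm_nonneg _)) (norm_nonneg _)
  rw [Complex.re_tsum hs]
  exact tsum_congr fun q => (szu_form b V q.1 q.2).symm

lemma szK_gap {φ : ℂ → ℂ} (hcont : ContinuousOn φ {z : ℂ | 1 ≤ ‖z‖})
    (hinj : Set.InjOn φ {z : ℂ | 1 ≤ ‖z‖}) {b : ℕ → ℕ → ℂ}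
    (hb : Summable fun p : ℕ × ℕ => ‖b p.1 p.2‖)
    (hF : ∀ θ η, szp θ ≠ szp η → φ (szp θ) - φ (szp η) = (szp θ - szp η) * Complex.exp (-szFF b θ η))
    (hsym : ∀ k l, b k l = b l k) {C : ℝ}
    (hC : ∀ k l : ℕ, ‖b k l‖ ≤ C / ((k:ℝ)+1)^4) :
    ∃ κ : ℝ, 0 < κ ∧ ∀ V : ℕ ⊕ ℕ → ℝ, V.support.Finite → κ * ∑' i, V i ^ 2 ≤ szEn (szK b) V := by
  have hKs := szK_summable hsym hC
  have hC0 : 0 ≤ C := by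
    have := (norm_nonneg _).trans (hC 0 0); simpa using this
  refine sz_gap (szK_symm hsym) hKs ?_ ?_
  · intro V hV
    have hV2 : Summable fun i => V i ^ 2 := by
      refine summable_of_ne_finset_zero (s := hV.toFinset) fun i hi => ?_
      simp at hi; simp [hi]
    have hu : Summable fun k => ‖szu V k‖ := by
      refine summable_of_ne_finset_zero
        (s := (hV.toFinset).image (Sum.elim id id)) fun k hk => ?_
      have h1 : V (Sum.inl k) = 0 := by
        by_contra h
        exact hk (Finset.mem_image.mpr ⟨Sum.inl k, by simpa using h, rfl⟩)
      have h2 : V (Sum.inr k) = 0 := by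
        by_contra h
        exact hk (Finset.mem_image.mpr ⟨Sum.inr k, by simpa using h, rfl⟩)
      simp [szu, h1, h2]
    rw [szEn_eq hb hKs hV2 hu]
    exact (sz_form_pos hcont hinj hb hF hu).1
  · intro V hV2 hfix hE
    have hw2 : Summable fun j => (szwt j ^ 2)⁻¹ := by
      have h := (summable_nat_add_iff 1).mpr (Real.summable_one_div_nat_pow.mpr (by norm_num : 1 < 2))
      refine Summable.sum _ ?_ ?_ <;>
      · refine h.congr fun k => ?_
        simp [szwt]
    have hs : Summable fun j => |V j| * (szwt j)⁻¹ := by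
      refine Summable.of_nonneg_of_le (fun j => ?_) (fun j => ?_) (hV2.add hw2)
      · have := szwt_pos j; positivity
      · have := szwt_pos j
        rw [← sq_abs, ← inv_pow]
        nlinarith [sq_nonneg (|V j| - (szwt j)⁻¹), sq_nonneg (|V j|), sq_nonneg ((szwt j)⁻¹)]
    set M := ∑' j, |V j| * (szwt j)⁻¹ with hM
    have hVb : ∀ i, |V i| ≤ C * M * (szwt i ^ 2)⁻¹ := fun i => by
      rw [hfix i, abs_neg]
      have hle : ∀ j, ‖szK b i j * V j‖ ≤ C * (szwt i ^ 2)⁻¹ * (|V j| * (szwt j)⁻¹) := fun j => by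
        rw [norm_mul, Real.norm_eq_abs, Real.norm_eq_abs]
        calc |szK b i j| * |V j| ≤ C / (szwt i ^ 2 * szwt j) * |V j| :=
              mul_le_mul_of_nonneg_right (szK_bound hsym hC i j) (abs_nonneg _)
          _ = _ := by rw [div_eq_mul_inv, mul_inv]; ring
      have h1 := tsum_of_norm_bounded (hs.hasSum.mul_left (C * (szwt i ^ 2)⁻¹)) hle
      rw [Real.norm_eq_abs] at h1
      refine h1.trans (le_of_eq ?_)
      ring
    have hu : Summable fun k => ‖szu V k‖ := by
      refine Summable.of_nonneg_of_le (fun k => norm_nonneg _) (fun k => ?_)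
        (szρ_summable_nat.mul_left (2 * (C * M)))
      refine (szu_norm_le V k).trans ?_
      have h1 := hVb (Sum.inl k)
      have h2 := hVb (Sum.inr k)
      simp only [szwt, Sum.elim_inl, Sum.elim_inr] at h1 h2
      have hk : (0:ℝ) < (k:ℝ)+1 := by positivity
      have hq := Real.sq_sqrt hk.le
      have hq0 := Real.sqrt_pos.mpr hk
      calc Real.sqrt ((k:ℝ)+1) * (|V (Sum.inl k)| + |V (Sum.inr k)|)
          ≤ Real.sqrt ((k:ℝ)+1) * (C * M * (((k:ℝ)+1) ^ 2)⁻¹ + C * M * (((k:ℝ)+1) ^ 2)⁻¹) :=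
            mul_le_mul_of_nonneg_left (add_le_add h1 h2) hq0.le
        _ = 2 * (C * M) * (((k:ℝ)+1) * Real.sqrt ((k:ℝ)+1))⁻¹ := by
            field_simp
            rw [hq]; ring
    rw [szEn_eq hb hKs hV2 hu] at hE
    have h0 := (sz_form_pos hcont hinj hb hF hu).2 hE
    have h3 : ∀ k, V (Sum.inl k) = 0 ∧ V (Sum.inr k) = 0 := fun k => by
      have := szu_normsq V k
      rw [h0 k] at this
      simp at this
      constructor <;> nlinarith [sq_nonneg (V (Sum.inl k)), sq_nonneg (V (Sum.inr k))]
    funext i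
    rcases i with k | k
    · exact (h3 k).1
    · exact (h3 k).2

/-- truncated matrix -/
noncomputable def szKm (b : ℕ → ℕ → ℂ) (m : ℕ) : Matrix (Fin m ⊕ Fin m) (Fin m ⊕ Fin m) ℝ :=
  Matrix.of fun i j => szK b (szi i) (szi j)

lemma szi_inj {m : ℕ} : Function.Injective (szi (m := m)) := by
  intro i j h
  rcases i with k | k <;> rcases j with l | l <;> simp [szi] at h ⊢ <;> exact Fin.ext h

lemma szKm_gap {b : ℕ → ℕ → ℂ} {κ : ℝ}
    (hgap : ∀ V : ℕ ⊕ ℕ → ℝ, V.support.Finite → κ * ∑' i, V i ^ 2 ≤ szEn (szK b) V) (m : ℕ)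
    (v : Fin m ⊕ Fin m → ℝ) : κ * (v ⬝ᵥ v) ≤ v ⬝ᵥ ((1 + szKm b m) *ᵥ v) := by
  let V : ℕ ⊕ ℕ → ℝ := Function.extend szi v (fun _ => 0)
  have hVi : ∀ i, V (szi i) = v i := fun i => szi_inj.extend_apply v (fun _ => 0) i
  have hV0 : ∀ j, j ∉ Set.range (szi (m := m)) → V j = 0 := fun j hj =>
    Function.extend_apply' v (fun _ => 0) j (fun ⟨i, hi⟩ => hj ⟨i, hi⟩)
  have hfin : V.support.Finite := (Set.finite_range (szi (m := m))).subset fun j hj => by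
    by_contra h
    exact hj (hV0 j h)
  have h1 := hgap V hfin
  have e1 : ∑' i, V i ^ 2 = v ⬝ᵥ v := by
    have := (szi_inj (m := m)).tsum_eq (f := fun i => V i ^ 2) (fun j hj => by
      by_contra h
      exact hj (by simp [hV0 j h]))
    rw [← this, tsum_fintype, dotProduct]
    exact Finset.sum_congr rfl fun i _ => by rw [hVi]; ring
  have e2 : ∑' p : (ℕ ⊕ ℕ) × (ℕ ⊕ ℕ), szK b p.1 p.2 * (V p.1 * V p.2) = v ⬝ᵥ (szKm b m *ᵥ v) := by
    have := ((szi_inj (m := m)).prodMap (szi_inj (m := m))).tsum_eq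
      (f := fun p : (ℕ ⊕ ℕ) × (ℕ ⊕ ℕ) => szK b p.1 p.2 * (V p.1 * V p.2)) (fun p hp => by
      by_contra h
      apply hp
      by_cases h1 : p.1 ∈ Set.range (szi (m := m))
      · by_cases h2 : p.2 ∈ Set.range (szi (m := m))
        · obtain ⟨i, hi⟩ := h1
          obtain ⟨j, hj⟩ := h2
          exact absurd ⟨(i, j), by simp [hi, hj]⟩ h
        · simp [hV0 _ h2]
      · simp [hV0 _ h1])
    rw [← this, tsum_fintype, Fintype.sum_prod_type, dotProduct]
    refine Finset.sum_congr rfl fun i _ => ?_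
    rw [mulVec, dotProduct, Finset.mul_sum]
    refine Finset.sum_congr rfl fun j _ => ?_
    simp only [Prod.map, hVi, szKm, of_apply]
    ring
  rw [szEn, e1, e2] at h1
  rw [add_mulVec, one_mulVec, dotProduct_add]
  exact h1

/-- truncated index set -/
def szI (m : ℕ) : Finset (ℕ ⊕ ℕ) := Finset.univ.image (szi (m := m))

lemma szI_mem {m : ℕ} {i : ℕ ⊕ ℕ} : i ∈ szI m ↔ Sum.elim id id i < m := by
  simp only [szI, Finset.mem_image, Finset.mem_univ, true_and]
  constructor
  · rintro ⟨j, rfl⟩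
    rcases j with k | k <;> simp [szi]
  · intro h
    rcases i with k | k
    · exact ⟨Sum.inl ⟨k, h⟩, rfl⟩
    · exact ⟨Sum.inr ⟨k, h⟩, rfl⟩

lemma szI_mono {m m' : ℕ} (h : m ≤ m') : szI m ⊆ szI m' := fun i hi => by
  rw [szI_mem] at hi ⊢; omega

lemma szI_exhaust (s : Finset (ℕ ⊕ ℕ)) : ∃ M, ∀ m, M ≤ m → s ⊆ szI m := by
  refine ⟨s.sup (Sum.elim id id) + 1, fun m hm i hi => ?_⟩
  rw [szI_mem]
  have := Finset.le_sup (f := Sum.elim id id) hi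
  omega

lemma szI_sum {E : Type*} [AddCommMonoid E] (m : ℕ) (f : ℕ ⊕ ℕ → E) :
    ∑ i ∈ szI m, f i = ∑ i : Fin m ⊕ Fin m, f (szi i) := by
  rw [szI, Finset.sum_image fun i _ j _ h => szi_inj h]

lemma szE_V1s (n : ℕ) (S : Finset (ℕ ⊕ ℕ)) (x : ℕ ⊕ ℕ → ℝ) :
    ∫ θ, Real.exp (∑ i ∈ S, x i * szW θ i) ∂(szE n) ≤ Real.exp (1/2 * ∑ i ∈ S, x i ^ 2) := by
  obtain ⟨M, hM⟩ := szI_exhaust S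
  have hS := hM M le_rfl
  have h := szE_V1 n (m := M) (fun i => if szi i ∈ S then x (szi i) else 0)
  have e1 : ∀ θ : Fin n → ℝ, ∑ i : Fin M ⊕ Fin M, (if szi i ∈ S then x (szi i) else 0) * szW θ (szi i) =
      ∑ i ∈ S, x i * szW θ i := fun θ => by
    rw [← szI_sum M (fun i => (if i ∈ S then x i else 0) * szW θ i)]
    simp only [ite_mul, zero_mul]
    rw [Finset.sum_ite_mem, Finset.inter_eq_right.mpr hS]
  have e2 : ∑ i : Fin M ⊕ Fin M, (if szi i ∈ S then x (szi i) else 0) ^ 2 = ∑ i ∈ S, x i ^ 2 := by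
    rw [← szI_sum M (fun i => (if i ∈ S then x i else 0) ^ 2)]
    simp only [ite_pow, ne_eq, OfNat.ofNat_ne_zero, not_false_eq_true, zero_pow]
    rw [Finset.sum_ite_mem, Finset.inter_eq_right.mpr hS]
  simp only [e1, e2] at h
  exact h

lemma szE_sq (n : ℕ) (i : ℕ ⊕ ℕ) :
    ∫ θ, Real.exp (szW θ i ^ 2 / 4) ∂(szE n) ≤ Real.exp 1 := by
  obtain ⟨M, hM⟩ := szI_exhaust {i}
  have hi : i ∈ szI M := hM M le_rfl (Finset.mem_singleton_self i)
  simp only [szI, Finset.mem_image, Finset.mem_univ, true_and] at hi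
  obtain ⟨j, rfl⟩ := hi
  let K : Matrix (Fin M ⊕ Fin M) (Fin M ⊕ Fin M) ℝ := Matrix.diagonal (fun k => if k = j then -(1/2) else 0)
  have hq : ∀ v : Fin M ⊕ Fin M → ℝ, v ⬝ᵥ (K *ᵥ v) = -(1/2) * v j ^ 2 := fun v => by
    simp only [K, dotProduct, mulVec_diagonal]
    rw [Finset.sum_eq_single j]
    · simp; ring
    · intro b _ hb; simp [hb]
    · simp
  have h := szE_G2 (K := K) (by simp [K]) (κ := 1/2) (by norm_num) (fun v => by
    rw [add_mulVec, one_mulVec, dotProduct_add, hq]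
    have : v j ^ 2 ≤ v ⬝ᵥ v := by
      rw [dotProduct]
      have := Finset.single_le_sum (f := fun i => v i * v i) (fun i _ => mul_self_nonneg _) (Finset.mem_univ j)
      simp only [← sq] at this ⊢; exact this
    linarith) n
  simp only [hq] at h
  have e1 : ∑ i, ∑ k, |K i k| = 1/2 := by
    rw [Finset.sum_eq_single j, Finset.sum_eq_single j]
    · simp [K]
    · intro b _ hb; simp [K, Matrix.diagonal, hb.symm]
    · simp
    · intro b _ hb
      refine Finset.sum_eq_zero fun c _ => ?_
      simp [K, Matrix.diagonal, hb]
    · simp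
  rw [e1] at h
  calc _ = ∫ θ, Real.exp (-(1/2) * (-(1/2) * szw M θ j ^ 2)) ∂(szE n) := by
        congr 1; funext θ; congr 1; simp only [szw]; ring
    _ ≤ _ := h
    _ ≤ Real.exp 1 := Real.exp_le_exp.mpr (by norm_num)

lemma sz_exp_jensen {ι : Type*} (S : Finset ι) (w x : ι → ℝ) (hw : ∀ i ∈ S, 0 ≤ w i) (h1 : ∑ i ∈ S, w i ≤ 1)
    : Real.exp (∑ i ∈ S, w i * x i) ≤ 1 + ∑ i ∈ S, w i * Real.exp (x i) := by
  classical
  have hc := convexOn_exp.map_sum_le (t := Finset.insertNone S)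
    (w := fun o : Option ι => o.elim (1 - ∑ i ∈ S, w i) w) (p := fun o : Option ι => o.elim 0 x)
    (by
      intro o ho
      rcases o with _ | i
      · simpa using h1
      · exact hw i (by simpa using ho))
    (by rw [Finset.sum_insertNone]; simp)
    (by simp)
  rw [Finset.sum_insertNone, Finset.sum_insertNone] at hc
  simp only [Option.elim_none, Option.elim_some, smul_eq_mul, mul_zero, zero_add, Real.exp_zero, mul_one] at hc
  have := Finset.sum_nonneg hw
  linarith

lemma szE_quad_tail (n : ℕ) (S : Finset ((ℕ ⊕ ℕ) × (ℕ ⊕ ℕ))) (w : (ℕ ⊕ ℕ) × (ℕ ⊕ ℕ) → ℝ)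
    (hw : ∀ p ∈ S, 0 ≤ w p) (h1 : ∑ p ∈ S, w p ≤ 1/4) :
    ∫ θ, Real.exp (∑ p ∈ S, w p * |szW θ p.1 * szW θ p.2|) ∂(szE n) ≤ 1 + 2 * Real.exp 1 := by
  have hW := szW_cont (n := n)
  have hpt : ∀ θ : Fin n → ℝ, Real.exp (∑ p ∈ S, w p * |szW θ p.1 * szW θ p.2|) ≤
      1 + ∑ p ∈ S, 4 * w p * (Real.exp (szW θ p.1 ^ 2 / 4) + Real.exp (szW θ p.2 ^ 2 / 4)) := fun θ => by
    have h2 := sz_exp_jensen S (fun p => 4 * w p) (fun p => |szW θ p.1 * szW θ p.2| / 4)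
      (fun p hp => mul_nonneg (by norm_num) (hw p hp)) (by rw [← Finset.mul_sum]; linarith)
    have e : ∑ p ∈ S, 4 * w p * (|szW θ p.1 * szW θ p.2| / 4) = ∑ p ∈ S, w p * |szW θ p.1 * szW θ p.2| :=
      Finset.sum_congr rfl fun p _ => by ring
    rw [e] at h2
    refine h2.trans (add_le_add_right (Finset.sum_le_sum fun p hp => ?_) _)
    refine mul_le_mul_of_nonneg_left ?_ (mul_nonneg (by norm_num) (hw p hp))
    have h3 : |szW θ p.1 * szW θ p.2| ≤ max (szW θ p.1 ^ 2) (szW θ p.2 ^ 2) := by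
      rw [abs_mul, ← sq_abs (szW θ p.1), ← sq_abs (szW θ p.2)]
      rcases le_total (|szW θ p.1|) (|szW θ p.2|) with h | h
      · exact le_max_of_le_right (by nlinarith [abs_nonneg (szW θ p.1), abs_nonneg (szW θ p.2)])
      · exact le_max_of_le_left (by nlinarith [abs_nonneg (szW θ p.1), abs_nonneg (szW θ p.2)])
    rcases le_max_iff.mp h3 with h | h
    · exact (Real.exp_le_exp.mpr (by linarith)).trans (le_add_of_nonneg_right (Real.exp_pos _).le)
    · exact (Real.exp_le_exp.mpr (by linarith)).trans (le_add_of_nonneg_left (Real.exp_pos _).le)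
  have hintg : ∀ i, Integrable (fun θ : Fin n → ℝ => Real.exp (szW θ i ^ 2 / 4)) (szE n) := fun i =>
    szE_integrable_of_cont (by have := hW i; fun_prop)
  have hint2 : ∀ p ∈ S, Integrable (fun θ : Fin n → ℝ => 4 * w p * (Real.exp (szW θ p.1 ^ 2 / 4) +
      Real.exp (szW θ p.2 ^ 2 / 4))) (szE n) := fun p _ => ((hintg p.1).add (hintg p.2)).const_mul _
  have hp := szE_prob n
  calc _ ≤ ∫ θ : Fin n → ℝ, (1 + ∑ p ∈ S, 4 * w p * (Real.exp (szW θ p.1 ^ 2 / 4) +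
        Real.exp (szW θ p.2 ^ 2 / 4))) ∂(szE n) := by
        refine integral_mono (szE_integrable_of_cont ?_) ((integrable_const _).add (integrable_finsetSum _ hint2)) hpt
        fun_prop
    _ = 1 + ∑ p ∈ S, 4 * w p * (∫ θ, Real.exp (szW θ p.1 ^ 2 / 4) ∂(szE n) +
          ∫ θ, Real.exp (szW θ p.2 ^ 2 / 4) ∂(szE n)) := by
        rw [integral_add (integrable_const _) (integrable_finsetSum _ hint2), integral_finsetSum _ hint2]
        simp only [integral_const_mul, integral_add (hintg _) (hintg _)]
        simp
    _ ≤ 1 + ∑ p ∈ S, 4 * w p * (Real.exp 1 + Real.exp 1) := by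
        refine add_le_add_right (Finset.sum_le_sum fun p hp => ?_) _
        exact mul_le_mul_of_nonneg_left (add_le_add (szE_sq n _) (szE_sq n _)) (mul_nonneg (by norm_num) (hw p hp))
    _ ≤ 1 + 2 * Real.exp 1 := by
        rw [← Finset.sum_mul, ← Finset.mul_sum]
        nlinarith [Real.exp_pos 1]

lemma szE_lin_tail (n : ℕ) (S : Finset (ℕ ⊕ ℕ)) (h : ℕ ⊕ ℕ → ℂ) (Λ : ℝ) :
    ∫ θ, Real.exp (Λ * ‖∑ i ∈ S, h i * (szW θ i : ℂ)‖) ∂(szE n) ≤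
      4 * Real.exp (2 * Λ ^ 2 * ∑ i ∈ S, ‖h i‖ ^ 2) := by
  have hW := szW_cont (n := n)
  have hpt : ∀ θ : Fin n → ℝ, Real.exp (Λ * ‖∑ i ∈ S, h i * (szW θ i : ℂ)‖) ≤
      ∑ p : Bool × Bool, Real.exp (∑ i ∈ S, (szζ p * Λ * h i).re * szW θ i) := fun θ => by
    have h1 := sz_exp_norm_le ((Λ:ℂ) * ∑ i ∈ S, h i * (szW θ i : ℂ))
    have h2 : Λ * ‖∑ i ∈ S, h i * (szW θ i : ℂ)‖ ≤ ‖(Λ:ℂ) * ∑ i ∈ S, h i * (szW θ i : ℂ)‖ := by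
      rw [norm_mul, Complex.norm_real]
      exact mul_le_mul_of_nonneg_right (Real.le_norm_self _) (norm_nonneg _)
    refine (Real.exp_le_exp.mpr h2).trans (h1.trans (le_of_eq (Finset.sum_congr rfl fun p _ => ?_)))
    congr 1
    rw [Finset.mul_sum, Finset.mul_sum, Complex.re_sum]
    refine Finset.sum_congr rfl fun i _ => ?_
    rw [← Complex.re_mul_ofReal]; congr 1; ring
  have hintg : ∀ p ∈ (Finset.univ : Finset (Bool × Bool)), Integrable (fun θ : Fin n → ℝ =>
      Real.exp (∑ i ∈ S, (szζ p * Λ * h i).re * szW θ i)) (szE n) := fun p _ =>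
    szE_integrable_of_cont (by fun_prop)
  calc _ ≤ ∫ θ : Fin n → ℝ, ∑ p : Bool × Bool, Real.exp (∑ i ∈ S, (szζ p * Λ * h i).re * szW θ i) ∂(szE n) := by
        refine integral_mono (szE_integrable_of_cont ?_) (integrable_finsetSum _ hintg) hpt
        fun_prop
    _ = ∑ p : Bool × Bool, ∫ θ : Fin n → ℝ, Real.exp (∑ i ∈ S, (szζ p * Λ * h i).re * szW θ i) ∂(szE n) :=
        integral_finsetSum _ hintg
    _ ≤ ∑ p : Bool × Bool, Real.exp (2 * Λ ^ 2 * ∑ i ∈ S, ‖h i‖ ^ 2) := by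
        refine Finset.sum_le_sum fun p _ => (szE_V1s n S _).trans (Real.exp_le_exp.mpr ?_)
        rw [Finset.mul_sum, Finset.mul_sum]
        refine Finset.sum_le_sum fun i _ => ?_
        have h3 : (szζ p * Λ * h i).re ^ 2 ≤ (2 * |Λ| * ‖h i‖) ^ 2 := by
          rw [← sq_abs]
          refine pow_le_pow_left₀ (abs_nonneg _) ((Complex.abs_re_le_norm _).trans ?_) 2
          rw [norm_mul, norm_mul, Complex.norm_real, Real.norm_eq_abs]
          have := szζ_norm p
          gcongr
        rw [mul_pow, mul_pow, sq_abs] at h3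
        linarith
    _ = _ := by simp

/-- quadratic form on a finite index set -/
noncomputable def szq (K : ℕ ⊕ ℕ → ℕ ⊕ ℕ → ℝ) {n : ℕ} (m : ℕ) (θ : Fin n → ℝ) : ℝ :=
  1/2 * ∑ p ∈ szI m ×ˢ szI m, K p.1 p.2 * (szW θ p.1 * szW θ p.2)

/-- linear form -/
noncomputable def szx (h : ℕ ⊕ ℕ → ℂ) {n : ℕ} (m : ℕ) (θ : Fin n → ℝ) : ℂ :=
  ∑ i ∈ szI m, h i * (szW θ i : ℂ)

/-- truncated exponent -/
noncomputable def szT (K : ℕ ⊕ ℕ → ℕ ⊕ ℕ → ℝ) (h : ℕ ⊕ ℕ → ℂ) {n : ℕ} (m : ℕ) (θ : Fin n → ℝ) : ℂ :=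
  -(szq K m θ : ℂ) + szx h m θ

section
variable {K : ℕ ⊕ ℕ → ℕ ⊕ ℕ → ℝ} {h : ℕ ⊕ ℕ → ℂ}

lemma szq_cont (n m : ℕ) : Continuous (szq K m : (Fin n → ℝ) → ℝ) := by
  have hW := szW_cont (n := n)
  unfold szq; fun_prop

lemma szx_cont (n m : ℕ) : Continuous (szx h m : (Fin n → ℝ) → ℂ) := by
  have hW := szW_cont (n := n)
  unfold szx; fun_prop

lemma szT_cont (n m : ℕ) : Continuous (szT K h m : (Fin n → ℝ) → ℂ) := by
  have h1 := szq_cont (K := K) n m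
  have h2 := szx_cont (h := h) n m
  unfold szT; fun_prop

lemma szq_eq (m n : ℕ) (θ : Fin n → ℝ) : szq K m θ =
    1/2 * (szw m θ ⬝ᵥ ((Matrix.of fun i j => K (szi i) (szi j)) *ᵥ szw m θ)) := by
  rw [szq, Finset.sum_product, szI_sum m, dotProduct]
  congr 1
  refine Finset.sum_congr rfl fun i _ => ?_
  rw [szI_sum m, mulVec, dotProduct, Finset.mul_sum]
  refine Finset.sum_congr rfl fun j _ => ?_
  simp only [szw, of_apply]; ring

lemma szE_sq_bound (hsym : ∀ i j, K i j = K j i) (hKs : Summable fun p : (ℕ ⊕ ℕ) × (ℕ ⊕ ℕ) => |K p.1 p.2|)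
    {κ : ℝ} (hκ : 0 < κ)
    (hgap : ∀ m (v : Fin m ⊕ Fin m → ℝ), κ * (v ⬝ᵥ v) ≤
      v ⬝ᵥ ((1 + Matrix.of fun i j => K (szi i) (szi j)) *ᵥ v)) (n m : ℕ) :
    ∫ θ, Real.exp (-(1 + κ/2) * szq K m θ) ∂(szE n) ≤
      Real.exp (κ⁻¹ * ((1 + κ/2) * ∑' p : (ℕ ⊕ ℕ) × (ℕ ⊕ ℕ), |K p.1 p.2|)) := by
  set s : ℝ := 1 + κ/2 with hs
  let M : Matrix (Fin m ⊕ Fin m) (Fin m ⊕ Fin m) ℝ := Matrix.of fun i j => K (szi i) (szi j)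
  have hMT : Mᵀ = M := by ext i j; exact hsym _ _
  have h1 := szE_G2 (K := s • M) (by rw [transpose_smul, hMT]) (κ := κ/2) (by positivity) (fun v => by
    have h2 := hgap m v
    rw [add_mulVec, one_mulVec, dotProduct_add] at h2 ⊢
    rw [smul_mulVec, dotProduct_smul, smul_eq_mul]
    have h3 : 0 ≤ v ⬝ᵥ v := by
      rw [dotProduct]; exact Finset.sum_nonneg fun i _ => mul_self_nonneg _
    change κ * (v ⬝ᵥ v) ≤ v ⬝ᵥ v + v ⬝ᵥ (M *ᵥ v) at h2
    have h4 := mul_le_mul_of_nonneg_left h2 (show (0:ℝ) ≤ s by positivity)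
    rw [hs] at h4 ⊢
    nlinarith [mul_nonneg (mul_pos hκ hκ).le h3]) n
  have e1 : ∀ θ : Fin n → ℝ, -(1/2) * (szw m θ ⬝ᵥ ((s • M) *ᵥ szw m θ)) = -s * szq K m θ := fun θ => by
    rw [szq_eq, smul_mulVec, dotProduct_smul, smul_eq_mul]; ring
  simp only [e1] at h1
  refine h1.trans (Real.exp_le_exp.mpr ?_)
  have hsp : 0 < s := by positivity
  have e2 : ∑ i, ∑ j, |(s • M) i j| = s * ∑ p ∈ szI m ×ˢ szI m, |K p.1 p.2| := by
    rw [Finset.sum_product, szI_sum m, Finset.mul_sum]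
    refine Finset.sum_congr rfl fun i _ => ?_
    rw [szI_sum m, Finset.mul_sum]
    refine Finset.sum_congr rfl fun j _ => ?_
    simp only [M, Matrix.smul_apply, of_apply, smul_eq_mul, abs_mul, abs_of_pos hsp]
  rw [e2, show 2 * (κ/2) = κ by ring]
  have h5 := hKs.sum_le_tsum (szI m ×ˢ szI m) (fun p _ => abs_nonneg _)
  have := inv_pos.mpr hκ
  gcongr

lemma sz_exp3 (a b c : ℝ) : Real.exp (a + b + c) ≤ Real.exp (3*a) + Real.exp (3*b) + Real.exp (3*c) := by
  have ha := Real.exp_pos (3*a)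
  have hb := Real.exp_pos (3*b)
  have hc := Real.exp_pos (3*c)
  rcases le_total a b with h1 | h1 <;> rcases le_total b c with h2 | h2 <;> rcases le_total a c with h3 | h3
  all_goals first
    | linarith [Real.exp_le_exp.mpr (show a + b + c ≤ 3*a by linarith)]
    | linarith [Real.exp_le_exp.mpr (show a + b + c ≤ 3*b by linarith)]
    | linarith [Real.exp_le_exp.mpr (show a + b + c ≤ 3*c by linarith)]

lemma sz_young {s Q Y : ℝ} (hs : 1 < s) :
    Real.exp (-Q + Y) ≤ Real.exp (-s * Q) + Real.exp (s / (s - 1) * Y) := by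
  have h1 : 0 < s - 1 := by linarith
  have hs0 : 0 < s := by linarith
  have e : -Q + Y = (1/s) * (-s * Q) + ((s-1)/s) * (s / (s - 1) * Y) := by
    field_simp
  have ha := Real.exp_pos (-s * Q)
  have hb := Real.exp_pos (s / (s - 1) * Y)
  have e2 : 1/s + (s-1)/s = 1 := by field_simp; ring
  have p1 : 0 < 1/s := by positivity
  have p2 : 0 < (s-1)/s := by positivity
  rcases le_total (-s * Q) (s / (s - 1) * Y) with h | h
  · have : -Q + Y ≤ s / (s - 1) * Y := by
      have := mul_le_mul_of_nonneg_left h p1.le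
      calc -Q + Y ≤ (1/s) * (s / (s - 1) * Y) + ((s-1)/s) * (s / (s - 1) * Y) := by rw [e]; linarith
        _ = s / (s - 1) * Y := by rw [← add_mul, e2, one_mul]
    linarith [Real.exp_le_exp.mpr this]
  · have : -Q + Y ≤ -s * Q := by
      have := mul_le_mul_of_nonneg_left h p2.le
      calc -Q + Y ≤ (1/s) * (-s * Q) + ((s-1)/s) * (-s * Q) := by rw [e]; linarith
        _ = -s * Q := by rw [← add_mul, e2, one_mul]
    linarith [Real.exp_le_exp.mpr this]

lemma sz_cauchy (hsym : ∀ i j, K i j = K j i) (hKs : Summable fun p : (ℕ ⊕ ℕ) × (ℕ ⊕ ℕ) => |K p.1 p.2|)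
    {κ : ℝ} (hκ : 0 < κ)
    (hgap : ∀ m (v : Fin m ⊕ Fin m → ℝ), κ * (v ⬝ᵥ v) ≤
      v ⬝ᵥ ((1 + Matrix.of fun i j => K (szi i) (szi j)) *ᵥ v))
    (hh : Summable fun i => ‖h i‖ ^ 2) {δ : ℝ} (hδ : 0 < δ) :
    ∃ M, ∀ m m', M ≤ m → m ≤ m' → ∀ n : ℕ,
      ∫ θ, ‖Complex.exp (szT K h m' θ) - Complex.exp (szT K h m θ)‖ ∂(szE n) ≤ δ := by
  set s : ℝ := 1 + κ/2 with hs
  have hs1 : 1 < s := by rw [hs]; linarith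
  set Λ : ℝ := s / (s - 1) with hΛ
  have hΛ0 : 0 < Λ := div_pos (by linarith) (by linarith)
  set c1 : ℝ := Real.exp (κ⁻¹ * (s * ∑' p : (ℕ ⊕ ℕ) × (ℕ ⊕ ℕ), |K p.1 p.2|)) with hc1
  set c2 : ℝ := 1 + 2 * Real.exp 1
  set c3 : ℝ := 4 * Real.exp 1
  set c4 : ℝ := 4 * Real.exp (2 * (3 * Λ) ^ 2 * ∑' i, ‖h i‖ ^ 2) with hc4
  set Ct : ℝ := c1 + (c2 + c3 + c4) with hCt
  have hCt0 : 0 < Ct := by positivity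
  set ε : ℝ := min 1 (δ / Ct) with hε
  have hε0 : 0 < ε := lt_min one_pos (div_pos hδ hCt0)
  have hε1 : ε ≤ 1 := min_le_left _ _
  set Λ' : ℝ := Λ * (2 / ε) with hΛ'
  have hΛ'0 : 0 < Λ' := by positivity
  -- tails
  obtain ⟨s1, hs1t⟩ := summable_iff_vanishing_norm.mp hKs (1 / (6 * Λ')) (by positivity)
  obtain ⟨s2, hs2t⟩ := summable_iff_vanishing_norm.mp hh (1 / (2 * (3 * Λ') ^ 2)) (by positivity)
  obtain ⟨M1, hM1⟩ := szI_exhaust (s1.image Prod.fst ∪ s1.image Prod.snd ∪ s2)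
  refine ⟨M1, fun m m' hm hmm' n => ?_⟩
  have hsub := hM1 m hm
  have hI := szI_mono hmm'
  set S2 : Finset ((ℕ ⊕ ℕ) × (ℕ ⊕ ℕ)) := (szI m' ×ˢ szI m') \ (szI m ×ˢ szI m) with hS2
  set S1 : Finset (ℕ ⊕ ℕ) := szI m' \ szI m with hS1
  have hd1 : Disjoint S2 s1 := by
    rw [Finset.disjoint_left]
    intro p hp hp1
    rw [hS2, Finset.mem_sdiff] at hp
    apply hp.2
    rw [Finset.mem_product]
    constructor
    · exact hsub (Finset.mem_union_left _ (Finset.mem_union_left _ (Finset.mem_image_of_mem _ hp1)))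
    · exact hsub (Finset.mem_union_left _ (Finset.mem_union_right _ (Finset.mem_image_of_mem _ hp1)))
  have hd2 : Disjoint S1 s2 := by
    rw [Finset.disjoint_left]
    intro p hp hp1
    rw [hS1, Finset.mem_sdiff] at hp
    exact hp.2 (hsub (Finset.mem_union_right _ hp1))
  have ht1 : ∑ p ∈ S2, |K p.1 p.2| ≤ 1 / (6 * Λ') :=
    (Real.le_norm_self _).trans (hs1t S2 hd1).le
  have ht2 : ∑ i ∈ S1, ‖h i‖ ^ 2 ≤ 1 / (2 * (3 * Λ') ^ 2) :=
    (Real.le_norm_self _).trans (hs2t S1 hd2).le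
  have hdq : ∀ θ : Fin n → ℝ, |szq K m' θ - szq K m θ| ≤
      ∑ p ∈ S2, 1/2 * |K p.1 p.2| * |szW θ p.1 * szW θ p.2| := fun θ => by
    have e : szq K m' θ - szq K m θ = 1/2 * ∑ p ∈ S2, K p.1 p.2 * (szW θ p.1 * szW θ p.2) := by
      rw [szq, szq, ← mul_sub, hS2, Finset.sum_sdiff_eq_sub (Finset.product_subset_product hI hI)]
    rw [e, Finset.mul_sum]
    refine (Finset.abs_sum_le_sum_abs _ _).trans (le_of_eq (Finset.sum_congr rfl fun p _ => ?_))
    rw [abs_mul, abs_mul, abs_of_pos (by norm_num : (0:ℝ) < 1/2)]; ring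
  have hdx : ∀ θ : Fin n → ℝ, szx h m' θ - szx h m θ = ∑ i ∈ S1, h i * (szW θ i : ℂ) := fun θ => by
    rw [szx, szx, hS1, Finset.sum_sdiff_eq_sub hI]
  have hpt : ∀ θ : Fin n → ℝ, ‖Complex.exp (szT K h m' θ) - Complex.exp (szT K h m θ)‖ ≤
      ε * (Real.exp (-s * szq K m θ) +
        (Real.exp (∑ p ∈ S2, (3 * Λ') * (1/2 * |K p.1 p.2|) * |szW θ p.1 * szW θ p.2|) +
          Real.exp ((3 * Λ') * ‖∑ i ∈ S1, h i * (szW θ i : ℂ)‖) +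
          Real.exp ((3 * Λ) * ‖∑ i ∈ szI m, h i * (szW θ i : ℂ)‖))) := fun θ => by
    refine (sz_exp_diff _ _ hε0 hε1).trans (mul_le_mul_of_nonneg_left ?_ hε0.le)
    have h1 : ‖szT K h m' θ - szT K h m θ‖ ≤ (∑ p ∈ S2, 1/2 * |K p.1 p.2| * |szW θ p.1 * szW θ p.2|) +
        ‖∑ i ∈ S1, h i * (szW θ i : ℂ)‖ := by
      have e : szT K h m' θ - szT K h m θ = -((szq K m' θ - szq K m θ : ℝ) : ℂ) +
          ∑ i ∈ S1, h i * (szW θ i : ℂ) := by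
        rw [← hdx, szT, szT]; push_cast; ring
      rw [e]
      refine (norm_add_le _ _).trans (add_le_add_left ?_ _)
      rw [norm_neg, Complex.norm_real]
      exact hdq θ
    have h2 : (szT K h m θ).re ≤ -szq K m θ + ‖∑ i ∈ szI m, h i * (szW θ i : ℂ)‖ := by
      rw [szT, Complex.add_re, Complex.neg_re, Complex.ofReal_re]
      exact add_le_add_right (Complex.re_le_norm _) _
    set a1 := ∑ p ∈ S2, 1/2 * |K p.1 p.2| * |szW θ p.1 * szW θ p.2| with ha1
    set a2 := ‖∑ i ∈ S1, h i * (szW θ i : ℂ)‖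
    set a3 := ‖∑ i ∈ szI m, h i * (szW θ i : ℂ)‖
    have h3 : 2 / ε * ‖szT K h m' θ - szT K h m θ‖ + (szT K h m θ).re ≤
        -szq K m θ + (2 / ε * a1 + 2 / ε * a2 + a3) := by
      have := mul_le_mul_of_nonneg_left h1 (show 0 ≤ 2 / ε by positivity)
      linarith
    refine (Real.exp_le_exp.mpr h3).trans ((sz_young hs1).trans (add_le_add_right ?_ _))
    rw [← hΛ, mul_add, mul_add]
    refine (sz_exp3 _ _ _).trans (le_of_eq ?_)
    have e1 : ∑ p ∈ S2, (3 * Λ') * (1/2 * |K p.1 p.2|) * |szW θ p.1 * szW θ p.2| = (3 * Λ') * a1 := by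
      rw [ha1, Finset.mul_sum]; exact Finset.sum_congr rfl fun p _ => by ring
    rw [e1, hΛ']
    congr 1
    · congr 1
      · congr 1; ring
      · congr 1; ring
    · congr 1; ring
  have hW := szW_cont (n := n)
  have hqc := szq_cont (K := K) n m
  have hT := szT_cont (K := K) (h := h) n
  have i1 : Integrable (fun θ : Fin n → ℝ => Real.exp (-s * szq K m θ)) (szE n) :=
    szE_integrable_of_cont (by fun_prop)
  have i2 : Integrable (fun θ : Fin n → ℝ =>
      Real.exp (∑ p ∈ S2, (3 * Λ') * (1/2 * |K p.1 p.2|) * |szW θ p.1 * szW θ p.2|)) (szE n) :=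
    szE_integrable_of_cont (by fun_prop)
  have i3 : Integrable (fun θ : Fin n → ℝ =>
      Real.exp ((3 * Λ') * ‖∑ i ∈ S1, h i * (szW θ i : ℂ)‖)) (szE n) :=
    szE_integrable_of_cont (by fun_prop)
  have i4 : Integrable (fun θ : Fin n → ℝ =>
      Real.exp ((3 * Λ) * ‖∑ i ∈ szI m, h i * (szW θ i : ℂ)‖)) (szE n) :=
    szE_integrable_of_cont (by fun_prop)
  have b1 := szE_sq_bound hsym hKs hκ hgap n m
  have b2 := szE_quad_tail n S2 (fun p => (3 * Λ') * (1/2 * |K p.1 p.2|)) (fun p _ => by positivity) (by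
    rw [← Finset.mul_sum, ← Finset.mul_sum]
    calc 3 * Λ' * (1/2 * ∑ p ∈ S2, |K p.1 p.2|) ≤ 3 * Λ' * (1/2 * (1 / (6 * Λ'))) := by
          refine mul_le_mul_of_nonneg_left ?_ (by positivity)
          linarith
      _ = 1/4 := by field_simp; norm_num)
  have b3 : ∫ θ, Real.exp ((3 * Λ') * ‖∑ i ∈ S1, h i * (szW θ i : ℂ)‖) ∂(szE n) ≤ c3 := by
    refine (szE_lin_tail n S1 h (3 * Λ')).trans ?_
    refine mul_le_mul_of_nonneg_left (Real.exp_le_exp.mpr ?_) (by norm_num)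
    calc 2 * (3 * Λ') ^ 2 * ∑ i ∈ S1, ‖h i‖ ^ 2 ≤ 2 * (3 * Λ') ^ 2 * (1 / (2 * (3 * Λ') ^ 2)) :=
          mul_le_mul_of_nonneg_left ht2 (by positivity)
      _ = 1 := by field_simp
  have b4 : ∫ θ, Real.exp ((3 * Λ) * ‖∑ i ∈ szI m, h i * (szW θ i : ℂ)‖) ∂(szE n) ≤ c4 := by
    refine (szE_lin_tail n (szI m) h (3 * Λ)).trans ?_
    refine mul_le_mul_of_nonneg_left (Real.exp_le_exp.mpr ?_) (by norm_num)
    exact mul_le_mul_of_nonneg_left (hh.sum_le_tsum _ fun _ _ => by positivity) (by positivity)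
  calc _ ≤ _ := integral_mono (szE_integrable_of_cont (by have := hT m; have := hT m'; fun_prop))
        ((i1.add ((i2.add i3).add i4)).const_mul ε) hpt
    _ = ε * (∫ θ, Real.exp (-s * szq K m θ) ∂(szE n) +
        (∫ θ, Real.exp (∑ p ∈ S2, (3 * Λ') * (1/2 * |K p.1 p.2|) * |szW θ p.1 * szW θ p.2|) ∂(szE n) +
          ∫ θ, Real.exp ((3 * Λ') * ‖∑ i ∈ S1, h i * (szW θ i : ℂ)‖) ∂(szE n) +
          ∫ θ, Real.exp ((3 * Λ) * ‖∑ i ∈ szI m, h i * (szW θ i : ℂ)‖) ∂(szE n))) := by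
        rw [integral_const_mul, integral_add' i1 ((i2.add i3).add i4), integral_add' (i2.add i3) i4,
          integral_add' i2 i3]
    _ ≤ ε * Ct := by
        refine mul_le_mul_of_nonneg_left ?_ hε0.le
        rw [hCt]
        linarith
    _ ≤ δ / Ct * Ct := mul_le_mul_of_nonneg_right (min_le_right _ _) hCt0.le
    _ = δ := by field_simp

end

section
variable {K : ℕ ⊕ ℕ → ℕ ⊕ ℕ → ℝ} {h : ℕ ⊕ ℕ → ℂ}

/-- finite dimensional constants -/
noncomputable def szL (K : ℕ ⊕ ℕ → ℕ ⊕ ℕ → ℝ) (h : ℕ ⊕ ℕ → ℂ) (m : ℕ) : ℂ :=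
  ((Real.sqrt ((1 + Matrix.of fun i j : Fin m ⊕ Fin m => K (szi i) (szi j)).det) : ℂ))⁻¹ *
        Complex.exp (1/2 * ((fun i : Fin m ⊕ Fin m => h (szi i)) ⬝ᵥ
          (((1 + Matrix.of fun i j : Fin m ⊕ Fin m => K (szi i) (szi j))⁻¹).map Complex.ofReal).mulVec
            (fun i : Fin m ⊕ Fin m => h (szi i))))

lemma szE_T_limit (hsym : ∀ i j, K i j = K j i) {κ : ℝ} (hκ : 0 < κ)
    (hgap : ∀ m (v : Fin m ⊕ Fin m → ℝ), κ * (v ⬝ᵥ v) ≤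
      v ⬝ᵥ ((1 + Matrix.of fun i j => K (szi i) (szi j)) *ᵥ v)) (m : ℕ) :
    Tendsto (fun n => ∫ θ, Complex.exp (szT K h m θ) ∂(szE n)) atTop (nhds (szL K h m)) := by
  have h1 := szE_G1 (K := Matrix.of fun i j : Fin m ⊕ Fin m => K (szi i) (szi j))
    (by ext i j; exact hsym _ _) hκ (hgap m) (fun i => h (szi i))
  refine h1.congr fun n => ?_
  congr 1
  funext θ
  congr 1
  rw [szT, szq_eq, szx, szI_sum m]
  simp only [szw]
  push_cast
  ring

lemma sz_fatou (n : ℕ) {δ : ℝ} {f : ℕ → (Fin n → ℝ) → ℂ} {F g : (Fin n → ℝ) → ℂ}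
    (hf : ∀ j, Continuous (f j)) (hg : Continuous g)
    (hlim : ∀ᵐ θ ∂(szE n), Tendsto (fun j => f j θ) atTop (nhds (F θ)))
    (hb : ∀ᶠ j in atTop, ∫ θ, ‖f j θ - g θ‖ ∂(szE n) ≤ δ) :
    Integrable F (szE n) ∧ ∫ θ, ‖F θ - g θ‖ ∂(szE n) ≤ δ := by
  have hFm : AEStronglyMeasurable F (szE n) :=
    aestronglyMeasurable_of_tendsto_ae atTop (fun j => (hf j).aestronglyMeasurable) hlim
  have h1 : ∫⁻ θ, ‖F θ - g θ‖ₑ ∂(szE n) ≤ ENNReal.ofReal δ := by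
    calc ∫⁻ θ, ‖F θ - g θ‖ₑ ∂(szE n) = ∫⁻ θ, liminf (fun j => ‖f j θ - g θ‖ₑ) atTop ∂(szE n) := by
          refine lintegral_congr_ae ?_
          filter_upwards [hlim] with θ hθ
          exact ((hθ.sub_const (g θ)).enorm.liminf_eq).symm
      _ ≤ liminf (fun j => ∫⁻ θ, ‖f j θ - g θ‖ₑ ∂(szE n)) atTop :=
          lintegral_liminf_le fun j => by
            have := hf j
            exact (this.sub hg).enorm.measurable
      _ ≤ ENNReal.ofReal δ := by
          refine liminf_le_of_frequently_le' (Eventually.frequently ?_)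
          filter_upwards [hb] with j hj
          have hii : Integrable (fun θ => f j θ - g θ) (szE n) := szE_integrable_of_cont ((hf j).sub hg)
          rw [← ofReal_integral_norm_eq_lintegral_enorm hii]
          exact ENNReal.ofReal_le_ofReal hj
  have hi : Integrable (fun θ => F θ - g θ) (szE n) :=
    ⟨hFm.sub hg.aestronglyMeasurable, h1.trans_lt ENNReal.ofReal_lt_top⟩
  have hgi : Integrable g (szE n) := szE_integrable_of_cont hg
  refine ⟨(hi.add hgi).congr (Eventually.of_forall fun θ => by simp), ?_⟩
  obtain ⟨j, hj⟩ := hb.exists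
  have hδ : 0 ≤ δ := le_trans (integral_nonneg fun _ => norm_nonneg _) hj
  rw [integral_norm_eq_lintegral_enorm hi.1]
  exact ENNReal.toReal_le_of_le_ofReal hδ h1

lemma sz_main (hsym : ∀ i j, K i j = K j i) (hKs : Summable fun p : (ℕ ⊕ ℕ) × (ℕ ⊕ ℕ) => |K p.1 p.2|)
    {κ : ℝ} (hκ : 0 < κ)
    (hgap : ∀ m (v : Fin m ⊕ Fin m → ℝ), κ * (v ⬝ᵥ v) ≤
      v ⬝ᵥ ((1 + Matrix.of fun i j => K (szi i) (szi j)) *ᵥ v))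
    (hh : Summable fun i => ‖h i‖ ^ 2) (T : (n : ℕ) → (Fin n → ℝ) → ℂ) {ms : ℕ → ℕ}
    (hms : Tendsto ms atTop atTop)
    (hT : ∀ n, ∀ᵐ θ ∂(szE n), Tendsto (fun j => szT K h (ms j) θ) atTop (nhds (T n θ))) :
    (∀ n, Integrable (fun θ => Complex.exp (T n θ)) (szE n)) ∧
    ∃ L, Tendsto (szL K h) atTop (nhds L) ∧
      Tendsto (fun n => ∫ θ, Complex.exp (T n θ) ∂(szE n)) atTop (nhds L) := by
  have hTc : ∀ n m, Continuous (fun θ : Fin n → ℝ => Complex.exp (szT K h m θ)) := fun n m =>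
    Complex.continuous_exp.comp (szT_cont n m)
  have hTi : ∀ n m, Integrable (fun θ : Fin n → ℝ => Complex.exp (szT K h m θ)) (szE n) := fun n m =>
    szE_integrable_of_cont (hTc n m)
  have hlim : ∀ n, ∀ᵐ θ ∂(szE n), Tendsto (fun j => Complex.exp (szT K h (ms j) θ)) atTop
      (nhds (Complex.exp (T n θ))) := fun n => by
    filter_upwards [hT n] with θ hθ
    exact (Complex.continuous_exp.tendsto _).comp hθ
  have hinf : ∀ {δ : ℝ}, 0 < δ → ∃ M, ∀ m, M ≤ m → ∀ n,
      Integrable (fun θ => Complex.exp (T n θ)) (szE n) ∧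
      ∫ θ, ‖Complex.exp (T n θ) - Complex.exp (szT K h m θ)‖ ∂(szE n) ≤ δ := by
    intro δ hδ
    obtain ⟨M, hM⟩ := sz_cauchy hsym hKs hκ hgap hh hδ
    refine ⟨M, fun m hm n => ?_⟩
    refine sz_fatou n (fun j => hTc n (ms j)) (hTc n m) (hlim n) ?_
    filter_upwards [hms.eventually_ge_atTop m] with j hj
    exact hM m (ms j) hm hj n
  have hi : ∀ n, Integrable (fun θ => Complex.exp (T n θ)) (szE n) := fun n => by
    obtain ⟨M, hM⟩ := hinf one_pos
    exact (hM M le_rfl n).1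
  refine ⟨hi, ?_⟩
  have hLlim := fun m => szE_T_limit (h := h) hsym hκ hgap m
  have hdiff : ∀ {n : ℕ} {f g : (Fin n → ℝ) → ℂ}, Integrable f (szE n) → Integrable g (szE n) → ∀ {δ : ℝ},
      ∫ θ, ‖f θ - g θ‖ ∂(szE n) ≤ δ → dist (∫ θ, f θ ∂(szE n)) (∫ θ, g θ ∂(szE n)) ≤ δ := by
    intro n f g hf hg δ hδ
    rw [dist_eq_norm, ← integral_sub hf hg]
    exact (norm_integral_le_integral_norm _).trans hδ
  have hLc : CauchySeq (szL K h) := by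
    rw [Metric.cauchySeq_iff']
    intro ε hε
    obtain ⟨M, hM⟩ := sz_cauchy hsym hKs hκ hgap hh (half_pos hε)
    refine ⟨M, fun m hm => ?_⟩
    have : dist (szL K h m) (szL K h M) ≤ ε/2 :=
      le_of_tendsto ((hLlim m).dist (hLlim M)) (Eventually.of_forall fun n =>
        hdiff (hTi n m) (hTi n M) (hM M m le_rfl hm n))
    linarith
  obtain ⟨L, hL⟩ := cauchySeq_tendsto_of_complete hLc
  refine ⟨L, hL, ?_⟩
  rw [Metric.tendsto_atTop]
  intro ε hε
  obtain ⟨M, hM⟩ := hinf (show 0 < ε/3 by positivity)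
  obtain ⟨m, hm1, hm2⟩ := ((hL.eventually (Metric.ball_mem_nhds L (show 0 < ε/3 by positivity))).and
    (eventually_ge_atTop M)).exists
  obtain ⟨N, hN⟩ := Metric.tendsto_atTop.mp (hLlim m) (ε/3) (by positivity)
  refine ⟨N, fun n hn => ?_⟩
  have h1 := hdiff (hi n) (hTi n m) (hM m hm2 n).2
  have h2 := hN n hn
  have h3 := dist_triangle4 (∫ θ, Complex.exp (T n θ) ∂(szE n)) (∫ θ, Complex.exp (szT K h m θ) ∂(szE n))
    (szL K h m) L
  linarith

/-- lower bound for the constants -/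
lemma sz_lower (hsym : ∀ i j, K i j = K j i)
    {κ : ℝ} (hκ : 0 < κ)
    (hgap : ∀ m (v : Fin m ⊕ Fin m → ℝ), κ * (v ⬝ᵥ v) ≤
      v ⬝ᵥ ((1 + Matrix.of fun i j => K (szi i) (szi j)) *ᵥ v))
    (hKs : Summable fun p : (ℕ ⊕ ℕ) × (ℕ ⊕ ℕ) => |K p.1 p.2|)
    (hh : Summable fun i => ‖h i‖ ^ 2) : ∃ c : ℝ, 0 < c ∧ ∀ m, c ≤ ‖szL K h m‖ := by
  set S := ∑' p : (ℕ ⊕ ℕ) × (ℕ ⊕ ℕ), |K p.1 p.2| with hS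
  have hS0 : 0 ≤ S := tsum_nonneg fun _ => abs_nonneg _
  set H := ∑' i, ‖h i‖ ^ 2 with hH
  refine ⟨(Real.exp S)⁻¹ * Real.exp (-(1/2 * (κ⁻¹ * H))), by positivity, fun m => ?_⟩
  set M : Matrix (Fin m ⊕ Fin m) (Fin m ⊕ Fin m) ℝ := Matrix.of fun i j => K (szi i) (szi j) with hM
  obtain ⟨U, l, h1, h2, hKU⟩ := sz_spec M (by ext i j; exact hsym _ _)
  have hl : ∀ i, κ ≤ 1 + l i := sz_gap_eig h1 hKU (hgap m)
  have hl0 : ∀ i, 0 < 1 + l i := fun i => hκ.trans_le (hl i)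
  have hdet : (1 + M).det = ∏ i, (1 + l i) := sz_det_diag h2 hKU
  have hdet0 : 0 < (1 + M).det := by rw [hdet]; exact Finset.prod_pos fun i _ => hl0 i
  have hsum : ∑ i, ∑ j, |M i j| ≤ S := by
    have := hKs.sum_le_tsum (szI m ×ˢ szI m) (fun p _ => abs_nonneg _)
    rw [Finset.sum_product, szI_sum m] at this
    simp only [szI_sum m] at this
    exact this
  have hdetle : (1 + M).det ≤ Real.exp S := by
    rw [hdet]
    calc ∏ i, (1 + l i) ≤ ∏ i, Real.exp (|l i|) := by
          refine Finset.prod_le_prod (fun i _ => (hl0 i).le) fun i _ => ?_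
          have := Real.add_one_le_exp (|l i|)
          linarith [le_abs_self (l i)]
      _ = Real.exp (∑ i, |l i|) := (Real.exp_sum _ _).symm
      _ ≤ Real.exp S := Real.exp_le_exp.mpr ((sz_sum_abs_eig h2 h1 hKU).trans hsum)
  have hsq : Real.sqrt ((1 + M).det) ≤ Real.exp S := by
    rw [Real.sqrt_le_left (Real.exp_pos _).le]
    have : 1 ≤ Real.exp S := Real.one_le_exp hS0
    nlinarith
  have hsq0 : 0 < Real.sqrt ((1 + M).det) := Real.sqrt_pos.mpr hdet0
  set hm : Fin m ⊕ Fin m → ℂ := fun i => h (szi i) with hhm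
  have hy : ∑ i, ‖((U.map Complex.ofReal)ᵀ *ᵥ hm) i‖ ^ 2 ≤ H := by
    have hone : (1 : Matrix (Fin m ⊕ Fin m) (Fin m ⊕ Fin m) ℝ) = U * diagonal (fun _ => 1) * Uᵀ := by
      rw [diagonal_one, Matrix.mul_one, h2]
    have hq := sz_quad_diag hone
    simp only [one_mulVec, one_mul] at hq
    have e : ∀ i, ‖((U.map Complex.ofReal)ᵀ *ᵥ hm) i‖ ^ 2 = ((Uᵀ *ᵥ (fun j => (hm j).re)) i) ^ 2 +
        ((Uᵀ *ᵥ (fun j => (hm j).im)) i) ^ 2 := fun i => by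
      rw [← Complex.normSq_eq_norm_sq, Complex.normSq_apply]
      simp only [mulVec, dotProduct, Complex.re_sum, Complex.im_sum, transpose_apply, map_apply,
        Complex.re_ofReal_mul, Complex.im_ofReal_mul]
      ring
    simp only [e]
    rw [Finset.sum_add_distrib, ← hq, ← hq]
    have h3 := hh.sum_le_tsum (szI m) (fun p _ => by positivity)
    rw [szI_sum m] at h3
    refine le_trans (le_of_eq ?_) h3
    simp only [dotProduct]
    rw [← Finset.sum_add_distrib]
    refine Finset.sum_congr rfl fun i _ => ?_
    rw [← Complex.normSq_eq_norm_sq, Complex.normSq_apply]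
  have hquad : ‖hm ⬝ᵥ (((1 + M)⁻¹).map Complex.ofReal).mulVec hm‖ ≤ κ⁻¹ * H := by
    rw [sz_inv_diag h2 h1 hKU hl0]
    refine (norm_sum_le _ _).trans ?_
    calc _ ≤ ∑ i, ‖((U.map Complex.ofReal)ᵀ *ᵥ hm) i‖ ^ 2 * κ⁻¹ := by
          refine Finset.sum_le_sum fun i _ => ?_
          rw [norm_mul, norm_pow, norm_inv, Complex.norm_real, Real.norm_of_nonneg (hl0 i).le]
          exact mul_le_mul_of_nonneg_left (inv_anti₀ hκ (hl i)) (by positivity)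
      _ = κ⁻¹ * ∑ i, ‖((U.map Complex.ofReal)ᵀ *ᵥ hm) i‖ ^ 2 := by rw [← Finset.sum_mul, mul_comm]
      _ ≤ κ⁻¹ * H := mul_le_mul_of_nonneg_left hy (inv_pos.mpr hκ).le
  rw [szL, norm_mul, norm_inv, Complex.norm_real, Complex.norm_exp, Real.norm_of_nonneg (Real.sqrt_nonneg _)]
  refine mul_le_mul (inv_anti₀ hsq0 hsq) (Real.exp_le_exp.mpr ?_) (Real.exp_pos _).le (inv_pos.mpr hsq0).le
  have h4 : ‖(1/2 : ℂ) * (hm ⬝ᵥ (((1 + M)⁻¹).map Complex.ofReal).mulVec hm)‖ ≤ 1/2 * (κ⁻¹ * H) := by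
    rw [norm_mul]
    norm_num
    linarith
  exact (neg_le_neg h4).trans ((neg_le_neg (Complex.abs_re_le_norm _)).trans (neg_abs_le _))

end

lemma szp_zpow_cont (k : ℤ) : Continuous (fun θ => szp θ ^ k) :=
  szp_cont.zpow₀ k (fun θ => Or.inl (szp_ne θ))

lemma szν_zpow (k : ℤ) : ∫ θ, szp θ ^ k ∂szν = if k = 0 then 1 else 0 := by
  split_ifs with h
  · subst h; simp
  · obtain ⟨m, rfl | rfl⟩ := k.eq_nat_or_neg
    · simp only [zpow_natCast]
      exact szν_pow (by simpa using h)
    · have h2 : m ≠ 0 := by simpa using h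
      rw [← szν_neg]
      rw [← szν_pow h2]
      congr 1; funext θ
      rw [szp_neg, szp_inv]; simp

lemma sz_L1_unique {H : ℝ → ℂ} (hH : Integrable H szν)
    (h0 : ∀ k : ℤ, ∫ θ, szp θ ^ k * H θ ∂szν = 0) : ∀ᵐ θ ∂szν, H θ = 0 := by
  have hHv : IntegrableOn H (Set.Icc (-Real.pi) Real.pi) := by
    unfold szν at hH
    exact (integrable_smul_measure (ENNReal.inv_ne_zero.2 ENNReal.ofReal_ne_top) (by simp [Real.pi_pos])).1 hH
  have key := IsOpen.ae_eq_zero_of_integral_contDiff_smul_eq_zero (μ := volume)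
    (f := H) (U := Set.Ioo (-Real.pi) Real.pi) isOpen_Ioo
    ((hHv.mono_set Set.Ioo_subset_Icc_self).locallyIntegrableOn) (by
    intro g hg hgc hgs
    have hcts : ContinuousOn (fun z : ℂ => (g z.arg : ℂ)) (Metric.sphere 0 1) := by
      obtain ⟨c, hc0, hc1, hc⟩ : ∃ c : ℝ, 0 ≤ c ∧ c < Real.pi ∧ ∀ x, g x ≠ 0 → |x| ≤ c := by
        rcases (tsupport g).eq_empty_or_nonempty with he | hne
        · refine ⟨0, le_rfl, Real.pi_pos, fun x hx => ?_⟩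
          have : x ∈ tsupport g := subset_tsupport g hx
          rw [he] at this; exact absurd this (Set.notMem_empty x)
        · obtain ⟨y, hy, hmax⟩ := hgc.isCompact.exists_isMaxOn hne (continuous_abs.continuousOn)
          refine ⟨|y|, abs_nonneg y, abs_lt.2 (hgs hy), fun x hx => hmax (subset_tsupport g hx)⟩
      intro z hz
      have hzn : ‖z‖ = 1 := mem_sphere_zero_iff_norm.1 hz
      by_cases hs : z ∈ Complex.slitPlane
      · exact (Complex.continuous_ofReal.continuousAt.comp
          (hg.continuous.continuousAt.comp (Complex.continuousAt_arg hs))).continuousWithinAt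
      · have hre : z.re = -1 := by
          rw [Complex.mem_slitPlane_iff] at hs
          push Not at hs
          have h1 := Complex.sq_norm z
          rw [hzn, Complex.normSq_apply, hs.2] at h1
          nlinarith
        have hcc : -1 < Real.cos c := by
          have := Real.cos_lt_cos_of_nonneg_of_le_pi hc0 le_rfl hc1
          rwa [Real.cos_pi] at this
        have hz0 : ∀ w : ℂ, ‖w‖ = 1 → w.re < Real.cos c → (g w.arg : ℂ) = 0 := by
          intro w hw hwc
          by_contra hne
          have h1 := hc w.arg (by simpa using hne)
          have h2 := Real.cos_le_cos_of_nonneg_of_le_pi (abs_nonneg _) hc1.le h1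
          rw [Real.cos_abs, Complex.cos_arg (by rw [← norm_ne_zero_iff, hw]; norm_num), hw,
            div_one] at h2
          linarith
        have hev : ∀ᶠ w in nhdsWithin z (Metric.sphere 0 1), (g w.arg : ℂ) = 0 := by
          have h1 : ∀ᶠ w in nhdsWithin z (Metric.sphere 0 1), w.re < Real.cos c :=
            nhdsWithin_le_nhds (Complex.continuous_re.continuousAt.eventually_lt_const
              (by rw [hre]; exact hcc))
          filter_upwards [h1, self_mem_nhdsWithin] with w hw1 hw2
          exact hz0 w (mem_sphere_zero_iff_norm.1 hw2) hw1
        refine ContinuousWithinAt.congr_of_eventuallyEq (f := fun _ => (0:ℂ)) continuousWithinAt_const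
          hev (hz0 z hzn (by rw [hre]; exact hcc))
    have h1 := sz_SW (φ := id) continuousOn_id (Set.injOn_id _) hH (fun a b => by
      rw [← h0 ((a:ℤ) - b)]
      congr 1; funext θ
      simp only [id]
      rw [szp_inv, zpow_sub₀ (szp_ne θ)]
      simp [div_eq_mul_inv]) hcts
    rw [szν, integral_smul_measure, smul_eq_zero] at h1
    have h2 := h1.resolve_left (by
      rw [ENNReal.toReal_inv, ENNReal.toReal_ofReal (by positivity)]
      positivity)
    rw [← setIntegral_eq_integral_of_forall_compl_eq_zero (s := Set.Ioo (-Real.pi) Real.pi)]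
    · rw [integral_Icc_eq_integral_Ioo] at h2
      rw [← h2]
      refine setIntegral_congr_fun measurableSet_Ioo fun θ hθ => ?_
      have : (szp θ).arg = θ := by
        unfold szp
        rw [mul_comm, Complex.arg_exp_mul_I, toIocMod_eq_self]
        exact ⟨hθ.1, by linarith [hθ.2]⟩
      rw [this]; simp
    · intro x hx
      have : g x = 0 := by
        by_contra hne
        exact hx (hgs (subset_tsupport g hne))
      simp [this])
  unfold szν
  refine Measure.ae_smul_measure ?_ _
  rw [← restrict_Ioo_eq_restrict_Icc]
  rw [ae_restrict_iff' measurableSet_Ioo]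
  exact key

noncomputable def szLp (k : ℤ) : Lp ℂ 2 szν :=
  MemLp.toLp (fun θ => szp θ ^ k) (MemLp.of_bound (szp_zpow_cont k).aestronglyMeasurable 1
    (Filter.Eventually.of_forall fun θ => by simp [szp_norm]))

lemma szLp_coe (k : ℤ) : szLp k =ᵐ[szν] fun θ => szp θ ^ k := MemLp.coeFn_toLp _

lemma szp_conj_zpow (θ : ℝ) (k : ℤ) : (starRingEnd ℂ) (szp θ ^ k) = szp θ ^ (-k) := by
  rw [map_zpow₀, szp_inv, _root_.inv_zpow, _root_.zpow_neg]

lemma szLp_inner (k : ℤ) (f : Lp ℂ 2 szν) : inner ℂ (szLp k) f = ∫ θ, szp θ ^ (-k) * f θ ∂szν := by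
  rw [L2.inner_def]
  refine integral_congr_ae ?_
  filter_upwards [szLp_coe k] with θ h
  rw [h, RCLike.inner_apply', szp_conj_zpow]

lemma szLp_on : Orthonormal ℂ szLp := by
  rw [orthonormal_iff_ite]
  intro k l
  rw [szLp_inner]
  have : ∫ θ, szp θ ^ (-k) * (szLp l) θ ∂szν = ∫ θ, szp θ ^ (-k + l) ∂szν := by
    refine integral_congr_ae ?_
    filter_upwards [szLp_coe l] with θ h
    rw [h, zpow_add₀ (szp_ne θ)]
  rw [this, szν_zpow]
  by_cases h : k = l
  · simp [h]
  · rw [if_neg, if_neg h]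
    intro h2; exact h (by omega)

lemma sz_fourier {H : ℝ → ℂ} (hH : Integrable H szν) {c : ℤ → ℂ}
    (hc : ∀ k : ℤ, c k = ∫ θ, szp θ ^ (-k) * H θ ∂szν) (hs : Summable fun k => ‖c k‖ ^ 2) :
    ∃ ms : ℕ → ℕ, StrictMono ms ∧ ∀ᵐ θ ∂szν,
      Tendsto (fun j => ∑ k ∈ Finset.Icc (-(ms j : ℤ)) (ms j), c k * szp θ ^ k) atTop (nhds (H θ)) := by
  have h1 : Summable fun k => c k • szLp k := by
    have := (szLp_on.orthogonalFamily.summable_iff_norm_sq_summable c).2 hs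
    simpa using this
  obtain ⟨F, hF⟩ := h1
  have hcF : ∀ k, ∫ θ, szp θ ^ (-k) * F θ ∂szν = c k := by
    intro k
    rw [← szLp_inner]
    have h2 := (innerSL ℂ (szLp k)).hasSum hF
    refine h2.unique ?_
    have h3 : ∀ l, (innerSL ℂ (szLp k)) (c l • szLp l) = if l = k then c k else 0 := by
      intro l
      rw [innerSL_apply_apply, inner_smul_right, orthonormal_iff_ite.1 szLp_on]
      by_cases h : k = l
      · simp [h]
      · rw [if_neg h, if_neg (fun h' => h h'.symm), mul_zero]
    have h4 := hasSum_ite_eq k (c k)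
    refine HasSum.congr_fun h4 ?_
    intro l; exact (h3 l)
  have hFi : Integrable F szν := (Lp.memLp F).integrable (by norm_num)
  have hFH : ∀ᵐ θ ∂szν, F θ - H θ = 0 := by
    refine sz_L1_unique (hFi.sub hH) fun k => ?_
    have hb : ∀ f : ℝ → ℂ, Integrable f szν → Integrable (fun θ => szp θ ^ k * f θ) szν := fun f hf =>
      hf.bdd_mul (c := 1) (szp_zpow_cont k).aestronglyMeasurable
        (Filter.Eventually.of_forall fun θ => by simp [szp_norm])
    simp only [mul_sub]
    rw [integral_sub (hb _ hFi) (hb _ hH)]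
    have := hcF (-k)
    rw [hc (-k), neg_neg] at this
    rw [this, sub_self]
  have ht : Tendsto (fun m : ℕ => ∑ k ∈ Finset.Icc (-(m : ℤ)) m, c k • szLp k) atTop (nhds F) :=
    hF.comp (Finset.tendsto_Icc_neg_atTop_atTop.comp tendsto_natCast_atTop_atTop)
  obtain ⟨ms, hms, hae⟩ := (tendstoInMeasure_of_tendsto_Lp ht).exists_seq_tendsto_ae
  refine ⟨ms, hms, ?_⟩
  have hall : ∀ᵐ θ ∂szν, ∀ k : ℤ, szLp k θ = szp θ ^ k := ae_all_iff.2 szLp_coe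
  have hsum : ∀ᵐ θ ∂szν, ∀ m : ℕ, (∑ k ∈ Finset.Icc (-(m : ℤ)) m, c k • szLp k : Lp ℂ 2 szν) θ
      = ∑ k ∈ Finset.Icc (-(m : ℤ)) m, c k * szLp k θ := by
    refine ae_all_iff.2 fun m => ?_
    have hsm : ∀ᵐ θ ∂szν, ∀ k : ℤ, (c k • szLp k : Lp ℂ 2 szν) θ = c k * szLp k θ :=
      ae_all_iff.2 fun k => by
        filter_upwards [Lp.coeFn_smul (c k) (szLp k)] with θ h
        rw [h]; rfl
    filter_upwards [Lp.coeFn_finsetSum (Finset.Icc (-(m : ℤ)) m) (fun k => c k • szLp k), hsm] with θ h h'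
    rw [h, Finset.sum_apply]
    exact Finset.sum_congr rfl fun k _ => h' k
  filter_upwards [hae, hall, hsum, hFH] with θ h1 h2 h3 h4
  rw [← sub_eq_zero.1 h4]
  refine h1.congr fun j => ?_
  rw [h3]
  exact Finset.sum_congr rfl fun k _ => by rw [h2]

lemma sz_sum_Icc (f : ℤ → ℂ) (m : ℕ) : ∑ k ∈ Finset.Icc (-(m : ℤ)) m, f k
    = f 0 + ∑ n ∈ Finset.range m, (f ((n:ℤ)+1) + f (-((n:ℤ)+1))) := by
  induction m with
  | zero => simp
  | succ m ih =>
    have h : Finset.Icc (-((m+1 : ℕ) : ℤ)) ((m+1 : ℕ) : ℤ)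
        = insert ((m:ℤ)+1) (insert (-((m:ℤ)+1)) (Finset.Icc (-(m : ℤ)) m)) := by
      ext x
      simp only [Finset.mem_Icc, Finset.mem_insert]
      push_cast
      omega
    rw [h, Finset.sum_insert, Finset.sum_insert, ih, Finset.sum_range_succ]
    · ring
    · simp only [Finset.mem_Icc]; omega
    · simp only [Finset.mem_Icc, Finset.mem_insert]; omega

lemma szp_zpow_pos (θ : ℝ) (n : ℕ) : szp θ ^ ((n:ℤ)+1)
    = (Real.cos (((n+1:ℕ):ℝ) * θ) : ℂ) + Complex.I * (Real.sin (((n+1:ℕ):ℝ) * θ) : ℂ) := by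
  unfold szp
  rw [← Complex.exp_int_mul]
  push_cast
  rw [mul_comm Complex.I (Complex.sin _), ← Complex.exp_mul_I]
  congr 1; ring

lemma szp_zpow_negg (θ : ℝ) (n : ℕ) : szp θ ^ (-((n:ℤ)+1))
    = (Real.cos (((n+1:ℕ):ℝ) * θ) : ℂ) - Complex.I * (Real.sin (((n+1:ℕ):ℝ) * θ) : ℂ) := by
  rw [← szp_conj_zpow, szp_zpow_pos]
  rw [map_add, map_mul, Complex.conj_I, Complex.conj_ofReal, Complex.conj_ofReal]
  ring

lemma sz_G {G : ℝ → ℂ} {A0 : ℂ} {A B : ℕ → ℂ}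
    (hGint : IntegrableOn G (Set.Icc (-Real.pi) Real.pi))
    (hA0 : A0 = ((Real.pi : ℂ))⁻¹ * ∫ θ in Set.Icc (-Real.pi) Real.pi, G θ)
    (hA : ∀ k : ℕ, 1 ≤ k → A k = ((Real.pi : ℂ))⁻¹ *
      ∫ θ in Set.Icc (-Real.pi) Real.pi, G θ * (Real.cos (k * θ) : ℂ))
    (hB : ∀ k : ℕ, 1 ≤ k → B k = ((Real.pi : ℂ))⁻¹ *
      ∫ θ in Set.Icc (-Real.pi) Real.pi, G θ * (Real.sin (k * θ) : ℂ))
    (hg : Summable (fun k : ℕ =>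
      ((k : ℝ) + 1) * (‖A (k + 1)‖ ^ 2 + ‖B (k + 1)‖ ^ 2))) :
    ∃ ms : ℕ → ℕ, StrictMono ms ∧ ∀ᵐ θ ∂szν,
      Tendsto (fun j => ∑ k ∈ Finset.range (ms j), (A (k+1) * (Real.cos (((k+1:ℕ):ℝ) * θ) : ℂ)
        + B (k+1) * (Real.sin (((k+1:ℕ):ℝ) * θ) : ℂ))) atTop (nhds (G θ - A0 / 2)) := by
  have hpi : (Real.pi : ℂ) ≠ 0 := by exact_mod_cast Real.pi_ne_zero
  have hν : ∀ f : ℝ → ℂ, ∫ θ, f θ ∂szν = (Real.pi : ℂ)⁻¹ * (∫ θ in Set.Icc (-Real.pi) Real.pi, f θ) / 2 := by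
    intro f
    rw [szν, integral_smul_measure, ENNReal.toReal_inv, ENNReal.toReal_ofReal (by positivity),
      Complex.real_smul]
    push_cast
    field_simp
  have hGν : Integrable G szν := by
    unfold szν
    exact hGint.smul_measure (by simp [Real.pi_pos])
  have hcos : ∀ n : ℕ, Integrable (fun θ => G θ * (Real.cos ((n:ℝ) * θ) : ℂ)) szν := fun n => by
    refine Integrable.mul_bdd (c := 1) hGν (Continuous.aestronglyMeasurable (by fun_prop))
      (Filter.Eventually.of_forall fun θ => ?_)
    rw [Complex.norm_real]; exact Real.abs_cos_le_one _
  have hsin : ∀ n : ℕ, Integrable (fun θ => G θ * (Real.sin ((n:ℝ) * θ) : ℂ)) szν := fun n => by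
    refine Integrable.mul_bdd (c := 1) hGν (Continuous.aestronglyMeasurable (by fun_prop))
      (Filter.Eventually.of_forall fun θ => ?_)
    rw [Complex.norm_real]; exact Real.abs_sin_le_one _
  have hAν : ∀ n : ℕ, ∫ θ, G θ * (Real.cos (((n+1:ℕ):ℝ) * θ) : ℂ) ∂szν = A (n+1) / 2 := fun n => by
    rw [hν, hA (n+1) (by omega)]
  have hBν : ∀ n : ℕ, ∫ θ, G θ * (Real.sin (((n+1:ℕ):ℝ) * θ) : ℂ) ∂szν = B (n+1) / 2 := fun n => by
    rw [hν, hB (n+1) (by omega)]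
  let c : ℤ → ℂ := fun k => ∫ θ, szp θ ^ (-k) * G θ ∂szν
  have hc0 : c 0 = A0 / 2 := by
    simp only [c, neg_zero, zpow_zero, one_mul]
    rw [hν, hA0]
  have hcp : ∀ n : ℕ, c ((n:ℤ)+1) = (A (n+1) - Complex.I * B (n+1)) / 2 := by
    intro n
    have : c ((n:ℤ)+1) = ∫ θ, (G θ * (Real.cos (((n+1:ℕ):ℝ) * θ) : ℂ)
        - Complex.I * (G θ * (Real.sin (((n+1:ℕ):ℝ) * θ) : ℂ))) ∂szν := by
      simp only [c]
      congr 1; funext θ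
      rw [szp_zpow_negg]; ring
    rw [this, integral_sub (hcos _) ((hsin _).const_mul _), integral_const_mul, hAν, hBν]
    ring
  have hcn : ∀ n : ℕ, c (-((n:ℤ)+1)) = (A (n+1) + Complex.I * B (n+1)) / 2 := by
    intro n
    have : c (-((n:ℤ)+1)) = ∫ θ, (G θ * (Real.cos (((n+1:ℕ):ℝ) * θ) : ℂ)
        + Complex.I * (G θ * (Real.sin (((n+1:ℕ):ℝ) * θ) : ℂ))) ∂szν := by
      simp only [c]
      congr 1; funext θ
      rw [neg_neg, szp_zpow_pos]; ring
    rw [this, integral_add (hcos _) ((hsin _).const_mul _), integral_const_mul, hAν, hBν]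
    ring
  have hbd : ∀ x y : ℂ, ∀ k : ℕ, ‖x‖ ≤ ‖A (k+1)‖ → ‖y‖ ≤ ‖B (k+1)‖ →
      ‖(x + y) / 2‖ ^ 2 ≤ ((k : ℝ) + 1) * (‖A (k + 1)‖ ^ 2 + ‖B (k + 1)‖ ^ 2) := by
    intro x y k hx hy
    have h1 : ‖(x + y) / 2‖ ≤ (‖A (k+1)‖ + ‖B (k+1)‖) / 2 := by
      rw [norm_div, Complex.norm_ofNat]
      have := norm_add_le x y
      linarith
    have h2 : ‖(x + y) / 2‖ ^ 2 ≤ ((‖A (k+1)‖ + ‖B (k+1)‖) / 2) ^ 2 := by gcongr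
    have h3 : (0:ℝ) ≤ k * (‖A (k + 1)‖ ^ 2 + ‖B (k + 1)‖ ^ 2) := by positivity
    nlinarith [sq_nonneg (‖A (k+1)‖ - ‖B (k+1)‖), sq_nonneg ‖A (k+1)‖, sq_nonneg ‖B (k+1)‖]
  have hs : Summable fun k => ‖c k‖ ^ 2 := by
    refine Summable.of_nat_of_neg ?_ ?_
    · rw [← summable_nat_add_iff 1]
      refine Summable.of_nonneg_of_le (fun _ => by positivity) (fun k => ?_) hg
      push_cast
      rw [hcp, sub_eq_add_neg]
      exact hbd _ _ k le_rfl (by simp)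
    · rw [← summable_nat_add_iff 1]
      refine Summable.of_nonneg_of_le (fun _ => by positivity) (fun k => ?_) hg
      push_cast
      rw [hcn]
      exact hbd _ _ k le_rfl (by simp)
  obtain ⟨ms, hms, hae⟩ := sz_fourier hGν (fun k => rfl) hs
  refine ⟨ms, hms, ?_⟩
  filter_upwards [hae] with θ h
  have h2 := h.sub_const (A0 / 2)
  refine h2.congr fun j => ?_
  rw [sz_sum_Icc (fun k => c k * szp θ ^ k)]
  simp only [zpow_zero, hc0, mul_one]
  rw [add_sub_cancel_left]
  refine Finset.sum_congr rfl fun k _ => ?_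
  rw [hcp, hcn, szp_zpow_pos, szp_zpow_negg]
  linear_combination (-(B (k+1) * (Real.sin (((k+1:ℕ):ℝ) * θ) : ℂ))) * Complex.I_sq

lemma szu_W {n : ℕ} (θ : Fin n → ℝ) (k : ℕ) :
    szu (szW θ) k = (Real.sqrt 2 : ℂ) * ∑ μ, szp (-(θ μ)) ^ (k+1) := by
  have h1 : ∑ μ, szp (-(θ μ)) ^ (k+1) = (starRingEnd ℂ) (szZ θ k) := by
    unfold szZ
    rw [map_sum]
    refine Finset.sum_congr rfl fun μ _ => ?_
    rw [map_pow, szp_neg]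
  have h2 : Real.sqrt ((k:ℝ)+1) * Real.sqrt (2 / ((k:ℝ)+1)) = Real.sqrt 2 := by
    rw [← Real.sqrt_mul (by positivity)]
    congr 1; field_simp
  have h3 : (starRingEnd ℂ) (szZ θ k) = ((szZ θ k).re : ℂ) - Complex.I * ((szZ θ k).im : ℂ) := by
    apply Complex.ext <;> simp
  rw [h1, h3, ← h2]
  simp only [szu, szW, Sum.elim_inl, Sum.elim_inr]
  push_cast
  ring

lemma szq_lim {b : ℕ → ℕ → ℂ} (hb : Summable fun p : ℕ × ℕ => ‖b p.1 p.2‖)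
    (hKs : Summable fun p : (ℕ ⊕ ℕ) × (ℕ ⊕ ℕ) => |szK b p.1 p.2|) {n : ℕ} (θ : Fin n → ℝ) :
    Tendsto (fun m => szq (szK b) m θ) atTop (nhds (∑ μ, ∑ ν, szFF b (θ μ) (θ ν)).re) := by
  have hs : Summable fun p : (ℕ ⊕ ℕ) × (ℕ ⊕ ℕ) => szK b p.1 p.2 * (szW θ p.1 * szW θ p.2) := by
    refine Summable.of_norm_bounded (hKs.mul_right ((2 * (n:ℝ)) * (2 * n))) fun p => ?_
    rw [Real.norm_eq_abs, abs_mul, abs_mul]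
    exact mul_le_mul_of_nonneg_left (mul_le_mul (szW_abs _ _) (szW_abs _ _) (abs_nonneg _)
      (by positivity)) (abs_nonneg _)
  have hval : ∑' p : (ℕ ⊕ ℕ) × (ℕ ⊕ ℕ), szK b p.1 p.2 * (szW θ p.1 * szW θ p.2)
      = 2 * (∑ μ, ∑ ν, szFF b (θ μ) (θ ν)).re := by
    have h4 := sz_tsum4 hs
    simp only [← szu_form] at h4
    have hF : ∀ μ ν, HasSum (fun p : ℕ × ℕ => b p.1 p.2 * szp (-(θ μ)) ^ (p.1+1) * szp (-(θ ν)) ^ (p.2+1))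
        (szFF b (θ μ) (θ ν)) := fun μ ν => by
      refine Summable.hasSum (Summable.of_norm ?_)
      simp_rw [szFF_term_norm]; exact hb
    have h5 := (hasSum_sum fun μ (_ : μ ∈ (Finset.univ : Finset (Fin n))) =>
      hasSum_sum fun ν (_ : ν ∈ (Finset.univ : Finset (Fin n))) => hF μ ν).mul_left 2
    have h6 := Complex.hasSum_re h5
    have h7 : (2 * ∑ μ, ∑ ν, szFF b (θ μ) (θ ν)).re = 2 * (∑ μ, ∑ ν, szFF b (θ μ) (θ ν)).re := by
      simp
    rw [← h7]
    refine h4.unique (HasSum.congr_fun h6 fun q => ?_)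
    congr 1
    rw [szu_W, szu_W]
    have h2 : (Real.sqrt 2 : ℂ) * (Real.sqrt 2 : ℂ) = 2 := by
      rw [← Complex.ofReal_mul, Real.mul_self_sqrt (by norm_num)]; simp
    have h8 : ∑ μ, ∑ ν, b q.1 q.2 * szp (-(θ μ)) ^ (q.1+1) * szp (-(θ ν)) ^ (q.2+1)
        = b q.1 q.2 * ((∑ μ, szp (-(θ μ)) ^ (q.1+1)) * ∑ ν, szp (-(θ ν)) ^ (q.2+1)) := by
      rw [Finset.sum_mul_sum, Finset.mul_sum]
      refine Finset.sum_congr rfl fun μ _ => ?_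
      rw [Finset.mul_sum]
      refine Finset.sum_congr rfl fun ν _ => ?_
      ring
    rw [h8, ← h2]
    ring
  have ht : Tendsto (fun m => szI m ×ˢ szI m) atTop atTop := by
    refine Filter.tendsto_atTop.2 fun s => ?_
    classical
    obtain ⟨M1, h1⟩ := szI_exhaust (s.image Prod.fst)
    obtain ⟨M2, h2⟩ := szI_exhaust (s.image Prod.snd)
    filter_upwards [eventually_ge_atTop M1, eventually_ge_atTop M2] with m hm1 hm2
    intro p hp
    exact Finset.mem_product.2 ⟨h1 m hm1 (Finset.mem_image_of_mem _ hp),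
      h2 m hm2 (Finset.mem_image_of_mem _ hp)⟩
  have h := (hs.hasSum.comp ht).const_mul (1/2)
  rw [hval] at h
  have e : 1/2 * (2 * (∑ μ, ∑ ν, szFF b (θ μ) (θ ν)).re) = (∑ μ, ∑ ν, szFF b (θ μ) (θ ν)).re := by ring
  rw [e] at h
  exact h

/-- linear coefficients -/
noncomputable def szh (A B : ℕ → ℂ) : ℕ ⊕ ℕ → ℂ :=
  Sum.elim (fun k => (Real.sqrt (((k:ℝ)+1) / 2) : ℂ) * A (k+1))
    (fun k => (Real.sqrt (((k:ℝ)+1) / 2) : ℂ) * B (k+1))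

lemma szh_summable {A B : ℕ → ℂ} (hg : Summable (fun k : ℕ =>
      ((k : ℝ) + 1) * (‖A (k + 1)‖ ^ 2 + ‖B (k + 1)‖ ^ 2))) :
    Summable fun i => ‖szh A B i‖ ^ 2 := by
  have key : ∀ (k : ℕ) (x : ℂ), ‖(Real.sqrt (((k:ℝ)+1) / 2) : ℂ) * x‖ ^ 2 = ((k:ℝ)+1)/2 * ‖x‖^2 := by
    intro k x
    rw [norm_mul, mul_pow, Complex.norm_real, Real.norm_eq_abs, sq_abs, Real.sq_sqrt (by positivity)]
  have h1 : Summable fun k : ℕ => ‖szh A B (Sum.inl k)‖ ^ 2 := by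
    refine Summable.of_nonneg_of_le (fun _ => by positivity) (fun k => ?_) hg
    simp only [szh, Sum.elim_inl]
    rw [key]
    nlinarith [sq_nonneg ‖A (k+1)‖, sq_nonneg ‖B (k+1)‖, mul_nonneg (Nat.cast_nonneg (α := ℝ) k) (sq_nonneg ‖A (k+1)‖), mul_nonneg (Nat.cast_nonneg (α := ℝ) k) (sq_nonneg ‖B (k+1)‖)]
  have h2 : Summable fun k : ℕ => ‖szh A B (Sum.inr k)‖ ^ 2 := by
    refine Summable.of_nonneg_of_le (fun _ => by positivity) (fun k => ?_) hg
    simp only [szh, Sum.elim_inr]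
    rw [key]
    nlinarith [sq_nonneg ‖A (k+1)‖, sq_nonneg ‖B (k+1)‖, mul_nonneg (Nat.cast_nonneg (α := ℝ) k) (sq_nonneg ‖A (k+1)‖), mul_nonneg (Nat.cast_nonneg (α := ℝ) k) (sq_nonneg ‖B (k+1)‖)]
  have h3 : HasSum (fun i => ‖szh A B i‖ ^ 2) _ := HasSum.sum h1.hasSum h2.hasSum
  exact h3.summable

lemma szx_eq (A B : ℕ → ℂ) {n : ℕ} (m : ℕ) (θ : Fin n → ℝ) :
    szx (szh A B) m θ = ∑ μ, ∑ k ∈ Finset.range m, (A (k+1) * (Real.cos (((k+1:ℕ):ℝ) * θ μ) : ℂ)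
        + B (k+1) * (Real.sin (((k+1:ℕ):ℝ) * θ μ) : ℂ)) := by
  have hr : ∀ k : ℕ, (Real.sqrt (((k:ℝ)+1) / 2) : ℂ) * (Real.sqrt (2 / ((k:ℝ)+1)) : ℂ) = 1 := by
    intro k
    rw [← Complex.ofReal_mul, ← Real.sqrt_mul (by positivity)]
    have : ((k:ℝ)+1) / 2 * (2 / ((k:ℝ)+1)) = 1 := by field_simp
    rw [this]; simp
  have hz : ∀ (k : ℕ), szZ θ k = ∑ μ, ((Real.cos (((k+1:ℕ):ℝ) * θ μ) : ℂ) + Complex.I * (Real.sin (((k+1:ℕ):ℝ) * θ μ) : ℂ)) := by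
    intro k
    unfold szZ
    refine Finset.sum_congr rfl fun μ _ => ?_
    rw [← szp_zpow_pos]
    norm_cast
  have hre : ∀ k : ℕ, (szZ θ k).re = ∑ μ, Real.cos (((k+1:ℕ):ℝ) * θ μ) := fun k => by
    rw [hz, Complex.re_sum]
    refine Finset.sum_congr rfl fun μ _ => ?_
    simp [-Complex.ofReal_cos, -Complex.ofReal_sin]
  have him : ∀ k : ℕ, (szZ θ k).im = ∑ μ, Real.sin (((k+1:ℕ):ℝ) * θ μ) := fun k => by
    rw [hz, Complex.im_sum]
    refine Finset.sum_congr rfl fun μ _ => ?_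
    simp [-Complex.ofReal_cos, -Complex.ofReal_sin]
  unfold szx
  rw [szI_sum, Fintype.sum_sum_type, Finset.sum_comm, ← Finset.sum_add_distrib, Finset.sum_range]
  refine Finset.sum_congr rfl fun k _ => ?_
  simp only [szi, Sum.map_inl, Sum.map_inr, szh, szW, Sum.elim_inl, Sum.elim_inr]
  rw [hre, him, Finset.sum_add_distrib, ← Finset.mul_sum, ← Finset.mul_sum]
  simp only [Complex.ofReal_mul, Complex.ofReal_sum]
  linear_combination (A (↑k + 1) * ∑ i, (Real.cos (((↑k + 1 : ℕ):ℝ) * θ i) : ℂ) + B (↑k + 1) * ∑ i, (Real.sin (((↑k + 1 : ℕ):ℝ) * θ i) : ℂ)) * hr k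

/-- limiting exponent -/
noncomputable def szTT (b : ℕ → ℕ → ℂ) (G : ℝ → ℂ) (A0 : ℂ) (n : ℕ) (θ : Fin n → ℝ) : ℂ :=
  -((∑ μ, ∑ ν, szFF b (θ μ) (θ ν)).re : ℂ) + ∑ μ, (G (θ μ) - A0 / 2)

lemma szE_ac (n : ℕ) {p : (Fin n → ℝ) → Prop} (h : ∀ᵐ θ ∂(Measure.pi fun _ : Fin n => szν), p θ) :
    ∀ᵐ θ ∂(szE n), p θ := (withDensity_absolutelyContinuous _ _).ae_le h

lemma szTT_lim {b : ℕ → ℕ → ℂ} (hb : Summable fun p : ℕ × ℕ => ‖b p.1 p.2‖)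
    (hKs : Summable fun p : (ℕ ⊕ ℕ) × (ℕ ⊕ ℕ) => |szK b p.1 p.2|)
    {G : ℝ → ℂ} {A0 : ℂ} {A B : ℕ → ℂ} {ms : ℕ → ℕ} (hms : Tendsto ms atTop atTop)
    (hG : ∀ᵐ θ ∂szν, Tendsto (fun j => ∑ k ∈ Finset.range (ms j), (A (k+1) * (Real.cos (((k+1:ℕ):ℝ) * θ) : ℂ)
        + B (k+1) * (Real.sin (((k+1:ℕ):ℝ) * θ) : ℂ))) atTop (nhds (G θ - A0 / 2))) (n : ℕ) :
    ∀ᵐ θ ∂(szE n), Tendsto (fun j => szT (szK b) (szh A B) (ms j) θ) atTop (nhds (szTT b G A0 n θ)) := by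
  apply szE_ac
  have h1 : ∀ᵐ θ ∂(Measure.pi fun _ : Fin n => szν), ∀ μ : Fin n,
      Tendsto (fun j => ∑ k ∈ Finset.range (ms j), (A (k+1) * (Real.cos (((k+1:ℕ):ℝ) * θ μ) : ℂ)
        + B (k+1) * (Real.sin (((k+1:ℕ):ℝ) * θ μ) : ℂ))) atTop (nhds (G (θ μ) - A0 / 2)) :=
    ae_all_iff.2 fun μ =>
      (Measure.tendsto_eval_ae_ae (μ := fun _ : Fin n => szν) (i := μ)).eventually hG
  filter_upwards [h1] with θ hθ
  unfold szT szTT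
  refine Tendsto.add ?_ ?_
  · exact ((Complex.continuous_ofReal.tendsto _).comp ((szq_lim hb hKs θ).comp hms)).neg
  · simp only [szx_eq]
    exact tendsto_finsetSum _ fun μ _ => hθ μ

/-- Grunsky series off the circle -/
noncomputable def szFz (b : ℕ → ℕ → ℂ) (q : ℂ × ℂ) : ℂ :=
  ∑' p : ℕ × ℕ, b p.1 p.2 * q.1⁻¹ ^ (p.1+1) * q.2⁻¹ ^ (p.2+1)

lemma sz_inv_zpow (z : ℂ) (k : ℕ) : z ^ (-(k:ℤ) - 1) = z⁻¹ ^ (k+1) := by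
  rw [inv_pow, ← zpow_natCast, ← _root_.zpow_neg]
  congr 1; push_cast; ring

lemma szFz_eq (b : ℕ → ℕ → ℂ) (θ η : ℝ) : szFz b (szp θ, szp η) = szFF b θ η := by
  simp only [szFz, szFF, szp_neg, szp_inv]

lemma szFz_cont {b : ℕ → ℕ → ℂ} (hb : Summable fun p : ℕ × ℕ => ‖b p.1 p.2‖) :
    ContinuousOn (szFz b) ({z : ℂ | 1 ≤ ‖z‖} ×ˢ {z : ℂ | 1 ≤ ‖z‖}) := by
  refine continuousOn_tsum (fun p => ?_) hb fun p q hq => ?_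
  · have h1 : ContinuousOn (fun q : ℂ × ℂ => q.1⁻¹) ({z : ℂ | 1 ≤ ‖z‖} ×ˢ {z : ℂ | 1 ≤ ‖z‖}) :=
      continuousOn_fst.inv₀ fun q hq h0 => by
        have := hq.1
        simp only [Set.mem_ofPred_eq, h0, norm_zero] at this
        linarith
    have h2 : ContinuousOn (fun q : ℂ × ℂ => q.2⁻¹) ({z : ℂ | 1 ≤ ‖z‖} ×ˢ {z : ℂ | 1 ≤ ‖z‖}) :=
      continuousOn_snd.inv₀ fun q hq h0 => by
        have := hq.2
        simp only [Set.mem_ofPred_eq, h0, norm_zero] at this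
        linarith
    exact (continuousOn_const.mul (h1.pow _)).mul (h2.pow _)
  · have h1 : ‖q.1⁻¹‖ ≤ 1 := by rw [norm_inv]; exact inv_le_one_of_one_le₀ hq.1
    have h2 : ‖q.2⁻¹‖ ≤ 1 := by rw [norm_inv]; exact inv_le_one_of_one_le₀ hq.2
    rw [norm_mul, norm_mul, norm_pow, norm_pow]
    have h3 := pow_le_one₀ (n := p.1+1) (norm_nonneg _) h1
    have h4 := pow_le_one₀ (n := p.2+1) (norm_nonneg _) h2
    calc ‖b p.1 p.2‖ * ‖q.1⁻¹‖ ^ (p.1+1) * ‖q.2⁻¹‖ ^ (p.2+1)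
        ≤ ‖b p.1 p.2‖ * 1 * 1 := by gcongr
      _ = _ := by ring

lemma sz_diag_out {φ ψ : ℂ → ℂ} {b : ℕ → ℕ → ℂ} (hb : Summable fun p : ℕ × ℕ => ‖b p.1 p.2‖)
    (hholo : DifferentiableOn ℂ φ {z : ℂ | 1 < ‖z‖})
    (hψ : ∀ z : ℂ, 1 < ‖z‖ → ψ z = deriv φ z)
    (hF : ∀ z ζ : ℂ, 1 ≤ ‖z‖ → 1 ≤ ‖ζ‖ → z ≠ ζ → φ ζ - φ z = (ζ - z) * Complex.exp (-szFz b (ζ, z)))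
    (z : ℂ) (hz : 1 < ‖z‖) : ψ z = Complex.exp (-szFz b (z, z)) := by
  have ho : IsOpen {z : ℂ | 1 < ‖z‖} := isOpen_lt continuous_const continuous_norm
  have hd : HasDerivAt φ (deriv φ z) z := ((hholo z hz).differentiableAt (ho.mem_nhds hz)).hasDerivAt
  rw [hasDerivAt_iff_tendsto_slope] at hd
  rw [hψ z hz]
  refine tendsto_nhds_unique hd ?_
  have hev : ∀ᶠ ζ in nhdsWithin z {z}ᶜ, slope φ z ζ = Complex.exp (-szFz b (ζ, z)) := by
    filter_upwards [nhdsWithin_le_nhds (ho.mem_nhds hz), self_mem_nhdsWithin] with ζ h1 h2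
    have h3 : ζ - z ≠ 0 := sub_ne_zero.2 h2
    rw [slope_def_field, hF z ζ hz.le (le_of_lt h1) (fun h => h2 h.symm)]
    field_simp
  refine Tendsto.congr' (hev.mono fun _ h => h.symm) ?_
  have hc : ContinuousAt (szFz b) (z, z) := (szFz_cont hb).continuousAt
    (Filter.mem_of_superset ((ho.prod ho).mem_nhds ⟨hz, hz⟩) fun q hq =>
      ⟨(show (1:ℝ) < ‖q.1‖ from hq.1).le, (show (1:ℝ) < ‖q.2‖ from hq.2).le⟩)
  have hc2 : ContinuousAt (fun ζ : ℂ => szFz b (ζ, z)) z :=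
    ContinuousAt.comp (f := fun ζ : ℂ => (ζ, z)) hc (by fun_prop)
  exact ((Complex.continuous_exp.continuousAt.comp hc2.neg).tendsto).mono_left nhdsWithin_le_nhds

lemma sz_diag {φ ψ : ℂ → ℂ} {b : ℕ → ℕ → ℂ} (hb : Summable fun p : ℕ × ℕ => ‖b p.1 p.2‖)
    (hholo : DifferentiableOn ℂ φ {z : ℂ | 1 < ‖z‖})
    (hψcont : ContinuousOn ψ {z : ℂ | 1 ≤ ‖z‖})
    (hψ : ∀ z : ℂ, 1 < ‖z‖ → ψ z = deriv φ z)
    (hF : ∀ z ζ : ℂ, 1 ≤ ‖z‖ → 1 ≤ ‖ζ‖ → z ≠ ζ → φ ζ - φ z = (ζ - z) * Complex.exp (-szFz b (ζ, z)))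
    (θ : ℝ) : ψ (szp θ) = Complex.exp (-szFF b θ θ) := by
  let s : ℕ → ℂ := fun j => ((1 + 1 / ((j:ℝ) + 1) : ℝ) : ℂ) * szp θ
  have hsn : ∀ j, 1 < ‖s j‖ := fun j => by
    simp only [s]
    rw [norm_mul, szp_norm, mul_one, Complex.norm_real, Real.norm_eq_abs, abs_of_pos (by positivity)]
    have : (0:ℝ) < 1 / ((j:ℝ) + 1) := by positivity
    linarith
  have hs : Tendsto s atTop (nhds (szp θ)) := by
    have h1 : Tendsto (fun j : ℕ => (1:ℝ) + 1 / ((j:ℝ) + 1)) atTop (nhds (1 + 0)) :=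
      tendsto_const_nhds.add tendsto_one_div_add_atTop_nhds_zero_nat
    have h2 := ((Complex.continuous_ofReal.tendsto _).comp h1).mul_const (szp θ)
    simpa [s] using h2
  have hs' : Tendsto s atTop (nhdsWithin (szp θ) {z : ℂ | 1 ≤ ‖z‖}) :=
    tendsto_nhdsWithin_iff.2 ⟨hs, Eventually.of_forall fun j => (hsn j).le⟩
  have hmem : szp θ ∈ {z : ℂ | 1 ≤ ‖z‖} := (szp_norm θ).ge
  have h1 : Tendsto (fun j => ψ (s j)) atTop (nhds (ψ (szp θ))) := (hψcont _ hmem).tendsto.comp hs'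
  have h2 : Tendsto (fun j => Complex.exp (-szFz b (s j, s j))) atTop
      (nhds (Complex.exp (-szFz b (szp θ, szp θ)))) := by
    have h3 := (szFz_cont hb (szp θ, szp θ) ⟨hmem, hmem⟩).tendsto
    rw [nhdsWithin_prod_eq] at h3
    exact (Complex.continuous_exp.tendsto _).comp ((h3.comp (hs'.prodMk hs')).neg)
  rw [← szFz_eq]
  refine tendsto_nhds_unique h1 (h2.congr fun j => ?_)
  exact (sz_diag_out hb hholo hψ hF _ (hsn j)).symm

lemma szV_norm {n : ℕ} (θ : Fin n → ℝ) : ‖szV θ‖ ^ 2 =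
    ∏ p ∈ Finset.univ.filter (fun p : Fin n × Fin n => p.1 < p.2), ‖szp (θ p.1) - szp (θ p.2)‖ ^ 2 := by
  unfold szV
  rw [Matrix.det_vandermonde, norm_prod, ← Finset.prod_pow, Finset.prod_filter, ← Finset.univ_product_univ,
    Finset.prod_product]
  refine Finset.prod_congr rfl fun i _ => ?_
  rw [norm_prod, ← Finset.prod_pow, ← Finset.prod_filter]
  refine Finset.prod_congr ?_ fun j _ => ?_
  · ext j; simp
  · rw [norm_sub_rev]

lemma sz_sum_split {n : ℕ} (f : Fin n → Fin n → ℝ) (hf : ∀ i j, f i j = f j i) :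
    ∑ i, ∑ j, f i j = 2 * ∑ p ∈ Finset.univ.filter (fun p : Fin n × Fin n => p.1 < p.2), f p.1 p.2
      + ∑ i, f i i := by
  have h1 : ∀ i j : Fin n, f i j = (if i < j then f i j else 0) + (if j < i then f j i else 0)
      + (if i = j then f i i else 0) := by
    intro i j
    rcases lt_trichotomy i j with h | h | h
    · simp [h, h.ne, h.not_gt]
    · subst h; simp
    · simp [h, h.ne', h.not_gt, hf i j]
  have h2 : ∑ p ∈ Finset.univ.filter (fun p : Fin n × Fin n => p.1 < p.2), f p.1 p.2
      = ∑ i, ∑ j, if i < j then f i j else 0 := by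
    rw [Finset.sum_filter, ← Finset.univ_product_univ, Finset.sum_product]
  have h3 : ∑ i, ∑ j, (if j < i then f j i else 0) = ∑ i, ∑ j, if i < j then f i j else 0 :=
    Finset.sum_comm
  calc ∑ i, ∑ j, f i j = ∑ i, ∑ j, ((if i < j then f i j else 0) + (if j < i then f j i else 0)
      + (if i = j then f i i else 0)) :=
        Finset.sum_congr rfl fun i _ => Finset.sum_congr rfl fun j _ => h1 i j
    _ = _ := by
      simp only [Finset.sum_add_distrib]
      rw [h3, h2]
      simp
      ring

lemma sz_integrand {φ ψ : ℂ → ℂ} {b : ℕ → ℕ → ℂ} (hsym : ∀ k l, b k l = b l k)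
    (hF : ∀ θ η, szp θ ≠ szp η → φ (szp θ) - φ (szp η) = (szp θ - szp η) * Complex.exp (-szFF b θ η))
    (hd : ∀ θ, ψ (szp θ) = Complex.exp (-szFF b θ θ)) {n : ℕ} (θ : Fin n → ℝ) :
    (∏ p ∈ Finset.univ.filter (fun p : Fin n × Fin n => p.1 < p.2),
      ‖φ (szp (θ p.1)) - φ (szp (θ p.2))‖ ^ 2) * ∏ μ, ‖ψ (szp (θ μ))‖
    = ‖szV θ‖ ^ 2 * Real.exp (-(∑ μ, ∑ ν, szFF b (θ μ) (θ ν)).re) := by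
  have h1 : ∀ p : Fin n × Fin n, ‖φ (szp (θ p.1)) - φ (szp (θ p.2))‖ ^ 2
      = ‖szp (θ p.1) - szp (θ p.2)‖ ^ 2 * Real.exp (-(2 * (szFF b (θ p.1) (θ p.2)).re)) := by
    intro p
    by_cases h : szp (θ p.1) = szp (θ p.2)
    · simp [h]
    · rw [hF _ _ h, norm_mul, Complex.norm_exp, mul_pow, ← Real.exp_nat_mul]
      congr 2; simp
  have h2 : ∀ μ, ‖ψ (szp (θ μ))‖ = Real.exp (-(szFF b (θ μ) (θ μ)).re) := fun μ => by
    rw [hd, Complex.norm_exp]; simp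
  have hs : ∀ i j, szFF b (θ i) (θ j) = szFF b (θ j) (θ i) := fun i j => by
    unfold szFF
    rw [← (Equiv.prodComm ℕ ℕ).tsum_eq]
    congr 1; funext p
    simp only [Equiv.prodComm_apply, Prod.fst_swap, Prod.snd_swap]
    rw [hsym p.2 p.1]; ring
  have h3 := sz_sum_split (fun i j => (szFF b (θ i) (θ j)).re) (fun i j => by rw [hs])
  simp only [h1, h2]
  rw [Finset.prod_mul_distrib, ← szV_norm, ← Real.exp_sum, ← Real.exp_sum, mul_assoc, ← Real.exp_add]
  congr 2
  rw [Complex.re_sum]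
  simp only [Complex.re_sum]
  rw [h3, Finset.sum_neg_distrib, Finset.sum_neg_distrib, ← Finset.mul_sum]
  ring

lemma szpi_eq (n : ℕ) : (Measure.pi fun _ : Fin n => szν) = ((ENNReal.ofReal (2 * Real.pi))⁻¹) ^ n •
    (volume.restrict (Set.pi Set.univ (fun _ : Fin n => Set.Icc (-Real.pi) Real.pi))) := by
  refine Measure.pi_eq fun s hs => ?_
  rw [volume_pi, Measure.restrict_pi_pi, Measure.smul_apply, Measure.pi_pi]
  simp only [szν, Measure.smul_apply, smul_eq_mul]
  rw [Finset.prod_mul_distrib]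
  simp

section final
variable {φ ψ : ℂ → ℂ} {b : ℕ → ℕ → ℂ} {G : ℝ → ℂ} {A0 : ℂ}

/-- the integrand of the determinant -/
noncomputable def szJ (φ ψ : ℂ → ℂ) (G : ℝ → ℂ) (n : ℕ) (θ : Fin n → ℝ) : ℂ :=
  (((∏ p ∈ Finset.univ.filter (fun p : Fin n × Fin n => p.1 < p.2),
            ‖φ (Complex.exp (Complex.I * (θ p.1 : ℂ)))
              - φ (Complex.exp (Complex.I * (θ p.2 : ℂ)))‖ ^ 2) *
          ∏ μ, ‖ψ (Complex.exp (Complex.I * (θ μ : ℂ)))‖ : ℝ) : ℂ) *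
        ∏ μ, Complex.exp (G (θ μ))

lemma szJ_eq (hsym : ∀ k l, b k l = b l k)
    (hF : ∀ θ η, szp θ ≠ szp η → φ (szp θ) - φ (szp η) = (szp θ - szp η) * Complex.exp (-szFF b θ η))
    (hd : ∀ θ, ψ (szp θ) = Complex.exp (-szFF b θ θ)) {n : ℕ} (θ : Fin n → ℝ) :
    (‖szV θ‖ ^ 2 / n.factorial : ℝ) • Complex.exp (szTT b G A0 n θ)
      = (1 / (n.factorial : ℂ)) * Complex.exp (-(n : ℂ) * A0 / 2) * szJ φ ψ G n θ := by
  have h1 := sz_integrand hsym hF hd θ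
  unfold szp at h1
  unfold szJ szTT
  rw [h1, Complex.real_smul, Complex.exp_add, Finset.sum_sub_distrib, sub_eq_add_neg, Complex.exp_add,
    Complex.exp_sum]
  simp only [Finset.sum_const, Finset.card_univ, Fintype.card_fin, nsmul_eq_mul]
  rw [show -(n:ℂ) * A0 / 2 = -((n:ℂ) * (A0 / 2)) by ring]
  push_cast
  ring

lemma szJ_int (hsym : ∀ k l, b k l = b l k)
    (hF : ∀ θ η, szp θ ≠ szp η → φ (szp θ) - φ (szp η) = (szp θ - szp η) * Complex.exp (-szFF b θ η))
    (hd : ∀ θ, ψ (szp θ) = Complex.exp (-szFF b θ θ)) {n : ℕ}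
    (hi : Integrable (fun θ => Complex.exp (szTT b G A0 n θ)) (szE n)) :
    IntegrableOn (szJ φ ψ G n) (Set.pi Set.univ (fun _ : Fin n => Set.Icc (-Real.pi) Real.pi)) := by
  rw [szE, integrable_withDensity_iff_integrable_smul (szE_meas n)] at hi
  have h2 : (fun θ : Fin n → ℝ => (Real.toNNReal (‖szV θ‖ ^ 2 / n.factorial)) • Complex.exp (szTT b G A0 n θ))
      = fun θ => (1 / (n.factorial : ℂ)) * Complex.exp (-(n : ℂ) * A0 / 2) * szJ φ ψ G n θ := by
    funext θ
    rw [← szJ_eq hsym hF hd, NNReal.smul_def, Real.coe_toNNReal _ (by positivity)]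
  rw [h2, integrable_const_mul_iff] at hi
  · rw [szpi_eq, integrable_smul_measure] at hi
    · exact hi
    · exact pow_ne_zero _ (ENNReal.inv_ne_zero.2 ENNReal.ofReal_ne_top)
    · exact ENNReal.pow_ne_top (by simp [Real.pi_pos])
  · refine IsUnit.mk0 _ (mul_ne_zero (one_div_ne_zero ?_) (Complex.exp_ne_zero _))
    exact_mod_cast n.factorial_ne_zero

lemma szJ_val (hsym : ∀ k l, b k l = b l k)
    (hF : ∀ θ η, szp θ ≠ szp η → φ (szp θ) - φ (szp η) = (szp θ - szp η) * Complex.exp (-szFF b θ η))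
    (hd : ∀ θ, ψ (szp θ) = Complex.exp (-szFF b θ θ)) (n : ℕ) :
    ∫ θ, Complex.exp (szTT b G A0 n θ) ∂(szE n) =
      Complex.exp (-(n : ℂ) * A0 / 2) * (((2 * Real.pi : ℝ) ^ n : ℝ) : ℂ)⁻¹ * ((1 / (n.factorial : ℂ)) *
        ∫ θ in Set.pi Set.univ (fun _ : Fin n => Set.Icc (-Real.pi) Real.pi), szJ φ ψ G n θ) := by
  rw [szE_integral]
  simp only [szJ_eq hsym hF hd]
  rw [integral_const_mul, szpi_eq, integral_smul_measure, ENNReal.toReal_pow, ENNReal.toReal_inv,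
    ENNReal.toReal_ofReal (by positivity), Complex.real_smul]
  push_cast
  rw [inv_pow]
  ring

end final

lemma sz_g_form {m : ℕ} (M : Matrix (Fin m ⊕ Fin m) (Fin m ⊕ Fin m) ℂ) (g h : Fin m ⊕ Fin m → ℂ)
    (hgh : h = (Real.sqrt 2 : ℂ) • g) : 1/2 * (h ⬝ᵥ (M *ᵥ h)) = g ⬝ᵥ (M *ᵥ g) := by
  have h2 : (Real.sqrt 2 : ℂ) * (Real.sqrt 2 : ℂ) = 2 := by
    rw [← Complex.ofReal_mul, Real.mul_self_sqrt (by norm_num)]; simp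
  rw [hgh, Matrix.mulVec_smul, dotProduct_smul, smul_dotProduct, smul_eq_mul, smul_eq_mul]
  linear_combination (1/2 * (g ⬝ᵥ (M *ᵥ g))) * h2

lemma sz_posdef {m : ℕ} {M : Matrix (Fin m ⊕ Fin m) (Fin m ⊕ Fin m) ℝ} (hs : M.IsHermitian) {κ : ℝ}
    (hκ : 0 < κ) (hg : ∀ v, κ * (v ⬝ᵥ v) ≤ v ⬝ᵥ (M *ᵥ v)) : M.PosDef := by
  refine Matrix.PosDef.of_dotProduct_mulVec_pos hs fun v hv => ?_
  have h1 : 0 < v ⬝ᵥ v := by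
    have h0 : 0 ≤ v ⬝ᵥ v := Finset.sum_nonneg fun i _ => mul_self_nonneg _
    exact lt_of_le_of_ne h0 fun h => hv (dotProduct_self_eq_zero.1 h.symm)
  have h2 := hg v
  have h3 : (star v) = v := by ext i; simp
  rw [h3]
  exact lt_of_lt_of_le (mul_pos hκ h1) h2

/-- Strong Szegő limit theorem on a `C^{5+α}` Jordan curve of capacity
`1`: with `φ` the exterior map (boundary values included), `ψ` the boundary extension
of `φ'`, `a_{kℓ}` the Grunsky coefficients, and `G` a `2π`-periodic symbol whose
Fourier coefficients `A0, A_k, B_k` satisfy `∑ k(|A_k|² + |B_k|²) < ∞`, the determinants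
`D_n` converge absolutely, `I + K_m` is invertible with positive determinant, the
finite-dimensional Szegő constants converge to some `L ≠ 0`, and
`e^{-nA0/2} (2π)^{-n} D_n → L`. -/
theorem stmt18 (φ ψ : ℂ → ℂ) (φ₀ : ℂ) (c : ℕ → ℂ) (a : ℕ → ℕ → ℂ) (α : ℝ)
    (hα : α ∈ Set.Ioo (0 : ℝ) 1)
    (hcont : ContinuousOn φ {z : ℂ | 1 ≤ ‖z‖})
    (hinj : Set.InjOn φ {z : ℂ | 1 ≤ ‖z‖})
    (hholo : DifferentiableOn ℂ φ {z : ℂ | 1 < ‖z‖})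
    (hLaurent : ∀ z : ℂ, 1 < ‖z‖ →
      Summable (fun k : ℕ => ‖c k * z ^ (-(k : ℤ) - 1)‖) ∧
      φ z = z + φ₀ + ∑' k : ℕ, c k * z ^ (-(k : ℤ) - 1))
    (hC5 : ContDiff ℝ 5 (fun θ : ℝ => φ (Complex.exp (Complex.I * (θ : ℂ)))))
    (hHolder : ∃ Cα : ℝ, ∀ x y : ℝ,
      ‖iteratedDeriv 5 (fun θ : ℝ => φ (Complex.exp (Complex.I * (θ : ℂ)))) x
        - iteratedDeriv 5 (fun θ : ℝ => φ (Complex.exp (Complex.I * (θ : ℂ)))) y‖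
        ≤ Cα * |x - y| ^ α)
    (hderiv_ne : ∀ θ : ℝ,
      deriv (fun t : ℝ => φ (Complex.exp (Complex.I * (t : ℂ)))) θ ≠ 0)
    (hψcont : ContinuousOn ψ {z : ℂ | 1 ≤ ‖z‖})
    (hψ : ∀ z : ℂ, 1 < ‖z‖ → ψ z = deriv φ z)
    (hψ0 : ∀ z : ℂ, 1 ≤ ‖z‖ → ψ z ≠ 0)
    (hsym : ∀ k l, a k l = a l k)
    (hGrunsky : ∀ z ζ : ℂ, 1 ≤ ‖z‖ → 1 ≤ ‖ζ‖ →
      Summable (fun p : ℕ × ℕ =>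
        ‖a (p.1 + 1) (p.2 + 1) * ζ ^ (-(p.1 : ℤ) - 1) * z ^ (-(p.2 : ℤ) - 1)‖) ∧
      (z ≠ ζ → φ ζ - φ z = (ζ - z) * Complex.exp
        (-∑' p : ℕ × ℕ, a (p.1 + 1) (p.2 + 1) * ζ ^ (-(p.1 : ℤ) - 1) * z ^ (-(p.2 : ℤ) - 1))))
    -- the symbol `G` and its Fourier coefficients
    (G : ℝ → ℂ) (A0 : ℂ) (A B : ℕ → ℂ)
    (hGper : Function.Periodic G (2 * Real.pi))
    (hGint : IntegrableOn G (Set.Icc (-Real.pi) Real.pi))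
    (hA0 : A0 = ((Real.pi : ℂ))⁻¹ * ∫ θ in Set.Icc (-Real.pi) Real.pi, G θ)
    (hA : ∀ k : ℕ, 1 ≤ k → A k = ((Real.pi : ℂ))⁻¹ *
      ∫ θ in Set.Icc (-Real.pi) Real.pi, G θ * (Real.cos (k * θ) : ℂ))
    (hB : ∀ k : ℕ, 1 ≤ k → B k = ((Real.pi : ℂ))⁻¹ *
      ∫ θ in Set.Icc (-Real.pi) Real.pi, G θ * (Real.sin (k * θ) : ℂ))
    (hg : Summable (fun k : ℕ =>
      ((k : ℝ) + 1) * (‖A (k + 1)‖ ^ 2 + ‖B (k + 1)‖ ^ 2)))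
    -- the vectors `g_m` and the determinants `D_n`
    (g : (m : ℕ) → (Fin m ⊕ Fin m → ℂ))
    (hgdef : ∀ m : ℕ, g m = Sum.elim
      (fun k : Fin m => (1 / 2 : ℂ) * (Real.sqrt ((k : ℕ) + 1) : ℂ) * A ((k : ℕ) + 1))
      (fun k : Fin m => (1 / 2 : ℂ) * (Real.sqrt ((k : ℕ) + 1) : ℂ) * B ((k : ℕ) + 1)))
    (D : ℕ → ℂ)
    (hD : ∀ n : ℕ, D n = (1 / (n.factorial : ℂ)) *
      ∫ θ in Set.pi Set.univ (fun _ : Fin n => Set.Icc (-Real.pi) Real.pi),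
        (((∏ p ∈ Finset.univ.filter (fun p : Fin n × Fin n => p.1 < p.2),
            ‖φ (Complex.exp (Complex.I * (θ p.1 : ℂ)))
              - φ (Complex.exp (Complex.I * (θ p.2 : ℂ)))‖ ^ 2) *
          ∏ μ, ‖ψ (Complex.exp (Complex.I * (θ μ : ℂ)))‖ : ℝ) : ℂ) *
        ∏ μ, Complex.exp (G (θ μ))) :
    (∀ n : ℕ, 1 ≤ n → IntegrableOn (fun θ : Fin n → ℝ =>
        (((∏ p ∈ Finset.univ.filter (fun p : Fin n × Fin n => p.1 < p.2),
            ‖φ (Complex.exp (Complex.I * (θ p.1 : ℂ)))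
              - φ (Complex.exp (Complex.I * (θ p.2 : ℂ)))‖ ^ 2) *
          ∏ μ, ‖ψ (Complex.exp (Complex.I * (θ μ : ℂ)))‖ : ℝ) : ℂ) *
        ∏ μ, Complex.exp (G (θ μ)))
        (Set.pi Set.univ (fun _ : Fin n => Set.Icc (-Real.pi) Real.pi))) ∧
    (∀ m : ℕ, IsUnit (1 + grunskyK a m) ∧ 0 < (1 + grunskyK a m).det) ∧
    ∃ L : ℂ, L ≠ 0 ∧
      Tendsto (fun m : ℕ =>
        ((Real.sqrt ((1 + grunskyK a m).det) : ℂ))⁻¹ *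
          Complex.exp (g m ⬝ᵥ (((1 + grunskyK a m)⁻¹).map (Complex.ofReal)).mulVec (g m)))
        atTop (nhds L) ∧
      Tendsto (fun n : ℕ =>
        Complex.exp (-(n : ℂ) * A0 / 2) * (((2 * Real.pi : ℝ) ^ n : ℝ) : ℂ)⁻¹ * D n)
        atTop (nhds L) := by
  have hG1 : ∀ z ζ : ℂ, (∑' p : ℕ × ℕ, a (p.1 + 1) (p.2 + 1) * ζ ^ (-(p.1 : ℤ) - 1) * z ^ (-(p.2 : ℤ) - 1))
      = szFz (fun k l => a (k+1) (l+1)) (ζ, z) := by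
    intro z ζ
    simp only [szFz, sz_inv_zpow]
  set b : ℕ → ℕ → ℂ := fun k l => a (k+1) (l+1) with hbdef
  have hbsym : ∀ k l, b k l = b l k := fun k l => hsym _ _
  have hb : Summable fun p : ℕ × ℕ => ‖b p.1 p.2‖ := by
    have h := (hGrunsky 1 1 (by simp) (by simp)).1
    simpa using h
  have hFz : ∀ z ζ : ℂ, 1 ≤ ‖z‖ → 1 ≤ ‖ζ‖ → z ≠ ζ →
      φ ζ - φ z = (ζ - z) * Complex.exp (-szFz b (ζ, z)) := by
    intro z ζ hz hζ hne
    have h := (hGrunsky z ζ hz hζ).2 hne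
    rw [hG1] at h
    exact h
  have hF : ∀ θ η, szp θ ≠ szp η →
      φ (szp θ) - φ (szp η) = (szp θ - szp η) * Complex.exp (-szFF b θ η) := by
    intro θ η hne
    rw [← szFz_eq]
    exact hFz _ _ (szp_norm η).ge (szp_norm θ).ge hne.symm
  have hd : ∀ θ, ψ (szp θ) = Complex.exp (-szFF b θ θ) := sz_diag hb hholo hψcont hψ hFz
  obtain ⟨C, hC⟩ := sz_decay (Φ := fun θ => φ (szp θ)) hC5 hb hF
  have hKs := szK_summable hbsym hC
  have hKsym := szK_symm hbsym
  obtain ⟨κ, hκ, hgap0⟩ := szK_gap hcont hinj hb hF hbsym hC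
  have hgap := szKm_gap hgap0
  have hh := szh_summable hg
  obtain ⟨ms, hms, hae⟩ := sz_G hGint hA0 hA hB hg
  have hT := szTT_lim (A0 := A0) hb hKs hms.tendsto_atTop hae
  obtain ⟨hintg, L, hL1, hL2⟩ := sz_main hKsym hKs hκ hgap hh (szTT b G A0) hms.tendsto_atTop hT
  obtain ⟨c0, hc0, hlow⟩ := sz_lower hKsym hκ hgap hKs hh
  have hKm : ∀ m, grunskyK a m = Matrix.of fun i j : Fin m ⊕ Fin m => szK b (szi i) (szi j) := by
    intro m
    ext i j
    rcases i with i | i <;> rcases j with j | j <;>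
      simp [grunskyK, szK, szi, szβ, hbdef]
  refine ⟨fun n _ => szJ_int hbsym hF hd (hintg n), fun m => ?_, L, ?_, ?_, ?_⟩
  · have hp : (1 + grunskyK a m).PosDef := by
      rw [hKm]
      refine sz_posdef ?_ hκ (hgap m)
      refine Matrix.isHermitian_one.add ?_
      ext i j
      simp [hKsym (szi i) (szi j)]
    exact ⟨hp.isUnit, hp.det_pos⟩
  · intro h0
    have h1 := ge_of_tendsto' hL1.norm hlow
    rw [h0, norm_zero] at h1
    linarith
  · refine hL1.congr fun m => ?_
    unfold szL
    rw [hKm]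
    congr 2
    refine sz_g_form _ _ _ ?_
    have h2 : ∀ k : ℕ, (Real.sqrt (((k:ℝ)+1)/2) : ℂ)
        = (Real.sqrt 2 : ℂ) * ((1/2 : ℂ) * (Real.sqrt ((k:ℝ) + 1) : ℂ)) := by
      intro k
      have h3 : Real.sqrt (((k:ℝ)+1)/2) = Real.sqrt 2 * (1/2 * Real.sqrt ((k:ℝ)+1)) := by
        have e1 := Real.mul_self_sqrt (show (0:ℝ) ≤ 2 by norm_num)
        have e2 := Real.mul_self_sqrt (show (0:ℝ) ≤ (k:ℝ)+1 by positivity)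
        have e3 : ((k:ℝ)+1)/2 = (Real.sqrt 2 * (1/2 * Real.sqrt ((k:ℝ)+1))) ^ 2 := by
          symm
          calc _ = (Real.sqrt 2 * Real.sqrt 2) * (Real.sqrt ((k:ℝ)+1) * Real.sqrt ((k:ℝ)+1)) / 4 := by ring
            _ = _ := by rw [e1, e2]; ring
        rw [e3, Real.sqrt_sq (by positivity)]
      rw [h3]; push_cast; ring
    rw [hgdef]
    ext i
    rcases i with k | k <;>
      simp only [szh, szi, Sum.map_inl, Sum.map_inr, Sum.elim_inl, Sum.elim_inr, Pi.smul_apply,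
        smul_eq_mul] <;> rw [h2] <;> ring
  · refine hL2.congr fun n => ?_
    rw [szJ_val hbsym hF hd, hD]
    rfl
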